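/- **Setting.** Let $G$ be a compact Lie group. Let $\pi:\mathcal X_T\to\mathbb C$ be a $G$-invariant smooth test configuration of relative dimension $n$: $\mathcal X_T$ is a complex manifold of dimension $n+1$, $\pi$ is a proper holomorphic submersion, $\mathbb C^*$ acts holomorphically on $\mathcal X_T$ by $\rho$ with $\pi(\rho_\lambda(x))=\lambda\,\pi(x)$, and $G$ acts smoothly on $\mathcal X_T$ by holomorphic maps that preserve the fibres of $\pi$ and commute with $\rho$. (In the polarized case $\mathcal X_T$ also carries a relatively ample line bundle $\mathcal L_T$ to which the actions lift, and $\Omega|_{\mathcal X_z}\in c_1(\mathcal L_z)$; this is not needed below.) Let $\mathcal X_1=\pi^{-1}(1)$ be the generic fibre, $\mathcal X_0=\pi^{-1}(0)$ the central fibre, both connected. Let $F:M\times\mathbb C\to\mathcal X_T$ be a $G$-equivariant diffeomorphism with $\pi(F(x,z))=z$, where $M$ is a compact connected complex manifold with an action of $G$ and $F_0=F(\cdot,0)$ is a biholomorphism of $M$ onto $\mathcal X_0$. Let $\Omega$ be a Kähler form on $\mathcal X_T$, invariant under $G$ and under $S^1\subset\mathbb C^*$, and let $H:\mathcal X_T\to\mathbb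 R$ be smooth with $i_W\Omega=dH$, where $W=\frac{d}{d\theta}\big|_{\theta=0}\rho_{e^{i\theta}}$. Put $\omega_t=\rho_{e^{-t}}^*\Omega$ on $\mathcal X_1$ for $t\in\mathbb R$, and let $\varphi_t$ be a smooth family of functions on $\mathcal X_1$ with $\omega_t=\omega_0+dd^c\varphi_t$, where $d^cu=-du\circ J$, so $dd^c=2\sqrt{-1}\,\partial\bar\partial$. **Notation.** Let $\omega$ be a $G$-invariant Kähler form on a compact connected complex manifold of dimension $n$ with a holomorphic $G$-action. Let $g=\omega(\cdot,J\cdot)$ be its metric, $d\mu_\omega=\omega^n/n!$, and $S(\omega)$ its scalar curvature (the trace with respect to $\omega$ of the Ricci form $-\sqrt{-1}\,\partial\bar\partial\log\det g$). Let $P^G_\omega$ be the space of smooth functions $f$ of mean value zero such that $J\nabla f$ is the vector field induced by an element of $\mathrm{Lie}(G)$, and $\Pi^G_\omega$ the $L^2(d\mu_\omega)$-orthogonal projection onto it. The reduced scalar curvature is $S^G(\omega)=S(\omega)-\underline S-\Pi^G_\omega S(\omega)$, where $\underline S$ is the mean value of $S(\omega)$. The modified K-energy $E^G$ is a primitive,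 on the space of $G$-invariant smooth $\varphi$ with $\omega_0+dd^c\varphi>0$, of the one-form $\psi\mapsto-\int\psi\,S^G(\omega_\varphi)\,d\mu_{\omega_\varphi}$, where $\omega_\varphi=\omega_0+dd^c\varphi$ and $\psi$ is smooth and $G$-invariant. If a vector field has the form $V=\nabla f^V+J\nabla h^V$ with $f^V,h^V$ smooth of mean value zero, then $f^V$ is its real potential, and the Futaki invariant relative to $G$, computed with $\omega$, is $\mathcal F^G(V)=\int f^V S^G(\omega)\,d\mu_\omega$. **Statement.** For every $t$, $\dot\varphi_t=\rho_{e^{-t}}^*H$ modulo constants and $$\frac{d}{dt}E^G(\varphi_t)=-\frac1{n!}\int_{\mathcal X_1}\dot\varphi_t\,S^G(\omega_t)\,\omega_t^n .$$ As $t\to\infty$ this converges exponentially fast to $$\Lambda=-\frac1{n!}\int_M(F_0^*H)\,S^G(F_0^*\Omega)\,(F_0^*\Omega)^n:$$ there is a constant $C$ with $\left|\frac{d}{dt}E^G(\varphi_t)-\Lambda\right|\le Ce^{-t}$ for all $t\ge0$. The limit is minus the relative Futaki invariant of the central fibre, computed with $F_0^*\Omega$, on the real holomorphic vector field $JW=\nabla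 H$ associated with $W$: its real potential on $M$ is $F_0^*H$ minus its mean value, and $\Lambda=-\mathcal F^G(JW)$. If moreover the metric induced on the central fibre is extremal with $S^G(F_0^*\Omega)=0$, then $\Lambda=0$, $\mathcal F^G(JW)=0$ and $\mathcal F^G(W)=0$; in particular $\Lambda=-\mathcal F^G(W)$ as well. -/

import Mathlib

open MeasureTheory
open scoped Manifold ContDiff Topology

namespace RelFutaki

noncomputable section

/-! Complex manifolds of dimension `n` are charted spaces over `Cn n = ℂⁿ` with holomorphic transition
maps (`IsManifold 𝓘(ℂ, Cn n) ω X`).  The same charts give the underlying real manifold, with model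
`𝓘(ℝ, Cn n)`; the real tangent space at `x` is `Cn n`, read in the preferred chart at `x`, and the
complex structure is multiplication by `i`. -/

/-- The model space `ℂⁿ`. -/
abbrev Cn (n : ℕ) : Type := Fin n → ℂ

/-- Real alternating 2-forms on `ℂⁿ`. -/
abbrev Alt2 (n : ℕ) : Type := (Cn n) [⋀^Fin 2]→L[ℝ] ℝ

/-- The complex structure `J` on tangent spaces: multiplication by `i`. -/
def J (n : ℕ) : Cn n →L[ℝ] Cn n :=
  (Complex.I • ContinuousLinearMap.id ℂ (Cn n)).restrictScalars ℝ

/-- The hermitian matrix `h_{ab} = α(e_a, i e_b) - i α(e_a, e_b)` of a real (1,1)-form `α` on `ℂⁿ`.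
If `α = i ∑ g_{ab̄} dz^a ∧ dz̄^b` then `h = 2 (g_{ab̄})`. -/
def herm {n : ℕ} (α : Alt2 n) : Matrix (Fin n) (Fin n) ℂ :=
  Matrix.of fun a b =>
    (α ![Pi.single a 1, J n (Pi.single b 1)] : ℂ)
      - Complex.I * (α ![Pi.single a 1, Pi.single b 1] : ℂ)

/-- `d dᶜ u = 2 i ∂ ∂̄ u` at a point of `ℂⁿ`, with `dᶜ u = - du ∘ J`. -/
def ddcLocal {n : ℕ} (u : Cn n → ℝ) (y : Cn n) : Alt2 n :=
  extDeriv (fun z => ContinuousAlternatingMap.ofSubsingleton ℝ (Cn n) ℝ (0 : Fin 1)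
    (-((fderiv ℝ u z).comp (J n)))) y

section Forms

variable {n m : ℕ} {X : Type*} [TopologicalSpace X] [ChartedSpace (Cn n) X]
  {Y : Type*} [TopologicalSpace Y] [ChartedSpace (Cn m) Y]

/-- The pullback `f^* α` of a 2-form under a map of manifolds. -/
def pullback (f : X → Y) (α : Y → Alt2 m) : X → Alt2 n := fun x =>
  (α (f x)).compContinuousLinearMap (mfderiv 𝓘(ℝ, Cn n) 𝓘(ℝ, Cn m) f x : Cn n →L[ℝ] Cn m)

/-- The coordinate expression of a 2-form in the chart at `p`: a 2-form on an open subset of `ℂⁿ`. -/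
def localRep (α : X → Alt2 n) (p : X) : Cn n → Alt2 n := fun y =>
  (α ((chartAt (Cn n) p).symm y)).compContinuousLinearMap
    (mfderiv 𝓘(ℝ, Cn n) 𝓘(ℝ, Cn n) (chartAt (Cn n) p).symm y : Cn n →L[ℝ] Cn n)

/-- `d dᶜ φ` on a complex manifold, computed at `x` in the holomorphic chart at `x`. -/
def ddc (φ : X → ℝ) : X → Alt2 n := fun x =>
  ddcLocal (φ ∘ (chartAt (Cn n) x).symm) (chartAt (Cn n) x x)

/-- Kähler forms: smooth closed real (1,1)-forms `η` whose associated metric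
`g(v, w) = η(v, J w)` is positive definite. -/
structure IsKahlerForm (η : X → Alt2 n) : Prop where
  smooth : ∀ p : X, ContDiffOn ℝ ∞ (localRep η p) (chartAt (Cn n) p).target
  closed : ∀ p : X, ∀ y ∈ (chartAt (Cn n) p).target, extDeriv (localRep η p) y = 0
  invariant : ∀ (x : X) (v w : Cn n), η x ![J n v, J n w] = η x ![v, w]
  positive : ∀ (x : X) (v : Cn n), v ≠ 0 → 0 < η x ![v, J n v]

/-- `A = ∇f` for the metric `g(v, w) = η(v, J w)`, that is `g(A, v) = df(v)` for all `v`. -/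
def IsGradient (η : X → Alt2 n) (f : X → ℝ) (A : X → Cn n) : Prop :=
  ∀ (x : X) (v : Cn n), η x ![A x, J n v] = (mfderiv 𝓘(ℝ, Cn n) 𝓘(ℝ, ℝ) f x : Cn n →L[ℝ] ℝ) v

/-- The Ricci form `-i ∂ ∂̄ log det (g_{ab̄}) = -(1/2) d dᶜ log det h`, in the chart at `x`. -/
def ricci (η : X → Alt2 n) : X → Alt2 n := fun x =>
  (-(1 / 2 : ℝ)) •
    ddcLocal (fun y => Real.log (herm (localRep η x y)).det.re) (chartAt (Cn n) x x)

/-- The scalar curvature `S(η)`: the trace with respect to `η` of the Ricci form,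
`-∑ g^{ab̄} ∂_a ∂_b̄ log det g`.  Its mean value is `2πn c₁(X) ∪ [η]ⁿ⁻¹ / [η]ⁿ`. -/
def scal (η : X → Alt2 n) (x : X) : ℝ :=
  (((herm (localRep η x (chartAt (Cn n) x x)))⁻¹ * herm (ricci η x)).trace).re

variable [MeasurableSpace X]

/-- The measure `ηⁿ / n!` on the domain of the chart at `p` (and zero outside): in the chart, `ηⁿ / n!`
is `det h` times Lebesgue measure on `ℂⁿ`. -/
def chartVolume (η : X → Alt2 n) (p : X) : Measure X :=
  (((volume : Measure (Cn n)).restrict (chartAt (Cn n) p).target).withDensity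
    (fun y => ENNReal.ofReal (herm (localRep η p y)).det.re)).map (chartAt (Cn n) p).symm

/-- The volume measure `ηⁿ / n!` of the Kähler form `η`.  The measures `chartVolume η p` agree on
overlaps of chart domains, and their supremum is the measure that they glue to. -/
def vol (η : X → Alt2 n) : Measure X := ⨆ p : X, chartVolume η p

/-- `f` is a real potential of the vector field `V`: `V = ∇f + J ∇h` with `f`, `h` smooth and of mean
value zero. -/
def IsRealPotential (η : X → Alt2 n) (V : X → Cn n) (f : X → ℝ) : Prop :=
  ContMDiff 𝓘(ℝ, Cn n) 𝓘(ℝ, ℝ) ∞ f ∧ ∫ x, f x ∂(vol η) = 0 ∧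
    ∃ h : X → ℝ, ContMDiff 𝓘(ℝ, Cn n) 𝓘(ℝ, ℝ) ∞ h ∧ ∫ x, h x ∂(vol η) = 0 ∧
      ∃ A B : X → Cn n, IsGradient η f A ∧ IsGradient η h B ∧ ∀ x, V x = A x + J n (B x)

open Classical in
/-- The real potential `f^V` of `V` with respect to `η` (zero if there is none; on a compact connected
Kähler manifold it is unique). -/
def realPotential (η : X → Alt2 n) (V : X → Cn n) : X → ℝ :=
  if hV : ∃ f, IsRealPotential η V f then hV.choose else 0

end Forms

section Group

variable {n : ℕ} {X : Type*} [TopologicalSpace X] [ChartedSpace (Cn n) X]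
  {EG : Type*} [NormedAddCommGroup EG] [NormedSpace ℝ EG]
  (G : Type*) [TopologicalSpace G] [ChartedSpace EG G] [Group G] [MulAction G X]

variable (n X) in
/-- The vector field on `X` induced by an element `ξ` of the Lie algebra of `G`. -/
def fundField (ξ : GroupLieAlgebra 𝓘(ℝ, EG) G) : X → Cn n := fun x =>
  (mfderiv 𝓘(ℝ, EG) 𝓘(ℝ, Cn n) (fun g : G => g • x) 1 : EG →L[ℝ] Cn n) ξ

variable [MeasurableSpace X]

variable (EG) in
/-- `P^G`: the mean value zero potentials `f` whose hamiltonian vector field `J ∇f` lies in `Lie(G)`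
(and is therefore Killing when `η` is `G`-invariant and `G` acts holomorphically). -/
def killingPotentials (η : X → Alt2 n) : Set (X → ℝ) :=
  {f | ContMDiff 𝓘(ℝ, Cn n) 𝓘(ℝ, ℝ) ∞ f ∧ ∫ x, f x ∂(vol η) = 0 ∧
    ∃ (A : X → Cn n) (ξ : GroupLieAlgebra 𝓘(ℝ, EG) G),
      IsGradient η f A ∧ ∀ x, fundField n X G ξ x = J n (A x)}

open Classical in
variable (EG) in
/-- The `L²(ηⁿ/n!)`-orthogonal projection `Π^G u` of a function onto the finite dimensional space
`P^G`. -/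
def proj (η : X → Alt2 n) (u : X → ℝ) : X → ℝ :=
  if hp : ∃ p ∈ killingPotentials EG G η, ∀ f ∈ killingPotentials EG G η,
    ∫ x, (u x - p x) * f x ∂(vol η) = 0 then hp.choose else 0

variable (EG) in
/-- The reduced scalar curvature `S^G(η) = S(η) - (mean value of S(η)) - Π^G S(η)`. -/
def redScal (η : X → Alt2 n) (x : X) : ℝ :=
  scal η x - (⨍ y, scal η y ∂(vol η)) - proj EG G η (scal η) x

variable (EG) in
/-- The Futaki character relative to `G`, `𝓕^G(V) = ∫ f^V S^G(η) ηⁿ/n!`, computed with the `G`-invariant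
Kähler form `η` in the given class. -/
def futaki (η : X → Alt2 n) (V : X → Cn n) : ℝ :=
  ∫ x, realPotential η V x * redScal EG G η x ∂(vol η)

/-- `η_φ = η + d dᶜ φ`. -/
def perturb (η : X → Alt2 n) (φ : X → ℝ) : X → Alt2 n := fun x => η x + ddc φ x

/-- Smooth `G`-invariant functions. -/
def IsInvSmooth (n : ℕ) {X : Type*} [TopologicalSpace X] [ChartedSpace (Cn n) X]
    (G : Type*) [Group G] [MulAction G X] (ψ : X → ℝ) : Prop :=
  ContMDiff 𝓘(ℝ, Cn n) 𝓘(ℝ, ℝ) ∞ ψ ∧ ∀ (g : G) (x : X), ψ (g • x) = ψ x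

/-- The space `𝓗^G` of `G`-invariant Kähler potentials with respect to `η`. -/
def potentials (η : X → Alt2 n) : Set (X → ℝ) :=
  {φ | IsInvSmooth n G φ ∧ ∀ (x : X) (v : Cn n), v ≠ 0 → 0 < perturb η φ x ![v, J n v]}

variable (EG) in
/-- `E` is a modified K-energy relative to `G`: a primitive on `𝓗^G` of the one-form
`φ ↦ - S^G(φ) dμ_φ`.  That is, the derivative of `E` at `φ ∈ 𝓗^G` in the direction of a `G`-invariant
smooth function `ψ` is `- ∫ ψ S^G(φ) dμ_φ`. -/
def IsModifiedKEnergy (η : X → Alt2 n) (E : (X → ℝ) → ℝ) : Prop :=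
  ∀ φ ∈ potentials G η, ∀ ψ : X → ℝ, IsInvSmooth n G ψ →
    HasDerivAt (fun s : ℝ => E (fun x => φ x + s * ψ x))
      (-∫ x, ψ x * redScal EG G (perturb η φ) x ∂(vol (perturb η φ))) 0

end Group

/-- `e^w` as an element of `ℂ*`. -/
def expUnit (w : ℂ) : ℂˣ := Units.mk0 (Complex.exp w) (Complex.exp_ne_zero w)

section TestConfiguration

variable {n : ℕ} {T : Type*} [TopologicalSpace T] [ChartedSpace (Cn (n + 1)) T] [MulAction ℂˣ T]

/-- A smooth test configuration `π : T → ℂ` with holomorphic `ℂ*`-action (the scalar action of `ℂˣ`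
on `T`), invariant under the Lie group `G`: `π` is a proper holomorphic submersion, equivariant for
multiplication on `ℂ`, and `G` acts smoothly, by holomorphic maps, along the fibres, and commutes with
`ℂ*`. -/
structure IsTestConfiguration (EG : Type*) [NormedAddCommGroup EG] [NormedSpace ℝ EG]
    (G : Type*) [TopologicalSpace G] [ChartedSpace EG G] [Group G] [MulAction G T]
    (π : T → ℂ) : Prop where
  holomorphic : ContMDiff 𝓘(ℂ, Cn (n + 1)) 𝓘(ℂ, ℂ) ω π
  submersion : ∀ x, Function.Surjective (mfderiv 𝓘(ℂ, Cn (n + 1)) 𝓘(ℂ, ℂ) π x)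
  proper : IsProperMap π
  action_holomorphic : ContMDiff (𝓘(ℂ, ℂ).prod 𝓘(ℂ, Cn (n + 1))) 𝓘(ℂ, Cn (n + 1)) ω
    (fun q : ℂˣ × T => q.1 • q.2)
  equivariant : ∀ (c : ℂˣ) (x : T), π (c • x) = c * π x
  group_smooth : ContMDiff (𝓘(ℝ, EG).prod 𝓘(ℝ, Cn (n + 1))) 𝓘(ℝ, Cn (n + 1)) ∞
    (fun q : G × T => q.1 • q.2)
  group_holomorphic : ∀ g : G,
    ContMDiff 𝓘(ℂ, Cn (n + 1)) 𝓘(ℂ, Cn (n + 1)) ω (fun x : T => g • x)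
  group_fibre : ∀ (g : G) (x : T), π (g • x) = π x
  group_comm : ∀ (g : G) (c : ℂˣ) (x : T), g • c • x = c • g • x

/-- `ι : X → T` is a biholomorphism of the complex manifold `X` onto the generic fibre `π⁻¹(1)`. -/
structure IsGenericFibre (π : T → ℂ) {X : Type*} [TopologicalSpace X] [ChartedSpace (Cn n) X]
    (ι : X → T) : Prop where
  holomorphic : ContMDiff 𝓘(ℂ, Cn n) 𝓘(ℂ, Cn (n + 1)) ω ι
  injective : Function.Injective ι
  immersion : ∀ x, Function.Injective (mfderiv 𝓘(ℂ, Cn n) 𝓘(ℂ, Cn (n + 1)) ι x)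
  range_eq : Set.range ι = π ⁻¹' {1}

variable (n T) in
/-- The vector field `W` generating the action of `S¹ ⊂ ℂ*` on `T`:
`W(x) = d/dθ (e^{iθ} • x)` at `θ = 0`. -/
def circleField : T → Cn (n + 1) := fun x =>
  (mfderiv 𝓘(ℝ, ℝ) 𝓘(ℝ, Cn (n + 1))
    (fun θ : ℝ => expUnit (Complex.I * (θ : ℂ)) • x) 0 : ℝ →L[ℝ] Cn (n + 1)) 1

/-- `Ω` is a Kähler form on `T`, invariant under `S¹` and `G`, and the function `H` is a hamiltonian
for the `S¹`-action: `i_W Ω = dH`. -/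
structure IsInvariantKahler (G : Type*) [Group G] [MulAction G T]
    (Ω : T → Alt2 (n + 1)) (H : T → ℝ) : Prop where
  kahler : IsKahlerForm Ω
  circle_invariant : ∀ θ : ℝ,
    pullback (fun x : T => expUnit (Complex.I * (θ : ℂ)) • x) Ω = Ω
  group_invariant : ∀ g : G, pullback (fun x : T => g • x) Ω = Ω
  smooth : ContMDiff 𝓘(ℝ, Cn (n + 1)) 𝓘(ℝ, ℝ) ∞ H
  hamiltonian : ∀ (x : T) (v : Cn (n + 1)), Ω x ![circleField n T x, v]
    = (mfderiv 𝓘(ℝ, Cn (n + 1)) 𝓘(ℝ, ℝ) H x : Cn (n + 1) →L[ℝ] ℝ) v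

/-- The forms `ω_t = ρ_{e^{-t}}^* Ω` on the generic fibre. -/
def omegaT {X : Type*} [TopologicalSpace X] [ChartedSpace (Cn n) X] (ι : X → T)
    (Ω : T → Alt2 (n + 1)) (t : ℝ) : X → Alt2 n :=
  pullback (fun x : X => expUnit (-(t : ℂ)) • ι x) Ω

section Trivialization

variable {M : Type*} [TopologicalSpace M] [ChartedSpace (Cn n) M]

/-- `F : M × ℂ → T` is a smooth `G`-equivariant trivialization of `π` such that
`F₀ = F(·, 0)` is holomorphic, that is, a biholomorphism of `M` onto the central fibre. -/
structure IsTrivialization (G : Type*) [Group G] [MulAction G T] [MulAction G M] (π : T → ℂ)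
    (F : (M × ℂ) ≃ₘ^∞⟮𝓘(ℝ, Cn n).prod 𝓘(ℝ, ℂ), 𝓘(ℝ, Cn (n + 1))⟯ T) : Prop where
  fibre : ∀ (x : M) (z : ℂ), π (F (x, z)) = z
  equivariant : ∀ (g : G) (x : M) (z : ℂ), F (g • x, z) = g • F (x, z)
  holomorphic : ContMDiff 𝓘(ℂ, Cn n) 𝓘(ℂ, Cn (n + 1)) ω (fun x : M => F (x, 0))

/-- The form `F₀^* Ω` on `M`. -/
def centralForm (F : (M × ℂ) ≃ₘ^∞⟮𝓘(ℝ, Cn n).prod 𝓘(ℝ, ℂ), 𝓘(ℝ, Cn (n + 1))⟯ T)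
    (Ω : T → Alt2 (n + 1)) : M → Alt2 n :=
  pullback (fun x : M => F (x, 0)) Ω

/-- The vector field `W` on the central fibre, as a field on `M`: the generator of the `S¹`-action
that `F₀` transports from the central fibre to `M`. -/
def centralField (F : (M × ℂ) ≃ₘ^∞⟮𝓘(ℝ, Cn n).prod 𝓘(ℝ, ℂ), 𝓘(ℝ, Cn (n + 1))⟯ T) :
    M → Cn n := fun x =>
  (mfderiv 𝓘(ℝ, ℝ) 𝓘(ℝ, Cn n)
    (fun θ : ℝ => (F.symm (expUnit (Complex.I * (θ : ℂ)) • F (x, 0))).1) 0 : ℝ →L[ℝ] Cn n) 1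

variable [MeasurableSpace M] (EG : Type*) [NormedAddCommGroup EG] [NormedSpace ℝ EG]
  (G : Type*) [TopologicalSpace G] [ChartedSpace EG G] [Group G] [MulAction G M]

/-- `-(1/n!) ∫ (F₀^*H) S^G(F₀^*Ω) (F₀^*Ω)ⁿ`. -/
def limitValue (F : (M × ℂ) ≃ₘ^∞⟮𝓘(ℝ, Cn n).prod 𝓘(ℝ, ℂ), 𝓘(ℝ, Cn (n + 1))⟯ T)
    (Ω : T → Alt2 (n + 1)) (H : T → ℝ) : ℝ :=
  -∫ x : M, H (F (x, 0)) * redScal EG G (centralForm F Ω) x ∂(vol (centralForm F Ω))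

end Trivialization

end TestConfiguration

end

end RelFutaki

open RelFutaki

set_option linter.unusedSectionVars false

namespace RelFutaki

section RealStructure

variable {E E' : Type*} [NormedAddCommGroup E] [NormedSpace ℂ E] [NormedSpace ℝ E]
  [IsScalarTower ℝ ℂ E] [NormedAddCommGroup E'] [NormedSpace ℂ E'] [NormedSpace ℝ E']
  [IsScalarTower ℝ ℂ E']
  {X : Type*} [TopologicalSpace X] [ChartedSpace E X]
  {Y : Type*} [TopologicalSpace Y] [ChartedSpace E' Y]

theorem isManifold_real_of_complex [IsManifold 𝓘(ℂ, E) ω X] : IsManifold 𝓘(ℝ, E) ∞ X := by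
  apply isManifold_of_contDiffOn
  intro e e' he he'
  have h : e.symm ≫ₕ e' ∈ contDiffGroupoid ω 𝓘(ℂ, E) :=
    HasGroupoid.compatible he he'
  exact ((mem_groupoid_of_pregroupoid.1 h).1.restrict_scalars ℝ).of_le le_top

instance isManifold_real {n : ℕ} {X : Type*} [TopologicalSpace X] [ChartedSpace (Cn n) X]
    [IsManifold 𝓘(ℂ, Cn n) ω X] : IsManifold 𝓘(ℝ, Cn n) ∞ X :=
  isManifold_real_of_complex

theorem contMDiffAt_real {f : X → Y} {x : X} (hf : ContMDiffAt 𝓘(ℂ, E) 𝓘(ℂ, E') ω f x) :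
    ContMDiffAt 𝓘(ℝ, E) 𝓘(ℝ, E') ∞ f x := by
  have h := contMDiffAt_iff.1 hf
  exact contMDiffAt_iff.2 ⟨h.1, (h.2.restrict_scalars ℝ).of_le le_top⟩

theorem contMDiff_real {f : X → Y} (hf : ContMDiff 𝓘(ℂ, E) 𝓘(ℂ, E') ω f) :
    ContMDiff 𝓘(ℝ, E) 𝓘(ℝ, E') ∞ f := fun x => contMDiffAt_real (hf x)

/-- The real derivative of a map of manifolds, read in the preferred charts. -/
noncomputable def tder (E E' : Type*) [NormedAddCommGroup E] [NormedSpace ℝ E]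
    [NormedAddCommGroup E'] [NormedSpace ℝ E']
    {X : Type*} [TopologicalSpace X] [ChartedSpace E X]
    {Y : Type*} [TopologicalSpace Y] [ChartedSpace E' Y] (f : X → Y) (x : X) : E →L[ℝ] E' :=
  mfderiv 𝓘(ℝ, E) 𝓘(ℝ, E') f x

/-- The complex derivative of a map of manifolds, read in the preferred charts. -/
noncomputable def ctder (E E' : Type*) [NormedAddCommGroup E] [NormedSpace ℂ E]
    [NormedAddCommGroup E'] [NormedSpace ℂ E']
    {X : Type*} [TopologicalSpace X] [ChartedSpace E X]
    {Y : Type*} [TopologicalSpace Y] [ChartedSpace E' Y] (f : X → Y) (x : X) : E →L[ℂ] E' :=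
  mfderiv 𝓘(ℂ, E) 𝓘(ℂ, E') f x

theorem tder_eq_restrictScalars {f : X → Y} {x : X}
    (hf : MDifferentiableAt 𝓘(ℂ, E) 𝓘(ℂ, E') f x) :
    tder E E' f x = (ctder E E' f x).restrictScalars ℝ := by
  have h2 : HasMFDerivAt 𝓘(ℝ, E) 𝓘(ℝ, E') f x ((ctder E E' f x).restrictScalars ℝ) :=
    ⟨hf.hasMFDerivAt.1, HasFDerivWithinAt.restrictScalars ℝ hf.hasMFDerivAt.2⟩
  exact h2.mfderiv

theorem contMDiff_action_real {f : ℂˣ × X → Y}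
    (hf : ContMDiff (𝓘(ℂ, ℂ).prod 𝓘(ℂ, E)) 𝓘(ℂ, E') ω f) :
    ContMDiff (𝓘(ℝ, ℂ).prod 𝓘(ℝ, E)) 𝓘(ℝ, E') ∞ f := by
  intro x
  have h := contMDiffAt_iff.1 (hf x)
  exact contMDiffAt_iff.2 ⟨h.1, (h.2.restrict_scalars ℝ).of_le le_top⟩

section TDer

variable {E E' E'' : Type*} [NormedAddCommGroup E] [NormedSpace ℝ E]
  [NormedAddCommGroup E'] [NormedSpace ℝ E'] [NormedAddCommGroup E''] [NormedSpace ℝ E'']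
  {X : Type*} [TopologicalSpace X] [ChartedSpace E X]
  {Y : Type*} [TopologicalSpace Y] [ChartedSpace E' Y]
  {Z : Type*} [TopologicalSpace Z] [ChartedSpace E'' Z]

theorem tder_comp {f : X → Y} {g : Y → Z} {x : X}
    (hg : MDifferentiableAt 𝓘(ℝ, E') 𝓘(ℝ, E'') g (f x))
    (hf : MDifferentiableAt 𝓘(ℝ, E) 𝓘(ℝ, E') f x) :
    tder E E'' (fun y => g (f y)) x = (tder E' E'' g (f x)).comp (tder E E' f x) :=
  mfderiv_comp x hg hf

theorem tder_comp_apply {f : X → Y} {g : Y → Z} {x : X}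
    (hg : MDifferentiableAt 𝓘(ℝ, E') 𝓘(ℝ, E'') g (f x))
    (hf : MDifferentiableAt 𝓘(ℝ, E) 𝓘(ℝ, E') f x) (v : E) :
    tder E E'' (fun y => g (f y)) x v = tder E' E'' g (f x) (tder E E' f x v) := by
  rw [tder_comp hg hf]; rfl

theorem tder_congr {f g : X → Y} {x : X} (h : f =ᶠ[𝓝 x] g) : tder E E' f x = tder E E' g x :=
  h.mfderiv_eq

theorem tder_id (x : X) : tder E E (fun y : X => y) x = ContinuousLinearMap.id ℝ E :=
  mfderiv_id

theorem tder_const (x : X) (c : Y) : tder E E' (fun _ : X => c) x = 0 :=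
  mfderiv_const

theorem tder_eq_fderiv (f : E → E') (x : E) : tder E E' f x = fderiv ℝ f x :=
  mfderiv_eq_fderiv

/-- Two maps that are inverse to each other near `x` have inverse derivatives. -/
theorem tder_leftInverse {f : X → Y} {g : Y → X} {x : X}
    (hg : MDifferentiableAt 𝓘(ℝ, E') 𝓘(ℝ, E) g (f x))
    (hf : MDifferentiableAt 𝓘(ℝ, E) 𝓘(ℝ, E') f x) (h : ∀ᶠ y in 𝓝 x, g (f y) = y) (v : E) :
    tder E' E g (f x) (tder E E' f x v) = v := by
  rw [← tder_comp_apply hg hf, tder_congr (g := fun y => y) h, tder_id]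
  rfl

end TDer

end RealStructure

section Holomorphic

variable {n m : ℕ} {X : Type*} [TopologicalSpace X] [ChartedSpace (Cn n) X]
  {Y : Type*} [TopologicalSpace Y] [ChartedSpace (Cn m) Y]

theorem J_apply (v : Cn n) : J n v = Complex.I • v := rfl

theorem J_J (v : Cn n) : J n (J n v) = -v := by
  simp [J_apply, smul_smul]

theorem tder_J {f : X → Y} {x : X}
    (hf : MDifferentiableAt 𝓘(ℂ, Cn n) 𝓘(ℂ, Cn m) f x) (v : Cn n) :
    tder (Cn n) (Cn m) f x (J n v) = J m (tder (Cn n) (Cn m) f x v) := by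
  rw [tder_eq_restrictScalars hf]
  exact (ctder (Cn n) (Cn m) f x).map_smul _ _

end Holomorphic

section Charts

variable {n m k : ℕ} {X : Type*} [TopologicalSpace X] [ChartedSpace (Cn n) X]
  {Y : Type*} [TopologicalSpace Y] [ChartedSpace (Cn m) Y]
  {Z : Type*} [TopologicalSpace Z] [ChartedSpace (Cn k) Z]

theorem pullback_apply (f : X → Y) (α : Y → Alt2 m) (x : X) (v w : Cn n) :
    pullback (n := n) f α x ![v, w] =
      α (f x) ![tder (Cn n) (Cn m) f x v, tder (Cn n) (Cn m) f x w] := by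
  change α (f x) (tder (Cn n) (Cn m) f x ∘ ![v, w]) = _
  congr 1
  funext i
  fin_cases i <;> rfl

theorem pullback_eq (f : X → Y) (α : Y → Alt2 m) (x : X) :
    pullback (n := n) f α x = (α (f x)).compContinuousLinearMap (tder (Cn n) (Cn m) f x) := rfl

theorem pullback_id (α : X → Alt2 n) : pullback (n := n) (fun x : X => x) α = α := by
  funext x
  rw [pullback_eq, tder_id]
  rfl

theorem pullback_pullback {f : X → Y} {g : Y → Z} (α : Z → Alt2 k) {x : X}
    (hf : MDifferentiableAt 𝓘(ℝ, Cn n) 𝓘(ℝ, Cn m) f x)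
    (hg : MDifferentiableAt 𝓘(ℝ, Cn m) 𝓘(ℝ, Cn k) g (f x)) :
    pullback (n := n) (m := m) f (pullback g α) x = pullback (fun y => g (f y)) α x := by
  simp only [pullback_eq, tder_comp hg hf]
  rfl

theorem pullback_congr {f g : X → Y} (α : Y → Alt2 m) {x : X} (h : f =ᶠ[𝓝 x] g) :
    pullback (n := n) f α x = pullback g α x := by
  simp only [pullback_eq, tder_congr h, h.self_of_nhds]

theorem localRep_eq_pullback (α : X → Alt2 n) (p : X) :
    localRep α p = pullback (chartAt (Cn n) p).symm α := rfl

theorem alt2_ext {α β : Alt2 n} (h : ∀ v w, α ![v, w] = β ![v, w]) : α = β := by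
  ext v
  have : v = ![v 0, v 1] := by ext i : 1; fin_cases i <;> rfl
  rw [this]; exact h _ _

theorem alt2_swap (α : Alt2 n) (v w : Cn n) : α ![w, v] = -α ![v, w] := by
  have h := α.toAlternatingMap.map_swap ![v, w] (show (0 : Fin 2) ≠ 1 by decide)
  have h2 : ![v, w] ∘ (Equiv.swap (0 : Fin 2) 1) = ![w, v] := by
    ext i : 1; fin_cases i <;> rfl
  rw [h2] at h
  exact h

theorem localRep_apply (α : X → Alt2 n) (p : X) (y v w : Cn n) :
    localRep α p y ![v, w] = α ((chartAt (Cn n) p).symm y)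
      ![tder (Cn n) (Cn n) (chartAt (Cn n) p).symm y v,
        tder (Cn n) (Cn n) (chartAt (Cn n) p).symm y w] :=
  pullback_apply _ _ _ _ _

variable [IsManifold 𝓘(ℝ, Cn n) ∞ X]

theorem contMDiffAt_chart_symm {p : X} {y : Cn n} (hy : y ∈ (chartAt (Cn n) p).target) :
    ContMDiffAt 𝓘(ℝ, Cn n) 𝓘(ℝ, Cn n) ∞ (chartAt (Cn n) p).symm y :=
  contMDiffOn_chart_symm.contMDiffAt ((chartAt (Cn n) p).open_target.mem_nhds hy)

theorem contMDiffAt_chart {p x : X} (hx : x ∈ (chartAt (Cn n) p).source) :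
    ContMDiffAt 𝓘(ℝ, Cn n) 𝓘(ℝ, Cn n) ∞ (chartAt (Cn n) p) x :=
  contMDiffOn_chart.contMDiffAt ((chartAt (Cn n) p).open_source.mem_nhds hx)

theorem mdifferentiableAt_chart_symm {p : X} {y : Cn n} (hy : y ∈ (chartAt (Cn n) p).target) :
    MDifferentiableAt 𝓘(ℝ, Cn n) 𝓘(ℝ, Cn n) (chartAt (Cn n) p).symm y :=
  (contMDiffAt_chart_symm hy).mdifferentiableAt (by simp)

theorem mdifferentiableAt_chart {p x : X} (hx : x ∈ (chartAt (Cn n) p).source) :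
    MDifferentiableAt 𝓘(ℝ, Cn n) 𝓘(ℝ, Cn n) (chartAt (Cn n) p) x :=
  (contMDiffAt_chart hx).mdifferentiableAt (by simp)

theorem tder_chart_symm_tder_chart {p x : X} (hx : x ∈ (chartAt (Cn n) p).source) (v : Cn n) :
    tder (Cn n) (Cn n) (chartAt (Cn n) p).symm (chartAt (Cn n) p x)
      (tder (Cn n) (Cn n) (chartAt (Cn n) p) x v) = v :=
  tder_leftInverse (mdifferentiableAt_chart_symm ((chartAt (Cn n) p).map_source hx))
    (mdifferentiableAt_chart hx) ((chartAt (Cn n) p).eventually_left_inverse hx) v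

theorem tder_chart_tder_chart_symm {p : X} {y : Cn n} (hy : y ∈ (chartAt (Cn n) p).target)
    (v : Cn n) :
    tder (Cn n) (Cn n) (chartAt (Cn n) p) ((chartAt (Cn n) p).symm y)
      (tder (Cn n) (Cn n) (chartAt (Cn n) p).symm y v) = v :=
  tder_leftInverse (mdifferentiableAt_chart ((chartAt (Cn n) p).map_target hy))
    (mdifferentiableAt_chart_symm hy) ((chartAt (Cn n) p).eventually_right_inverse hy) v

theorem tder_chart_self (x : X) :
    tder (Cn n) (Cn n) (chartAt (Cn n) x) x = ContinuousLinearMap.id ℝ _ := by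
  have h := mfderiv_chartAt_eq_tangentCoordChange (I := 𝓘(ℝ, Cn n)) (mem_chart_source (Cn n) x)
  rw [tder, h]
  ext1 v
  exact tangentCoordChange_self (I := 𝓘(ℝ, Cn n)) (by simp)

theorem tder_chart_symm_self (x : X) :
    tder (Cn n) (Cn n) (chartAt (Cn n) x).symm (chartAt (Cn n) x x) =
      ContinuousLinearMap.id ℝ _ := by
  ext1 v
  have := tder_chart_symm_tder_chart (mem_chart_source (Cn n) x) v
  rw [tder_chart_self] at this
  exact this

theorem localRep_self (α : X → Alt2 n) (x : X) : localRep α x (chartAt (Cn n) x x) = α x := by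
  rw [localRep_eq_pullback, pullback_eq, tder_chart_symm_self,
    (chartAt (Cn n) x).left_inv (mem_chart_source _ x)]
  rfl

/-- A form is recovered from its coordinate expression. -/
theorem form_eq_localRep (α : X → Alt2 n) {p x : X} (hx : x ∈ (chartAt (Cn n) p).source)
    (v w : Cn n) :
    α x ![v, w] = localRep α p (chartAt (Cn n) p x)
      ![tder (Cn n) (Cn n) (chartAt (Cn n) p) x v, tder (Cn n) (Cn n) (chartAt (Cn n) p) x w] := by
  rw [localRep_apply, tder_chart_symm_tder_chart hx, tder_chart_symm_tder_chart hx,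
    (chartAt (Cn n) p).left_inv hx]

end Charts

section Calculus

variable {E E' : Type*} [NormedAddCommGroup E'] [NormedSpace ℝ E'] [NormedAddCommGroup E]
  [NormedSpace ℝ E]

/-- A 2-form on a vector space as a bilinear form, depending linearly on the 2-form. -/
noncomputable def curryForm : (E [⋀^Fin 2]→L[ℝ] ℝ) →L[ℝ] E →L[ℝ] E →L[ℝ] ℝ :=
  (ContinuousLinearMap.compL ℝ E (E [⋀^Fin 1]→L[ℝ] ℝ) (E →L[ℝ] ℝ)
    ((ContinuousAlternatingMap.ofSubsingletonLIE (𝕜 := ℝ) (E := E) (F := ℝ)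
      (0 : Fin 1)).symm.toContinuousLinearEquiv : _ →L[ℝ] _)).comp
    (ContinuousAlternatingMap.curryLeftLI (𝕜 := ℝ) (E := E) (F := ℝ)
      (n := 1)).toContinuousLinearMap

theorem curryForm_apply (α : E [⋀^Fin 2]→L[ℝ] ℝ) (v w : E) : curryForm α v w = α ![v, w] := by
  change α (Matrix.vecCons v _) = _
  congr 1
  funext i
  fin_cases i <;> rfl

theorem form_comp_apply (α : E [⋀^Fin 2]→L[ℝ] ℝ) (B : E' →L[ℝ] E) (v w : E') :
    α.compContinuousLinearMap B ![v, w] = α ![B v, B w] := by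
  change α (B ∘ ![v, w]) = _
  congr 1
  funext i
  fin_cases i <;> rfl

theorem contDiff_curryForm {r : WithTop ℕ∞} :
    ContDiff ℝ r (fun α : E [⋀^Fin 2]→L[ℝ] ℝ => curryForm α) := by
  apply ContinuousLinearMap.contDiff

theorem contDiffAt_form_apply {r : WithTop ℕ∞} {β : E' → E [⋀^Fin 2]→L[ℝ] ℝ} {a b : E' → E} {z : E'}
    (hβ : ContDiffAt ℝ r β z) (ha : ContDiffAt ℝ r a z) (hb : ContDiffAt ℝ r b z) :
    ContDiffAt ℝ r (fun z => β z ![a z, b z]) z := by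
  simp only [← curryForm_apply]
  have h : ContDiffAt ℝ r (fun z => curryForm (β z)) z :=
    (contDiff_curryForm (E := E)).comp_contDiffAt z hβ
  exact (h.clm_apply ha).clm_apply hb

/-- The pullback of a closed 2-form is closed: the cyclic identity for constant vector fields. -/
theorem closed_pullback_identity {β : E → E [⋀^Fin 2]→L[ℝ] ℝ} {Q : E' → E} {z : E'}
    (hβ : DifferentiableAt ℝ β (Q z)) (hc : extDeriv β (Q z) = 0) (hQ : ContDiffAt ℝ 2 Q z)
    (a b c : E') :
    fderiv ℝ (fun y => β (Q y) ![fderiv ℝ Q y b, fderiv ℝ Q y c]) z a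
      - fderiv ℝ (fun y => β (Q y) ![fderiv ℝ Q y a, fderiv ℝ Q y c]) z b
      + fderiv ℝ (fun y => β (Q y) ![fderiv ℝ Q y a, fderiv ℝ Q y b]) z c = 0 := by
  have hdQ : DifferentiableAt ℝ (fderiv ℝ Q) z :=
    (hQ.fderiv_right (m := 1) (by norm_num)).differentiableAt (by simp)
  have h := extDeriv_pullback (r := 2) hβ hQ (by simp)
  rw [hc] at h
  have hd : DifferentiableAt ℝ
      (fun x => (β (Q x)).compContinuousLinearMap (fderiv ℝ Q x)) z :=
    (hβ.comp z (hQ.differentiableAt (by simp))).continuousAlternatingMapCompContinuousLinearMap hdQ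
  have h2 := extDeriv_apply hd ![a, b, c]
  rw [h] at h2
  rw [Fin.sum_univ_three] at h2
  have e0 : ∀ y, (β (Q y)).compContinuousLinearMap (fderiv ℝ Q y)
      (Fin.removeNth 0 ![a, b, c]) = β (Q y) ![fderiv ℝ Q y b, fderiv ℝ Q y c] := by
    intro y
    change β (Q y) _ = _
    congr 1
    funext i
    fin_cases i <;> rfl
  have e1 : ∀ y, (β (Q y)).compContinuousLinearMap (fderiv ℝ Q y)
      (Fin.removeNth 1 ![a, b, c]) = β (Q y) ![fderiv ℝ Q y a, fderiv ℝ Q y c] := by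
    intro y
    change β (Q y) _ = _
    congr 1
    funext i
    fin_cases i <;> rfl
  have e2 : ∀ y, (β (Q y)).compContinuousLinearMap (fderiv ℝ Q y)
      (Fin.removeNth 2 ![a, b, c]) = β (Q y) ![fderiv ℝ Q y a, fderiv ℝ Q y b] := by
    intro y
    change β (Q y) _ = _
    congr 1
    funext i
    fin_cases i <;> rfl
  simp only [e0, e1, e2] at h2
  simp at h2
  linarith

end Calculus

section LinearAlgebra

variable {n m : ℕ}

/-- The sesquilinear form `α(v, J w) - i α(v, w)` of a real 2-form. -/
noncomputable def sesq (α : Alt2 n) (v w : Cn n) : ℂ :=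
  (α ![v, J n w] : ℂ) - Complex.I * (α ![v, w] : ℂ)

/-- Real forms of type (1,1). -/
def IsOneOne (α : Alt2 n) : Prop := ∀ v w, α ![J n v, J n w] = α ![v, w]

/-- Positive (1,1)-forms. -/
def IsPositiveForm (α : Alt2 n) : Prop := IsOneOne α ∧ ∀ v, v ≠ 0 → 0 < α ![v, J n v]

theorem form_add_left (α : Alt2 n) (u v w : Cn n) : α ![u + v, w] = α ![u, w] + α ![v, w] := by
  simp only [← curryForm_apply, map_add, add_apply]

theorem form_add_right (α : Alt2 n) (u v w : Cn n) : α ![u, v + w] = α ![u, v] + α ![u, w] := by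
  simp only [← curryForm_apply, map_add]

theorem form_smul_left (α : Alt2 n) (c : ℝ) (v w : Cn n) : α ![c • v, w] = c * α ![v, w] := by
  simp only [← curryForm_apply, map_smul, smul_apply, smul_eq_mul]

theorem form_smul_right (α : Alt2 n) (c : ℝ) (v w : Cn n) : α ![v, c • w] = c * α ![v, w] := by
  simp only [← curryForm_apply, map_smul, smul_eq_mul]

theorem form_neg_left (α : Alt2 n) (v w : Cn n) : α ![-v, w] = -α ![v, w] := by
  simp only [← curryForm_apply, map_neg, neg_apply]

theorem form_neg_right (α : Alt2 n) (v w : Cn n) : α ![v, -w] = -α ![v, w] := by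
  simp only [← curryForm_apply, map_neg]

theorem form_zero_left (α : Alt2 n) (w : Cn n) : α ![0, w] = 0 := by
  simp only [← curryForm_apply, map_zero, zero_apply]

theorem form_zero_right (α : Alt2 n) (w : Cn n) : α ![w, 0] = 0 := by
  simp only [← curryForm_apply, map_zero]

theorem IsOneOne.J_left {α : Alt2 n} (h : IsOneOne α) (v w : Cn n) :
    α ![J n v, w] = -α ![v, J n w] := by
  rw [← h v (J n w), J_J, form_neg_right, neg_neg]

theorem complex_smul_eq (c : ℂ) (v : Cn n) : c • v = c.re • v + c.im • J n v := by
  rw [J_apply]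
  ext i
  simp only [Pi.smul_apply, Pi.add_apply, smul_eq_mul, Complex.real_smul]
  conv_lhs => rw [← Complex.re_add_im c]
  ring

theorem sesq_add_left (α : Alt2 n) (u v w : Cn n) : sesq α (u + v) w = sesq α u w + sesq α v w := by
  simp only [sesq, form_add_left]; push_cast; ring

theorem sesq_add_right (α : Alt2 n) (u v w : Cn n) :
    sesq α u (v + w) = sesq α u v + sesq α u w := by
  simp only [sesq, map_add, form_add_right]; push_cast; ring

theorem sesq_smul_left {α : Alt2 n} (h : IsOneOne α) (c : ℂ) (v w : Cn n) :
    sesq α (c • v) w = c * sesq α v w := by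
  rw [complex_smul_eq]
  simp only [sesq, form_add_left, form_smul_left, h.J_left, J_J, form_neg_right]
  conv_rhs => rw [← Complex.re_add_im c]
  push_cast
  linear_combination ((c.im : ℂ) * (α ![v, w] : ℂ)) * Complex.I_sq

theorem sesq_smul_right {α : Alt2 n} (c : ℂ) (v w : Cn n) :
    sesq α v (c • w) = (starRingEnd ℂ) c * sesq α v w := by
  rw [complex_smul_eq]
  simp only [sesq, map_add, map_smul, form_add_right, form_smul_right, J_J, form_neg_right]
  conv_rhs => rw [← Complex.re_add_im c]
  simp only [map_add, map_mul, Complex.conj_ofReal, Complex.conj_I]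
  push_cast
  linear_combination (-(c.im : ℂ) * (α ![v, w] : ℂ)) * Complex.I_sq

theorem sesq_conj {α : Alt2 n} (h : IsOneOne α) (v w : Cn n) :
    (starRingEnd ℂ) (sesq α v w) = sesq α w v := by
  have h1 : α ![w, J n v] = α ![v, J n w] := by
    rw [alt2_swap, h.J_left, neg_neg]
  simp only [sesq, map_sub, map_mul, Complex.conj_ofReal, Complex.conj_I, h1, alt2_swap α v w]
  push_cast; ring

theorem herm_apply (α : Alt2 n) (a b : Fin n) :
    herm α a b = sesq α (Pi.single a 1) (Pi.single b 1) := rfl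

theorem sesq_sum_left (α : Alt2 n) {ι : Type*} (s : Finset ι) (v : ι → Cn n) (w : Cn n) :
    sesq α (∑ i ∈ s, v i) w = ∑ i ∈ s, sesq α (v i) w := by
  classical
  induction s using Finset.induction_on with
  | empty => simp [sesq, form_zero_left]
  | insert a s ha ih => rw [Finset.sum_insert ha, Finset.sum_insert ha, sesq_add_left, ih]

theorem sesq_sum_right (α : Alt2 n) {ι : Type*} (s : Finset ι) (v : ι → Cn n) (w : Cn n) :
    sesq α w (∑ i ∈ s, v i) = ∑ i ∈ s, sesq α w (v i) := by
  classical
  induction s using Finset.induction_on with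
  | empty => simp [sesq, form_zero_right]
  | insert a s ha ih => rw [Finset.sum_insert ha, Finset.sum_insert ha, sesq_add_right, ih]

theorem sum_smul_single (v : Cn n) : v = ∑ a, v a • (Pi.single a 1 : Cn n) := by
  funext i
  simp [Finset.sum_apply, Pi.single_apply]

theorem sesq_eq_sum {α : Alt2 n} (h : IsOneOne α) (v w : Cn n) :
    sesq α v w = ∑ a, ∑ b, v a * herm α a b * (starRingEnd ℂ) (w b) := by
  conv_lhs => rw [sum_smul_single v, sum_smul_single w]
  simp only [sesq_sum_left, sesq_sum_right, sesq_smul_left h, sesq_smul_right, herm_apply, Finset.mul_sum]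
  rw [Finset.sum_comm]
  refine Finset.sum_congr rfl fun a _ => ?_
  refine Finset.sum_congr rfl fun b _ => ?_
  ring

theorem herm_comp {α : Alt2 n} (h : IsOneOne α) (A : Cn n →L[ℂ] Cn n) :
    herm (α.compContinuousLinearMap (A.restrictScalars ℝ)) =
      (LinearMap.toMatrix' (A : Cn n →ₗ[ℂ] Cn n)).transpose * herm α *
        (LinearMap.toMatrix' (A : Cn n →ₗ[ℂ] Cn n)).map (starRingEnd ℂ) := by
  ext a b
  have h1 : herm (α.compContinuousLinearMap (A.restrictScalars ℝ)) a b =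
      sesq α (A (Pi.single a 1)) (A (Pi.single b 1)) := by
    have hJ : A (J n (Pi.single b 1)) = J n (A (Pi.single b 1)) := A.map_smul _ _
    rw [herm_apply, sesq, sesq, ← hJ]
    simp only [form_comp_apply]
    rfl
  rw [h1, sesq_eq_sum h, Matrix.mul_apply, Finset.sum_comm]
  refine Finset.sum_congr rfl fun j _ => ?_
  rw [Matrix.mul_apply, Finset.sum_mul]
  refine Finset.sum_congr rfl fun i _ => ?_
  simp [LinearMap.toMatrix'_apply]

open ComplexOrder in
theorem IsPositiveForm.posDef {α : Alt2 n} (h : IsPositiveForm α) : (herm α).PosDef := by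
  have hself : ∀ v, sesq α v v = ((α ![v, J n v] : ℝ) : ℂ) := by
    intro v
    have : α ![v, v] = 0 := by
      have := alt2_swap α v v; linarith
    simp [sesq, this]
  refine Matrix.PosDef.of_dotProduct_mulVec_pos ?_ ?_
  · ext a b
    rw [Matrix.conjTranspose_apply, herm_apply, herm_apply]
    exact sesq_conj h.1 _ _
  · intro x hx
    have hx' : star x ≠ 0 := by simpa using hx
    have h1 := sesq_eq_sum h.1 (star x) (star x)
    have h2 : star x ⬝ᵥ (herm α).mulVec x = sesq α (star x) (star x) := by
      rw [h1]
      simp only [dotProduct, Matrix.mulVec, Finset.mul_sum]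
      refine Finset.sum_congr rfl fun a _ => Finset.sum_congr rfl fun b _ => ?_
      simp [mul_assoc]
    rw [h2, hself]
    exact_mod_cast h.2 _ hx'

open ComplexOrder in
theorem IsPositiveForm.det_eq {α : Alt2 n} (h : IsPositiveForm α) :
    (herm α).det = ((herm α).det.re : ℂ) := by
  have := h.posDef.det_pos
  apply Complex.ext
  · simp
  · simpa using (Complex.lt_def.1 this).2.symm

open ComplexOrder in
theorem IsPositiveForm.det_re_pos {α : Alt2 n} (h : IsPositiveForm α) : 0 < (herm α).det.re := by
  simpa using (Complex.lt_def.1 h.posDef.det_pos).1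

/-- The real basis `e_a, i e_a` of `ℂⁿ`. -/
noncomputable def realBasis (n : ℕ) : Module.Basis (Σ _ : Fin n, Fin 2) ℝ (Cn n) :=
  Pi.basis fun _ => Complex.basisOneI

/-- The matrix of a 2-form in the real basis. -/
noncomputable def formMatrix (α : Alt2 n) : Matrix (Σ _ : Fin n, Fin 2) (Σ _ : Fin n, Fin 2) ℝ :=
  Matrix.of fun i j => α ![realBasis n i, realBasis n j]

/-- The density `|αⁿ / n!|` of a 2-form on `ℂⁿ` with respect to Lebesgue measure. -/
noncomputable def dens (α : Alt2 n) : ℝ := Real.sqrt |(formMatrix α).det|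

theorem formMatrix_comp (α : Alt2 n) (B : Cn n →L[ℝ] Cn n) :
    formMatrix (α.compContinuousLinearMap B) =
      (LinearMap.toMatrix (realBasis n) (realBasis n) (B : Cn n →ₗ[ℝ] Cn n)).transpose *
        formMatrix α * LinearMap.toMatrix (realBasis n) (realBasis n) (B : Cn n →ₗ[ℝ] Cn n) := by
  ext i j
  have h1 : formMatrix (α.compContinuousLinearMap B) i j =
      curryForm α (B (realBasis n i)) (B (realBasis n j)) := by
    rw [curryForm_apply, ← form_comp_apply]
    rfl
  have h2 : ∀ v : Cn n, v = ∑ k, (realBasis n).repr v k • realBasis n k := fun v =>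
    ((realBasis n).sum_repr v).symm
  rw [h1, h2 (B (realBasis n i)), h2 (B (realBasis n j))]
  simp only [map_sum, map_smul, sum_apply, smul_apply,
    smul_eq_mul, Matrix.mul_apply, Finset.sum_mul, Finset.mul_sum, Matrix.transpose_apply,
    LinearMap.toMatrix_apply, curryForm_apply, formMatrix, Matrix.of_apply]
  refine Finset.sum_congr rfl fun a _ => Finset.sum_congr rfl fun b _ => ?_
  simp only [ContinuousLinearMap.coe_coe]
  ring

theorem dens_comp (α : Alt2 n) (B : Cn n →L[ℝ] Cn n) :
    dens (α.compContinuousLinearMap B) = |B.det| * dens α := by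
  rw [dens, formMatrix_comp, Matrix.det_mul, Matrix.det_mul, Matrix.det_transpose,
    LinearMap.det_toMatrix, mul_right_comm, abs_mul, abs_mul,
    Real.sqrt_mul (by positivity), Real.sqrt_mul_self (abs_nonneg _)]
  rfl

theorem realBasis_zero (a : Fin n) : realBasis n ⟨a, 0⟩ = Pi.single a 1 := by
  simp [realBasis, Pi.basis_apply]

theorem realBasis_one (a : Fin n) : realBasis n ⟨a, 1⟩ = J n (Pi.single a 1) := by
  rw [J_apply, ← Pi.single_smul]
  simp [realBasis, Pi.basis_apply]

/-- The endomorphism of `ℂⁿ` that represents a 2-form. -/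
noncomputable def formEnd (α : Alt2 n) : Cn n →ₗ[ℝ] Cn n where
  toFun v := fun a => (α ![v, Pi.single a 1] : ℂ) + Complex.I * (α ![v, J n (Pi.single a 1)] : ℂ)
  map_add' v w := by
    funext a
    simp only [form_add_left, Pi.add_apply]; push_cast; ring
  map_smul' c v := by
    funext a
    simp only [form_smul_left, Pi.smul_apply, RingHom.id_apply, Complex.real_smul]
    push_cast; ring

theorem formEnd_apply (α : Alt2 n) (v : Cn n) (a : Fin n) : formEnd α v a =
    (α ![v, Pi.single a 1] : ℂ) + Complex.I * (α ![v, J n (Pi.single a 1)] : ℂ) := rfl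

theorem formMatrix_eq (α : Alt2 n) :
    formMatrix α = (LinearMap.toMatrix (realBasis n) (realBasis n) (formEnd α)).transpose := by
  ext i ⟨a, k⟩
  rw [Matrix.transpose_apply, LinearMap.toMatrix_apply]
  have : (realBasis n).repr (formEnd α (realBasis n i)) ⟨a, k⟩ =
      Complex.basisOneI.repr (formEnd α (realBasis n i) a) k := by
    simp [realBasis, Pi.basis_repr]
  rw [this, formEnd_apply]
  fin_cases k
  · simp [formMatrix, realBasis_zero]
  · simp [formMatrix, realBasis_one]

theorem dens_eq_sqrt (α : Alt2 n) : dens α = Real.sqrt |LinearMap.det (formEnd α)| := by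
  rw [dens, formMatrix_eq, Matrix.det_transpose, LinearMap.det_toMatrix]

/-- Nondegenerate 2-forms. -/
def IsNondeg (α : Alt2 n) : Prop := ∀ v, (∀ w, α ![v, w] = 0) → v = 0

theorem formEnd_ne_zero {α : Alt2 n} (h : IsNondeg α) : LinearMap.det (formEnd α) ≠ 0 := by
  have hinj : LinearMap.ker (formEnd α) = ⊥ := by
    rw [LinearMap.ker_eq_bot']
    intro v hv
    apply h
    have h1 : ∀ a, α ![v, Pi.single a 1] = 0 ∧ α ![v, J n (Pi.single a 1)] = 0 := by
      intro a
      have := congrFun hv a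
      rw [formEnd_apply] at this
      have h1 := congrArg Complex.re this
      have h2 := congrArg Complex.im this
      simp at h1 h2
      exact ⟨h1, h2⟩
    have h2 : curryForm α v = 0 := by
      apply ContinuousLinearMap.coe_injective
      apply (realBasis n).ext
      rintro ⟨a, k⟩
      fin_cases k
      · simpa [realBasis_zero, curryForm_apply] using (h1 a).1
      · simpa [realBasis_one, curryForm_apply] using (h1 a).2
    intro w
    rw [← curryForm_apply, h2]; rfl
  intro h0
  exact (LinearMap.bot_lt_ker_of_det_eq_zero h0).ne' hinj

theorem dens_pos {α : Alt2 n} (h : IsNondeg α) : 0 < dens α := by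
  rw [dens_eq_sqrt]
  exact Real.sqrt_pos.2 (abs_pos.2 (formEnd_ne_zero h))

theorem formMatrix_det_ne_zero {α : Alt2 n} (h : IsNondeg α) : (formMatrix α).det ≠ 0 := by
  rw [formMatrix_eq, Matrix.det_transpose, LinearMap.det_toMatrix]
  exact formEnd_ne_zero h

theorem IsPositiveForm.isNondeg {α : Alt2 n} (h : IsPositiveForm α) : IsNondeg α := by
  intro v hv
  by_contra hne
  exact (h.2 v hne).ne' (hv _)

theorem IsPositiveForm.dens_eq {α : Alt2 n} (h : IsPositiveForm α) :
    dens α = (herm α).det.re := by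
  have h1 : formEnd α = (Matrix.toLin' (Complex.I • (herm α).transpose)).restrictScalars ℝ := by
    refine LinearMap.ext fun v => funext fun a => ?_
    have h2 : formEnd α v a = Complex.I * sesq α v (Pi.single a 1) := by
      rw [formEnd_apply, sesq]
      linear_combination ((α ![v, Pi.single a 1] : ℂ)) * Complex.I_sq
    rw [h2, sesq_eq_sum h.1]
    simp only [LinearMap.coe_restrictScalars, Matrix.toLin'_apply, Matrix.mulVec, dotProduct,
      Matrix.smul_apply, Matrix.transpose_apply, smul_eq_mul, Finset.mul_sum]
    refine Finset.sum_congr rfl fun b _ => ?_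
    rw [Finset.sum_eq_single a]
    · simp; ring
    · intro c _ hc
      simp [hc]
    · simp
  rw [dens_eq_sqrt, h1, LinearMap.det_restrictScalars, LinearMap.det_toLin', Matrix.det_smul,
    Matrix.det_transpose, Algebra.norm_complex_apply, map_mul, h.det_eq, Complex.normSq_ofReal]
  simp only [map_pow, Complex.normSq_I, one_pow, one_mul, Complex.ofReal_re]
  rw [abs_mul_self, Real.sqrt_mul_self h.det_re_pos.le]

end LinearAlgebra

section Family

variable {n : ℕ} {X : Type*} [TopologicalSpace X] [ChartedSpace (Cn n) X]

/-- Smooth families of 2-forms, parametrized by a normed space. -/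
def SmoothFamily {B : Type*} [NormedAddCommGroup B] [NormedSpace ℝ B] (α : B → X → Alt2 n) : Prop :=
  ∀ (p : X) (v w : Cn n), ContDiffOn ℝ ∞ (fun z : B × Cn n => localRep (α z.1) p z.2 ![v, w])
    (Set.univ ×ˢ (chartAt (Cn n) p).target)

variable [IsManifold 𝓘(ℝ, Cn n) ∞ X]

theorem localRep_nondeg {α : X → Alt2 n} (h : ∀ x, IsNondeg (α x)) (p : X) {y : Cn n}
    (hy : y ∈ (chartAt (Cn n) p).target) : IsNondeg (localRep α p y) := by
  intro v hv
  have h1 : tder (Cn n) (Cn n) (chartAt (Cn n) p).symm y v = 0 := by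
    apply h ((chartAt (Cn n) p).symm y)
    intro w
    have h2 := hv (tder (Cn n) (Cn n) (chartAt (Cn n) p) ((chartAt (Cn n) p).symm y) w)
    rw [localRep_apply] at h2
    have h3 := tder_chart_symm_tder_chart ((chartAt (Cn n) p).map_target hy) w
    rw [(chartAt (Cn n) p).right_inv hy] at h3
    rwa [h3] at h2
  have := tder_chart_tder_chart_symm hy v
  rw [h1, map_zero] at this
  exact this.symm

theorem contDiffAt_dens {E : Type*} [NormedAddCommGroup E] [NormedSpace ℝ E] {β : E → Alt2 n}
    {z : E} (h : ∀ v w, ContDiffAt ℝ ∞ (fun z => β z ![v, w]) z)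
    (hn : IsNondeg (β z)) : ContDiffAt ℝ ∞ (fun z => dens (β z)) z := by
  have h1 : ContDiffAt ℝ ∞ (fun z => (formMatrix (β z)).det) z := by
    simp only [Matrix.det_apply, Units.smul_def, zsmul_eq_mul]
    refine ContDiffAt.sum fun σ _ => contDiffAt_const.mul (contDiffAt_prod fun i _ => h _ _)
  have h0 := formMatrix_det_ne_zero hn
  exact (h1.abs h0).sqrt (abs_pos.2 h0).ne'

variable {B : Type*} [NormedAddCommGroup B] [NormedSpace ℝ B] {α : B → X → Alt2 n}

theorem SmoothFamily.contDiffOn_dens (hα : SmoothFamily α) (hn : ∀ b x, IsNondeg (α b x)) (p : X) :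
    ContDiffOn ℝ ∞ (fun z : B × Cn n => dens (localRep (α z.1) p z.2))
      (Set.univ ×ˢ (chartAt (Cn n) p).target) := by
  intro z hz
  have hopen : IsOpen ((Set.univ : Set B) ×ˢ (chartAt (Cn n) p).target) :=
    isOpen_univ.prod (chartAt (Cn n) p).open_target
  exact (contDiffAt_dens (fun v w => (hα p v w).contDiffAt (hopen.mem_nhds hz))
    (localRep_nondeg (hn z.1) p hz.2)).contDiffWithinAt

theorem SmoothFamily.continuousOn_dens (hα : SmoothFamily α) (hn : ∀ b x, IsNondeg (α b x)) (b : B)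
    (p : X) : ContinuousOn (fun y => dens (localRep (α b) p y)) (chartAt (Cn n) p).target :=
  (hα.contDiffOn_dens hn p).continuousOn.comp (f := fun y => (b, y))
    (by fun_prop) fun y hy => ⟨trivial, hy⟩

/-- The density of `α b` with respect to `α b₀`. -/
noncomputable def densRatio (α : B → X → Alt2 n) (b₀ b : B) (x : X) : ℝ :=
  dens (α b x) / dens (α b₀ x)

theorem densRatio_eq_chart (hn : ∀ b x, IsNondeg (α b x)) (b₀ b : B) {p : X} {y : Cn n}
    (hy : y ∈ (chartAt (Cn n) p).target) : densRatio α b₀ b ((chartAt (Cn n) p).symm y) =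
      dens (localRep (α b) p y) / dens (localRep (α b₀) p y) := by
  have h0 := (dens_pos (localRep_nondeg (hn b₀) p hy)).ne'
  simp only [localRep_eq_pullback, pullback_eq, dens_comp] at h0 ⊢
  rw [densRatio, mul_div_mul_left _ _ (left_ne_zero_of_mul h0)]

theorem densRatio_pos (hn : ∀ b x, IsNondeg (α b x)) (b₀ b : B) (x : X) : 0 < densRatio α b₀ b x :=
  div_pos (dens_pos (hn b x)) (dens_pos (hn b₀ x))

theorem contDiffOn_densRatio (hα : SmoothFamily α) (hn : ∀ b x, IsNondeg (α b x)) (b₀ : B) (p : X) :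
    ContDiffOn ℝ ∞ (fun z : B × Cn n => densRatio α b₀ z.1 ((chartAt (Cn n) p).symm z.2))
      (Set.univ ×ˢ (chartAt (Cn n) p).target) := by
  have h1 := hα.contDiffOn_dens hn p
  have hpre : ContDiff ℝ ∞ (fun z : B × Cn n => ((b₀, z.2) : B × Cn n)) :=
    contDiff_const.prodMk contDiff_snd
  have h2 : ContDiffOn ℝ ∞ (fun z : B × Cn n => dens (localRep (α b₀) p z.2))
      (Set.univ ×ˢ (chartAt (Cn n) p).target) :=
    ContDiffOn.comp (t := Set.univ ×ˢ (chartAt (Cn n) p).target) h1 hpre.contDiffOn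
      fun z hz => ⟨trivial, hz.2⟩
  refine (h1.div h2 fun z hz => (dens_pos (localRep_nondeg (hn b₀) p hz.2)).ne').congr fun z hz => ?_
  exact densRatio_eq_chart hn b₀ z.1 hz.2

theorem continuous_densRatio (hα : SmoothFamily α) (hn : ∀ b x, IsNondeg (α b x)) (b₀ b : B) :
    Continuous (densRatio α b₀ b) := by
  rw [continuous_iff_continuousAt]
  intro x
  have hx := mem_chart_source (Cn n) x
  have h1 : ContinuousAt (fun y => densRatio α b₀ b ((chartAt (Cn n) x).symm y))
      (chartAt (Cn n) x x) := by
    have := (contDiffOn_densRatio hα hn b₀ x).continuousOn.comp (f := fun y => (b, y))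
      (s := (chartAt (Cn n) x).target) (by fun_prop) fun y hy => ⟨trivial, hy⟩
    exact this.continuousAt ((chartAt (Cn n) x).open_target.mem_nhds
      ((chartAt (Cn n) x).map_source hx))
  have h2 := h1.comp ((chartAt (Cn n) x).continuousAt hx)
  refine h2.congr ?_
  filter_upwards [(chartAt (Cn n) x).eventually_left_inverse hx] with z hz
  simp only [Function.comp_apply, hz]

end Family

section Volume

variable {n : ℕ} {X : Type*} [TopologicalSpace X] [ChartedSpace (Cn n) X] [MeasurableSpace X]

/-- The measure `|αⁿ / n!|` of a 2-form on the domain of the chart at `p`. -/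
noncomputable def densChart (α : X → Alt2 n) (p : X) : Measure X :=
  (((volume : Measure (Cn n)).restrict (chartAt (Cn n) p).target).withDensity
    (fun y => ENNReal.ofReal (dens (localRep α p y)))).map (chartAt (Cn n) p).symm

/-- The measure `|αⁿ / n!|` of a 2-form on a real manifold modelled on `ℂⁿ`. -/
noncomputable def densVol (α : X → Alt2 n) : Measure X := ⨆ p : X, densChart α p

variable [BorelSpace X]

theorem aemeasurable_chart_symm (p : X) (f : Cn n → ENNReal) :
    AEMeasurable (chartAt (Cn n) p).symm
      (((volume : Measure (Cn n)).restrict (chartAt (Cn n) p).target).withDensity f) :=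
  ((chartAt (Cn n) p).continuousOn_symm.aemeasurable
    (chartAt (Cn n) p).open_target.measurableSet).mono_ac (withDensity_absolutelyContinuous _ _)

theorem measurableSet_chart_image {p : X} {A : Set X} (hA : MeasurableSet A)
    (hAp : A ⊆ (chartAt (Cn n) p).source) : MeasurableSet (chartAt (Cn n) p '' A) := by
  classical
  rw [(chartAt (Cn n) p).image_eq_target_inter_inv_preimage hAp]
  have hm : Measurable ((chartAt (Cn n) p).target.piecewise (chartAt (Cn n) p).symm fun _ => p) :=
    (chartAt (Cn n) p).continuousOn_symm.measurable_piecewise continuousOn_const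
      (chartAt (Cn n) p).open_target.measurableSet
  have : (chartAt (Cn n) p).target ∩ (chartAt (Cn n) p).symm ⁻¹' A =
      (chartAt (Cn n) p).target ∩
        ((chartAt (Cn n) p).target.piecewise (chartAt (Cn n) p).symm fun _ => p) ⁻¹' A := by
    ext y
    constructor
    · rintro ⟨h1, h2⟩
      exact ⟨h1, by simpa [h1] using h2⟩
    · rintro ⟨h1, h2⟩
      exact ⟨h1, by simpa [h1] using h2⟩
  rw [this]
  exact (chartAt (Cn n) p).open_target.measurableSet.inter (hm hA)

theorem densChart_apply (α : X → Alt2 n) (p : X) {A : Set X} (hA : MeasurableSet A) :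
    densChart α p A = ∫⁻ y in chartAt (Cn n) p '' (A ∩ (chartAt (Cn n) p).source),
      ENNReal.ofReal (dens (localRep α p y)) := by
  have hs : chartAt (Cn n) p '' (A ∩ (chartAt (Cn n) p).source) =
      (chartAt (Cn n) p).symm ⁻¹' A ∩ (chartAt (Cn n) p).target := by
    rw [(chartAt (Cn n) p).image_eq_target_inter_inv_preimage Set.inter_subset_right]
    ext y
    constructor
    · rintro ⟨h1, h2⟩; exact ⟨h2.1, h1⟩
    · rintro ⟨h1, h2⟩; exact ⟨h2, h1, (chartAt (Cn n) p).map_target h2⟩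
  rw [densChart, Measure.map_apply_of_aemeasurable (aemeasurable_chart_symm p _) hA,
    withDensity_apply', Measure.restrict_restrict' (chartAt (Cn n) p).open_target.measurableSet, hs]

theorem densChart_inter_source (α : X → Alt2 n) (p : X) {A : Set X} (hA : MeasurableSet A) :
    densChart α p (A ∩ (chartAt (Cn n) p).source) = densChart α p A := by
  rw [densChart_apply α p hA,
    densChart_apply α p (hA.inter (chartAt (Cn n) p).open_source.measurableSet), Set.inter_assoc,
    Set.inter_self]

variable [IsManifold 𝓘(ℝ, Cn n) ∞ X]
  {Y : Type*} [TopologicalSpace Y] [ChartedSpace (Cn n) Y] [MeasurableSpace Y] [BorelSpace Y]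
  [IsManifold 𝓘(ℝ, Cn n) ∞ Y]

/-- Change of variables in charts. -/
theorem densChart_pullback {Θ : X → Y} (hΘ : ContMDiff 𝓘(ℝ, Cn n) 𝓘(ℝ, Cn n) ∞ Θ)
    (hinj : Function.Injective Θ) (α : Y → Alt2 n) {p : X} {q : Y} {A : Set X}
    (hA : MeasurableSet A) (hAp : A ⊆ (chartAt (Cn n) p).source) (hB : MeasurableSet (Θ '' A))
    (hAq : Θ '' A ⊆ (chartAt (Cn n) q).source) :
    densChart (pullback (n := n) Θ α) p A = densChart α q (Θ '' A) := by
  set c := chartAt (Cn n) p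
  set d := chartAt (Cn n) q
  set τ : Cn n → Cn n := fun y => d (Θ (c.symm y)) with hτ
  have himg : d '' (Θ '' A) = τ '' (c '' A) := by
    rw [Set.image_image, Set.image_image]
    refine Set.image_congr fun x hx => ?_
    simp only [hτ, c.left_inv (hAp hx)]
  have hmem : ∀ y ∈ c '' A, y ∈ c.target ∧ Θ (c.symm y) ∈ d.source := by
    rintro _ ⟨x, hx, rfl⟩
    refine ⟨c.map_source (hAp hx), ?_⟩
    rw [c.left_inv (hAp hx)]
    exact hAq ⟨x, hx, rfl⟩
  have hΘd : ∀ x, MDifferentiableAt 𝓘(ℝ, Cn n) 𝓘(ℝ, Cn n) Θ x := fun x =>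
    (hΘ x).mdifferentiableAt (by simp)
  have hd1 : ∀ y ∈ c '' A, MDifferentiableAt 𝓘(ℝ, Cn n) 𝓘(ℝ, Cn n) (fun y => Θ (c.symm y)) y :=
    fun y hy => (hΘd _).comp y (mdifferentiableAt_chart_symm (hmem y hy).1)
  have hd2 : ∀ y ∈ c '' A, MDifferentiableAt 𝓘(ℝ, Cn n) 𝓘(ℝ, Cn n) τ y := fun y hy =>
    (mdifferentiableAt_chart (hmem y hy).2).comp y (hd1 y hy)
  have hder : ∀ y ∈ c '' A, HasFDerivWithinAt τ (tder (Cn n) (Cn n) τ y) (c '' A) y := by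
    intro y hy
    rw [tder_eq_fderiv]
    exact (mdifferentiableAt_iff_differentiableAt.1 (hd2 y hy)).hasFDerivAt.hasFDerivWithinAt
  have hinjτ : Set.InjOn τ (c '' A) := by
    rintro _ ⟨x, hx, rfl⟩ _ ⟨x', hx', rfl⟩ h
    simp only [hτ, c.left_inv (hAp hx), c.left_inv (hAp hx')] at h
    rw [hinj (d.injOn (hAq ⟨x, hx, rfl⟩) (hAq ⟨x', hx', rfl⟩) h)]
  rw [densChart_apply _ _ hA, densChart_apply _ _ hB, Set.inter_eq_left.2 hAp,
    Set.inter_eq_left.2 hAq]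
  change _ = ∫⁻ y in d '' (Θ '' A), _
  rw [himg, lintegral_image_eq_lintegral_abs_det_fderiv_mul volume
    (measurableSet_chart_image hA hAp) hder hinjτ]
  refine setLIntegral_congr_fun (measurableSet_chart_image hA hAp) fun y hy => ?_
  have h1 : localRep (pullback (n := n) Θ α) p y = pullback τ (localRep α q) y := by
    rw [localRep_eq_pullback, pullback_pullback α (mdifferentiableAt_chart_symm (hmem y hy).1)
      (hΘd _), localRep_eq_pullback, pullback_pullback α (hd2 y hy)
      (mdifferentiableAt_chart_symm (d.map_source (hmem y hy).2))]
    refine pullback_congr α ?_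
    have : ∀ᶠ z in 𝓝 y, Θ (c.symm z) ∈ d.source :=
      (hd1 y hy).continuousAt.eventually (d.open_source.mem_nhds (hmem y hy).2)
    filter_upwards [this] with z hz
    exact (d.left_inv hz).symm
  rw [h1, pullback_eq, dens_comp, ENNReal.ofReal_mul (abs_nonneg _)]

theorem densChart_le {α : X → Alt2 n} {p q : X} {A : Set X} (hA : MeasurableSet A)
    (hAp : A ⊆ (chartAt (Cn n) p).source) : densChart α q A ≤ densChart α p A := by
  have hm := hA.inter (chartAt (Cn n) q).open_source.measurableSet
  have h := densChart_pullback (Θ := fun x : X => x) contMDiff_id Function.injective_id α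
    (p := q) (q := p) (A := A ∩ (chartAt (Cn n) q).source) hm
    Set.inter_subset_right (by simpa using hm)
    (by simpa using Set.inter_subset_left.trans hAp)
  rw [pullback_id, densChart_inter_source _ _ hA] at h
  rw [h]
  simp only [Set.image_id']
  exact measure_mono Set.inter_subset_left

theorem densVol_apply (α : X → Alt2 n) {p : X} {A : Set X} (hA : MeasurableSet A)
    (hAp : A ⊆ (chartAt (Cn n) p).source) : densVol α A = densChart α p A := by
  apply le_antisymm
  · set s := (chartAt (Cn n) p).source
    have hs : MeasurableSet s := (chartAt (Cn n) p).open_source.measurableSet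
    have hle : densVol α ≤ densChart α p + (⊤ : Measure X).restrict sᶜ := by
      refine iSup_le fun q => Measure.le_iff.2 fun B hB => ?_
      rw [← measure_inter_add_sdiff B hs, Measure.add_apply,
        Measure.restrict_apply hB]
      refine add_le_add ((densChart_le (hB.inter hs) Set.inter_subset_right).trans
        (measure_mono Set.inter_subset_left)) ?_
      rw [Set.sdiff_eq]
      rcases (B ∩ sᶜ).eq_empty_or_nonempty with h | h
      · simp [h]
      · exact le_top.trans_eq (OuterMeasure.top_apply h).symm
    refine (Measure.le_iff.1 hle A hA).trans ?_
    rw [Measure.add_apply, Measure.restrict_apply hA]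
    have : A ∩ sᶜ = ∅ := by
      rw [← Set.sdiff_eq, Set.sdiff_eq_empty]; exact hAp
    simp [this]
  · exact Measure.le_iff.1 (le_iSup (densChart α) p) A hA

theorem densVol_restrict (α : X → Alt2 n) (p : X) :
    (densVol α).restrict (chartAt (Cn n) p).source = densChart α p := by
  have hs : MeasurableSet (chartAt (Cn n) p).source := (chartAt (Cn n) p).open_source.measurableSet
  ext A hA
  rw [Measure.restrict_apply hA, densVol_apply α (hA.inter hs) Set.inter_subset_right,
    densChart_inter_source _ _ hA]

theorem measure_ext_locally [CompactSpace X] {μ ν : Measure X}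
    (h : ∀ x, ∃ U : Set X, IsOpen U ∧ x ∈ U ∧ ∀ A, MeasurableSet A → A ⊆ U → μ A = ν A) :
    μ = ν := by
  choose U hU hxU hA using h
  obtain ⟨t, ht⟩ := isCompact_univ.elim_finite_subcover U hU
    fun x _ => Set.mem_iUnion.2 ⟨x, hxU x⟩
  have hcov : ⋃ i : t, U i = Set.univ := by
    apply Set.eq_univ_of_univ_subset
    refine ht.trans fun x hx => ?_
    simp only [Set.mem_iUnion] at hx ⊢
    obtain ⟨i, hi, hxi⟩ := hx
    exact ⟨⟨i, hi⟩, hxi⟩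
  refine (Measure.ext_iff_of_iUnion_eq_univ hcov).2 fun i => ?_
  ext A hAm
  rw [Measure.restrict_apply hAm, Measure.restrict_apply hAm]
  exact hA i _ (hAm.inter (hU i).measurableSet) Set.inter_subset_right

/-- The density measure is natural under diffeomorphisms. -/
theorem map_densVol_pullback [CompactSpace Y] (Θ : X ≃ₜ Y)
    (hΘ : ContMDiff 𝓘(ℝ, Cn n) 𝓘(ℝ, Cn n) ∞ Θ) (α : Y → Alt2 n) :
    (densVol (pullback (n := n) Θ α)).map Θ = densVol α := by
  apply measure_ext_locally
  intro y
  set p := Θ.symm y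
  refine ⟨(chartAt (Cn n) y).source ∩ Θ '' (chartAt (Cn n) p).source,
    (chartAt (Cn n) y).open_source.inter (Θ.isOpenMap _ (chartAt (Cn n) p).open_source),
    ⟨mem_chart_source _ y, p, mem_chart_source _ p, Θ.apply_symm_apply y⟩, fun A hA hAs => ?_⟩
  have hp : Θ ⁻¹' A ⊆ (chartAt (Cn n) p).source := by
    intro x hx
    obtain ⟨x', hx', h⟩ := (hAs hx).2
    rwa [← Θ.injective h]
  have himg : Θ '' (Θ ⁻¹' A) = A := Θ.image_preimage A
  rw [Measure.map_apply Θ.continuous.measurable hA, densVol_apply _ (Θ.continuous.measurable hA) hp,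
    densChart_pullback hΘ Θ.injective α (q := y) (Θ.continuous.measurable hA) hp
      (by rwa [himg]) (by rw [himg]; exact hAs.trans Set.inter_subset_left), himg,
    densVol_apply α hA (hAs.trans Set.inter_subset_left)]

section Family

variable {B : Type*} [NormedAddCommGroup B] [NormedSpace ℝ B] {α : B → X → Alt2 n}

theorem densVol_eq_withDensity [CompactSpace X] (hα : SmoothFamily α)
    (hn : ∀ b x, IsNondeg (α b x)) (b₀ b : B) : densVol (α b) =
      (densVol (α b₀)).withDensity fun x => ENNReal.ofReal (densRatio α b₀ b x) := by
  apply measure_ext_locally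
  intro x
  refine ⟨(chartAt (Cn n) x).source, (chartAt (Cn n) x).open_source, mem_chart_source _ x,
    fun A hA hAx => ?_⟩
  set c := chartAt (Cn n) x
  have hmeas : Measurable fun x => ENNReal.ofReal (densRatio α b₀ b x) :=
    (continuous_densRatio hα hn b₀ b).measurable.ennreal_ofReal
  have hs : MeasurableSet c.source := c.open_source.measurableSet
  have h1 : ∫⁻ x in A, ENNReal.ofReal (densRatio α b₀ b x) ∂densVol (α b₀) =
      ∫⁻ x in A, ENNReal.ofReal (densRatio α b₀ b x) ∂densChart (α b₀) x := by
    rw [← densVol_restrict, Measure.restrict_restrict hA, Set.inter_eq_left.2 hAx]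
  rw [withDensity_apply _ hA, h1, ← lintegral_indicator hA, densChart,
    lintegral_map' (hmeas.indicator hA).aemeasurable (aemeasurable_chart_symm x _),
    lintegral_withDensity_eq_lintegral_mul₀, densVol_apply _ hA hAx, densChart_apply _ _ hA,
    Set.inter_eq_left.2 hAx]
  · have hsub : c '' A ⊆ c.target := by
      rintro _ ⟨a, ha, rfl⟩; exact c.map_source (hAx ha)
    rw [← lintegral_indicator (measurableSet_chart_image hA hAx),
      ← lintegral_indicator c.open_target.measurableSet]
    refine lintegral_congr fun y => ?_
    by_cases hy : y ∈ c.target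
    · rw [Set.indicator_of_mem hy, Pi.mul_apply]
      by_cases hyA : c.symm y ∈ A
      · rw [Set.indicator_of_mem (show y ∈ c '' A from ⟨_, hyA, c.right_inv hy⟩),
          Set.indicator_of_mem hyA, densRatio_eq_chart hn b₀ b hy,
          ← ENNReal.ofReal_mul (dens_pos (localRep_nondeg (hn b₀) x hy)).le,
          mul_div_cancel₀ _ (dens_pos (localRep_nondeg (hn b₀) x hy)).ne']
      · rw [Set.indicator_of_notMem, Set.indicator_of_notMem hyA, mul_zero]
        rintro ⟨a, ha, rfl⟩
        exact hyA (by rwa [c.left_inv (hAx ha)])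
    · rw [Set.indicator_of_notMem hy, Set.indicator_of_notMem fun h => hy (hsub h)]
  · exact ((hα.continuousOn_dens hn b₀ x).aemeasurable c.open_target.measurableSet).ennreal_ofReal
  · exact (hmeas.indicator hA).comp_aemeasurable
      (c.continuousOn_symm.aemeasurable c.open_target.measurableSet)

theorem isFiniteMeasure_densVol [CompactSpace X] (hα : SmoothFamily α)
    (hn : ∀ b x, IsNondeg (α b x)) (b : B) : IsFiniteMeasure (densVol (α b)) := by
  refine ⟨isCompact_univ.measure_lt_top_of_nhdsWithin fun x _ => ?_⟩
  rw [nhdsWithin_univ]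
  set c := chartAt (Cn n) x
  have hx := mem_chart_source (Cn n) x
  obtain ⟨K, hK, hKt, hKx⟩ := local_compact_nhds (c.open_target.mem_nhds (c.map_source hx))
  obtain ⟨U, hUK, hU, hxU⟩ := mem_nhds_iff.1 hK
  have hpre : IsOpen (c.source ∩ c ⁻¹' U) := c.continuousOn.isOpen_inter_preimage c.open_source hU
  refine ⟨c.source ∩ c ⁻¹' U, hpre.mem_nhds ⟨hx, hxU⟩, ?_⟩
  rw [densVol_apply _ hpre.measurableSet Set.inter_subset_left,
    densChart_apply _ _ hpre.measurableSet]
  have hsub : c '' ((c.source ∩ c ⁻¹' U) ∩ c.source) ⊆ K := by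
    rintro _ ⟨a, ha, rfl⟩; exact hUK ha.1.2
  refine (lintegral_mono_set hsub).trans_lt ?_
  have hinteg : IntegrableOn (fun y => dens (localRep (α b) x y)) K volume :=
    ((hα.continuousOn_dens hn b x).mono hKt).integrableOn_compact hKx
  exact hinteg.lintegral_lt_top

theorem isOpenPosMeasure_densVol (hα : SmoothFamily α)
    (hn : ∀ b x, IsNondeg (α b x)) (b : B) : (densVol (α b)).IsOpenPosMeasure := by
  refine ⟨fun U hU ⟨x, hxU⟩ h0 => ?_⟩
  set c := chartAt (Cn n) x
  have hx := mem_chart_source (Cn n) x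
  have hm : MeasurableSet (U ∩ c.source) := (hU.inter c.open_source).measurableSet
  have h1 : densVol (α b) (U ∩ c.source) = 0 := measure_mono_null Set.inter_subset_left h0
  have hopen : IsOpen (c '' (U ∩ c.source)) :=
    c.isOpen_image_of_subset_source (hU.inter c.open_source) Set.inter_subset_right
  rw [densVol_apply _ hm Set.inter_subset_right, densChart_apply _ _ hm, Set.inter_assoc,
    Set.inter_self, lintegral_eq_zero_iff'] at h1
  · rw [Filter.EventuallyEq, ae_restrict_iff' hopen.measurableSet] at h1
    have h2 : volume (c '' (U ∩ c.source)) = 0 := by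
      refine measure_mono_null ?_ (ae_iff.1 h1)
      rintro _ ⟨a, ha, rfl⟩ h
      have h3 := h ⟨a, ha, rfl⟩
      have h4 := dens_pos (localRep_nondeg (hn b) x (c.map_source ha.2))
      simp only [Pi.zero_apply, ENNReal.ofReal_eq_zero] at h3
      exact absurd h3 (not_le.2 h4)
    exact (hopen.measure_pos volume ⟨c x, x, ⟨hxU, hx⟩, rfl⟩).ne' h2
  · refine (((hα.continuousOn_dens hn b x).mono ?_).aemeasurable hopen.measurableSet).ennreal_ofReal
    rintro _ ⟨a, ha, rfl⟩; exact c.map_source ha.2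

theorem integral_densVol [CompactSpace X] (hα : SmoothFamily α)
    (hn : ∀ b x, IsNondeg (α b x)) (b₀ b : B) (f : X → ℝ) :
    ∫ x, f x ∂densVol (α b) = ∫ x, densRatio α b₀ b x * f x ∂densVol (α b₀) := by
  rw [densVol_eq_withDensity hα hn b₀ b, integral_withDensity_eq_integral_toReal_smul
    (continuous_densRatio hα hn b₀ b).measurable.ennreal_ofReal
    (Filter.Eventually.of_forall fun _ => ENNReal.ofReal_lt_top)]
  refine integral_congr_ae (Filter.Eventually.of_forall fun x => ?_)
  simp only [ENNReal.toReal_ofReal (densRatio_pos hn b₀ b x).le, smul_eq_mul]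

end Family

end Volume

section Positivity

variable {n m : ℕ} {X : Type*} [TopologicalSpace X] [ChartedSpace (Cn n) X]
  {Y : Type*} [TopologicalSpace Y] [ChartedSpace (Cn m) Y]

theorem IsOneOne.comp {α : Alt2 m} (h : IsOneOne α) (A : Cn n →L[ℂ] Cn m) :
    IsOneOne (α.compContinuousLinearMap (A.restrictScalars ℝ)) := by
  intro v w
  have hJ : ∀ v, A (J n v) = J m (A v) := fun v => A.map_smul _ _
  rw [form_comp_apply, form_comp_apply]
  simp only [ContinuousLinearMap.coe_restrictScalars', hJ]
  exact h _ _

theorem IsPositiveForm.comp {α : Alt2 m} (h : IsPositiveForm α) {A : Cn n →L[ℂ] Cn m}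
    (hA : Function.Injective A) :
    IsPositiveForm (α.compContinuousLinearMap (A.restrictScalars ℝ)) := by
  refine ⟨h.1.comp A, fun v hv => ?_⟩
  have hJ : ∀ v, A (J n v) = J m (A v) := fun v => A.map_smul _ _
  rw [form_comp_apply]
  simp only [ContinuousLinearMap.coe_restrictScalars', hJ]
  exact h.2 _ fun h0 => hv (hA (by rw [h0, map_zero]))

theorem IsPositiveForm.pullback {α : Y → Alt2 m} {f : X → Y} {x : X} (h : IsPositiveForm (α (f x)))
    (hf : MDifferentiableAt 𝓘(ℂ, Cn n) 𝓘(ℂ, Cn m) f x)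
    (hinj : Function.Injective (ctder (Cn n) (Cn m) f x)) :
    IsPositiveForm (pullback (n := n) f α x) := by
  rw [pullback_eq, tder_eq_restrictScalars hf]
  exact h.comp hinj

theorem IsKahlerForm.isPositiveForm {η : X → Alt2 n} (h : IsKahlerForm η) (x : X) :
    IsPositiveForm (η x) :=
  ⟨h.invariant x, h.positive x⟩

variable [IsManifold 𝓘(ℂ, Cn n) ω X]

theorem contMDiffAt_chart_symm_complex {p : X} {y : Cn n} (hy : y ∈ (chartAt (Cn n) p).target) :
    ContMDiffAt 𝓘(ℂ, Cn n) 𝓘(ℂ, Cn n) ω (chartAt (Cn n) p).symm y :=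
  contMDiffOn_chart_symm.contMDiffAt ((chartAt (Cn n) p).open_target.mem_nhds hy)

theorem contMDiffAt_chart_complex {p x : X} (hx : x ∈ (chartAt (Cn n) p).source) :
    ContMDiffAt 𝓘(ℂ, Cn n) 𝓘(ℂ, Cn n) ω (chartAt (Cn n) p) x :=
  contMDiffOn_chart.contMDiffAt ((chartAt (Cn n) p).open_source.mem_nhds hx)

theorem ctder_injective_of_tder {f : X → Y} {x : X}
    (hf : MDifferentiableAt 𝓘(ℂ, Cn n) 𝓘(ℂ, Cn m) f x)
    (h : Function.Injective (tder (Cn n) (Cn m) f x)) :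
    Function.Injective (ctder (Cn n) (Cn m) f x) := by
  rw [tder_eq_restrictScalars hf] at h
  exact h

theorem tder_chart_symm_injective {p : X} {y : Cn n} (hy : y ∈ (chartAt (Cn n) p).target) :
    Function.Injective (tder (Cn n) (Cn n) (chartAt (Cn n) p).symm y) :=
  Function.LeftInverse.injective (g := tder (Cn n) (Cn n) (chartAt (Cn n) p)
    ((chartAt (Cn n) p).symm y)) fun v => tder_chart_tder_chart_symm hy v

theorem localRep_positive {η : X → Alt2 n} (h : ∀ x, IsPositiveForm (η x)) (p : X) {y : Cn n}
    (hy : y ∈ (chartAt (Cn n) p).target) : IsPositiveForm (localRep η p y) := by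
  have hd := (contMDiffAt_chart_symm_complex hy).mdifferentiableAt (by simp)
  exact (h _).pullback hd (ctder_injective_of_tder hd (tder_chart_symm_injective hy))

theorem vol_eq_densVol [MeasurableSpace X] [BorelSpace X] {η : X → Alt2 n}
    (h : ∀ x, IsPositiveForm (η x)) : vol η = densVol η := by
  refine iSup_congr fun p => ?_
  rw [chartVolume, densChart]
  congr 1
  refine withDensity_congr_ae ?_
  filter_upwards [ae_restrict_mem (chartAt (Cn n) p).open_target.measurableSet] with y hy
  rw [(localRep_positive h p hy).dens_eq]

end Positivity

section DDC

variable {n : ℕ}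

/-- The 1-form `dᶜ u = - du ∘ J`. -/
noncomputable def dcForm (u : Cn n → ℝ) (z : Cn n) : (Cn n) [⋀^Fin 1]→L[ℝ] ℝ :=
  ContinuousAlternatingMap.ofSubsingleton ℝ (Cn n) ℝ (0 : Fin 1) (-((fderiv ℝ u z).comp (J n)))

theorem ddcLocal_eq (u : Cn n → ℝ) (y : Cn n) : ddcLocal u y = extDeriv (dcForm u) y := rfl

theorem dcForm_apply (u : Cn n → ℝ) (z : Cn n) (v : Fin 1 → Cn n) :
    dcForm u z v = -(fderiv ℝ u z (J n (v 0))) := rfl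

theorem ddcLocal_congr {u u' : Cn n → ℝ} {y : Cn n} (h : u =ᶠ[𝓝 y] u') :
    ddcLocal u y = ddcLocal u' y := by
  rw [ddcLocal_eq, ddcLocal_eq]
  refine Filter.EventuallyEq.extDeriv_eq ?_
  filter_upwards [h.fderiv (𝕜 := ℝ)] with z hz
  simp only [dcForm, hz]

theorem differentiableAt_dcForm {u : Cn n → ℝ} {y : Cn n} (hu : ContDiffAt ℝ 2 u y) :
    DifferentiableAt ℝ (dcForm u) y := by
  have h1 : DifferentiableAt ℝ (fderiv ℝ u) y :=
    (hu.fderiv_right (m := 1) (by norm_num)).differentiableAt (by simp)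
  have h2 : DifferentiableAt ℝ (fun z => -((fderiv ℝ u z).comp (J n))) y :=
    (h1.clm_comp (differentiableAt_const _)).neg
  exact ((ContinuousAlternatingMap.ofSubsingletonLIE (𝕜 := ℝ) (E := Cn n) (F := ℝ)
    (0 : Fin 1)).toContinuousLinearEquiv.differentiableAt).comp y h2

theorem ddcLocal_apply {u : Cn n → ℝ} {y : Cn n} (hu : ContDiffAt ℝ 2 u y) (v w : Cn n) :
    ddcLocal u y ![v, w] = -(fderiv ℝ (fderiv ℝ u) y v (J n w)) +
      fderiv ℝ (fderiv ℝ u) y w (J n v) := by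
  have h1 : DifferentiableAt ℝ (fderiv ℝ u) y :=
    (hu.fderiv_right (m := 1) (by norm_num)).differentiableAt (by simp)
  rw [ddcLocal_eq, extDeriv_apply (differentiableAt_dcForm hu), Fin.sum_univ_two]
  have e : ∀ a : Cn n, fderiv ℝ (fun z => -(fderiv ℝ u z (J n a))) y =
      -((fderiv ℝ (fderiv ℝ u) y).flip (J n a)) := by
    intro a
    rw [fderiv_fun_neg, fderiv_clm_apply h1 (differentiableAt_const _)]
    simp
  have e0 : (fun z => dcForm u z (Fin.removeNth 0 ![v, w])) =
    fun z => -(fderiv ℝ u z (J n w)) := rfl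
  have e1 : (fun z => dcForm u z (Fin.removeNth 1 ![v, w])) =
    fun z => -(fderiv ℝ u z (J n v)) := rfl
  rw [e0, e1, e, e]
  simp

theorem ddcLocal_isOneOne {u : Cn n → ℝ} {y : Cn n} (hu : ContDiffAt ℝ 2 u y) :
    IsOneOne (ddcLocal u y) := by
  intro v w
  have hs : IsSymmSndFDerivAt ℝ u y := hu.isSymmSndFDerivAt (by simp)
  rw [ddcLocal_apply hu, ddcLocal_apply hu, J_J, J_J, map_neg, map_neg, hs.eq (J n v) w,
    hs.eq (J n w) v]
  ring

theorem ddcLocal_add {u u' : Cn n → ℝ} {y : Cn n} (hu : ContDiffAt ℝ 2 u y)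
    (hu' : ContDiffAt ℝ 2 u' y) :
    ddcLocal (fun z => u z + u' z) y = ddcLocal u y + ddcLocal u' y := by
  have h : dcForm (fun z => u z + u' z) =ᶠ[𝓝 y] dcForm u + dcForm u' := by
    have e1 : ∀ᶠ z in 𝓝 y, DifferentiableAt ℝ u z :=
      (hu.eventually (by simp)).mono fun z hz => hz.differentiableAt (by simp)
    have e2 : ∀ᶠ z in 𝓝 y, DifferentiableAt ℝ u' z :=
      (hu'.eventually (by simp)).mono fun z hz => hz.differentiableAt (by simp)
    filter_upwards [e1, e2] with z h1 h2
    ext v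
    simp only [dcForm_apply, Pi.add_apply, add_apply, fderiv_fun_add h1 h2,
      ContinuousAlternatingMap.add_apply]
    ring
  rw [ddcLocal_eq, h.extDeriv_eq,
    extDeriv_add (differentiableAt_dcForm hu) (differentiableAt_dcForm hu')]
  rfl

theorem ddcLocal_const_smul (c : ℝ) {u : Cn n → ℝ} {y : Cn n} (hu : ContDiffAt ℝ 2 u y) :
    ddcLocal (fun z => c * u z) y = c • ddcLocal u y := by
  have h : dcForm (fun z => c * u z) =ᶠ[𝓝 y] c • dcForm u := by
    have e1 : ∀ᶠ z in 𝓝 y, DifferentiableAt ℝ u z :=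
      (hu.eventually (by simp)).mono fun z hz => hz.differentiableAt (by simp)
    filter_upwards [e1] with z h1
    ext v
    simp only [dcForm_apply, Pi.smul_apply, ContinuousAlternatingMap.smul_apply, smul_eq_mul]
    rw [fderiv_const_mul h1]
    simp
  rw [ddcLocal_eq, h.extDeriv_eq, extDeriv_smul]
  rfl

/-- `d dᶜ` commutes with holomorphic pullback. -/
theorem ddcLocal_comp {m : ℕ} {u : Cn m → ℝ} {τ : Cn n → Cn m} {y : Cn n}
    (hu : ContDiffAt ℝ 2 u (τ y)) (hτ : ContDiffAt ℂ ω τ y) :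
    ddcLocal (fun z => u (τ z)) y =
      (ddcLocal u (τ y)).compContinuousLinearMap (fderiv ℝ τ y) := by
  have hτR : ContDiffAt ℝ 2 τ y := (hτ.restrict_scalars ℝ).of_le le_top
  have h : dcForm (fun z => u (τ z)) =ᶠ[𝓝 y]
      fun z => (dcForm u (τ z)).compContinuousLinearMap (fderiv ℝ τ z) := by
    have e1 : ∀ᶠ z in 𝓝 y, DifferentiableAt ℝ u (τ z) :=
      hτR.continuousAt.eventually
        ((hu.eventually (by simp)).mono fun z hz => hz.differentiableAt (by simp))
    have e2 : ∀ᶠ z in 𝓝 y, DifferentiableAt ℂ τ z :=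
      (hτ.eventually (by simp)).mono fun z hz => hz.differentiableAt (by simp)
    filter_upwards [e1, e2] with z h1 h2
    ext v
    have hJ : fderiv ℝ τ z (J n (v 0)) = J m (fderiv ℝ τ z (v 0)) := by
      rw [h2.fderiv_restrictScalars ℝ]
      exact (fderiv ℂ τ z).map_smul _ _
    have h3 : fderiv ℝ (fun z => u (τ z)) z = (fderiv ℝ u (τ z)).comp (fderiv ℝ τ z) :=
      fderiv_comp z h1 (h2.restrictScalars ℝ)
    rw [dcForm_apply, h3]
    change -(fderiv ℝ u (τ z) (fderiv ℝ τ z (J n (v 0)))) =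
      -(fderiv ℝ u (τ z) (J m (fderiv ℝ τ z (v 0))))
    rw [hJ]
  rw [ddcLocal_eq, h.extDeriv_eq,
    extDeriv_pullback (r := 2) (differentiableAt_dcForm hu) hτR (by simp)]
  rfl

/-- Real parts of holomorphic functions are pluriharmonic. -/
theorem ddcLocal_re {f : Cn n → ℂ} {y : Cn n} (hf : ContDiffAt ℂ ω f y) :
    ddcLocal (fun z => (f z).re) y = 0 := by
  have him : ContDiffAt ℝ 2 (fun z => (f z).im) y :=
    Complex.imCLM.contDiff.contDiffAt.comp y ((hf.restrict_scalars ℝ).of_le le_top)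
  have h : dcForm (fun z => (f z).re) =ᶠ[𝓝 y] extDeriv (fun z =>
      ContinuousAlternatingMap.constOfIsEmpty ℝ (Cn n) (Fin 0) ((f z).im)) := by
    have e2 : ∀ᶠ z in 𝓝 y, DifferentiableAt ℂ f z :=
      (hf.eventually (by simp)).mono fun z hz => hz.differentiableAt (by simp)
    filter_upwards [e2] with z h2
    rw [extDeriv_constOfIsEmpty]
    ext v
    have h3 := (h2.hasFDerivAt.restrictScalars ℝ)
    have hre : HasFDerivAt (fun z => (f z).re)
        (Complex.reCLM.comp ((fderiv ℂ f z).restrictScalars ℝ)) z :=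
      Complex.reCLM.hasFDerivAt.comp z h3
    have him : HasFDerivAt (fun z => (f z).im)
        (Complex.imCLM.comp ((fderiv ℂ f z).restrictScalars ℝ)) z :=
      Complex.imCLM.hasFDerivAt.comp z h3
    rw [dcForm_apply, hre.fderiv, him.fderiv]
    have h4 : fderiv ℂ f z (J n (v 0)) = Complex.I * fderiv ℂ f z (v 0) :=
      (fderiv ℂ f z).map_smul _ _
    change -(fderiv ℂ f z (J n (v 0))).re = (fderiv ℂ f z (v 0)).im
    rw [h4]
    simp
  rw [ddcLocal_eq, h.extDeriv_eq]
  refine extDeriv_extDeriv_apply (r := 2) ?_ (by simp)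
  exact (ContinuousAlternatingMap.constOfIsEmptyLIE ℝ (Cn n) ℝ
    (Fin 0)).toContinuousLinearEquiv.contDiff.contDiffAt.comp y him

theorem ddcLocal_log_normSq {g : Cn n → ℂ} {y : Cn n} (hg : ContDiffAt ℂ ω g y) (h0 : g y ≠ 0) :
    ddcLocal (fun z => Real.log (Complex.normSq (g z))) y = 0 := by
  set f : Cn n → ℂ := fun z => 2 * Complex.log (g z / g y) with hf
  have hfc : ContDiffAt ℂ ω f y := by
    have hs : g y / g y ∈ Complex.slitPlane := by
      rw [div_self h0]; exact Complex.one_mem_slitPlane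
    have hl : ContDiffAt ℂ ω (fun z => Complex.log (g z / g y)) y :=
      ContDiffAt.comp y (f := fun z => g z / g y) (Complex.contDiffAt_log hs) (hg.div_const _)
    exact contDiffAt_const.mul hl
  have hre : ContDiffAt ℝ 2 (fun z => (f z).re) y :=
    Complex.reCLM.contDiff.contDiffAt.comp y ((hfc.restrict_scalars ℝ).of_le le_top)
  have h1 : (fun z => Real.log (Complex.normSq (g z))) =ᶠ[𝓝 y]
      fun z => (f z + (Real.log (Complex.normSq (g y)) : ℂ)).re := by
    filter_upwards [hg.continuousAt.eventually_ne h0] with z hz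
    simp only [hf, Complex.add_re, Complex.mul_re, Complex.re_ofNat, Complex.im_ofNat, zero_mul,
      sub_zero, Complex.log_re, Complex.ofReal_re, norm_div, Complex.normSq_eq_norm_sq,
      Real.log_pow, Nat.cast_ofNat]
    rw [Real.log_div (norm_ne_zero_iff.2 hz) (norm_ne_zero_iff.2 h0)]
    ring
  rw [ddcLocal_congr h1]
  exact ddcLocal_re (hfc.add contDiffAt_const)

end DDC

section LocalScal

variable {n : ℕ}

/-- The function `log det h` of a positive (1,1)-form on an open subset of `ℂⁿ`. -/
noncomputable def logDet (β : Cn n → Alt2 n) (y : Cn n) : ℝ := Real.log (herm (β y)).det.re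

/-- The scalar curvature of a positive (1,1)-form on an open subset of `ℂⁿ`. -/
noncomputable def localScal (β : Cn n → Alt2 n) (y : Cn n) : ℝ :=
  (((herm (β y))⁻¹ * herm ((-(1 / 2 : ℝ)) • ddcLocal (logDet β) y)).trace).re

theorem localScal_congr {β β' : Cn n → Alt2 n} {y : Cn n} (h : β =ᶠ[𝓝 y] β') :
    localScal β y = localScal β' y := by
  have h2 : logDet β =ᶠ[𝓝 y] logDet β' := by
    filter_upwards [h] with z hz
    rw [logDet, logDet, hz]
  rw [localScal, localScal, ddcLocal_congr h2, h.self_of_nhds]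

theorem scal_eq_localScal {X : Type*} [TopologicalSpace X] [ChartedSpace (Cn n) X]
    (η : X → Alt2 n) (x : X) : scal η x = localScal (localRep η x) (chartAt (Cn n) x x) := rfl

theorem contDiffAt_herm {E : Type*} [NormedAddCommGroup E] [NormedSpace ℝ E] {β : E → Alt2 n}
    {z : E} (h : ∀ v w, ContDiffAt ℝ ∞ (fun z => β z ![v, w]) z) (a b : Fin n) :
    ContDiffAt ℝ ∞ (fun z => herm (β z) a b) z := by
  have h1 : ∀ v w, ContDiffAt ℝ ∞ (fun z => ((β z ![v, w] : ℝ) : ℂ)) z := fun v w =>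
    Complex.ofRealCLM.contDiff.contDiffAt.comp z (h v w)
  exact (h1 _ _).sub (contDiffAt_const.mul (h1 _ _))

theorem contDiffAt_det {E : Type*} [NormedAddCommGroup E] [NormedSpace ℝ E]
    {A : E → Matrix (Fin n) (Fin n) ℂ} {z : E} (h : ∀ a b, ContDiffAt ℝ ∞ (fun z => A z a b) z) :
    ContDiffAt ℝ ∞ (fun z => (A z).det) z := by
  simp only [Matrix.det_apply, Units.smul_def, zsmul_eq_mul]
  exact ContDiffAt.sum fun σ _ => contDiffAt_const.mul (contDiffAt_prod fun i _ => h _ _)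

theorem contDiffAt_logDet {E : Type*} [NormedAddCommGroup E] [NormedSpace ℝ E] {β : E → Alt2 n}
    {z : E} (h : ∀ v w, ContDiffAt ℝ ∞ (fun z => β z ![v, w]) z) (hp : IsPositiveForm (β z)) :
    ContDiffAt ℝ ∞ (fun z => Real.log (herm (β z)).det.re) z :=
  ContDiffAt.log (Complex.reCLM.contDiff.contDiffAt.comp z (contDiffAt_det (contDiffAt_herm h)))
    hp.det_re_pos.ne'

/-- The scalar curvature is invariant under local biholomorphisms. -/
theorem localScal_comp {β : Cn n → Alt2 n} {τ : Cn n → Cn n} {y : Cn n}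
    (hβ : ∀ v w, ContDiffAt ℝ ∞ (fun z => β z ![v, w]) (τ y))
    (hp : ∀ᶠ z in 𝓝 (τ y), IsPositiveForm (β z)) (hτ : ContDiffAt ℂ ω τ y)
    (hinj : Function.Injective (fderiv ℂ τ y)) :
    localScal (fun z => (β (τ z)).compContinuousLinearMap (fderiv ℝ τ z)) y =
      localScal β (τ y) := by
  set A : Cn n → Matrix (Fin n) (Fin n) ℂ := fun z =>
    LinearMap.toMatrix' (fderiv ℂ τ z : Cn n →ₗ[ℂ] Cn n) with hA
  have hAc : ContDiffAt ℂ ω (fun z => (A z).det) y := by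
    have hd : ContDiffAt ℂ ω (fderiv ℂ τ) y := hτ.fderiv_right (m := ω) (by simp)
    simp only [Matrix.det_apply, Units.smul_def, zsmul_eq_mul]
    refine ContDiffAt.sum fun σ _ => contDiffAt_const.mul (contDiffAt_prod fun i _ => ?_)
    simp only [hA, LinearMap.toMatrix'_apply, ContinuousLinearMap.coe_coe]
    exact contDiffAt_pi.1 (hd.clm_apply contDiffAt_const) _
  have hA0 : (A y).det ≠ 0 := by
    rw [hA, LinearMap.det_toMatrix']
    intro h0
    refine (LinearMap.bot_lt_ker_of_det_eq_zero h0).ne' (LinearMap.ker_eq_bot.2 hinj)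
  have hherm : ∀ᶠ z in 𝓝 y, herm ((β (τ z)).compContinuousLinearMap (fderiv ℝ τ z)) =
      (A z).transpose * herm (β (τ z)) * (A z).map (starRingEnd ℂ) := by
    have e2 : ∀ᶠ z in 𝓝 y, DifferentiableAt ℂ τ z :=
      (hτ.eventually (by simp)).mono fun z hz => hz.differentiableAt (by simp)
    filter_upwards [e2, hτ.continuousAt.eventually hp] with z h1 h2
    rw [h1.fderiv_restrictScalars ℝ]
    exact herm_comp h2.1 _
  have hdetmap : ∀ M : Matrix (Fin n) (Fin n) ℂ,
      (M.map (starRingEnd ℂ)).det = (starRingEnd ℂ) M.det := fun M =>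
    (RingHom.map_det (starRingEnd ℂ) M).symm
  have hlog : logDet (fun z => (β (τ z)).compContinuousLinearMap (fderiv ℝ τ z)) =ᶠ[𝓝 y]
      fun z => Real.log (Complex.normSq (A z).det) + logDet β (τ z) := by
    filter_upwards [hherm, hτ.continuousAt.eventually hp, hAc.continuousAt.eventually_ne hA0]
      with z h1 h2 h3
    rw [logDet, h1, Matrix.det_mul, Matrix.det_mul, Matrix.det_transpose, hdetmap, logDet,
      ← Real.log_mul (by simpa using h3) h2.det_re_pos.ne', h2.det_eq, mul_right_comm,
      Complex.mul_conj, ← Complex.ofReal_mul, Complex.ofReal_re, Complex.ofReal_re]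
  have hL : ContDiffAt ℝ 2 (logDet β) (τ y) :=
    (contDiffAt_logDet hβ hp.self_of_nhds).of_le (by norm_cast)
  have hτR : ContDiffAt ℝ 2 τ y := (hτ.restrict_scalars ℝ).of_le le_top
  have hAR : ContDiffAt ℝ 2 (fun z => Real.log (Complex.normSq (A z).det)) y := by
    have h1 : ContDiffAt ℝ 2 (fun z => (A z).det) y := (hAc.restrict_scalars ℝ).of_le le_top
    have h2 : ContDiffAt ℝ 2 (fun z => Complex.normSq (A z).det) y := by
      simp only [Complex.normSq_apply]
      have hr := Complex.reCLM.contDiff.contDiffAt.comp y h1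
      have hi := Complex.imCLM.contDiff.contDiffAt.comp y h1
      exact (hr.mul hr).add (hi.mul hi)
    exact h2.log (by simpa using hA0)
  have hdd : ddcLocal (logDet (fun z => (β (τ z)).compContinuousLinearMap (fderiv ℝ τ z))) y =
      (ddcLocal (logDet β) (τ y)).compContinuousLinearMap (fderiv ℝ τ y) := by
    rw [ddcLocal_congr hlog, ddcLocal_add (u' := fun z => logDet β (τ z)) hAR (hL.comp y hτR), ddcLocal_log_normSq hAc hA0,
      zero_add, ddcLocal_comp hL hτ]
  set r : Alt2 n := (-(1 / 2 : ℝ)) • ddcLocal (logDet β) (τ y) with hr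
  have hr1 : IsOneOne r := by
    intro v w
    simp only [hr, ContinuousAlternatingMap.smul_apply, ddcLocal_isOneOne hL v w]
  have hrc : herm ((-(1 / 2 : ℝ)) •
      (ddcLocal (logDet β) (τ y)).compContinuousLinearMap (fderiv ℝ τ y)) =
      (A y).transpose * herm r * (A y).map (starRingEnd ℂ) := by
    have : (-(1 / 2 : ℝ)) • (ddcLocal (logDet β) (τ y)).compContinuousLinearMap (fderiv ℝ τ y) =
        r.compContinuousLinearMap ((fderiv ℂ τ y).restrictScalars ℝ) := by
      rw [← (hτ.differentiableAt (by simp)).fderiv_restrictScalars ℝ]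
      rfl
    rw [this]
    exact herm_comp hr1 _
  rw [localScal, hdd, hherm.self_of_nhds, hrc, localScal, ← hr]
  have hu1 : IsUnit ((A y).transpose).det := by
    rw [Matrix.det_transpose]; exact hA0.isUnit
  have hu2 : IsUnit ((A y).map (starRingEnd ℂ)).det := by
    rw [hdetmap]; exact ((map_ne_zero _).2 hA0).isUnit
  congr 1
  rw [Matrix.mul_inv_rev, Matrix.mul_inv_rev]
  set C := (A y).map (starRingEnd ℂ)
  set D := (A y).transpose
  set h := herm (β (τ y))
  have : C⁻¹ * (h⁻¹ * D⁻¹) * (D * herm r * C) = C⁻¹ * (h⁻¹ * herm r * C) := by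
    calc C⁻¹ * (h⁻¹ * D⁻¹) * (D * herm r * C) = C⁻¹ * (h⁻¹ * (D⁻¹ * D) * herm r * C) := by
          simp only [Matrix.mul_assoc]
      _ = _ := by rw [Matrix.nonsing_inv_mul D hu1, Matrix.mul_one]
  rw [this, Matrix.trace_mul_comm, Matrix.mul_assoc, Matrix.mul_nonsing_inv C hu2, Matrix.mul_one]

end LocalScal

section Pluriharmonic

variable {n : ℕ} {X : Type*} [TopologicalSpace X] [ChartedSpace (Cn n) X]
  [IsManifold 𝓘(ℂ, Cn n) ω X]

theorem contDiffAt_comp_chart_symm {u : X → ℝ} (hu : ContMDiff 𝓘(ℝ, Cn n) 𝓘(ℝ, ℝ) ∞ u) {p : X}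
    {y : Cn n} (hy : y ∈ (chartAt (Cn n) p).target) :
    ContDiffAt ℝ ∞ (fun y => u ((chartAt (Cn n) p).symm y)) y :=
  contMDiffAt_iff_contDiffAt.1 ((hu _).comp y (contMDiffAt_chart_symm hy))

theorem contDiffAt_transition {p x : X} {y : Cn n} (hy : y ∈ (chartAt (Cn n) p).target)
    (hx : (chartAt (Cn n) p).symm y ∈ (chartAt (Cn n) x).source) :
    ContDiffAt ℂ ω (fun z => chartAt (Cn n) x ((chartAt (Cn n) p).symm z)) y :=
  contMDiffAt_iff_contDiffAt.1
    ((contMDiffAt_chart_complex hx).comp y (contMDiffAt_chart_symm_complex hy))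

/-- `d dᶜ u` may be computed in any chart. -/
theorem localRep_ddc {u : X → ℝ} (hu : ContMDiff 𝓘(ℝ, Cn n) 𝓘(ℝ, ℝ) ∞ u) {p : X} {y : Cn n}
    (hy : y ∈ (chartAt (Cn n) p).target) :
    localRep (ddc u) p y = ddcLocal (fun z => u ((chartAt (Cn n) p).symm z)) y := by
  set x := (chartAt (Cn n) p).symm y with hxdef
  have hx := mem_chart_source (Cn n) x
  set τ : Cn n → Cn n := fun z => chartAt (Cn n) x ((chartAt (Cn n) p).symm z) with hτ
  have hτy : τ y = chartAt (Cn n) x x := rfl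
  have hτc : ContDiffAt ℂ ω τ y := contDiffAt_transition hy hx
  have h1 : (fun z => u ((chartAt (Cn n) p).symm z)) =ᶠ[𝓝 y]
      fun z => (u ∘ (chartAt (Cn n) x).symm) (τ z) := by
    have : ∀ᶠ z in 𝓝 y, (chartAt (Cn n) p).symm z ∈ (chartAt (Cn n) x).source :=
      ((chartAt (Cn n) p).continuousAt_symm hy).eventually
        ((chartAt (Cn n) x).open_source.mem_nhds hx)
    filter_upwards [this] with z hz
    simp only [hτ, Function.comp_apply, (chartAt (Cn n) x).left_inv hz]
  have h2 : ContDiffAt ℝ 2 (u ∘ (chartAt (Cn n) x).symm) (τ y) :=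
    (contDiffAt_comp_chart_symm hu ((chartAt (Cn n) x).map_source hx)).of_le (by norm_cast)
  rw [ddcLocal_congr h1, ddcLocal_comp h2 hτc, localRep_eq_pullback, pullback_eq]
  have h3 : fderiv ℝ τ y = tder (Cn n) (Cn n) (chartAt (Cn n) p).symm y := by
    have h4 := tder_comp (f := (chartAt (Cn n) p).symm) (g := chartAt (Cn n) x) (x := y)
      (mdifferentiableAt_chart hx) (mdifferentiableAt_chart_symm hy)
    rw [← hxdef, tder_chart_self] at h4
    rw [← tder_eq_fderiv]
    exact h4
  rw [h3]
  rfl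

theorem ddc_add_mul {u v : X → ℝ} (hu : ContMDiff 𝓘(ℝ, Cn n) 𝓘(ℝ, ℝ) ∞ u)
    (hv : ContMDiff 𝓘(ℝ, Cn n) 𝓘(ℝ, ℝ) ∞ v) (c : ℝ) (x : X) (a b : Cn n) :
    ddc (n := n) (fun x => u x + c * v x) x ![a, b] =
      ddc (n := n) u x ![a, b] + c * ddc (n := n) v x ![a, b] := by
  have h1 := contDiffAt_comp_chart_symm hu (mem_chart_target (Cn n) x)
  have h2 := contDiffAt_comp_chart_symm hv (mem_chart_target (Cn n) x)
  have h3 : ddc (n := n) (fun x => u x + c * v x) x =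
      ddcLocal (fun y => u ((chartAt (Cn n) x).symm y) + c * v ((chartAt (Cn n) x).symm y))
        (chartAt (Cn n) x x) := rfl
  rw [h3, ddcLocal_add (h1.of_le (by norm_cast)) ((contDiffAt_const.mul h2).of_le (by norm_cast)),
    ddcLocal_const_smul _ (h2.of_le (by norm_cast))]
  rfl

theorem harmonicAt_line {u : Cn n → ℝ} {y v : Cn n} {ζ : ℂ} {U : Set (Cn n)} (hU : IsOpen U)
    (hu : ContDiffOn ℝ ∞ u U) (h0 : ∀ z ∈ U, ddcLocal u z = 0) (hζ : y + ζ • v ∈ U) :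
    InnerProductSpace.HarmonicAt (fun ζ : ℂ => u (y + ζ • v)) ζ := by
  set L : ℂ →L[ℝ] Cn n :=
    ((ContinuousLinearMap.id ℂ ℂ).smulRight v : ℂ →L[ℂ] Cn n).restrictScalars ℝ with hL
  have hLa : ∀ a, L a = a • v := fun a => rfl
  have hℓ : ∀ ζ : ℂ, HasFDerivAt (fun ζ : ℂ => y + ζ • v) L ζ := fun ζ =>
    (L.hasFDerivAt).const_add y
  have hcu : ∀ z ∈ U, ContDiffAt ℝ ∞ u z := fun z hz => hu.contDiffAt (hU.mem_nhds hz)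
  have hℓc : Continuous fun ζ : ℂ => y + ζ • v := by fun_prop
  have hev : ∀ᶠ ξ in 𝓝 ζ, y + ξ • v ∈ U := hℓc.continuousAt.eventually (hU.mem_nhds hζ)
  refine ⟨?_, ?_⟩
  · have h1 : ContDiffAt ℝ 2 (fun ζ : ℂ => y + ζ • v) ζ :=
      contDiffAt_const.add L.contDiff.contDiffAt
    exact ((hcu _ hζ).of_le (by norm_cast)).comp ζ h1
  · filter_upwards [hev.eventually_nhds] with ξ hξ
    have hξU := hξ.self_of_nhds
    rw [InnerProductSpace.laplacian_eq_iteratedFDeriv_complexPlane]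
    simp only [iteratedFDeriv_two_apply, Matrix.cons_val_zero, Matrix.cons_val_one, Pi.zero_apply]
    have h1 : fderiv ℝ (fun ζ : ℂ => u (y + ζ • v)) =ᶠ[𝓝 ξ]
        fun ζ => (fderiv ℝ u (y + ζ • v)).comp L := by
      filter_upwards [hξ] with ζ' hζ'
      exact (((hcu _ hζ').differentiableAt (by simp)).hasFDerivAt.comp ζ' (hℓ ζ')).fderiv
    have hd2 : DifferentiableAt ℝ (fderiv ℝ u) (y + ξ • v) :=
      ((hcu _ hξU).fderiv_right (m := 1) (by norm_cast)).differentiableAt (by simp)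
    have h2 : HasFDerivAt (fun ζ : ℂ => fderiv ℝ u (y + ζ • v))
        ((fderiv ℝ (fderiv ℝ u) (y + ξ • v)).comp L) ξ := hd2.hasFDerivAt.comp ξ (hℓ ξ)
    have h3 : ∀ a b : ℂ, fderiv ℝ (fderiv ℝ (fun ζ : ℂ => u (y + ζ • v))) ξ a b =
        fderiv ℝ (fderiv ℝ u) (y + ξ • v) (a • v) (b • v) := by
      intro a b
      rw [h1.fderiv_eq, (h2.clm_comp (hasFDerivAt_const L ξ)).fderiv]
      simp [hLa]
    rw [h3, h3, one_smul]
    have h4 := congrArg (fun α : Alt2 n => α ![v, J n v]) (h0 _ hξU)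
    simp only [ddcLocal_apply ((hcu _ hξU).of_le (by norm_cast)), J_J, map_neg, neg_neg] at h4
    exact h4

/-- The strong maximum principle for pluriharmonic functions on a ball. -/
theorem eq_of_isMax_pluriharmonic {u : Cn n → ℝ} {y z : Cn n} {R : ℝ}
    (hu : ContDiffOn ℝ ∞ u (Metric.ball y R)) (h0 : ∀ z ∈ Metric.ball y R, ddcLocal u z = 0)
    (hmax : ∀ z ∈ Metric.ball y R, u z ≤ u y) (hz : z ∈ Metric.ball y R) : u z = u y := by
  by_cases hzy : z = y
  · rw [hzy]
  have hv : 0 < ‖z - y‖ := norm_pos_iff.2 (sub_ne_zero.2 hzy)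
  have hzR : ‖z - y‖ < R := by simpa [dist_eq_norm] using hz
  set ρ := R / ‖z - y‖ with hρ
  have hρ1 : 1 < ρ := by rw [hρ, lt_div_iff₀ hv]; simpa using hzR
  have hmem : ∀ ζ ∈ Metric.ball (0 : ℂ) ρ, y + ζ • (z - y) ∈ Metric.ball y R := by
    intro ζ hζ
    have : ‖ζ‖ < ρ := by simpa using hζ
    rw [Metric.mem_ball, dist_eq_norm, add_sub_cancel_left, norm_smul]
    rwa [hρ, lt_div_iff₀ hv] at this
  have hharm : InnerProductSpace.HarmonicOnNhd (fun ζ : ℂ => u (y + ζ • (z - y)))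
      (Metric.ball 0 ρ) := fun ζ hζ =>
    harmonicAt_line Metric.isOpen_ball hu h0 (hmem ζ hζ)
  obtain ⟨F, hF, hFre⟩ := hharm.exists_analyticOnNhd_ball_re_eq
  have hb0 : (0 : ℂ) ∈ Metric.ball (0 : ℂ) ρ := by
    simpa using (zero_lt_one.trans hρ1)
  have hb1 : (1 : ℂ) ∈ Metric.ball (0 : ℂ) ρ := by simpa using hρ1
  have hnorm : ∀ ζ ∈ Metric.ball (0 : ℂ) ρ,
      ‖Complex.exp (F ζ)‖ = Real.exp (u (y + ζ • (z - y))) := by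
    intro ζ hζ
    rw [Complex.norm_exp]
    exact congrArg _ (hFre hζ)
  have hd : DifferentiableOn ℂ (fun ζ => Complex.exp (F ζ)) (Metric.ball 0 ρ) :=
    hF.differentiableOn.cexp
  have hmaxF : IsMaxOn (norm ∘ fun ζ => Complex.exp (F ζ)) (Metric.ball 0 ρ) 0 := by
    intro ζ hζ
    simp only [Set.mem_ofPred_eq, Function.comp_apply, hnorm ζ hζ, hnorm 0 hb0, zero_smul, add_zero,
      Real.exp_le_exp]
    exact hmax _ (hmem ζ hζ)
  have hconst := Complex.norm_eqOn_of_isPreconnected_of_isMaxOn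
    (convex_ball (0 : ℂ) ρ).isPreconnected Metric.isOpen_ball hd hb0 hmaxF hb1
  simp only [Function.comp_apply, Function.const_apply, hnorm 1 hb1, hnorm 0 hb0, one_smul,
    zero_smul, add_zero, add_sub_cancel, Real.exp_eq_exp] at hconst
  exact hconst

/-- Pluriharmonic functions on a compact connected complex manifold are constant. -/
theorem exists_eq_const_of_ddc_eq_zero [CompactSpace X] [ConnectedSpace X] {u : X → ℝ}
    (hu : ContMDiff 𝓘(ℝ, Cn n) 𝓘(ℝ, ℝ) ∞ u) (h0 : ∀ x, ddc (n := n) u x = 0) :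
    ∃ c, ∀ x, u x = c := by
  obtain ⟨a, -, ha⟩ := isCompact_univ.exists_isMaxOn Set.univ_nonempty hu.continuous.continuousOn
  have hamax : ∀ x, u x ≤ u a := fun x => ha (Set.mem_univ x)
  have hopen : IsOpen {x | u x = u a} := by
    rw [isOpen_iff_mem_nhds]
    intro x hx
    have hxs := mem_chart_source (Cn n) x
    obtain ⟨R, hR, hball⟩ := Metric.isOpen_iff.1 (chartAt (Cn n) x).open_target _
      ((chartAt (Cn n) x).map_source hxs)
    have hcont : ContDiffOn ℝ ∞ (fun y => u ((chartAt (Cn n) x).symm y))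
        (Metric.ball (chartAt (Cn n) x x) R) := fun y hy =>
      (contDiffAt_comp_chart_symm hu (hball hy)).contDiffWithinAt
    have hdd : ∀ z ∈ Metric.ball (chartAt (Cn n) x x) R,
        ddcLocal (fun y => u ((chartAt (Cn n) x).symm y)) z = 0 := by
      intro z hz
      rw [← localRep_ddc hu (hball hz), localRep_eq_pullback, pullback_eq, h0]
      rfl
    have hnear : ∀ᶠ x' in 𝓝 x, x' ∈ (chartAt (Cn n) x).source ∧
        chartAt (Cn n) x x' ∈ Metric.ball (chartAt (Cn n) x x) R :=
      ((chartAt (Cn n) x).open_source.mem_nhds hxs |> Filter.Eventually.and <|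
        ((chartAt (Cn n) x).continuousAt hxs).eventually (Metric.ball_mem_nhds _ hR))
    filter_upwards [hnear] with x' hx'
    have hmax' : ∀ z ∈ Metric.ball (chartAt (Cn n) x x) R,
        u ((chartAt (Cn n) x).symm z) ≤
          u ((chartAt (Cn n) x).symm (chartAt (Cn n) x x)) := by
      intro z _
      rw [(chartAt (Cn n) x).left_inv hxs, show u x = u a from hx]
      exact hamax _
    have := eq_of_isMax_pluriharmonic hcont hdd hmax' hx'.2
    simp only [(chartAt (Cn n) x).left_inv hx'.1, (chartAt (Cn n) x).left_inv hxs] at this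
    exact this.trans hx
  have hclopen : IsClopen {x | u x = u a} :=
    ⟨isClosed_eq hu.continuous continuous_const, hopen⟩
  have := hclopen.eq_univ ⟨a, rfl⟩
  exact ⟨u a, fun x => (this ▸ Set.mem_univ x : x ∈ {x | u x = u a})⟩

end Pluriharmonic

section Parameters

variable {k m : ℕ} {W : Type*} [NormedAddCommGroup W] [NormedSpace ℝ W]

/-- 2-forms with smooth coordinate expressions. -/
def IsSmoothForm {T : Type*} [TopologicalSpace T] [ChartedSpace (Cn m) T] (Ω : T → Alt2 m) : Prop :=
  ∀ p : T, ContDiffOn ℝ ∞ (localRep Ω p) (chartAt (Cn m) p).target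

theorem eventually_slice_contDiffAt {F : Type*} [NormedAddCommGroup F] [NormedSpace ℝ F]
    {E : Type*} [NormedAddCommGroup E] [NormedSpace ℝ E]
    {f : W → E → F} {z : W × E} (r : ℕ)
    (hf : ContDiffAt ℝ ∞ (fun z : W × E => f z.1 z.2) z) :
    ∀ᶠ q in 𝓝 z, ContDiffAt ℝ r (f q.1) q.2 := by
  have h1 : ContDiffAt ℝ r (fun z : W × E => f z.1 z.2) z := hf.of_le (by exact_mod_cast le_top)
  filter_upwards [h1.eventually (by simp)] with q hq
  exact ContDiffAt.comp (f := fun y : E => (q.1, y)) q.2 hq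
    (contDiffAt_const.prodMk contDiffAt_id)

theorem contDiffAt_fderiv_slice {F : Type*} [NormedAddCommGroup F] [NormedSpace ℝ F]
    {E : Type*} [NormedAddCommGroup E] [NormedSpace ℝ E]
    {f : W → E → F} {z : W × E}
    (hf : ContDiffAt ℝ ∞ (fun z : W × E => f z.1 z.2) z) :
    ContDiffAt ℝ ∞ (fun z : W × E => fderiv ℝ (f z.1) z.2) z := by
  refine ContDiffAt.fderiv (f := fun (z : W × E) (y : E) => f z.1 y) (g := fun z => z.2)
    (n := ∞) (m := ∞) ?_ contDiffAt_snd (by simp)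
  exact ContDiffAt.comp (f := fun q : (W × E) × E => (q.1.1, q.2))
    (g := fun z : W × E => f z.1 z.2) (z, z.2) hf (by fun_prop)

variable {T : Type*} [TopologicalSpace T] [ChartedSpace (Cn m) T] [IsManifold 𝓘(ℝ, Cn m) ∞ T]

theorem pullback_eventually_eq {f : W → Cn k → T} {z : W × Cn k} (Ω : T → Alt2 m)
    (hf : ContMDiffAt 𝓘(ℝ, W × Cn k) 𝓘(ℝ, Cn m) ∞ (fun z : W × Cn k => f z.1 z.2) z) :
    ∀ᶠ q in 𝓝 z, ∀ u v, pullback (n := k) (f q.1) Ω q.2 ![u, v] =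
      localRep Ω (f z.1 z.2) (chartAt (Cn m) (f z.1 z.2) (f q.1 q.2))
        ![fderiv ℝ (fun y => chartAt (Cn m) (f z.1 z.2) (f q.1 y)) q.2 u,
          fderiv ℝ (fun y => chartAt (Cn m) (f z.1 z.2) (f q.1 y)) q.2 v] := by
  set p := f z.1 z.2
  have h1 : ∀ᶠ q in 𝓝 z, f q.1 q.2 ∈ (chartAt (Cn m) p).source :=
    hf.continuousAt.eventually ((chartAt (Cn m) p).open_source.mem_nhds (mem_chart_source _ p))
  have h2 : ∀ᶠ q in 𝓝 z, ContMDiffAt 𝓘(ℝ, W × Cn k) 𝓘(ℝ, Cn m) 1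
      (fun z : W × Cn k => f z.1 z.2) q :=
    (contMDiffAt_iff_contMDiffAt_nhds (by simp)).1 (hf.of_le (by norm_cast))
  filter_upwards [h1, h2] with q hq1 hq2 u v
  have h3 : MDifferentiableAt 𝓘(ℝ, Cn k) 𝓘(ℝ, Cn m) (f q.1) q.2 := by
    have h4 : ContMDiffAt 𝓘(ℝ, Cn k) 𝓘(ℝ, W × Cn k) 1 (fun y : Cn k => (q.1, y)) q.2 :=
      contMDiffAt_iff_contDiffAt.2 (contDiffAt_const.prodMk contDiffAt_id)
    exact (ContMDiffAt.comp (g := fun z : W × Cn k => f z.1 z.2) q.2 hq2 h4).mdifferentiableAt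
      (by simp)
  rw [pullback_apply, form_eq_localRep Ω hq1, ← tder_eq_fderiv,
    tder_comp_apply (mdifferentiableAt_chart hq1) h3, tder_comp_apply (mdifferentiableAt_chart hq1) h3]

/-- The pullback of a smooth form by a smooth family of maps is a smooth family. -/
theorem contDiffAt_pullback_family {f : W → Cn k → T} {z : W × Cn k} {Ω : T → Alt2 m}
    (hΩ : IsSmoothForm Ω)
    (hf : ContMDiffAt 𝓘(ℝ, W × Cn k) 𝓘(ℝ, Cn m) ∞ (fun z : W × Cn k => f z.1 z.2) z) (u v : Cn k) :
    ContDiffAt ℝ ∞ (fun q : W × Cn k => pullback (n := k) (f q.1) Ω q.2 ![u, v]) z := by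
  set p := f z.1 z.2 with hp
  have hQ : ContDiffAt ℝ ∞ (fun q : W × Cn k => chartAt (Cn m) p (f q.1 q.2)) z :=
    contMDiffAt_iff_contDiffAt.1
      (ContMDiffAt.comp z (contMDiffAt_chart (mem_chart_source _ p)) hf)
  have hD := contDiffAt_fderiv_slice (f := fun (b : W) (y : Cn k) => chartAt (Cn m) p (f b y)) hQ
  have hβ : ContDiffAt ℝ ∞ (localRep Ω p) (chartAt (Cn m) p p) :=
    (hΩ p).contDiffAt ((chartAt (Cn m) p).open_target.mem_nhds (mem_chart_target _ p))
  have h1 : ContDiffAt ℝ ∞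
      (fun q : W × Cn k => localRep Ω p (chartAt (Cn m) p (f q.1 q.2))) z :=
    ContDiffAt.comp (g := localRep Ω p) (f := fun q : W × Cn k => chartAt (Cn m) p (f q.1 q.2)) z
      hβ hQ
  refine (contDiffAt_form_apply h1 (hD.clm_apply (contDiffAt_const (c := u)))
    (hD.clm_apply (contDiffAt_const (c := v)))).congr_of_eventuallyEq ?_
  filter_upwards [pullback_eventually_eq Ω hf] with q hq
  exact hq u v

theorem contDiffAt_ddcLocal_family {u : W → Cn k → ℝ} {z : W × Cn k}
    (hu : ContDiffAt ℝ ∞ (fun q : W × Cn k => u q.1 q.2) z) (v w : Cn k) :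
    ContDiffAt ℝ ∞ (fun q : W × Cn k => ddcLocal (u q.1) q.2 ![v, w]) z := by
  have h1 := contDiffAt_fderiv_slice (f := u) hu
  have h2 := contDiffAt_fderiv_slice (f := fun b y => fderiv ℝ (u b) y) h1
  have h3 : ∀ v w, ContDiffAt ℝ ∞
      (fun q : W × Cn k => fderiv ℝ (fun y => fderiv ℝ (u q.1) y) q.2 v w) z := fun v w =>
    (h2.clm_apply contDiffAt_const).clm_apply contDiffAt_const
  refine (((h3 v (J k w)).neg).add (h3 w (J k v))).congr_of_eventuallyEq ?_
  filter_upwards [eventually_slice_contDiffAt 2 hu] with q hq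
  exact ddcLocal_apply (by exact_mod_cast hq) v w

theorem contDiffAt_trace_inv_mul {A R : W → Matrix (Fin k) (Fin k) ℂ} {z : W}
    (hA : ∀ a b, ContDiffAt ℝ ∞ (fun q => A q a b) z)
    (hR : ∀ a b, ContDiffAt ℝ ∞ (fun q => R q a b) z) (h0 : (A z).det ≠ 0) :
    ContDiffAt ℝ ∞ (fun q => ((A q)⁻¹ * R q).trace) z := by
  have hadj : ∀ a b, ContDiffAt ℝ ∞ (fun q => (A q).adjugate a b) z := by
    intro a b
    simp only [Matrix.adjugate_apply]
    refine contDiffAt_det fun i j => ?_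
    simp only [Matrix.updateRow_apply]
    split_ifs
    · exact contDiffAt_const
    · exact hA i j
  have hdet := contDiffAt_det hA
  simp only [Matrix.inv_def, Ring.inverse_eq_inv', Matrix.trace, Matrix.diag_apply,
    Matrix.mul_apply, Matrix.smul_apply, smul_eq_mul]
  exact ContDiffAt.sum fun i _ => ContDiffAt.sum fun j _ =>
    ((hdet.inv h0).mul (hadj i j)).mul (hR j i)

/-- The scalar curvature of a smooth family of positive forms is smooth. -/
theorem contDiffAt_localScal_family {β : W → Cn k → Alt2 k} {z : W × Cn k}
    (hβ : ∀ u v, ContDiffAt ℝ ∞ (fun q : W × Cn k => β q.1 q.2 ![u, v]) z)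
    (hp : IsPositiveForm (β z.1 z.2)) :
    ContDiffAt ℝ ∞ (fun q : W × Cn k => localScal (β q.1) q.2) z := by
  have hL : ContDiffAt ℝ ∞ (fun q : W × Cn k => logDet (β q.1) q.2) z :=
    contDiffAt_logDet (β := fun q : W × Cn k => β q.1 q.2) hβ hp
  have h0 : (herm (β z.1 z.2)).det ≠ 0 := by
    intro h
    have := hp.det_re_pos
    rw [h] at this
    simp at this
  have hr : ∀ u v, ContDiffAt ℝ ∞
      (fun q : W × Cn k => ((-(1 / 2 : ℝ)) • ddcLocal (logDet (β q.1)) q.2) ![u, v]) z :=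
    fun u v => contDiffAt_const.mul (contDiffAt_ddcLocal_family (u := fun b => logDet (β b)) hL u v)
  exact Complex.reCLM.contDiff.contDiffAt.comp z
    (contDiffAt_trace_inv_mul (A := fun q : W × Cn k => herm (β q.1 q.2))
      (contDiffAt_herm hβ) (contDiffAt_herm hr) h0)

end Parameters

section Adapted

variable {n : ℕ} {T : Type*} [TopologicalSpace T] [ChartedSpace (Cn (n + 1)) T]

/-- Holomorphic coordinates `(π, P)` near `y` with inverse `A`. -/
structure IsAdapted (π : T → ℂ) (A : ℂ × Cn n → T) (P : T → Cn n) (y : T) : Prop where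
  holo_symm : ContMDiffAt 𝓘(ℂ, ℂ × Cn n) 𝓘(ℂ, Cn (n + 1)) ω A (π y, P y)
  holo : ContMDiffAt 𝓘(ℂ, Cn (n + 1)) 𝓘(ℂ, Cn n) ω P y
  left_inv : ∀ᶠ y' in 𝓝 y, A (π y', P y') = y'
  right_inv : ∀ᶠ q in 𝓝 (π y, P y), P (A q) = q.2 ∧ π (A q) = q.1

theorem exists_equiv_fst_eq {ℓ : Cn (n + 1) →L[ℂ] ℂ} (h : Function.Surjective ℓ) :
    ∃ e : Cn (n + 1) ≃L[ℂ] ℂ × Cn n, ∀ v, (e v).1 = ℓ v := by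
  obtain ⟨s, hs⟩ := (ℓ : Cn (n + 1) →ₗ[ℂ] ℂ).exists_rightInverse_of_surjective
    (LinearMap.range_eq_top.2 h)
  have hs' : Function.RightInverse (LinearMap.toContinuousLinearMap s) ℓ := fun z => by
    have := LinearMap.congr_fun hs z
    simpa using this
  set e₁ := ContinuousLinearEquiv.equivOfRightInverse ℓ (LinearMap.toContinuousLinearMap s) hs'
  have hk : Module.finrank ℂ ℓ.ker = Module.finrank ℂ (Cn n) := by
    have h1 := e₁.toLinearEquiv.finrank_eq
    rw [Module.finrank_prod] at h1
    simp only [Module.finrank_fin_fun, Module.finrank_self] at h1 ⊢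
    omega
  set e₂ : ℓ.ker ≃L[ℂ] Cn n := ContinuousLinearEquiv.ofFinrankEq hk
  refine ⟨e₁.trans ((ContinuousLinearEquiv.refl ℂ ℂ).prodCongr e₂), fun v => ?_⟩
  rfl

variable [IsManifold 𝓘(ℂ, Cn (n + 1)) ω T] {π : T → ℂ}

theorem exists_isAdapted (hπ : ContMDiff 𝓘(ℂ, Cn (n + 1)) 𝓘(ℂ, ℂ) ω π)
    (hs : ∀ x, Function.Surjective (ctder (Cn (n + 1)) ℂ π x)) (y : T) :
    ∃ A P, IsAdapted (n := n) π A P y := by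
  set c := chartAt (Cn (n + 1)) y
  have hy := mem_chart_source (Cn (n + 1)) y
  have hcy := c.map_source hy
  set p : Cn (n + 1) → ℂ := fun w => π (c.symm w) with hp
  have hpc : ContDiffAt ℂ ω p (c y) :=
    contMDiffAt_iff_contDiffAt.1 ((hπ _).comp (c y) (contMDiffAt_chart_symm_complex hcy))
  have hsurj : Function.Surjective (fderiv ℂ p (c y)) := by
    have h1 : ctder (Cn (n + 1)) ℂ π y = fderiv ℂ p (c y) := by
      have h2 : (fun y' => p (c y')) =ᶠ[𝓝 y] π := by
        filter_upwards [c.open_source.mem_nhds hy] with y' hy'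
        simp only [hp, c.left_inv hy']
      have h3 : ctder (Cn (n + 1)) ℂ (fun y' => p (c y')) y =
          (fderiv ℂ p (c y)).comp (ctder (Cn (n + 1)) (Cn (n + 1)) c y) := by
        have := mfderiv_comp (I := 𝓘(ℂ, Cn (n + 1))) (I' := 𝓘(ℂ, Cn (n + 1))) (I'' := 𝓘(ℂ, ℂ))
          (f := c) (g := p) y (hpc.differentiableAt (by simp)).mdifferentiableAt
          ((contMDiffAt_chart_complex hy).mdifferentiableAt (by simp))
        rw [mfderiv_eq_fderiv] at this
        exact this
      have h4 : ctder (Cn (n + 1)) (Cn (n + 1)) c y = ContinuousLinearMap.id ℂ _ := by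
        have h := mfderiv_chartAt_eq_tangentCoordChange (I := 𝓘(ℂ, Cn (n + 1))) hy
        rw [ctder, h]
        ext1 v
        exact tangentCoordChange_self (I := 𝓘(ℂ, Cn (n + 1))) (by simp)
      have h5 : ctder (Cn (n + 1)) ℂ (fun y' => p (c y')) y = ctder (Cn (n + 1)) ℂ π y :=
        h2.mfderiv_eq
      rw [← h5, h3, h4]
      rfl
    rw [← h1]
    exact hs y
  obtain ⟨e, he⟩ := exists_equiv_fst_eq hsurj
  set Ψ : Cn (n + 1) → ℂ × Cn n := fun w => (p w, (e w).2) with hΨ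
  have hΨc : ContDiffAt ℂ ω Ψ (c y) :=
    hpc.prodMk (contDiff_snd.comp e.contDiff).contDiffAt
  have hΨd : HasFDerivAt Ψ (e : Cn (n + 1) →L[ℂ] ℂ × Cn n) (c y) := by
    have h1 := (hpc.differentiableAt (by simp)).hasFDerivAt.prodMk
      (((ContinuousLinearMap.snd ℂ ℂ (Cn n)).comp
        (e : Cn (n + 1) →L[ℂ] ℂ × Cn n)).hasFDerivAt (x := c y))
    have h2 : (e : Cn (n + 1) →L[ℂ] ℂ × Cn n) = (fderiv ℂ p (c y)).prod
        ((ContinuousLinearMap.snd ℂ ℂ (Cn n)).comp (e : Cn (n + 1) →L[ℂ] ℂ × Cn n)) :=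
      ContinuousLinearMap.ext fun v => Prod.ext (he v) rfl
    rw [h2]
    exact h1
  set h := hΨc.toOpenPartialHomeomorph Ψ hΨd (by simp)
  have hsrc : c y ∈ h.source := hΨc.mem_toOpenPartialHomeomorph_source hΨd (by simp)
  have htgt : Ψ (c y) ∈ h.target := h.map_source hsrc
  have hsymm : ContDiffAt ℂ ω h.symm (Ψ (c y)) := hΨc.to_localInverse hΨd (by simp)
  have hsy : h.symm (Ψ (c y)) = c y := h.left_inv hsrc
  have hbase : (π y, (e (c y)).2) = Ψ (c y) := by
    simp only [hΨ, hp, c.left_inv hy]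
  refine ⟨fun q => c.symm (h.symm q), fun y' => (e (c y')).2, ?_, ?_, ?_, ?_⟩
  · rw [hbase]
    refine ContMDiffAt.comp (Ψ (c y)) ?_ (contMDiffAt_iff_contDiffAt.2 hsymm)
    rw [hsy]
    exact contMDiffAt_chart_symm_complex hcy
  · exact ContMDiffAt.comp (g := fun w => (e w).2) y
      (contMDiffAt_iff_contDiffAt.2 (contDiff_snd.comp e.contDiff).contDiffAt)
      (contMDiffAt_chart_complex hy)
  · filter_upwards [c.open_source.mem_nhds hy,
      (c.continuousAt hy).eventually (h.open_source.mem_nhds hsrc)] with y' h1 h2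
    have h3 : (π y', (e (c y')).2) = Ψ (c y') := by
      simp only [hΨ, hp, c.left_inv h1]
    have h4 : h.symm (Ψ (c y')) = c y' := h.left_inv h2
    simp only [h3, h4, c.left_inv h1]
  · rw [hbase]
    filter_upwards [h.open_target.mem_nhds htgt, hsymm.continuousAt.eventually
      (c.open_target.mem_nhds (by rw [hsy]; exact hcy))] with q h1 h2
    have h3 : Ψ (h.symm q) = q := h.right_inv h1
    rw [c.right_inv h2]
    have h4 : (e (h.symm q)).2 = q.2 := by
      have := congrArg Prod.snd h3
      exact this
    exact ⟨h4, congrArg Prod.fst h3⟩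

variable {A : ℂ × Cn n → T} {P : T → Cn n} {y : T}

theorem IsAdapted.eventually (h : IsAdapted π A P y)
    (hπ : ContMDiff 𝓘(ℂ, Cn (n + 1)) 𝓘(ℂ, ℂ) ω π) : ∀ᶠ y' in 𝓝 y, IsAdapted π A P y' := by
  have hc : ContinuousAt (fun y' => (π y', P y')) y :=
    (hπ y).continuousAt.prodMk h.holo.continuousAt
  filter_upwards [hc.eventually ((contMDiffAt_iff_contMDiffAt_nhds (by simp)).1 h.holo_symm),
    (contMDiffAt_iff_contMDiffAt_nhds (by simp)).1 h.holo, eventually_eventually_nhds.2 h.left_inv,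
    hc.eventually (eventually_eventually_nhds.2 h.right_inv)] with y' h1 h2 h3 h4
  exact ⟨h1, h2, h3, h4⟩

theorem IsAdapted.apply_self (h : IsAdapted π A P y) : A (π y, P y) = y := h.left_inv.self_of_nhds

theorem IsAdapted.slice_eventually (h : IsAdapted π A P y) : ∀ᶠ w in 𝓝 (P y),
    ContMDiffAt 𝓘(ℂ, Cn n) 𝓘(ℂ, Cn (n + 1)) ω (fun w => A (π y, w)) w ∧
    Function.Injective (tder (Cn n) (Cn (n + 1)) (fun w => A (π y, w)) w) := by
  have hc : ContinuousAt (fun w : Cn n => (π y, w)) (P y) := by fun_prop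
  have hP : ContinuousAt (fun w : Cn n => A (π y, w)) (P y) :=
    ContinuousAt.comp (f := fun w : Cn n => (π y, w)) h.holo_symm.continuousAt hc
  have hP2 : ∀ᶠ w in 𝓝 (P y),
      ContMDiffAt 𝓘(ℂ, Cn (n + 1)) 𝓘(ℂ, Cn n) ω P (A (π y, w)) := by
    refine hP.eventually ?_
    change ∀ᶠ y' in 𝓝 (A (π y, P y)), ContMDiffAt 𝓘(ℂ, Cn (n + 1)) 𝓘(ℂ, Cn n) ω P y'
    rw [h.apply_self]
    exact (contMDiffAt_iff_contMDiffAt_nhds (by simp)).1 h.holo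
  filter_upwards [hc.eventually ((contMDiffAt_iff_contMDiffAt_nhds (by simp)).1 h.holo_symm),
    hc.eventually (eventually_eventually_nhds.2 h.right_inv), hP2] with w h1 h2 h3
  have h4 : ContMDiffAt 𝓘(ℂ, Cn n) 𝓘(ℂ, Cn (n + 1)) ω (fun w => A (π y, w)) w :=
    ContMDiffAt.comp w h1 (contMDiffAt_iff_contDiffAt.2 (contDiffAt_const.prodMk contDiffAt_id))
  refine ⟨h4, Function.LeftInverse.injective (g := tder (Cn (n + 1)) (Cn n) P (A (π y, w)))
    fun v => tder_leftInverse (f := fun w => A (π y, w)) ((contMDiffAt_real h3).mdifferentiableAt (by simp))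
      ((contMDiffAt_real h4).mdifferentiableAt (by simp)) ?_ v⟩
  have hcw : ContinuousAt (fun w : Cn n => (π y, w)) w := by fun_prop
  exact (hcw.eventually h2).mono fun w hw => hw.1

variable {Ω : T → Alt2 (n + 1)}

/-- The scalar curvature of the restriction of `Ω` to the fibre of `π` through `y`, computed in the
coordinates `(A, P)`. -/
noncomputable def adaptedScal (π : T → ℂ) (Ω : T → Alt2 (n + 1)) (A : ℂ × Cn n → T) (P : T → Cn n)
    (y : T) : ℝ :=
  localScal (pullback (n := n) (fun w => A (π y, w)) Ω) (P y)

variable {Y : Type*} [TopologicalSpace Y] [ChartedSpace (Cn n) Y] [IsManifold 𝓘(ℂ, Cn n) ω Y]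

theorem scal_pullback_eq_adaptedScal (hΩ : IsKahlerForm Ω) {f : Y → T} {x : Y}
    (hA : IsAdapted π A P (f x)) (hf : ContMDiffAt 𝓘(ℂ, Cn n) 𝓘(ℂ, Cn (n + 1)) ω f x)
    (hinj : Function.Injective (tder (Cn n) (Cn (n + 1)) f x))
    (hπ : ∀ᶠ x' in 𝓝 x, π (f x') = π (f x)) :
    scal (pullback (n := n) f Ω) x = adaptedScal π Ω A P (f x) := by
  set c := chartAt (Cn n) x
  have hx := mem_chart_source (Cn n) x
  have hcx := c.map_source hx
  have hcc : c.symm (c x) = x := c.left_inv hx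
  set z := π (f x) with hz
  set g : Cn n → T := fun w => A (z, w) with hg
  set τ : Cn n → Cn n := fun w => P (f (c.symm w)) with hτ
  have hτx : τ (c x) = P (f x) := by simp only [hτ, hcc]
  have hct : Filter.Tendsto c.symm (𝓝 (c x)) (𝓝 x) := by
    have := c.continuousAt_symm hcx
    rwa [ContinuousAt, hcc] at this
  have hfτ : ∀ᶠ w in 𝓝 (c x), g (τ w) = f (c.symm w) := by
    have h1 := hct.eventually (hf.continuousAt.eventually hA.left_inv)
    filter_upwards [h1, hct.eventually hπ] with w h1 h2
    rw [h2] at h1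
    exact h1
  have hfc : ∀ᶠ w in 𝓝 (c x),
      ContMDiffAt 𝓘(ℂ, Cn n) 𝓘(ℂ, Cn (n + 1)) ω (fun w => f (c.symm w)) w := by
    filter_upwards [hct.eventually ((contMDiffAt_iff_contMDiffAt_nhds (by simp)).1 hf),
      c.open_target.mem_nhds hcx] with w h1 h2
    exact h1.comp w (contMDiffAt_chart_symm_complex h2)
  have hτc : ContDiffAt ℂ ω τ (c x) := by
    refine contMDiffAt_iff_contDiffAt.1 (ContMDiffAt.comp (g := P) (c x) ?_ hfc.self_of_nhds)
    rw [hcc]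
    exact hA.holo
  have hslice : ∀ᶠ w in 𝓝 (τ (c x)), ContMDiffAt 𝓘(ℂ, Cn n) 𝓘(ℂ, Cn (n + 1)) ω g w ∧
      Function.Injective (tder (Cn n) (Cn (n + 1)) g w) := by
    rw [hτx]
    exact hA.slice_eventually
  have hd : ∀ᶠ w in 𝓝 (c x), tder (Cn n) (Cn (n + 1)) (fun w => g (τ w)) w =
      (tder (Cn n) (Cn (n + 1)) g (τ w)).comp (fderiv ℝ τ w) := by
    filter_upwards [hτc.continuousAt.eventually hslice, hτc.eventually (by simp)] with w h1 h2
    rw [← tder_eq_fderiv]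
    exact tder_comp ((contMDiffAt_real h1.1).mdifferentiableAt (by simp))
      ((h2.differentiableAt (by simp)).restrictScalars ℝ).mdifferentiableAt
  have hloc : localRep (pullback (n := n) f Ω) x =ᶠ[𝓝 (c x)] fun w =>
      (pullback (n := n) g Ω (τ w)).compContinuousLinearMap (fderiv ℝ τ w) := by
    filter_upwards [hct.eventually ((contMDiffAt_iff_contMDiffAt_nhds (by simp)).1 hf),
      c.open_target.mem_nhds hcx, hfτ.eventually_nhds, hd] with w h1 h2 h3 h4
    rw [localRep_eq_pullback, pullback_pullback Ω (mdifferentiableAt_chart_symm h2)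
      ((contMDiffAt_real h1).mdifferentiableAt (by simp)), ← pullback_congr Ω h3, pullback_eq, h4]
    rfl
  rw [scal_eq_localScal, localScal_congr hloc]
  have hτd := hτc.differentiableAt (n := ω) (by simp)
  rw [localScal_comp (β := pullback (n := n) g Ω) ?_ ?_ hτc ?_, hτx, adaptedScal]
  · intro v w
    have h1 : ContMDiffAt 𝓘(ℝ, Cn n) 𝓘(ℝ, Cn (n + 1)) ∞ g (τ (c x)) :=
      contMDiffAt_real hslice.self_of_nhds.1
    have h2 := contDiffAt_pullback_family (W := ℝ) (f := fun _ => g) (z := (0, τ (c x))) hΩ.smooth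
      (ContMDiffAt.comp (f := fun q : ℝ × Cn n => q.2) (0, τ (c x)) h1
        (contMDiffAt_iff_contDiffAt.2 contDiffAt_snd)) v w
    exact ContDiffAt.comp (f := fun w : Cn n => ((0 : ℝ), w)) (τ (c x)) h2
      (contDiffAt_const.prodMk contDiffAt_id)
  · filter_upwards [hslice] with w h1
    have h2 := h1.1.mdifferentiableAt (n := ω) (by simp)
    exact (hΩ.isPositiveForm _).pullback h2 (ctder_injective_of_tder h2 h1.2)
  · have h1 : Function.Injective (fderiv ℝ τ (c x)) := by
      have h2 := hd.self_of_nhds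
      rw [tder_congr (g := fun w => f (c.symm w)) hfτ,
        tder_comp (f := c.symm) (g := f) (x := c x)
          (by rw [hcc]; exact (contMDiffAt_real hf).mdifferentiableAt (by simp))
          (mdifferentiableAt_chart_symm hcx)] at h2
      have h3 : Function.Injective ((tder (Cn n) (Cn (n + 1)) f (c.symm (c x))).comp
          (tder (Cn n) (Cn n) c.symm (c x))) := by
        rw [hcc]
        exact hinj.comp (tder_chart_symm_injective hcx)
      rw [h2] at h3
      exact Function.Injective.of_comp h3
    rw [hτd.fderiv_restrictScalars ℝ] at h1
    exact h1

/-- The scalar curvature of the fibres does not depend on the coordinates. -/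
theorem adaptedScal_eq (hΩ : IsKahlerForm Ω) {A' : ℂ × Cn n → T} {P' : T → Cn n}
    (hA : IsAdapted π A P y) (hA' : IsAdapted π A' P' y) :
    adaptedScal π Ω A P y = adaptedScal π Ω A' P' y := by
  have h1 : ∀ {A' : ℂ × Cn n → T} {P' : T → Cn n}, IsAdapted π A' P' y →
      scal (X := Cn n) (pullback (n := n) (fun w => A (π y, w)) Ω) (P y) =
        adaptedScal π Ω A' P' y := by
    intro A' P' h
    have h2 := hA.slice_eventually.self_of_nhds
    have h3 := hA.apply_self
    have h4 := scal_pullback_eq_adaptedScal (Y := Cn n) (A := A') (P := P') hΩ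
      (f := fun w => A (π y, w)) (x := P y) (by rw [h3]; exact h) h2.1 h2.2 ?_
    · rw [h4, h3]
    · have hc : ContinuousAt (fun w : Cn n => (π y, w)) (P y) := by fun_prop
      filter_upwards [hc.eventually hA.right_inv] with w hw
      rw [hw.2, h3]
  rw [← h1 hA, h1 hA']

open Classical in
/-- The function on `T` whose restriction to each fibre of `π` is the scalar curvature of the
restriction of `Ω`. -/
noncomputable def fibreScal (π : T → ℂ) (Ω : T → Alt2 (n + 1)) (y : T) : ℝ :=
  if h : ∃ q : (ℂ × Cn n → T) × (T → Cn n), IsAdapted π q.1 q.2 y then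
    adaptedScal π Ω h.choose.1 h.choose.2 y else 0

theorem fibreScal_eq (hΩ : IsKahlerForm Ω) (hA : IsAdapted π A P y) :
    fibreScal π Ω y = adaptedScal π Ω A P y := by
  have h : ∃ q : (ℂ × Cn n → T) × (T → Cn n), IsAdapted π q.1 q.2 y := ⟨(A, P), hA⟩
  rw [fibreScal, dif_pos h]
  exact adaptedScal_eq hΩ h.choose_spec hA

theorem contDiffAt_adaptedScal_family (hΩ : IsKahlerForm Ω) (hA : IsAdapted π A P y) :
    ContDiffAt ℝ ∞ (fun q : ℂ × Cn n =>
      localScal (pullback (n := n) (fun w => A (q.1, w)) Ω) q.2) (π y, P y) := by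
  have h0 : ContMDiffAt 𝓘(ℝ, ℂ × Cn n) 𝓘(ℝ, Cn (n + 1)) ∞ A (π y, P y) :=
    contMDiffAt_real hA.holo_symm
  have h3 := hA.slice_eventually.self_of_nhds
  have h4 := h3.1.mdifferentiableAt (n := ω) (by simp)
  have h5 : IsPositiveForm (pullback (n := n) (fun w => A (π y, w)) Ω (P y)) :=
    (hΩ.isPositiveForm _).pullback h4 (ctder_injective_of_tder h4 h3.2)
  have h6 : ∀ u v, ContDiffAt ℝ ∞ (fun q : ℂ × Cn n =>
      pullback (n := n) (fun w => A (q.1, w)) Ω q.2 ![u, v]) (π y, P y) := fun u v =>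
    contDiffAt_pullback_family (f := fun b w => A (b, w)) hΩ.smooth h0 u v
  exact contDiffAt_localScal_family (β := fun b => pullback (n := n) (fun w => A (b, w)) Ω) h6 h5

theorem contMDiff_fibreScal (hΩ : IsKahlerForm Ω)
    (hπ : ContMDiff 𝓘(ℂ, Cn (n + 1)) 𝓘(ℂ, ℂ) ω π)
    (hs : ∀ x, Function.Surjective (ctder (Cn (n + 1)) ℂ π x)) :
    ContMDiff 𝓘(ℝ, Cn (n + 1)) 𝓘(ℝ, ℝ) ∞ (fibreScal π Ω) := by
  intro y
  obtain ⟨A, P, hA⟩ := exists_isAdapted hπ hs y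
  set σ : ℂ × Cn n → ℝ := fun q =>
    localScal (pullback (n := n) (fun w => A (q.1, w)) Ω) q.2 with hσ
  have h1 : fibreScal π Ω =ᶠ[𝓝 y] fun y' => σ (π y', P y') := by
    filter_upwards [hA.eventually hπ] with y' hy'
    exact fibreScal_eq hΩ hy'
  have h2 : ContDiffAt ℝ ∞ σ (π y, P y) := contDiffAt_adaptedScal_family hΩ hA
  have h3 : ContMDiffAt 𝓘(ℝ, Cn (n + 1)) 𝓘(ℝ, ℂ × Cn n) ∞ (fun y' => (π y', P y')) y :=
    (contMDiffAt_real (hπ y)).prodMk_space (contMDiffAt_real hA.holo)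
  clear_value σ
  exact ContMDiffAt.congr_of_eventuallyEq
    (ContMDiffAt.comp (g := σ) y (contMDiffAt_iff_contDiffAt.2 h2) h3) h1

/-- The scalar curvature of the form induced by a holomorphic immersion into a fibre. -/
theorem scal_pullback_eq_fibreScal (hΩ : IsKahlerForm Ω)
    (hπ : ContMDiff 𝓘(ℂ, Cn (n + 1)) 𝓘(ℂ, ℂ) ω π)
    (hs : ∀ x, Function.Surjective (ctder (Cn (n + 1)) ℂ π x)) {f : Y → T} {x : Y}
    (hf : ContMDiffAt 𝓘(ℂ, Cn n) 𝓘(ℂ, Cn (n + 1)) ω f x)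
    (hinj : Function.Injective (tder (Cn n) (Cn (n + 1)) f x))
    (hfπ : ∀ᶠ x' in 𝓝 x, π (f x') = π (f x)) :
    scal (pullback (n := n) f Ω) x = fibreScal π Ω (f x) := by
  obtain ⟨A, P, hA⟩ := exists_isAdapted hπ hs (f x)
  rw [fibreScal_eq hΩ hA, scal_pullback_eq_adaptedScal hΩ hA hf hinj hfπ]

end Adapted

section C1Fam

variable {B : Type*} [NormedAddCommGroup B] [NormedSpace ℝ B]
  {K : Type*} [TopologicalSpace K]

/-- Families of continuous functions with a continuous derivative with respect to the parameter. -/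
def C1Fam (u : B → K → ℝ) : Prop :=
  Continuous (fun q : B × K => u q.1 q.2) ∧ ∃ u' : B → K → B →L[ℝ] ℝ,
    Continuous (fun q : B × K => u' q.1 q.2) ∧ ∀ b x, HasFDerivAt (fun b => u b x) (u' b x) b

theorem C1Fam.continuous {u : B → K → ℝ} (h : C1Fam u) (b : B) : Continuous (u b) :=
  h.1.comp (by fun_prop : Continuous fun x : K => (b, x))

theorem C1Fam.add {u v : B → K → ℝ} (hu : C1Fam u) (hv : C1Fam v) :
    C1Fam (fun b x => u b x + v b x) := by
  obtain ⟨hu, u', hu', hud⟩ := hu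
  obtain ⟨hv, v', hv', hvd⟩ := hv
  exact ⟨hu.add hv, fun b x => u' b x + v' b x, hu'.add hv', fun b x => (hud b x).add (hvd b x)⟩

theorem C1Fam.mul {u v : B → K → ℝ} (hu : C1Fam u) (hv : C1Fam v) :
    C1Fam (fun b x => u b x * v b x) := by
  obtain ⟨hu, u', hu', hud⟩ := hu
  obtain ⟨hv, v', hv', hvd⟩ := hv
  exact ⟨hu.mul hv, fun b x => u b x • v' b x + v b x • u' b x,
    (hu.smul hv').add (hv.smul hu'), fun b x => (hud b x).mul (hvd b x)⟩

theorem c1Fam_of_continuous {u : K → ℝ} (hu : Continuous u) : C1Fam (fun _ : B => u) :=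
  ⟨hu.comp continuous_snd, fun _ _ => 0, continuous_const, fun _ _ => hasFDerivAt_const _ _⟩

theorem c1Fam_of_contDiff {f : B → ℝ} (hf : ContDiff ℝ 1 f) : C1Fam (fun b (_ : K) => f b) := by
  obtain ⟨f', h1, h2⟩ := contDiff_one_iff_hasFDerivAt.1 hf
  exact ⟨hf.continuous.comp continuous_fst, fun b _ => f' b, h1.comp continuous_fst, fun b _ => h2 b⟩

theorem C1Fam.neg {u : B → K → ℝ} (hu : C1Fam u) : C1Fam (fun b x => -u b x) := by
  obtain ⟨hu, u', hu', hud⟩ := hu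
  exact ⟨hu.neg, fun b x => -u' b x, hu'.neg, fun b x => (hud b x).neg⟩

theorem C1Fam.sub {u v : B → K → ℝ} (hu : C1Fam u) (hv : C1Fam v) :
    C1Fam (fun b x => u b x - v b x) := by
  simpa only [sub_eq_add_neg] using hu.add hv.neg

theorem integrable_of_continuous [CompactSpace K] [MeasurableSpace K] [BorelSpace K]
    {ν : Measure K} [IsFiniteMeasure ν] {u : K → ℝ} (hu : Continuous u) : Integrable u ν :=
  hu.integrable_of_hasCompactSupport (HasCompactSupport.of_compactSpace u)

theorem C1Fam.hasFDerivAt_integral [FiniteDimensional ℝ B] [CompactSpace K] [MeasurableSpace K]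
    [BorelSpace K] {u : B → K → ℝ} (hu : C1Fam u) (ν : Measure K) [IsFiniteMeasure ν] (b : B) :
    Integrable (fun x => fderiv ℝ (fun b => u b x) b) ν ∧
      HasFDerivAt (fun b => ∫ x, u b x ∂ν) (∫ x, fderiv ℝ (fun b => u b x) b ∂ν) b := by
  obtain ⟨hc, u', hc', hd⟩ := hu
  have hs : ∀ b, Continuous (u b) := fun b =>
    hc.comp (by fun_prop : Continuous fun x : K => (b, x))
  have hs' : ∀ b, Continuous (u' b) := fun b =>
    hc'.comp (by fun_prop : Continuous fun x : K => (b, x))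
  have hnorm : Continuous (fun q : B × K => ‖u' q.1 q.2‖) := hc'.norm
  obtain ⟨C, hC⟩ : ∃ C, ∀ q ∈ Metric.closedBall b 1 ×ˢ (Set.univ : Set K), ‖u' q.1 q.2‖ ≤ C := by
    obtain ⟨C, hC⟩ := ((isCompact_closedBall b 1).prod isCompact_univ).bddAbove_image
      hnorm.continuousOn (K := Metric.closedBall b 1 ×ˢ (Set.univ : Set K))
    exact ⟨C, fun q hq => hC ⟨q, hq, rfl⟩⟩
  have hu' : (fun x => fderiv ℝ (fun b => u b x) b) = u' b := funext fun x => (hd b x).fderiv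
  rw [hu']
  refine ⟨(integrable_const C).mono' (hs' b).aestronglyMeasurable (Filter.Eventually.of_forall
    fun x => hC (b, x) ⟨Metric.mem_closedBall_self zero_le_one, trivial⟩), ?_⟩
  exact hasFDerivAt_integral_of_dominated_of_fderiv_le (F := u) (F' := u')
    (bound := fun _ => C) (Metric.closedBall_mem_nhds b one_pos)
    (Filter.Eventually.of_forall fun b => (hs b).aestronglyMeasurable)
    (integrable_of_continuous (hs b)) (hs' b).aestronglyMeasurable
    (Filter.Eventually.of_forall fun x b' hb' => hC (b', x) ⟨hb', trivial⟩)
    (integrable_const C) (Filter.Eventually.of_forall fun x b' _ => hd b' x)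

theorem C1Fam.contDiff_integral [FiniteDimensional ℝ B] [CompactSpace K] [MeasurableSpace K]
    [BorelSpace K] {u : B → K → ℝ} (hu : C1Fam u) (ν : Measure K) [IsFiniteMeasure ν] :
    ContDiff ℝ 1 (fun b => ∫ x, u b x ∂ν) := by
  refine contDiff_one_iff_hasFDerivAt.2
    ⟨_, ?_, fun b => (hu.hasFDerivAt_integral ν b).2⟩
  obtain ⟨hc, u', hc', hd⟩ := hu
  have hu' : (fun b x => fderiv ℝ (fun b => u b x) b) = u' := funext₂ fun b x => (hd b x).fderiv
  have h := continuous_parametric_integral_of_continuous (μ := ν) (f := u') hc' isCompact_univ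
  rw [← hu'] at h
  simpa using h

theorem C1Fam.hasDerivAt_integral [CompactSpace K] [MeasurableSpace K]
    [BorelSpace K] {u : ℝ → K → ℝ} (hu : C1Fam u) (ν : Measure K) [IsFiniteMeasure ν] (t : ℝ) :
    HasDerivAt (fun t => ∫ x, u t x ∂ν) (∫ x, deriv (fun t => u t x) t ∂ν) t := by
  obtain ⟨h1, h2⟩ := hu.hasFDerivAt_integral ν t
  have h3 := h2.hasDerivAt
  rw [ContinuousLinearMap.integral_apply h1] at h3
  exact h3

variable {n : ℕ} [ChartedSpace (Cn n) K]

theorem c1Fam_of_charts {u : B → K → ℝ}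
    (h : ∀ p : K, ContDiffOn ℝ ∞ (fun z : B × Cn n => u z.1 ((chartAt (Cn n) p).symm z.2))
      (Set.univ ×ˢ (chartAt (Cn n) p).target)) : C1Fam u := by
  have hat : ∀ (b : B) (x : K), ContDiffAt ℝ ∞
      (fun z : B × Cn n => u z.1 ((chartAt (Cn n) x).symm z.2)) (b, chartAt (Cn n) x x) := fun b x =>
    (h x).contDiffAt ((isOpen_univ.prod (chartAt (Cn n) x).open_target).mem_nhds
      ⟨trivial, mem_chart_target _ x⟩)
  have hch : ∀ (b : B) (x : K), ContinuousAt (fun q : B × K => (q.1, chartAt (Cn n) x q.2)) (b, x) :=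
    fun b x => continuousAt_fst.prodMk (ContinuousAt.comp (f := Prod.snd)
      ((chartAt (Cn n) x).continuousAt (mem_chart_source _ x)) continuousAt_snd)
  have hsrc : ∀ (b : B) (x : K), ∀ᶠ q in 𝓝 (b, x), (chartAt (Cn n) x).symm (chartAt (Cn n) x q.2) =
      q.2 := fun b x => by
    filter_upwards [continuousAt_snd.eventually ((chartAt (Cn n) x).open_source.mem_nhds
      (mem_chart_source _ x))] with q hq
    exact (chartAt (Cn n) x).left_inv hq
  refine ⟨continuous_iff_continuousAt.2 fun q => ?_, fun b x => fderiv ℝ (fun b => u b x) b,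
    continuous_iff_continuousAt.2 fun q => ?_, fun b x => ?_⟩
  · obtain ⟨b, x⟩ := q
    refine (ContinuousAt.comp (f := fun q : B × K => (q.1, chartAt (Cn n) x q.2))
      (hat b x).continuousAt (hch b x)).congr ?_
    filter_upwards [hsrc b x] with q hq
    simp only [Function.comp_apply, hq]
  · obtain ⟨b, x⟩ := q
    have h1 : ContDiffAt ℝ ∞ (fun z : Cn n × B => u z.2 ((chartAt (Cn n) x).symm z.1))
        (chartAt (Cn n) x x, b) :=
      ContDiffAt.comp (f := fun z : Cn n × B => (z.2, z.1)) (chartAt (Cn n) x x, b) (hat b x)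
        (contDiffAt_snd.prodMk contDiffAt_fst)
    have h2 := contDiffAt_fderiv_slice
      (f := fun (y : Cn n) (b : B) => u b ((chartAt (Cn n) x).symm y)) h1
    refine (ContinuousAt.comp (f := fun q : B × K => (chartAt (Cn n) x q.2, q.1))
      h2.continuousAt (continuousAt_snd.prodMk continuousAt_fst |>.comp (hch b x))).congr ?_
    filter_upwards [hsrc b x] with q hq
    simp only [Function.comp_apply, hq]
  · have h1 := (hat b x).comp b (f := fun b : B => (b, chartAt (Cn n) x x))
      (contDiffAt_id.prodMk contDiffAt_const)
    have h2 : DifferentiableAt ℝ (fun b => u b x) b := by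
      have h3 := h1.differentiableAt (by simp)
      simpa only [Function.comp_def, (chartAt (Cn n) x).left_inv (mem_chart_source _ x)] using h3
    exact h2.hasFDerivAt

theorem contDiffOn_charts_of_contMDiff [IsManifold 𝓘(ℝ, Cn n) ∞ K] {u : B → K → ℝ}
    (h : ContMDiff (𝓘(ℝ, B).prod 𝓘(ℝ, Cn n)) 𝓘(ℝ, ℝ) ∞ (fun q : B × K => u q.1 q.2)) (p : K) :
    ContDiffOn ℝ ∞ (fun z : B × Cn n => u z.1 ((chartAt (Cn n) p).symm z.2))
      (Set.univ ×ˢ (chartAt (Cn n) p).target) := by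
  intro z hz
  refine ContDiffAt.contDiffWithinAt (contMDiffAt_iff_contDiffAt.1 ?_)
  have h1 : ContMDiffAt 𝓘(ℝ, B × Cn n) (𝓘(ℝ, B).prod 𝓘(ℝ, Cn n)) ∞
      (fun z : B × Cn n => (z.1, (chartAt (Cn n) p).symm z.2)) z :=
    (contMDiffAt_iff_contDiffAt.2 contDiffAt_fst).prodMk
      (ContMDiffAt.comp z (contMDiffAt_chart_symm hz.2) (contMDiffAt_iff_contDiffAt.2 contDiffAt_snd))
  exact ContMDiffAt.comp (g := fun q : B × K => u q.1 q.2) z (h _) h1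

theorem c1Fam_of_contMDiff [IsManifold 𝓘(ℝ, Cn n) ∞ K] {u : B → K → ℝ}
    (h : ContMDiff (𝓘(ℝ, B).prod 𝓘(ℝ, Cn n)) 𝓘(ℝ, ℝ) ∞ (fun q : B × K => u q.1 q.2)) : C1Fam u :=
  c1Fam_of_charts (contDiffOn_charts_of_contMDiff h)

end C1Fam

section Projection

variable {K : Type*} [TopologicalSpace K] [CompactSpace K] [MeasurableSpace K] [BorelSpace K]
  {μ : Measure K} [IsFiniteMeasure μ] {k : ℕ} {f : Fin k → K → ℝ}

/-- The Gram matrix of functions in `L²(μ)`. -/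
noncomputable def gram (μ : Measure K) (f : Fin k → K → ℝ) : Matrix (Fin k) (Fin k) ℝ :=
  Matrix.of fun i j => ∫ x, f i x * f j x ∂μ

theorem integral_mul_sum (hf : ∀ i, Continuous (f i)) {u : K → ℝ} (hu : Continuous u)
    (c : Fin k → ℝ) :
    ∫ x, u x * ∑ i, c i * f i x ∂μ = ∑ i, c i * ∫ x, u x * f i x ∂μ := by
  simp only [Finset.mul_sum]
  rw [integral_finsetSum _ fun i _ => integrable_of_continuous (by fun_prop)]
  refine Finset.sum_congr rfl fun i _ => ?_
  rw [← integral_const_mul]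
  congr 1
  funext x
  ring

theorem gram_mulVec (hf : ∀ i, Continuous (f i)) (c : Fin k → ℝ) (i : Fin k) :
    (gram μ f).mulVec c i = ∫ x, f i x * ∑ j, c j * f j x ∂μ := by
  rw [integral_mul_sum hf (hf i)]
  simp only [Matrix.mulVec, dotProduct, gram, Matrix.of_apply]
  exact Finset.sum_congr rfl fun j _ => mul_comm _ _

theorem gram_det_ne_zero [μ.IsOpenPosMeasure] (hf : ∀ i, Continuous (f i))
    (hind : ∀ c : Fin k → ℝ, (∀ x, ∑ i, c i * f i x = 0) → c = 0) : (gram μ f).det ≠ 0 := by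
  intro h0
  obtain ⟨c, hc, hc0⟩ := Matrix.exists_mulVec_eq_zero_iff.2 h0
  refine hc (hind c fun x => ?_)
  set g : K → ℝ := fun x => ∑ i, c i * f i x with hg
  have hgc : Continuous g := by fun_prop
  have h1 : ∫ x, g x * g x ∂μ = 0 := by
    have h2 := integral_mul_sum (μ := μ) hf hgc c
    rw [h2]
    refine Finset.sum_eq_zero fun i _ => ?_
    have h3 := gram_mulVec (μ := μ) hf c i
    rw [hc0] at h3
    have h4 : ∫ x, g x * f i x ∂μ = 0 := by
      simp only [mul_comm (g _) (f i _)]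
      exact h3.symm
    rw [h4, mul_zero]
  have h2 := (integral_eq_zero_iff_of_nonneg (fun x => mul_self_nonneg (g x))
    (integrable_of_continuous (hgc.mul hgc))).1 h1
  have h3 := (Continuous.ae_eq_iff_eq μ (hgc.mul hgc) continuous_const).1 h2
  exact mul_self_eq_zero.1 (congrFun h3 x)

/-- The orthogonal projection onto the span of the functions `f i`. -/
theorem exists_projection (hf : ∀ i, Continuous (f i)) (h0 : (gram μ f).det ≠ 0) {σ : K → ℝ}
    (hσ : Continuous σ) : ∃ c : Fin k → ℝ, ∀ d : Fin k → ℝ,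
      ∫ x, (σ x - ∑ i, c i * f i x) * ∑ i, d i * f i x ∂μ = 0 := by
  set s : Fin k → ℝ := fun i => ∫ x, σ x * f i x ∂μ with hs
  refine ⟨(gram μ f)⁻¹.mulVec s, fun d => ?_⟩
  set c := (gram μ f)⁻¹.mulVec s with hc
  have hcs : (gram μ f).mulVec c = s := by
    rw [hc, Matrix.mulVec_mulVec, Matrix.mul_nonsing_inv _ h0.isUnit, Matrix.one_mulVec]
  rw [integral_mul_sum hf (by fun_prop)]
  refine Finset.sum_eq_zero fun i _ => ?_
  simp only [sub_mul]
  rw [integral_sub (integrable_of_continuous (by fun_prop)) (integrable_of_continuous (by fun_prop))]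
  have h1 := congrFun hcs i
  rw [gram_mulVec hf] at h1
  simp only [mul_comm (∑ i, c i * f i _) (f i _), h1, hs, sub_self, mul_zero]

theorem integral_mul_projection (hf : ∀ i, Continuous (f i)) (h0 : (gram μ f).det ≠ 0)
    {σ h : K → ℝ} (hσ : Continuous σ) (hh : Continuous h) {c : Fin k → ℝ}
    (hc : ∀ d : Fin k → ℝ, ∫ x, (σ x - ∑ i, c i * f i x) * ∑ i, d i * f i x ∂μ = 0) :
    ∫ x, h x * ∑ i, c i * f i x ∂μ =
      ∑ i, (gram μ f)⁻¹.mulVec (fun i => ∫ x, σ x * f i x ∂μ) i * ∫ x, h x * f i x ∂μ := by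
  have hcs : (gram μ f).mulVec c = fun i => ∫ x, σ x * f i x ∂μ := by
    funext i
    have h1 := hc (Pi.single i 1)
    simp only [Pi.single_apply, ite_mul, one_mul, zero_mul, Finset.sum_ite_eq', Finset.mem_univ,
      if_true, sub_mul] at h1
    rw [integral_sub (integrable_of_continuous (by fun_prop))
      (integrable_of_continuous (by fun_prop)), sub_eq_zero] at h1
    rw [gram_mulVec hf, h1]
    simp only [mul_comm (f i _)]
  have : c = (gram μ f)⁻¹.mulVec (fun i => ∫ x, σ x * f i x ∂μ) := by
    rw [← hcs, Matrix.mulVec_mulVec, Matrix.nonsing_inv_mul _ h0.isUnit, Matrix.one_mulVec]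
  rw [integral_mul_sum hf hh, ← this]

end Projection

section Constant

variable {n : ℕ} {K : Type*} [TopologicalSpace K] [ChartedSpace (Cn n) K]
  [IsManifold 𝓘(ℝ, Cn n) ∞ K]

theorem exists_eq_const_of_tder_eq_zero [ConnectedSpace K] {f : K → ℝ}
    (hf : ContMDiff 𝓘(ℝ, Cn n) 𝓘(ℝ, ℝ) ∞ f) (h : ∀ x, tder (Cn n) ℝ f x = 0) (x y : K) :
    f x = f y := by
  have hl : IsLocallyConstant f := by
    rw [IsLocallyConstant.iff_eventually_eq]
    intro x
    set c := chartAt (Cn n) x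
    have hx := mem_chart_source (Cn n) x
    obtain ⟨ε, hε, hball⟩ := Metric.isOpen_iff.1 c.open_target (c x) (c.map_source hx)
    have hd : ∀ y ∈ Metric.ball (c x) ε, HasFDerivAt (fun y => f (c.symm y)) (0 : Cn n →L[ℝ] ℝ) y := by
      intro y hy
      have h1 : MDifferentiableAt 𝓘(ℝ, Cn n) 𝓘(ℝ, ℝ) (fun y => f (c.symm y)) y :=
        ((hf _).mdifferentiableAt (by simp)).comp y (mdifferentiableAt_chart_symm (hball hy))
      have h2 := tder_comp (f := c.symm) (g := f) (x := y) ((hf _).mdifferentiableAt (by simp))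
        (mdifferentiableAt_chart_symm (hball hy))
      rw [h, tder_eq_fderiv, ContinuousLinearMap.zero_comp] at h2
      rw [← h2]
      exact (mdifferentiableAt_iff_differentiableAt.1 h1).hasFDerivAt
    filter_upwards [(c.continuousAt hx).eventually (Metric.ball_mem_nhds _ hε),
      c.open_source.mem_nhds hx] with y hy hys
    have h3 := (convex_ball (c x) ε).is_const_of_fderivWithin_eq_zero (𝕜 := ℝ)
      (f := fun y => f (c.symm y)) (fun y hy => (hd y hy).differentiableAt.differentiableWithinAt)
      (fun y hy => (hd y hy).hasFDerivWithinAt.fderivWithin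
        (Metric.isOpen_ball.uniqueDiffWithinAt hy)) hy (Metric.mem_ball_self hε)
    simpa only [c.left_inv hys, c.left_inv hx] using h3
  exact hl.apply_eq_of_preconnectedSpace x y

end Constant

section Family

variable {n : ℕ} {K : Type*} [TopologicalSpace K] [CompactSpace K] [ConnectedSpace K]
  [ChartedSpace (Cn n) K] [IsManifold 𝓘(ℝ, Cn n) ∞ K]

/-- `f` is a smooth hamiltonian of the vector field `Z`: `df = -i_Z α`. -/
def IsHam (α : K → Alt2 n) (Z : K → Cn n) (f : K → ℝ) : Prop :=
  ContMDiff 𝓘(ℝ, Cn n) 𝓘(ℝ, ℝ) ∞ f ∧ ∀ x v, tder (Cn n) ℝ f x v = -α x ![Z x, v]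

theorem tder_add_fun {f g : K → ℝ} (hf : ContMDiff 𝓘(ℝ, Cn n) 𝓘(ℝ, ℝ) ∞ f)
    (hg : ContMDiff 𝓘(ℝ, Cn n) 𝓘(ℝ, ℝ) ∞ g) (x : K) :
    tder (Cn n) ℝ (fun y => f y + g y) x = tder (Cn n) ℝ f x + tder (Cn n) ℝ g x :=
  ((((hf x).mdifferentiableAt (by simp)).hasMFDerivAt).add
    (((hg x).mdifferentiableAt (by simp)).hasMFDerivAt)).mfderiv

theorem tder_const_mul_fun {f : K → ℝ} (hf : ContMDiff 𝓘(ℝ, Cn n) 𝓘(ℝ, ℝ) ∞ f) (c : ℝ) (x : K) :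
    tder (Cn n) ℝ (fun y => c * f y) x = c • tder (Cn n) ℝ f x :=
  (((hf x).mdifferentiableAt (by simp)).hasMFDerivAt.const_smul c).mfderiv

theorem IsHam.add {α : K → Alt2 n} {Z Z' : K → Cn n} {f g : K → ℝ} (hf : IsHam α Z f)
    (hg : IsHam α Z' g) : IsHam α (Z + Z') (fun x => f x + g x) := by
  refine ⟨hf.1.add hg.1, fun x v => ?_⟩
  rw [tder_add_fun hf.1 hg.1, add_apply, hf.2, hg.2, Pi.add_apply, form_add_left]
  ring

theorem IsHam.const_mul {α : K → Alt2 n} {Z : K → Cn n} {f : K → ℝ} (hf : IsHam α Z f) (c : ℝ) :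
    IsHam α (c • Z) (fun x => c * f x) := by
  refine ⟨contMDiff_const.mul hf.1, fun x v => ?_⟩
  rw [tder_const_mul_fun hf.1, smul_apply, hf.2, Pi.smul_apply, form_smul_left, smul_eq_mul]
  ring

theorem isHam_zero (α : K → Alt2 n) (c : ℝ) : IsHam α 0 (fun _ => c) := by
  refine ⟨contMDiff_const, fun x v => ?_⟩
  rw [tder_const, Pi.zero_apply, form_zero_left]
  simp

theorem IsHam.add_const {α : K → Alt2 n} {Z : K → Cn n} {f : K → ℝ} (hf : IsHam α Z f) (c : ℝ) :
    IsHam α Z (fun x => f x + c) := by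
  simpa using hf.add (isHam_zero α c)

theorem IsHam.sum {α : K → Alt2 n} {k : ℕ} {Z : Fin k → K → Cn n} {f : Fin k → K → ℝ}
    (hf : ∀ i, IsHam α (Z i) (f i)) (c : Fin k → ℝ) :
    IsHam α (∑ i, c i • Z i) (fun x => ∑ i, c i * f i x) := by
  classical
  have : ∀ s : Finset (Fin k), IsHam α (∑ i ∈ s, c i • Z i) (fun x => ∑ i ∈ s, c i * f i x) := by
    intro s
    induction s using Finset.induction_on with
    | empty => simpa using isHam_zero α 0
    | insert a s ha ih => simpa only [Finset.sum_insert ha] using ((hf a).const_mul (c a)).add ih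
  exact this _

theorem IsHam.eq_add_const {α : K → Alt2 n} {Z : K → Cn n} {f g : K → ℝ} (hf : IsHam α Z f)
    (hg : IsHam α Z g) (x y : K) : f x - g x = f y - g y := by
  have h1 : IsHam α (Z + (-1 : ℝ) • Z) (fun x => f x + (-1) * g x) := hf.add (hg.const_mul (-1))
  have h2 := exists_eq_const_of_tder_eq_zero h1.1 (fun x => by
    ext v
    rw [h1.2]
    simp [form_zero_left]) x y
  linarith

variable [MeasurableSpace K] [BorelSpace K] {V : Type*} [AddCommGroup V] [Module ℝ V]

/-- The hamiltonians of mean value zero of the fields in the image of `Z`. -/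
def hamPot (α : K → Alt2 n) (Z : V →ₗ[ℝ] (K → Cn n)) : Set (K → ℝ) :=
  {f | (∃ ξ, IsHam α (Z ξ) f) ∧ ∫ x, f x ∂(densVol α) = 0}

variable {B : Type*} [NormedAddCommGroup B] [NormedSpace ℝ B] [FiniteDimensional ℝ B]
  {α : B → K → Alt2 n}

theorem C1Fam.contDiff_integral_densVol (hα : SmoothFamily α) (hn : ∀ b x, IsNondeg (α b x))
    {u : B → K → ℝ} (hu : C1Fam u) : ContDiff ℝ 1 (fun b => ∫ x, u b x ∂(densVol (α b))) := by
  have := isFiniteMeasure_densVol hα hn 0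
  have h1 : C1Fam (densRatio α 0) := c1Fam_of_charts (contDiffOn_densRatio hα hn 0)
  have h2 := (h1.mul hu).contDiff_integral (densVol (α 0))
  simpa only [← integral_densVol hα hn] using h2

theorem densVol_real_univ_pos (hα : SmoothFamily α) (hn : ∀ b x, IsNondeg (α b x)) (b : B) :
    0 < (densVol (α b)).real Set.univ := by
  have := isFiniteMeasure_densVol hα hn b
  have := isOpenPosMeasure_densVol hα hn b
  exact ENNReal.toReal_pos (isOpen_univ.measure_pos _ Set.univ_nonempty).ne' (measure_ne_top _ _)

theorem contDiff_densVol_univ (hα : SmoothFamily α) (hn : ∀ b x, IsNondeg (α b x)) :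
    ContDiff ℝ 1 (fun b => (densVol (α b)).real Set.univ) := by
  have h := (c1Fam_of_continuous (B := B) (K := K) (u := fun _ => (1 : ℝ))
    continuous_const).contDiff_integral_densVol hα hn
  simpa using h

theorem C1Fam.contDiff_average (hα : SmoothFamily α) (hn : ∀ b x, IsNondeg (α b x))
    {u : B → K → ℝ} (hu : C1Fam u) : ContDiff ℝ 1 (fun b => ⨍ x, u b x ∂(densVol (α b))) := by
  simp only [average_eq, smul_eq_mul]
  exact ((contDiff_densVol_univ hα hn).inv fun b => (densVol_real_univ_pos hα hn b).ne').mul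
    (hu.contDiff_integral_densVol hα hn)

theorem contDiff_inv_mulVec {k : ℕ} {A : B → Matrix (Fin k) (Fin k) ℝ} {s : B → Fin k → ℝ}
    (hA : ∀ i j, ContDiff ℝ 1 (fun b => A b i j)) (h0 : ∀ b, (A b).det ≠ 0)
    (hs : ∀ i, ContDiff ℝ 1 (fun b => s b i)) (i : Fin k) :
    ContDiff ℝ 1 (fun b => (A b)⁻¹.mulVec (s b) i) := by
  have hd : ∀ {A : B → Matrix (Fin k) (Fin k) ℝ}, (∀ i j, ContDiff ℝ 1 (fun b => A b i j)) →
      ContDiff ℝ 1 (fun b => (A b).det) := by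
    intro A hA
    simp only [Matrix.det_apply, Units.smul_def, zsmul_eq_mul]
    exact ContDiff.sum fun σ _ => contDiff_const.mul (contDiff_prod fun i _ => hA _ _)
  have hadj : ∀ a b, ContDiff ℝ 1 (fun q => (A q).adjugate a b) := by
    intro a b
    simp only [Matrix.adjugate_apply]
    refine hd fun i j => ?_
    simp only [Matrix.updateRow_apply]
    split_ifs
    · exact contDiff_const
    · exact hA i j
  simp only [Matrix.inv_def, Ring.inverse_eq_inv', Matrix.mulVec, dotProduct, Matrix.smul_apply,
    smul_eq_mul]
  exact ContDiff.sum fun j _ => (((hd hA).inv h0).mul (hadj i j)).mul (hs j)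

variable {Z : V →ₗ[ℝ] (K → Cn n)}

/-- Generators of the hamiltonians of a family of forms. -/
theorem exists_ham_basis [FiniteDimensional ℝ V] (hα : SmoothFamily α)
    (hn : ∀ b x, IsNondeg (α b x))
    (hpot : ∀ ξ b₀ f₀, IsHam (α b₀) (Z ξ) f₀ →
      ∃ f : B → K → ℝ, C1Fam f ∧ ∀ b, IsHam (α b) (Z ξ) (f b)) :
    ∃ (k : ℕ) (f : Fin k → B → K → ℝ), (∀ i, C1Fam (f i)) ∧
      (∀ b g, g ∈ hamPot (α b) Z ↔ ∃ c : Fin k → ℝ, g = fun x => ∑ i, c i * f i b x) ∧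
      (∀ b (c : Fin k → ℝ), (∀ x, ∑ i, c i * f i b x = 0) → c = 0) ∧
      (∀ b i, ∫ x, f i b x ∂(densVol (α b)) = 0) := by
  let R : Submodule ℝ (K → Cn n) :=
    { carrier := {z | ∃ ξ, Z ξ = z ∧ ∃ f : B → K → ℝ, C1Fam f ∧ ∀ b, IsHam (α b) z (f b)}
      add_mem' := by
        rintro _ _ ⟨ξ, rfl, f, hf, hf'⟩ ⟨ζ, rfl, g, hg, hg'⟩
        exact ⟨ξ + ζ, map_add _ _ _, _, hf.add hg, fun b => (hf' b).add (hg' b)⟩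
      zero_mem' := ⟨0, map_zero _, fun _ _ => 0, c1Fam_of_continuous continuous_const,
        fun b => isHam_zero _ 0⟩
      smul_mem' := by
        rintro c _ ⟨ξ, rfl, f, hf, hf'⟩
        exact ⟨c • ξ, map_smul _ _ _, _,
          (c1Fam_of_continuous (continuous_const (y := c))).mul hf, fun b => (hf' b).const_mul c⟩ }
  have hfin : FiniteDimensional ℝ R := by
    have : R ≤ LinearMap.range Z := by
      rintro _ ⟨ξ, rfl, -⟩
      exact ⟨ξ, rfl⟩
    exact Submodule.finiteDimensional_of_le this
  set e := Module.finBasis ℝ R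
  choose ξ hξ f hf hham using fun i => (e i).2
  have hvol := fun b => densVol_real_univ_pos hα hn b
  have hfinm := fun b => isFiniteMeasure_densVol hα hn b
  set g : Fin (Module.finrank ℝ R) → B → K → ℝ := fun i b x =>
    f i b x - ⨍ y, f i b y ∂(densVol (α b)) with hg
  have hgc : ∀ i, C1Fam (g i) := fun i =>
    (hf i).sub (c1Fam_of_contDiff ((hf i).contDiff_average hα hn))
  have hgh : ∀ i b, IsHam (α b) (e i : K → Cn n) (g i b) := fun i b => by
    simpa only [hg, sub_eq_add_neg] using (hham i b).add_const _
  have hmean : ∀ b (u : K → ℝ), Continuous u →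
      ∫ x, (u x - ⨍ y, u y ∂(densVol (α b))) ∂(densVol (α b)) = 0 := fun b u hu => by
    have := hfinm b
    exact integral_sub_average _ _
  have hg0 : ∀ b i, ∫ x, g i b x ∂(densVol (α b)) = 0 := fun b i =>
    hmean b _ ((hf i).continuous b)
  refine ⟨_, g, hgc, fun b u => ⟨?_, ?_⟩, fun b c hc => ?_, hg0⟩
  · rintro ⟨⟨ζ, hζ⟩, hu⟩
    obtain ⟨q, hq, hq'⟩ := hpot ζ b u hζ
    set z : R := ⟨Z ζ, ζ, rfl, q, hq, hq'⟩
    refine ⟨fun i => e.repr z i, ?_⟩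
    have h1 := IsHam.sum (hgh · b) fun i => e.repr z i
    have h2 : ∑ i, e.repr z i • (e i : K → Cn n) = Z ζ := by
      have := congrArg Subtype.val (e.sum_repr z)
      rwa [Submodule.coe_sum] at this
    rw [h2] at h1
    obtain ⟨x₀⟩ : Nonempty K := inferInstance
    have h3 : ∀ x, u x = (∑ i, e.repr z i * g i b x) + (u x₀ - ∑ i, e.repr z i * g i b x₀) :=
      fun x => by have := hζ.eq_add_const h1 x x₀; linarith
    set C := u x₀ - ∑ i, e.repr z i * g i b x₀ with hC
    have h4 : C = 0 := by
      have := hfinm b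
      have h5 : ∫ x, u x ∂(densVol (α b)) = C * (densVol (α b)).real Set.univ := by
        simp only [h3]
        rw [integral_add (integrable_of_continuous h1.1.continuous) (integrable_const _)]
        have h6 := integral_mul_sum (μ := densVol (α b)) (f := fun i => g i b)
          (fun i => (hgc i).continuous b) (u := fun _ => 1) continuous_const (fun i => e.repr z i)
        simp only [one_mul, hg0, mul_zero, Finset.sum_const_zero] at h6
        rw [h6, zero_add, integral_const, smul_eq_mul, mul_comm]
      rw [hu] at h5
      exact (mul_eq_zero.1 h5.symm).resolve_right (hvol b).ne'
    funext x
    rw [h3 x, h4, add_zero]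
  · rintro ⟨c, rfl⟩
    have h1 := IsHam.sum (hgh · b) c
    refine ⟨⟨∑ i, c i • ξ i, ?_⟩, ?_⟩
    · rw [map_sum]
      simpa only [map_smul, hξ] using h1
    · have := hfinm b
      have h6 := integral_mul_sum (μ := densVol (α b)) (f := fun i => g i b)
        (fun i => (hgc i).continuous b) (u := fun _ => 1) continuous_const c
      simpa only [one_mul, hg0, mul_zero, Finset.sum_const_zero] using h6
  · have h1 := IsHam.sum (hgh · b) c
    have h2 : ∑ i, c i • (e i : K → Cn n) = 0 := by
      funext x
      refine hn b x _ fun w => ?_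
      have h3 := h1.2 x w
      have h4 : (fun x => ∑ i, c i * g i b x) = fun _ => 0 := funext hc
      rw [h4, tder_const] at h3
      have : (0 : ℝ) = -α b x ![(∑ i, c i • (e i : K → Cn n)) x, w] := h3
      linarith
    have h5 : ∑ i, c i • e i = 0 := Subtype.ext (by simpa using h2)
    exact funext (Fintype.linearIndependent_iff.1 e.linearIndependent c h5)

/-- The integrals against the component of `σ b` orthogonal to the constants and to the hamiltonians
of the form `α b` depend differentiably on `b`. -/
theorem exists_reduced_integral [FiniteDimensional ℝ V] (hα : SmoothFamily α)
    (hn : ∀ b x, IsNondeg (α b x))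
    (hpot : ∀ ξ b₀ f₀, IsHam (α b₀) (Z ξ) f₀ →
      ∃ f : B → K → ℝ, C1Fam f ∧ ∀ b, IsHam (α b) (Z ξ) (f b))
    {σ h : B → K → ℝ} (hσ : C1Fam σ) (hh : C1Fam h) :
    ∃ Φ : B → ℝ, ContDiff ℝ 1 Φ ∧ ∀ b,
      (∃ p ∈ hamPot (α b) Z, ∀ f ∈ hamPot (α b) Z,
        ∫ x, (σ b x - p x) * f x ∂(densVol (α b)) = 0) ∧
      ∀ p ∈ hamPot (α b) Z, (∀ f ∈ hamPot (α b) Z,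
        ∫ x, (σ b x - p x) * f x ∂(densVol (α b)) = 0) →
        ∫ x, h b x * (σ b x - (⨍ y, σ b y ∂(densVol (α b))) - p x) ∂(densVol (α b)) = Φ b := by
  obtain ⟨k, f, hf, hmem, hind, hf0⟩ := exists_ham_basis hα hn hpot
  have hfinm := fun b => isFiniteMeasure_densVol hα hn b
  have hopen := fun b => isOpenPosMeasure_densVol hα hn b
  have hfc : ∀ b i, Continuous (f i b) := fun b i => (hf i).continuous b
  have hdet : ∀ b, (gram (densVol (α b)) fun i => f i b).det ≠ 0 := fun b =>
    gram_det_ne_zero (hfc b) (hind b)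
  refine ⟨fun b => (∫ x, h b x * σ b x ∂(densVol (α b)))
    - (⨍ y, σ b y ∂(densVol (α b))) * (∫ x, h b x ∂(densVol (α b)))
    - ∑ i, (gram (densVol (α b)) fun i => f i b)⁻¹.mulVec
        (fun i => ∫ x, σ b x * f i b x ∂(densVol (α b))) i *
          ∫ x, h b x * f i b x ∂(densVol (α b)), ?_, fun b => ⟨?_, ?_⟩⟩
  · refine (((hh.mul hσ).contDiff_integral_densVol hα hn).sub ((hσ.contDiff_average hα hn).mul
      (hh.contDiff_integral_densVol hα hn))).sub (ContDiff.sum fun i _ => ?_)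
    exact (contDiff_inv_mulVec (fun i j => ((hf i).mul (hf j)).contDiff_integral_densVol hα hn)
      hdet (fun i => (hσ.mul (hf i)).contDiff_integral_densVol hα hn) i).mul
        ((hh.mul (hf i)).contDiff_integral_densVol hα hn)
  · obtain ⟨c, hc⟩ := exists_projection (hfc b) (hdet b) (hσ.continuous b)
    refine ⟨_, (hmem b _).2 ⟨c, rfl⟩, fun g hg => ?_⟩
    obtain ⟨d, rfl⟩ := (hmem b g).1 hg
    exact hc d
  · intro p hp hpf
    obtain ⟨c, rfl⟩ := (hmem b p).1 hp
    have hh' := hh.continuous b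
    have hσ' := hσ.continuous b
    have hfb := hfc b
    beta_reduce
    rw [← integral_mul_projection (hfc b) (hdet b) hσ' hh'
      fun d => hpf _ ((hmem b _).2 ⟨d, rfl⟩), ← integral_const_mul,
      ← integral_sub (integrable_of_continuous (by fun_prop))
        (integrable_of_continuous (by fun_prop)),
      ← integral_sub (integrable_of_continuous (by fun_prop))
        (integrable_of_continuous (by fun_prop))]
    congr 1
    funext x
    ring

end Family

section ChartDerivative

variable {E E' : Type*} [NormedAddCommGroup E] [NormedSpace ℝ E] [NormedAddCommGroup E']
  [NormedSpace ℝ E'] {X : Type*} [TopologicalSpace X] [ChartedSpace E X]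

theorem tder_eq_fderiv_chart {f : X → E'} {x : X} (hf : MDifferentiableAt 𝓘(ℝ, E) 𝓘(ℝ, E') f x) :
    tder E E' f x = fderiv ℝ (fun y => f ((chartAt E x).symm y)) (chartAt E x x) := by
  have h : HasFDerivWithinAt (fun y => f ((chartAt E x).symm y)) (tder E E' f x) (Set.range id)
    (chartAt E x x) := hf.hasMFDerivAt.2
  rw [Set.range_id, hasFDerivWithinAt_univ] at h
  exact h.fderiv.symm

theorem contMDiff_of_charts {n : ℕ} {K : Type*} [TopologicalSpace K] [ChartedSpace (Cn n) K]
    [IsManifold 𝓘(ℝ, Cn n) ∞ K] {f : K → ℝ}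
    (h : ∀ p : K, ContDiffOn ℝ ∞ (fun y => f ((chartAt (Cn n) p).symm y)) (chartAt (Cn n) p).target) :
    ContMDiff 𝓘(ℝ, Cn n) 𝓘(ℝ, ℝ) ∞ f := by
  intro x
  have h1 := ((h x).contDiffAt ((chartAt (Cn n) x).open_target.mem_nhds (mem_chart_target _ x)))
  refine ((contMDiffAt_iff_contDiffAt.2 h1).comp x
    (contMDiffAt_chart (mem_chart_source _ x))).congr_of_eventuallyEq ?_
  filter_upwards [(chartAt (Cn n) x).open_source.mem_nhds (mem_chart_source _ x)] with y hy
  simp only [Function.comp_apply, (chartAt (Cn n) x).left_inv hy]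

end ChartDerivative

section Mixed

variable {W E F : Type*} [NormedAddCommGroup W] [NormedSpace ℝ W] [NormedAddCommGroup E]
  [NormedSpace ℝ E] [NormedAddCommGroup F] [NormedSpace ℝ F]

theorem fderiv_slice_fst {Q : W × E → F} {z : W × E} (h : DifferentiableAt ℝ Q z) (v : W) :
    fderiv ℝ (fun y => Q (y, z.2)) z.1 v = fderiv ℝ Q z (v, 0) := by
  have h1 := h.hasFDerivAt.comp z.1 (f := fun y => (y, z.2)) (hasFDerivAt_prodMk_left z.1 z.2)
  have h2 := h1.fderiv
  change fderiv ℝ (Q ∘ fun y => (y, z.2)) z.1 v = _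
  rw [h2]
  rfl

theorem fderiv_slice_snd {Q : W × E → F} {z : W × E} (h : DifferentiableAt ℝ Q z) (v : E) :
    fderiv ℝ (fun y => Q (z.1, y)) z.2 v = fderiv ℝ Q z (0, v) := by
  have h1 := h.hasFDerivAt.comp z.2 (f := fun y => (z.1, y)) (hasFDerivAt_prodMk_right z.1 z.2)
  have h2 := h1.fderiv
  change fderiv ℝ (Q ∘ fun y => (z.1, y)) z.2 v = _
  rw [h2]
  rfl

theorem fderiv_mixed {Q : W × E → F} {y : W} {s : E} (hQ : ContDiffAt ℝ 2 Q (y, s)) (v : W) (ξ : E) :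
    fderiv ℝ (fun y' => fderiv ℝ Q (y', s) (0, ξ)) y v =
      fderiv ℝ (fun z => fderiv ℝ Q z (v, 0)) (y, s) (0, ξ) := by
  have hd : DifferentiableAt ℝ (fderiv ℝ Q) (y, s) :=
    (hQ.fderiv_right (m := 1) (by norm_num)).differentiableAt (by simp)
  have e : ∀ a : W × E, fderiv ℝ (fun z => fderiv ℝ Q z a) (y, s) =
      (fderiv ℝ (fderiv ℝ Q) (y, s)).flip a := fun a => by
    rw [fderiv_clm_apply hd (differentiableAt_const a)]
    simp
  have h1 := fderiv_slice_fst (Q := fun z => fderiv ℝ Q z (0, ξ)) (z := (y, s))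
    (hd.clm_apply (differentiableAt_const _)) v
  have hsym : IsSymmSndFDerivAt ℝ Q (y, s) := hQ.isSymmSndFDerivAt (by simp)
  have h2 : fderiv ℝ (fun y' => fderiv ℝ Q (y', s) (0, ξ)) y v =
      fderiv ℝ (fun z => fderiv ℝ Q z (0, ξ)) (y, s) (v, 0) := h1
  rw [h2, e, e]
  exact hsym.eq _ _

theorem fderiv_mixed_equivariant {Q : W × E → F} {y : W} {s : E} (hQ : ContDiffAt ℝ 2 Q (y, s))
    (L : F →L[ℝ] F) {v w : W} (hL : ∀ᶠ z in 𝓝 (y, s), fderiv ℝ Q z (w, 0) = L (fderiv ℝ Q z (v, 0)))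
    (ξ : E) : fderiv ℝ (fun y' => fderiv ℝ Q (y', s) (0, ξ)) y w =
      L (fderiv ℝ (fun y' => fderiv ℝ Q (y', s) (0, ξ)) y v) := by
  have hd : DifferentiableAt ℝ (fderiv ℝ Q) (y, s) :=
    (hQ.fderiv_right (m := 1) (by norm_num)).differentiableAt (by simp)
  rw [fderiv_mixed hQ, fderiv_mixed hQ, Filter.EventuallyEq.fderiv_eq hL]
  have h1 := (L.hasFDerivAt.comp (y, s) (hd.clm_apply (differentiableAt_const (v, 0))).hasFDerivAt).fderiv
  change fderiv ℝ (L ∘ fun z => fderiv ℝ Q z (v, 0)) (y, s) (0, ξ) = _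
  rw [h1]
  rfl

/-- `d(dφ(Jζ)) = i_ζ d dᶜ φ` for a holomorphic vector field `ζ` that preserves `φ`. -/
theorem fderiv_dc_field {n : ℕ} {φ : Cn n → ℝ} {ζ : Cn n → Cn n} {y : Cn n}
    (hφ : ContDiffAt ℝ 2 φ y) (hζ : DifferentiableAt ℝ ζ y)
    (hJ : ∀ v, fderiv ℝ ζ y (J n v) = J n (fderiv ℝ ζ y v))
    (h0 : ∀ᶠ z in 𝓝 y, fderiv ℝ φ z (ζ z) = 0) (v : Cn n) :
    fderiv ℝ (fun z => fderiv ℝ φ z (J n (ζ z))) y v = ddcLocal φ y ![ζ y, v] := by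
  have hd : DifferentiableAt ℝ (fderiv ℝ φ) y :=
    (hφ.fderiv_right (m := 1) (by norm_num)).differentiableAt (by simp)
  have hsym : IsSymmSndFDerivAt ℝ φ y := hφ.isSymmSndFDerivAt (by simp)
  have h1 : fderiv ℝ (fun z => fderiv ℝ φ z (ζ z)) y (J n v) = 0 := by
    rw [Filter.EventuallyEq.fderiv_eq (f := fun _ => (0 : ℝ)) h0]
    simp
  rw [fderiv_clm_apply hd hζ] at h1
  have hJζ : HasFDerivAt (fun z => J n (ζ z)) ((J n).comp (fderiv ℝ ζ y)) y :=
    (J n).hasFDerivAt.comp y hζ.hasFDerivAt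
  rw [fderiv_clm_apply hd hJζ.differentiableAt, hJζ.fderiv, ddcLocal_apply hφ]
  simp only [add_apply, ContinuousLinearMap.comp_apply, ContinuousLinearMap.flip_apply, hJ] at h1 ⊢
  rw [hsym.eq (ζ y) (J n v)]
  linarith

end Mixed

section FundamentalField

variable {n : ℕ} {EG : Type*} [NormedAddCommGroup EG] [NormedSpace ℝ EG]
  {G : Type*} [TopologicalSpace G] [ChartedSpace EG G] [Group G]
  {X : Type*} [TopologicalSpace X] [ChartedSpace (Cn n) X] [MulAction G X]

variable (n EG G X) in
/-- The vector fields induced by the Lie algebra, as a linear map. -/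
noncomputable def fundLin : EG →ₗ[ℝ] (X → Cn n) where
  toFun ξ x := tder EG (Cn n) (fun g : G => g • x) 1 ξ
  map_add' ξ ζ := by funext x; exact map_add _ _ _
  map_smul' c ξ := by funext x; exact map_smul _ _ _

/-- The coordinate expression of a vector field in the chart at `p`. -/
noncomputable def fieldRep (Z : X → Cn n) (p : X) (y : Cn n) : Cn n :=
  tder (Cn n) (Cn n) (chartAt (Cn n) p) ((chartAt (Cn n) p).symm y) (Z ((chartAt (Cn n) p).symm y))

theorem fieldRep_self [IsManifold 𝓘(ℝ, Cn n) ∞ X] (Z : X → Cn n) (x : X) :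
    fieldRep Z x (chartAt (Cn n) x x) = Z x := by
  rw [fieldRep, (chartAt (Cn n) x).left_inv (mem_chart_source _ x), tder_chart_self]
  rfl

variable [IsManifold 𝓘(ℝ, EG) ∞ G]

theorem contMDiffAt_chart_symm_group {s : EG} (hs : s ∈ (chartAt EG (1 : G)).target) :
    ContMDiffAt 𝓘(ℝ, EG) 𝓘(ℝ, EG) ∞ (chartAt EG (1 : G)).symm s :=
  contMDiffOn_chart_symm.contMDiffAt ((chartAt EG (1 : G)).open_target.mem_nhds hs)

section Real

variable [IsManifold 𝓘(ℝ, Cn n) ∞ X]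

/-- The action near `1 ∈ G` in coordinates. -/
noncomputable def actionRep (EG G : Type*) [NormedAddCommGroup EG] [NormedSpace ℝ EG]
    [TopologicalSpace G] [ChartedSpace EG G] [Group G] [MulAction G X] (p : X)
    (q : Cn n × EG) : Cn n :=
  chartAt (Cn n) p ((chartAt EG (1 : G)).symm q.2 • (chartAt (Cn n) p).symm q.1)

theorem actionRep_eventually (hG : ContMDiff (𝓘(ℝ, EG).prod 𝓘(ℝ, Cn n)) 𝓘(ℝ, Cn n) ∞
    (fun q : G × X => q.1 • q.2)) {p : X} {y : Cn n} (hy : y ∈ (chartAt (Cn n) p).target) :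
    ∀ᶠ q in 𝓝 (y, chartAt EG (1 : G) 1), q.1 ∈ (chartAt (Cn n) p).target ∧
      q.2 ∈ (chartAt EG (1 : G)).target ∧
      (chartAt EG (1 : G)).symm q.2 • (chartAt (Cn n) p).symm q.1 ∈ (chartAt (Cn n) p).source := by
  have h1 : ContinuousAt (fun q : Cn n × EG =>
      (chartAt EG (1 : G)).symm q.2 • (chartAt (Cn n) p).symm q.1) (y, chartAt EG (1 : G) 1) := by
    have h2 : ContinuousAt (fun q : Cn n × EG =>
        ((chartAt EG (1 : G)).symm q.2, (chartAt (Cn n) p).symm q.1)) (y, chartAt EG (1 : G) 1) :=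
      (ContinuousAt.comp (f := Prod.snd)
        ((chartAt EG (1 : G)).continuousAt_symm (mem_chart_target _ _)) continuousAt_snd).prodMk
      (ContinuousAt.comp (f := Prod.fst) ((chartAt (Cn n) p).continuousAt_symm hy) continuousAt_fst)
    exact ContinuousAt.comp (g := fun q : G × X => q.1 • q.2) hG.continuous.continuousAt h2
  refine (continuousAt_fst.eventually ((chartAt (Cn n) p).open_target.mem_nhds hy)).and
    ((continuousAt_snd.eventually ((chartAt EG (1 : G)).open_target.mem_nhds
      (mem_chart_target _ _))).and (h1.eventually ((chartAt (Cn n) p).open_source.mem_nhds ?_)))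
  simp only [(chartAt EG (1 : G)).left_inv (mem_chart_source _ _), one_smul]
  exact (chartAt (Cn n) p).map_target hy

theorem contDiffAt_actionRep (hG : ContMDiff (𝓘(ℝ, EG).prod 𝓘(ℝ, Cn n)) 𝓘(ℝ, Cn n) ∞
    (fun q : G × X => q.1 • q.2)) {p : X} {q : Cn n × EG}
    (h1 : q.1 ∈ (chartAt (Cn n) p).target) (h2 : q.2 ∈ (chartAt EG (1 : G)).target)
    (h3 : (chartAt EG (1 : G)).symm q.2 • (chartAt (Cn n) p).symm q.1 ∈
      (chartAt (Cn n) p).source) :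
    ContDiffAt ℝ ∞ (actionRep EG G p) q := by
  refine contMDiffAt_iff_contDiffAt.1 ?_
  have h4 : ContMDiffAt 𝓘(ℝ, Cn n × EG) (𝓘(ℝ, EG).prod 𝓘(ℝ, Cn n)) ∞
      (fun q : Cn n × EG => ((chartAt EG (1 : G)).symm q.2, (chartAt (Cn n) p).symm q.1)) q :=
    (ContMDiffAt.comp q (contMDiffAt_chart_symm_group h2)
      (contMDiffAt_iff_contDiffAt.2 contDiffAt_snd)).prodMk
    (ContMDiffAt.comp q (contMDiffAt_chart_symm h1) (contMDiffAt_iff_contDiffAt.2 contDiffAt_fst))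
  exact ContMDiffAt.comp (g := chartAt (Cn n) p) q (contMDiffAt_chart h3)
    (ContMDiffAt.comp (g := fun q : G × X => q.1 • q.2) q (hG _) h4)

theorem fieldRep_fundLin_eq (hG : ContMDiff (𝓘(ℝ, EG).prod 𝓘(ℝ, Cn n)) 𝓘(ℝ, Cn n) ∞
    (fun q : G × X => q.1 • q.2)) (ξ : EG) {p : X} {y : Cn n} (hy : y ∈ (chartAt (Cn n) p).target) :
    fieldRep (fundLin n EG G X ξ) p y =
      fderiv ℝ (actionRep EG G p) (y, chartAt EG (1 : G) 1) (0, ξ) := by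
  set x := (chartAt (Cn n) p).symm y with hx
  have hxs : x ∈ (chartAt (Cn n) p).source := (chartAt (Cn n) p).map_target hy
  have ha : MDifferentiableAt 𝓘(ℝ, EG) 𝓘(ℝ, Cn n) (fun g : G => g • x) 1 :=
    (ContMDiffAt.comp (g := fun q : G × X => q.1 • q.2) (1 : G) (hG _)
      (contMDiffAt_id.prodMk contMDiffAt_const)).mdifferentiableAt (by simp)
  have hc : MDifferentiableAt 𝓘(ℝ, Cn n) 𝓘(ℝ, Cn n) (chartAt (Cn n) p) ((1 : G) • x) := by
    rw [one_smul]; exact mdifferentiableAt_chart hxs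
  have h1 := tder_comp_apply (g := chartAt (Cn n) p) (f := fun g : G => g • x) hc ha ξ
  rw [tder_eq_fderiv_chart (f := fun g : G => chartAt (Cn n) p (g • x))
    (MDifferentiableAt.comp (g := chartAt (Cn n) p) _ hc ha), one_smul] at h1
  have h2 := (actionRep_eventually hG hy).self_of_nhds
  have h3 := fderiv_slice_snd (Q := actionRep EG G p) (z := (y, chartAt EG (1 : G) 1))
    ((contDiffAt_actionRep hG h2.1 h2.2.1 h2.2.2).differentiableAt (by simp)) ξ
  rw [← h3]
  exact h1.symm

theorem contDiffAt_fieldRep_fundLin (hG : ContMDiff (𝓘(ℝ, EG).prod 𝓘(ℝ, Cn n)) 𝓘(ℝ, Cn n) ∞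
    (fun q : G × X => q.1 • q.2)) (ξ : EG) {p : X} {y : Cn n} (hy : y ∈ (chartAt (Cn n) p).target) :
    ContDiffAt ℝ ∞ (fieldRep (fundLin n EG G X ξ) p) y := by
  have h2 := (actionRep_eventually hG hy).self_of_nhds
  have h3 := contDiffAt_actionRep hG h2.1 h2.2.1 h2.2.2
  have h4 : ContDiffAt ℝ ∞ (fun q => fderiv ℝ (actionRep EG G p) q (0, ξ))
      (y, chartAt EG (1 : G) 1) := (h3.fderiv_right (m := ∞) (by simp)).clm_apply contDiffAt_const
  refine (ContDiffAt.comp (f := fun y : Cn n => (y, chartAt EG (1 : G) 1)) y h4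
    (contDiffAt_id.prodMk contDiffAt_const)).congr_of_eventuallyEq ?_
  filter_upwards [(chartAt (Cn n) p).open_target.mem_nhds hy] with y' hy'
  exact fieldRep_fundLin_eq hG ξ hy'

/-- Invariant functions are constant along the fields of the Lie algebra. -/
theorem tder_fundLin_eq_zero (hG : ContMDiff (𝓘(ℝ, EG).prod 𝓘(ℝ, Cn n)) 𝓘(ℝ, Cn n) ∞
    (fun q : G × X => q.1 • q.2)) {φ : X → ℝ} (hφ : IsInvSmooth n G φ) (ξ : EG) (x : X) :
    tder (Cn n) ℝ φ x (fundLin n EG G X ξ x) = 0 := by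
  have ha : MDifferentiableAt 𝓘(ℝ, EG) 𝓘(ℝ, Cn n) (fun g : G => g • x) 1 :=
    (ContMDiffAt.comp (g := fun q : G × X => q.1 • q.2) (1 : G) (hG _)
      (contMDiffAt_id.prodMk contMDiffAt_const)).mdifferentiableAt (by simp)
  have h1 := tder_comp_apply (g := φ) (f := fun g : G => g • x)
    ((hφ.1 _).mdifferentiableAt (by simp)) ha ξ
  simp only [hφ.2] at h1
  rw [tder_const, one_smul] at h1
  exact h1.symm

end Real

variable [IsManifold 𝓘(ℂ, Cn n) ω X]

theorem fderiv_fieldRep_J (hG : ContMDiff (𝓘(ℝ, EG).prod 𝓘(ℝ, Cn n)) 𝓘(ℝ, Cn n) ∞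
    (fun q : G × X => q.1 • q.2))
    (hGh : ∀ g : G, ContMDiff 𝓘(ℂ, Cn n) 𝓘(ℂ, Cn n) ω (fun x : X => g • x)) (ξ : EG) {p : X}
    {y : Cn n} (hy : y ∈ (chartAt (Cn n) p).target) (v : Cn n) :
    fderiv ℝ (fieldRep (fundLin n EG G X ξ) p) y (J n v) =
      J n (fderiv ℝ (fieldRep (fundLin n EG G X ξ) p) y v) := by
  have h2 := actionRep_eventually hG hy
  have h3 := contDiffAt_actionRep hG h2.self_of_nhds.1 h2.self_of_nhds.2.1 h2.self_of_nhds.2.2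
  have h4 : fieldRep (fundLin n EG G X ξ) p =ᶠ[𝓝 y] fun y' =>
      fderiv ℝ (actionRep EG G p) (y', chartAt EG (1 : G) 1) (0, ξ) := by
    filter_upwards [(chartAt (Cn n) p).open_target.mem_nhds hy] with y' hy'
    exact fieldRep_fundLin_eq hG ξ hy'
  rw [h4.fderiv_eq]
  refine fderiv_mixed_equivariant (h3.of_le (by norm_cast)) (J n) ?_ ξ
  filter_upwards [h2] with q ⟨q1, q2, q3⟩
  have hd := (contDiffAt_actionRep hG q1 q2 q3).differentiableAt (n := ∞) (by simp)
  rw [← fderiv_slice_fst hd, ← fderiv_slice_fst hd, ← tder_eq_fderiv]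
  refine tder_J ?_ v
  exact ((contMDiffAt_chart_complex q3).comp q.1
    ((hGh _ _).comp q.1 (contMDiffAt_chart_symm_complex q1))).mdifferentiableAt (by simp)

end FundamentalField

section ScalFamily

variable {n : ℕ} {X : Type*} [TopologicalSpace X] [ChartedSpace (Cn n) X]
  [IsManifold 𝓘(ℂ, Cn n) ω X]
  {B : Type*} [NormedAddCommGroup B] [NormedSpace ℝ B]

/-- The scalar curvature may be computed in any chart. -/
theorem scal_eq_localScal_chart {η : X → Alt2 n} (hpos : ∀ x, IsPositiveForm (η x)) {p : X}
    {y : Cn n} (hy : y ∈ (chartAt (Cn n) p).target)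
    (hη : ∀ v w, ContDiffAt ℝ ∞ (fun z => localRep η p z ![v, w]) y) :
    scal η ((chartAt (Cn n) p).symm y) = localScal (localRep η p) y := by
  set x := (chartAt (Cn n) p).symm y with hx
  have hxp : x ∈ (chartAt (Cn n) p).source := (chartAt (Cn n) p).map_target hy
  have hxx := mem_chart_source (Cn n) x
  set τ : Cn n → Cn n := fun z => chartAt (Cn n) p ((chartAt (Cn n) x).symm z) with hτ
  have hxs : (chartAt (Cn n) x).symm (chartAt (Cn n) x x) = x := (chartAt (Cn n) x).left_inv hxx
  have hτy : τ (chartAt (Cn n) x x) = y := by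
    simp only [hτ, hxs]
    exact (chartAt (Cn n) p).right_inv hy
  have hτc : ContDiffAt ℂ ω τ (chartAt (Cn n) x x) :=
    contDiffAt_transition (mem_chart_target _ x) (by rw [hxs]; exact hxp)
  have hloc : localRep η x =ᶠ[𝓝 (chartAt (Cn n) x x)] fun z =>
      (localRep η p (τ z)).compContinuousLinearMap (fderiv ℝ τ z) := by
    have h1 : ∀ᶠ z in 𝓝 (chartAt (Cn n) x x),
        (chartAt (Cn n) x).symm z ∈ (chartAt (Cn n) p).source :=
      ((chartAt (Cn n) x).continuousAt_symm (mem_chart_target _ x)).eventually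
        ((chartAt (Cn n) p).open_source.mem_nhds (by rw [hxs]; exact hxp))
    filter_upwards [h1, (chartAt (Cn n) x).open_target.mem_nhds (mem_chart_target _ x)] with z h1 h2
    refine alt2_ext fun v w => ?_
    have h3 := tder_comp (f := (chartAt (Cn n) x).symm) (g := chartAt (Cn n) p) (x := z)
      (mdifferentiableAt_chart h1) (mdifferentiableAt_chart_symm h2)
    rw [tder_eq_fderiv] at h3
    rw [localRep_apply, form_eq_localRep η h1, form_comp_apply, h3]
    rfl
  rw [scal_eq_localScal, localScal_congr hloc, localScal_comp (by rw [hτy]; exact hη) ?_ hτc ?_, hτy]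
  · rw [hτy]
    filter_upwards [(chartAt (Cn n) p).open_target.mem_nhds hy] with z hz
    exact localRep_positive hpos p hz
  · have h1 : Function.Injective (fderiv ℝ τ (chartAt (Cn n) x x)) := by
      have h3 := tder_comp (f := (chartAt (Cn n) x).symm) (g := chartAt (Cn n) p)
        (x := chartAt (Cn n) x x) (by rw [hxs]; exact mdifferentiableAt_chart hxp)
        (mdifferentiableAt_chart_symm (mem_chart_target _ x))
      rw [tder_eq_fderiv, tder_chart_symm_self, hxs] at h3
      rw [hτ, h3]
      exact Function.LeftInverse.injective fun v => tder_chart_symm_tder_chart hxp v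
    rw [(hτc.differentiableAt (n := ω) (by simp)).fderiv_restrictScalars ℝ] at h1
    exact h1

theorem c1Fam_scal {η : B → X → Alt2 n} (hη : SmoothFamily η)
    (hpos : ∀ b x, IsPositiveForm (η b x)) : C1Fam (fun b => scal (η b)) := by
  refine c1Fam_of_charts (n := n) fun p z hz => ?_
  have hopen := (isOpen_univ (X := B)).prod (chartAt (Cn n) p).open_target
  have hat : ∀ z ∈ Set.univ ×ˢ (chartAt (Cn n) p).target, ∀ v w, ContDiffAt ℝ ∞
      (fun z : B × Cn n => localRep (η z.1) p z.2 ![v, w]) z := fun z hz v w =>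
    (hη p v w).contDiffAt (hopen.mem_nhds hz)
  have h1 : ContDiffAt ℝ ∞ (fun z : B × Cn n => localScal (localRep (η z.1) p) z.2) z :=
    contDiffAt_localScal_family (β := fun b => localRep (η b) p) (hat z hz)
      (localRep_positive (hpos _) p hz.2)
  refine (h1.congr_of_eventuallyEq ?_).contDiffWithinAt
  filter_upwards [hopen.mem_nhds hz] with q hq
  refine scal_eq_localScal_chart (hpos q.1) hq.2 fun v w => ?_
  exact ContDiffAt.comp (f := fun y : Cn n => (q.1, y)) q.2 (hat q hq v w)
    (contDiffAt_const.prodMk contDiffAt_id)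

end ScalFamily

section Reduced

variable {n : ℕ} {EG : Type*} [NormedAddCommGroup EG] [NormedSpace ℝ EG]
  {G : Type*} [TopologicalSpace G] [ChartedSpace EG G] [Group G]
  {X : Type*} [TopologicalSpace X] [CompactSpace X] [ConnectedSpace X] [ChartedSpace (Cn n) X]
  [IsManifold 𝓘(ℂ, Cn n) ω X] [MeasurableSpace X] [BorelSpace X] [MulAction G X]

theorem killingPotentials_eq_hamPot {η : X → Alt2 n} (hpos : ∀ x, IsPositiveForm (η x)) :
    killingPotentials EG G η = hamPot η (fundLin n EG G X) := by
  ext f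
  rw [killingPotentials, hamPot, vol_eq_densVol hpos]
  constructor
  · rintro ⟨hf, h0, A, ξ, hA, hξ⟩
    refine ⟨⟨ξ, hf, fun x v => ?_⟩, h0⟩
    have h1 : fundLin n EG G X ξ x = J n (A x) := hξ x
    rw [h1, (hpos x).1.J_left, neg_neg]
    exact (hA x v).symm
  · rintro ⟨⟨ξ, hf, hd⟩, h0⟩
    refine ⟨hf, h0, fun x => -J n (fundLin n EG G X ξ x), ξ, fun x v => ?_, fun x => ?_⟩
    · have h1 := hd x v
      rw [form_neg_left, (hpos x).1]
      exact h1.symm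
    · rw [map_neg, J_J, neg_neg]
      rfl

theorem proj_spec {η : X → Alt2 n} (hpos : ∀ x, IsPositiveForm (η x)) {u : X → ℝ}
    (hex : ∃ p ∈ hamPot η (fundLin n EG G X), ∀ f ∈ hamPot η (fundLin n EG G X),
      ∫ x, (u x - p x) * f x ∂(densVol η) = 0) :
    proj EG G η u ∈ hamPot η (fundLin n EG G X) ∧ ∀ f ∈ hamPot η (fundLin n EG G X),
      ∫ x, (u x - proj EG G η u x) * f x ∂(densVol η) = 0 := by
  rw [← killingPotentials_eq_hamPot hpos, ← vol_eq_densVol hpos] at hex ⊢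
  rw [proj, dif_pos hex]
  exact hex.choose_spec

variable [FiniteDimensional ℝ EG] {B : Type*} [NormedAddCommGroup B] [NormedSpace ℝ B]
  [FiniteDimensional ℝ B]

/-- The integrals of a family of functions against the reduced scalar curvature of a family of
Kähler forms. -/
theorem exists_redScal_integral {η : B → X → Alt2 n} (hη : SmoothFamily η)
    (hpos : ∀ b x, IsPositiveForm (η b x))
    (hpot : ∀ ξ b₀ f₀, IsHam (η b₀) (fundLin n EG G X ξ) f₀ →
      ∃ f : B → X → ℝ, C1Fam f ∧ ∀ b, IsHam (η b) (fundLin n EG G X ξ) (f b))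
    {h : B → X → ℝ} (hh : C1Fam h) :
    ∃ Φ : B → ℝ, ContDiff ℝ 1 Φ ∧ ∀ b,
      ∫ x, h b x * redScal EG G (η b) x ∂(vol (η b)) = Φ b := by
  obtain ⟨Φ, hΦ, h1⟩ := exists_reduced_integral hη (fun b x => (hpos b x).isNondeg) hpot
    (c1Fam_scal hη hpos) hh
  refine ⟨Φ, hΦ, fun b => ?_⟩
  obtain ⟨h2, h3⟩ := proj_spec (hpos b) (h1 b).1
  rw [vol_eq_densVol (hpos b), ← (h1 b).2 _ h2 h3]
  simp only [redScal, vol_eq_densVol (hpos b)]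

theorem continuous_redScal {η : X → Alt2 n} (hη : SmoothFamily (fun _ : ℝ => η))
    (hpos : ∀ x, IsPositiveForm (η x))
    (hex : ∃ p ∈ hamPot η (fundLin n EG G X), ∀ f ∈ hamPot η (fundLin n EG G X),
      ∫ x, (scal η x - p x) * f x ∂(densVol η) = 0) : Continuous (redScal EG G η) := by
  obtain ⟨⟨⟨ξ, h2⟩, -⟩, -⟩ := proj_spec hpos hex
  have h1 := (c1Fam_scal hη (fun _ => hpos)).continuous 0
  exact (h1.sub continuous_const).sub h2.1.continuous

theorem exists_projection_scal {η : X → Alt2 n} (hη : SmoothFamily (fun _ : ℝ => η))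
    (hpos : ∀ x, IsPositiveForm (η x)) :
    ∃ p ∈ hamPot η (fundLin n EG G X), ∀ f ∈ hamPot η (fundLin n EG G X),
      ∫ x, (scal η x - p x) * f x ∂(densVol η) = 0 := by
  obtain ⟨Φ, -, h1⟩ := exists_reduced_integral (B := ℝ) (Z := fundLin n EG G X) hη
    (fun b x => (hpos x).isNondeg)
    (fun ξ _ f₀ hf₀ => ⟨fun _ => f₀, c1Fam_of_continuous hf₀.1.continuous, fun _ => hf₀⟩)
    (c1Fam_scal hη fun _ => hpos) (c1Fam_of_continuous (u := fun _ => (0 : ℝ)) continuous_const)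
  exact (h1 0).1

theorem integral_redScal {η : X → Alt2 n} (hη : SmoothFamily (fun _ : ℝ => η))
    (hpos : ∀ x, IsPositiveForm (η x)) : ∫ x, redScal EG G η x ∂(vol η) = 0 := by
  have hex := exists_projection_scal (EG := EG) (G := G) hη hpos
  have hfin : IsFiniteMeasure (densVol η) :=
    isFiniteMeasure_densVol hη (fun _ x => (hpos x).isNondeg) 0
  obtain ⟨⟨⟨ξ, h2⟩, h3⟩, -⟩ := proj_spec hpos hex
  have h1 := (c1Fam_scal hη (fun _ => hpos)).continuous 0
  simp only [redScal, vol_eq_densVol hpos]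
  have h4 : Continuous fun x => scal η x - ⨍ y, scal η y ∂(densVol η) := h1.sub continuous_const
  rw [integral_sub (integrable_of_continuous h4) (integrable_of_continuous h2.1.continuous), h3,
    integral_sub_average, sub_zero]

end Reduced

section Perturb

variable {n : ℕ} {X : Type*} [TopologicalSpace X] [ChartedSpace (Cn n) X]
  [IsManifold 𝓘(ℂ, Cn n) ω X] {B : Type*} [NormedAddCommGroup B] [NormedSpace ℝ B]

theorem IsKahlerForm.isSmoothForm {η : X → Alt2 n} (h : IsKahlerForm η) : IsSmoothForm η := h.smooth

theorem SmoothFamily.const {α : B → X → Alt2 n} (h : SmoothFamily α) (b : B)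
    {B' : Type*} [NormedAddCommGroup B'] [NormedSpace ℝ B'] : SmoothFamily (fun _ : B' => α b) := by
  intro p v w
  exact (h p v w).comp (f := fun z : B' × Cn n => (b, z.2))
    (contDiff_const.prodMk contDiff_snd).contDiffOn fun z hz => ⟨trivial, hz.2⟩

theorem contMDiff_slice {φ : B → X → ℝ}
    (hφ : ContMDiff (𝓘(ℝ, B).prod 𝓘(ℝ, Cn n)) 𝓘(ℝ, ℝ) ∞ (fun q : B × X => φ q.1 q.2)) (b : B) :
    ContMDiff 𝓘(ℝ, Cn n) 𝓘(ℝ, ℝ) ∞ (φ b) :=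
  ContMDiff.comp (g := fun q : B × X => φ q.1 q.2) hφ (contMDiff_const.prodMk contMDiff_id)

theorem localRep_perturb {η : X → Alt2 n} {φ : X → ℝ} (hφ : ContMDiff 𝓘(ℝ, Cn n) 𝓘(ℝ, ℝ) ∞ φ)
    {p : X} {y : Cn n} (hy : y ∈ (chartAt (Cn n) p).target) (v w : Cn n) :
    localRep (perturb η φ) p y ![v, w] = localRep η p y ![v, w] +
      ddcLocal (fun z => φ ((chartAt (Cn n) p).symm z)) y ![v, w] := by
  rw [← localRep_ddc hφ hy, localRep_apply, localRep_apply, localRep_apply]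
  rfl

theorem smoothFamily_perturb {η : X → Alt2 n} (hη : SmoothFamily (fun _ : B => η)) {φ : B → X → ℝ}
    (hφ : ContMDiff (𝓘(ℝ, B).prod 𝓘(ℝ, Cn n)) 𝓘(ℝ, ℝ) ∞ (fun q : B × X => φ q.1 q.2)) :
    SmoothFamily (fun b => perturb η (φ b)) := by
  intro p v w z hz
  have hopen := (isOpen_univ (X := B)).prod (chartAt (Cn n) p).open_target
  have h1 := (hη p v w).contDiffAt (hopen.mem_nhds hz)
  have h2 := contDiffAt_ddcLocal_family
    (u := fun b y => φ b ((chartAt (Cn n) p).symm y))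
    ((contDiffOn_charts_of_contMDiff hφ p).contDiffAt (hopen.mem_nhds hz)) v w
  refine ((h1.add h2).congr_of_eventuallyEq ?_).contDiffWithinAt
  filter_upwards [hopen.mem_nhds hz] with q hq
  exact localRep_perturb (contMDiff_slice hφ q.1) hq.2 v w

theorem ddc_isOneOne {φ : X → ℝ} (hφ : ContMDiff 𝓘(ℝ, Cn n) 𝓘(ℝ, ℝ) ∞ φ) (x : X) :
    IsOneOne (ddc (n := n) φ x) :=
  ddcLocal_isOneOne ((contDiffAt_comp_chart_symm hφ (mem_chart_target _ x)).of_le (by norm_cast))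

theorem isPositiveForm_perturb {η : X → Alt2 n} (hη : ∀ x, IsPositiveForm (η x)) {φ : X → ℝ}
    (hφ : ContMDiff 𝓘(ℝ, Cn n) 𝓘(ℝ, ℝ) ∞ φ) {x : X}
    (hp : ∀ v : Cn n, v ≠ 0 → 0 < perturb η φ x ![v, J n v]) : IsPositiveForm (perturb η φ x) := by
  refine ⟨fun v w => ?_, hp⟩
  have h1 := (hη x).1 v w
  have h2 := ddc_isOneOne hφ x v w
  simp only [perturb, ContinuousAlternatingMap.add_apply, h1, h2]

variable {EG : Type*} [NormedAddCommGroup EG] [NormedSpace ℝ EG]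
  {G : Type*} [TopologicalSpace G] [ChartedSpace EG G] [Group G] [IsManifold 𝓘(ℝ, EG) ∞ G]
  [CompactSpace X] [ConnectedSpace X] [MulAction G X]

/-- The family of functions `dφ_b(Jξ)`. -/
noncomputable def dcField (n : ℕ) {X : Type*} [TopologicalSpace X] [ChartedSpace (Cn n) X]
    (Z : X → Cn n) (φ : X → ℝ) (x : X) : ℝ := tder (Cn n) ℝ φ x (J n (Z x))

theorem dcField_chart {φ : X → ℝ} (hφ : ContMDiff 𝓘(ℝ, Cn n) 𝓘(ℝ, ℝ) ∞ φ) (Z : X → Cn n)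
    {p : X} {y : Cn n} (hy : y ∈ (chartAt (Cn n) p).target) (L : Cn n →L[ℝ] Cn n)
    (hL : ∀ v, tder (Cn n) (Cn n) (chartAt (Cn n) p) ((chartAt (Cn n) p).symm y) (L v) =
      L (tder (Cn n) (Cn n) (chartAt (Cn n) p) ((chartAt (Cn n) p).symm y) v)) :
    tder (Cn n) ℝ φ ((chartAt (Cn n) p).symm y) (L (Z ((chartAt (Cn n) p).symm y))) =
      fderiv ℝ (fun z => φ ((chartAt (Cn n) p).symm z)) y (L (fieldRep Z p y)) := by
  have h1 := tder_comp_apply (f := (chartAt (Cn n) p).symm) (g := φ) (x := y)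
    ((hφ _).mdifferentiableAt (by simp)) (mdifferentiableAt_chart_symm hy) (L (fieldRep Z p y))
  rw [tder_eq_fderiv] at h1
  rw [h1, fieldRep, ← hL]
  congr 1
  have h2 := tder_chart_symm_tder_chart ((chartAt (Cn n) p).map_target hy)
    (L (Z ((chartAt (Cn n) p).symm y)))
  rw [(chartAt (Cn n) p).right_inv hy] at h2
  exact h2.symm

theorem tder_chart_J {p : X} {y : Cn n} (hy : y ∈ (chartAt (Cn n) p).target) (v : Cn n) :
    tder (Cn n) (Cn n) (chartAt (Cn n) p) ((chartAt (Cn n) p).symm y) (J n v) =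
      J n (tder (Cn n) (Cn n) (chartAt (Cn n) p) ((chartAt (Cn n) p).symm y) v) :=
  tder_J ((contMDiffAt_chart_complex ((chartAt (Cn n) p).map_target hy)).mdifferentiableAt
    (by simp)) v

theorem contDiffOn_dcField (hG : ContMDiff (𝓘(ℝ, EG).prod 𝓘(ℝ, Cn n)) 𝓘(ℝ, Cn n) ∞
    (fun q : G × X => q.1 • q.2)) (ξ : EG) {φ : B → X → ℝ}
    (hφ : ContMDiff (𝓘(ℝ, B).prod 𝓘(ℝ, Cn n)) 𝓘(ℝ, ℝ) ∞ (fun q : B × X => φ q.1 q.2)) (p : X) :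
    ContDiffOn ℝ ∞ (fun z : B × Cn n => dcField n (fundLin n EG G X ξ) (φ z.1)
      ((chartAt (Cn n) p).symm z.2)) (Set.univ ×ˢ (chartAt (Cn n) p).target) := by
  intro z hz
  have hopen := (isOpen_univ (X := B)).prod (chartAt (Cn n) p).open_target
  have h1 := contDiffAt_fderiv_slice (f := fun b y => φ b ((chartAt (Cn n) p).symm y))
    ((contDiffOn_charts_of_contMDiff hφ p).contDiffAt (hopen.mem_nhds hz))
  have h2 : ContDiffAt ℝ ∞ (fun z : B × Cn n => J n (fieldRep (fundLin n EG G X ξ) p z.2)) z :=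
    (J n).contDiff.contDiffAt.comp z (ContDiffAt.comp
      (g := fieldRep (fundLin n EG G X ξ) p) z (contDiffAt_fieldRep_fundLin hG ξ hz.2) contDiffAt_snd)
  refine ((h1.clm_apply h2).congr_of_eventuallyEq ?_).contDiffWithinAt
  filter_upwards [hopen.mem_nhds hz] with q hq
  exact dcField_chart (contMDiff_slice hφ q.1) _ hq.2 (J n) (tder_chart_J hq.2)

theorem contMDiff_dcField (hG : ContMDiff (𝓘(ℝ, EG).prod 𝓘(ℝ, Cn n)) 𝓘(ℝ, Cn n) ∞
    (fun q : G × X => q.1 • q.2)) (ξ : EG) {φ : X → ℝ} (hφ : ContMDiff 𝓘(ℝ, Cn n) 𝓘(ℝ, ℝ) ∞ φ) :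
    ContMDiff 𝓘(ℝ, Cn n) 𝓘(ℝ, ℝ) ∞ (dcField n (fundLin n EG G X ξ) φ) := by
  refine contMDiff_of_charts fun p => ?_
  have h1 := contDiffOn_dcField (B := ℝ) hG ξ (φ := fun _ => φ)
    (hφ.comp contMDiff_snd) p
  exact h1.comp (f := fun y : Cn n => ((0 : ℝ), y)) (by fun_prop) fun y hy => ⟨trivial, hy⟩

/-- `d(dφ(Jξ)) = i_ξ d dᶜ φ` for `G`-invariant `φ`. -/
theorem tder_dcField (hG : ContMDiff (𝓘(ℝ, EG).prod 𝓘(ℝ, Cn n)) 𝓘(ℝ, Cn n) ∞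
    (fun q : G × X => q.1 • q.2))
    (hGh : ∀ g : G, ContMDiff 𝓘(ℂ, Cn n) 𝓘(ℂ, Cn n) ω (fun x : X => g • x)) (ξ : EG) {φ : X → ℝ}
    (hφ : IsInvSmooth n G φ) (x : X) (v : Cn n) :
    tder (Cn n) ℝ (dcField n (fundLin n EG G X ξ) φ) x v = ddc φ x ![fundLin n EG G X ξ x, v] := by
  have hx := mem_chart_target (Cn n) x
  rw [tder_eq_fderiv_chart ((contMDiff_dcField hG ξ hφ.1 x).mdifferentiableAt (by simp))]
  have h1 : (fun y => dcField n (fundLin n EG G X ξ) φ ((chartAt (Cn n) x).symm y))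
      =ᶠ[𝓝 (chartAt (Cn n) x x)] fun y => fderiv ℝ (fun z => φ ((chartAt (Cn n) x).symm z)) y
        (J n (fieldRep (fundLin n EG G X ξ) x y)) := by
    filter_upwards [(chartAt (Cn n) x).open_target.mem_nhds hx] with y hy
    exact dcField_chart hφ.1 _ hy (J n) (tder_chart_J hy)
  rw [h1.fderiv_eq, fderiv_dc_field
    ((contDiffAt_comp_chart_symm hφ.1 hx).of_le (by norm_cast))
    ((contDiffAt_fieldRep_fundLin hG ξ hx).differentiableAt (by simp))
    (fderiv_fieldRep_J hG hGh ξ hx) ?_ v, fieldRep_self]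
  · rfl
  · filter_upwards [(chartAt (Cn n) x).open_target.mem_nhds hx] with y hy
    have h2 := dcField_chart hφ.1 (fundLin n EG G X ξ) hy (ContinuousLinearMap.id ℝ _) fun _ => rfl
    simp only [ContinuousLinearMap.id_apply] at h2
    rw [← h2]
    exact tder_fundLin_eq_zero hG hφ ξ _

theorem exists_ham_perturb (hG : ContMDiff (𝓘(ℝ, EG).prod 𝓘(ℝ, Cn n)) 𝓘(ℝ, Cn n) ∞
    (fun q : G × X => q.1 • q.2))
    (hGh : ∀ g : G, ContMDiff 𝓘(ℂ, Cn n) 𝓘(ℂ, Cn n) ω (fun x : X => g • x)) {η : X → Alt2 n}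
    {φ : B → X → ℝ}
    (hφ : ContMDiff (𝓘(ℝ, B).prod 𝓘(ℝ, Cn n)) 𝓘(ℝ, ℝ) ∞ (fun q : B × X => φ q.1 q.2))
    (hinv : ∀ b (g : G) x, φ b (g • x) = φ b x) (ξ : EG) (b₀ : B) {f₀ : X → ℝ}
    (hf₀ : IsHam (perturb η (φ b₀)) (fundLin n EG G X ξ) f₀) :
    ∃ f : B → X → ℝ, C1Fam f ∧ ∀ b, IsHam (perturb η (φ b)) (fundLin n EG G X ξ) (f b) := by
  set Z := fundLin n EG G X ξ with hZ
  have hs : ∀ b, ContMDiff 𝓘(ℝ, Cn n) 𝓘(ℝ, ℝ) ∞ (dcField n Z (φ b)) := fun b =>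
    contMDiff_dcField hG ξ (contMDiff_slice hφ b)
  have hu : C1Fam (fun b => dcField n Z (φ b)) := c1Fam_of_charts (contDiffOn_dcField hG ξ hφ)
  refine ⟨fun b x => f₀ x + (dcField n Z (φ b₀) x + (-1) * dcField n Z (φ b) x),
    (c1Fam_of_continuous hf₀.1.continuous).add ((c1Fam_of_continuous (hs b₀).continuous).add
      ((c1Fam_of_continuous (u := fun _ => (-1 : ℝ)) continuous_const).mul hu)), fun b => ?_⟩
  have h1 : ContMDiff 𝓘(ℝ, Cn n) 𝓘(ℝ, ℝ) ∞ (fun x => (-1) * dcField n Z (φ b) x) :=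
    contMDiff_const.mul (hs b)
  have h2 : ContMDiff 𝓘(ℝ, Cn n) 𝓘(ℝ, ℝ) ∞
      (fun x => dcField n Z (φ b₀) x + (-1) * dcField n Z (φ b) x) := (hs b₀).add h1
  refine ⟨hf₀.1.add h2, fun x v => ?_⟩
  rw [tder_add_fun hf₀.1 h2, tder_add_fun (hs b₀) h1, tder_const_mul_fun (hs b)]
  simp only [add_apply, smul_apply, hf₀.2]
  rw [hZ, tder_dcField hG hGh ξ ⟨contMDiff_slice hφ b₀, hinv b₀⟩,
    tder_dcField hG hGh ξ ⟨contMDiff_slice hφ b, hinv b⟩]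
  simp only [perturb, ContinuousAlternatingMap.add_apply, smul_eq_mul]
  ring

end Perturb

section Primitive

variable {E : Type*} [NormedAddCommGroup E] [NormedSpace ℝ E] [FiniteDimensional ℝ E]

theorem hasFDerivAt_intervalIntegral {U : Set E} (hU : IsOpen U) {g : ℝ → E → ℝ}
    (hg : ContDiffOn ℝ ∞ (fun z : ℝ × E => g z.1 z.2) (Set.univ ×ˢ U)) (a b : ℝ) {y : E}
    (hy : y ∈ U) :
    IntervalIntegrable (fun t => fderiv ℝ (g t) y) volume a b ∧
    HasFDerivAt (fun y => ∫ t in a..b, g t y) (∫ t in a..b, fderiv ℝ (g t) y) y := by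
  have hopen := (isOpen_univ (X := ℝ)).prod hU
  have hat : ∀ t, ∀ y ∈ U, ContDiffAt ℝ ∞ (fun z : ℝ × E => g z.1 z.2) (t, y) := fun t y hy =>
    hg.contDiffAt (hopen.mem_nhds ⟨trivial, hy⟩)
  obtain ⟨ε, hε, hball⟩ := Metric.nhds_basis_closedBall.mem_iff.1 (hU.mem_nhds hy)
  have hcg : ∀ y ∈ U, Continuous fun t => g t y := fun y hy =>
    continuous_iff_continuousAt.2 fun t => ContinuousAt.comp (f := fun t => (t, y))
      (g := fun z : ℝ × E => g z.1 z.2) (hat t y hy).continuousAt (by fun_prop)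
  have hcd : ContinuousOn (fun z : ℝ × E => fderiv ℝ (g z.1) z.2) (Set.univ ×ˢ U) := fun z hz =>
    (contDiffAt_fderiv_slice (f := g) (hat z.1 z.2 hz.2)).continuousAt.continuousWithinAt
  have hcd' : Continuous fun t => fderiv ℝ (g t) y :=
    continuous_iff_continuousAt.2 fun t => ContinuousAt.comp (f := fun t => (t, y))
      (g := fun z : ℝ × E => fderiv ℝ (g z.1) z.2)
      (contDiffAt_fderiv_slice (f := g) (hat t y hy)).continuousAt (by fun_prop)
  obtain ⟨C, hC⟩ := ((isCompact_uIcc (a := a) (b := b)).prod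
    (isCompact_closedBall y ε)).bddAbove_image (f := fun z : ℝ × E => ‖fderiv ℝ (g z.1) z.2‖)
    (hcd.norm.mono fun z hz => ⟨trivial, hball hz.2⟩)
  refine ⟨hcd'.intervalIntegrable _ _, ?_⟩
  refine intervalIntegral.hasFDerivAt_integral_of_dominated_of_fderiv_le (bound := fun _ => C)
    (F := fun y t => g t y) (F' := fun y t => fderiv ℝ (g t) y)
    (Metric.closedBall_mem_nhds y hε) ?_ ((hcg y hy).intervalIntegrable _ _)
    hcd'.aestronglyMeasurable ?_ intervalIntegrable_const ?_
  · filter_upwards [hU.mem_nhds hy] with y' hy'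
    exact (hcg y' hy').aestronglyMeasurable
  · exact Filter.Eventually.of_forall fun t ht y' hy' =>
      hC ⟨(t, y'), ⟨Set.uIoc_subset_uIcc ht, hy'⟩, rfl⟩
  · refine Filter.Eventually.of_forall fun t _ y' hy' => ?_
    have h1 := ContDiffAt.comp (f := fun y : E => (t, y)) (g := fun z : ℝ × E => g z.1 z.2) y'
      (hat t y' (hball hy')) (contDiffAt_const.prodMk contDiffAt_id)
    exact (h1.differentiableAt (by simp)).hasFDerivAt

theorem hasFDerivAt_primitive {U : Set E} (hU : IsOpen U) {g : ℝ → E → ℝ}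
    (hg : ContDiffOn ℝ ∞ (fun z : ℝ × E => g z.1 z.2) (Set.univ ×ˢ U)) {A : ℝ → E → E →L[ℝ] ℝ}
    (hA : ∀ y ∈ U, ∀ t v, HasDerivAt (fun t => A t y v) (fderiv ℝ (g t) y v) t) {f₀ : E → ℝ} {r₀ : ℝ}
    (hf₀ : ∀ y ∈ U, HasFDerivAt f₀ (-A r₀ y) y) (r : ℝ) {y : E} (hy : y ∈ U) :
    HasFDerivAt (fun y => f₀ y - ∫ t in r₀..r, g t y) (-A r y) y := by
  obtain ⟨h1, h2⟩ := hasFDerivAt_intervalIntegral hU hg r₀ r hy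
  have h3 : ∫ t in r₀..r, fderiv ℝ (g t) y = A r y - A r₀ y := by
    ext v
    rw [ContinuousLinearMap.intervalIntegral_apply h1,
      intervalIntegral.integral_eq_sub_of_hasDerivAt (fun t _ => hA y hy t v)
        ⟨h1.1.apply_continuousLinearMap v, h1.2.apply_continuousLinearMap v⟩]
    rfl
  have h4 := (hf₀ y hy).sub h2
  rw [h3] at h4
  have h5 : -A r₀ y - (A r y - A r₀ y) = -A r y := by abel
  rw [h5] at h4
  exact h4

end Primitive

section ClosedForm

variable {m : ℕ} {T : Type*} [TopologicalSpace T] [ChartedSpace (Cn m) T]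
  [IsManifold 𝓘(ℝ, Cn m) ∞ T] {E : Type*} [NormedAddCommGroup E] [NormedSpace ℝ E]
  {Ω : T → Alt2 m} {q : E → T} {z : E}

/-- The function `(q^*Ω)(a, b)` for constant vector fields `a`, `b`. -/
noncomputable def pullFun (Ω : T → Alt2 m) (q : E → T) (a b : E) (z : E) : ℝ :=
  Ω (q z) ![tder E (Cn m) q z a, tder E (Cn m) q z b]

theorem pullFun_eventually_eq (Ω : T → Alt2 m)
    (hq : ContMDiffAt 𝓘(ℝ, E) 𝓘(ℝ, Cn m) ∞ q z) (a b : E) :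
    pullFun Ω q a b =ᶠ[𝓝 z] fun y => localRep Ω (q z) (chartAt (Cn m) (q z) (q y))
      ![fderiv ℝ (fun y => chartAt (Cn m) (q z) (q y)) y a,
        fderiv ℝ (fun y => chartAt (Cn m) (q z) (q y)) y b] := by
  have h1 : ∀ᶠ y in 𝓝 z, q y ∈ (chartAt (Cn m) (q z)).source :=
    hq.continuousAt.eventually ((chartAt (Cn m) _).open_source.mem_nhds (mem_chart_source _ _))
  have h2 : ∀ᶠ y in 𝓝 z, ContMDiffAt 𝓘(ℝ, E) 𝓘(ℝ, Cn m) 1 q y :=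
    (contMDiffAt_iff_contMDiffAt_nhds (by simp)).1 (hq.of_le (by norm_cast))
  filter_upwards [h1, h2] with y hy1 hy2
  have h3 := hy2.mdifferentiableAt (n := 1) (by simp)
  rw [pullFun, form_eq_localRep Ω hy1, ← tder_eq_fderiv,
    tder_comp_apply (mdifferentiableAt_chart hy1) h3, tder_comp_apply (mdifferentiableAt_chart hy1) h3]

theorem contDiffAt_chart_comp (hq : ContMDiffAt 𝓘(ℝ, E) 𝓘(ℝ, Cn m) ∞ q z) :
    ContDiffAt ℝ ∞ (fun y => chartAt (Cn m) (q z) (q y)) z :=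
  contMDiffAt_iff_contDiffAt.1 (ContMDiffAt.comp z (contMDiffAt_chart (mem_chart_source _ _)) hq)

theorem contDiffAt_pullFun (hΩ : IsSmoothForm Ω) (hq : ContMDiffAt 𝓘(ℝ, E) 𝓘(ℝ, Cn m) ∞ q z)
    (a b : E) : ContDiffAt ℝ ∞ (pullFun Ω q a b) z := by
  refine ContDiffAt.congr_of_eventuallyEq ?_ (pullFun_eventually_eq Ω hq a b)
  have h1 := contDiffAt_chart_comp hq
  have h2 : ContDiffAt ℝ ∞ (fderiv ℝ (fun y => chartAt (Cn m) (q z) (q y))) z :=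
    h1.fderiv_right (m := ∞) (by simp)
  have hβ : ContDiffAt ℝ ∞ (localRep Ω (q z)) (chartAt (Cn m) (q z) (q z)) :=
    (hΩ _).contDiffAt ((chartAt (Cn m) _).open_target.mem_nhds (mem_chart_target _ _))
  have h3 : ContDiffAt ℝ ∞ (fun y => localRep Ω (q z) (chartAt (Cn m) (q z) (q y))) z :=
    ContDiffAt.comp (g := localRep Ω (q z)) (f := fun y => chartAt (Cn m) (q z) (q y)) z hβ h1
  exact contDiffAt_form_apply h3 (h2.clm_apply (contDiffAt_const (c := a)))
    (h2.clm_apply (contDiffAt_const (c := b)))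

/-- The pullback of a closed 2-form is closed. -/
theorem pullFun_cyclic (hΩ : IsKahlerForm Ω) (hq : ContMDiffAt 𝓘(ℝ, E) 𝓘(ℝ, Cn m) ∞ q z)
    (a b c : E) : fderiv ℝ (pullFun Ω q b c) z a - fderiv ℝ (pullFun Ω q a c) z b +
      fderiv ℝ (pullFun Ω q a b) z c = 0 := by
  rw [(pullFun_eventually_eq Ω hq b c).fderiv_eq, (pullFun_eventually_eq Ω hq a c).fderiv_eq,
    (pullFun_eventually_eq Ω hq a b).fderiv_eq]
  have hβ : ContDiffAt ℝ ∞ (localRep Ω (q z)) (chartAt (Cn m) (q z) (q z)) :=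
    (hΩ.smooth _).contDiffAt ((chartAt (Cn m) _).open_target.mem_nhds (mem_chart_target _ _))
  exact closed_pullback_identity (β := localRep Ω (q z))
    (Q := fun y => chartAt (Cn m) (q z) (q y)) (hβ.differentiableAt (by simp))
    (hΩ.closed _ _ (mem_chart_target _ _)) ((contDiffAt_chart_comp hq).of_le (by norm_cast)) a b c

end ClosedForm

section Slices

variable {W E E' : Type*} [NormedAddCommGroup W] [NormedSpace ℝ W] [NormedAddCommGroup E]
  [NormedSpace ℝ E] [NormedAddCommGroup E'] [NormedSpace ℝ E'] {T : Type*} [TopologicalSpace T]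
  [ChartedSpace E' T]

theorem tder_slice_fst {q : W × E → T} {z : W × E}
    (h : MDifferentiableAt 𝓘(ℝ, W × E) 𝓘(ℝ, E') q z) (v : W) :
    tder W E' (fun y => q (y, z.2)) z.1 v = tder (W × E) E' q z (v, 0) := by
  have hd : HasFDerivAt (fun y : W => (y, z.2)) (ContinuousLinearMap.inl ℝ W E) z.1 :=
    hasFDerivAt_prodMk_left z.1 z.2
  rw [tder_comp_apply (f := fun y : W => (y, z.2)) h hd.differentiableAt.mdifferentiableAt,
    tder_eq_fderiv, hd.fderiv]
  rfl

theorem tder_slice_snd {q : W × E → T} {z : W × E}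
    (h : MDifferentiableAt 𝓘(ℝ, W × E) 𝓘(ℝ, E') q z) (v : E) :
    tder E E' (fun y => q (z.1, y)) z.2 v = tder (W × E) E' q z (0, v) := by
  have hd : HasFDerivAt (fun y : E => (z.1, y)) (ContinuousLinearMap.inr ℝ W E) z.2 :=
    hasFDerivAt_prodMk_right z.1 z.2
  rw [tder_comp_apply (f := fun y : E => (z.1, y)) h hd.differentiableAt.mdifferentiableAt,
    tder_eq_fderiv, hd.fderiv]
  rfl

end Slices

section TransportedHam

variable {n m : ℕ} {EG : Type*} [NormedAddCommGroup EG] [NormedSpace ℝ EG]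
  {G : Type*} [TopologicalSpace G] [ChartedSpace EG G] [Group G] [IsManifold 𝓘(ℝ, EG) ∞ G]
  {T : Type*} [TopologicalSpace T] [ChartedSpace (Cn m) T] [IsManifold 𝓘(ℝ, Cn m) ∞ T]
  [MulAction G T]
  {M : Type*} [TopologicalSpace M] [ChartedSpace (Cn n) M] [IsManifold 𝓘(ℝ, Cn n) ∞ M]
  [MulAction G M] {Φ : ℝ → M → T} {Ω : T → Alt2 m}

theorem smoothFamily_pullback (hΩ : IsSmoothForm Ω)
    (hΦ : ContMDiff (𝓘(ℝ, ℝ).prod 𝓘(ℝ, Cn n)) 𝓘(ℝ, Cn m) ∞ (fun q : ℝ × M => Φ q.1 q.2)) :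
    SmoothFamily (fun r => pullback (n := n) (Φ r) Ω) := by
  intro p v w z hz
  have hopen := (isOpen_univ (X := ℝ)).prod (chartAt (Cn n) p).open_target
  have hq : ContMDiffAt 𝓘(ℝ, ℝ × Cn n) 𝓘(ℝ, Cn m) ∞
      (fun z : ℝ × Cn n => Φ z.1 ((chartAt (Cn n) p).symm z.2)) z := by
    have h1 : ContMDiffAt 𝓘(ℝ, ℝ × Cn n) (𝓘(ℝ, ℝ).prod 𝓘(ℝ, Cn n)) ∞
        (fun z : ℝ × Cn n => (z.1, (chartAt (Cn n) p).symm z.2)) z :=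
      (contMDiffAt_iff_contDiffAt.2 contDiffAt_fst).prodMk (ContMDiffAt.comp z
        (contMDiffAt_chart_symm hz.2) (contMDiffAt_iff_contDiffAt.2 contDiffAt_snd))
    exact ContMDiffAt.comp (g := fun q : ℝ × M => Φ q.1 q.2) z (hΦ _) h1
  refine ((contDiffAt_pullback_family (f := fun r y => Φ r ((chartAt (Cn n) p).symm y)) hΩ hq v
    w).congr_of_eventuallyEq ?_).contDiffWithinAt
  filter_upwards [hopen.mem_nhds hz] with q hq
  rw [localRep_eq_pullback, pullback_pullback Ω (mdifferentiableAt_chart_symm hq.2)]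
  exact ((ContMDiff.comp (g := fun q : ℝ × M => Φ q.1 q.2) hΦ
    (contMDiff_const.prodMk contMDiff_id)) _).mdifferentiableAt (n := ∞) (by simp)

theorem contMDiff_family_slice
    (hΦ : ContMDiff (𝓘(ℝ, ℝ).prod 𝓘(ℝ, Cn n)) 𝓘(ℝ, Cn m) ∞ (fun q : ℝ × M => Φ q.1 q.2)) (r : ℝ) :
    ContMDiff 𝓘(ℝ, Cn n) 𝓘(ℝ, Cn m) ∞ (Φ r) :=
  ContMDiff.comp (g := fun q : ℝ × M => Φ q.1 q.2) hΦ (contMDiff_const.prodMk contMDiff_id)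

theorem tder_chart_symm_group (ξ : EG) :
    tder EG EG (chartAt EG (1 : G)).symm (chartAt EG (1 : G) 1) ξ = ξ := by
  set e := chartAt EG (1 : G)
  have h1 : (1 : G) ∈ e.source := mem_chart_source _ _
  have hd : MDifferentiableAt 𝓘(ℝ, EG) 𝓘(ℝ, EG) e 1 :=
    (contMDiffOn_chart.contMDiffAt (n := ∞) (e.open_source.mem_nhds h1)).mdifferentiableAt (by simp)
  have h2 : tder EG EG e 1 = ContinuousLinearMap.id ℝ EG := by
    rw [tder_eq_fderiv_chart hd]
    have h3 : (fun y => e (e.symm y)) =ᶠ[𝓝 (e 1)] id := e.eventually_right_inverse (e.map_source h1)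
    rw [h3.fderiv_eq, fderiv_id]
  have h4 := tder_leftInverse ((contMDiffAt_chart_symm_group (G := G)
    (e.map_source h1)).mdifferentiableAt (by simp)) hd (e.eventually_left_inverse h1) ξ
  rw [h2] at h4
  exact h4

theorem mdifferentiableAt_orbit (hG : ContMDiff (𝓘(ℝ, EG).prod 𝓘(ℝ, Cn m)) 𝓘(ℝ, Cn m) ∞
    (fun q : G × T => q.1 • q.2)) (y : T) (g : G) :
    MDifferentiableAt 𝓘(ℝ, EG) 𝓘(ℝ, Cn m) (fun g : G => g • y) g :=
  (ContMDiffAt.comp (g := fun q : G × T => q.1 • q.2) g (hG _)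
    (contMDiffAt_id.prodMk contMDiffAt_const)).mdifferentiableAt (by simp)

theorem contMDiff_smul_left (hG : ContMDiff (𝓘(ℝ, EG).prod 𝓘(ℝ, Cn m)) 𝓘(ℝ, Cn m) ∞
    (fun q : G × T => q.1 • q.2)) (g : G) : ContMDiff 𝓘(ℝ, Cn m) 𝓘(ℝ, Cn m) ∞ (fun y : T => g • y) :=
  ContMDiff.comp (g := fun q : G × T => q.1 • q.2) hG (contMDiff_const.prodMk contMDiff_id)

/-- Equivariant maps relate the fields induced by the Lie algebra. -/
theorem fundLin_equivariant
    (hGM : ContMDiff (𝓘(ℝ, EG).prod 𝓘(ℝ, Cn n)) 𝓘(ℝ, Cn n) ∞ (fun q : G × M => q.1 • q.2))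
    {f : M → T} (hf : ContMDiff 𝓘(ℝ, Cn n) 𝓘(ℝ, Cn m) ∞ f)
    (heq : ∀ (g : G) x, f (g • x) = g • f x) (ξ : EG) (x : M) :
    fundLin m EG G T ξ (f x) = tder (Cn n) (Cn m) f x (fundLin n EG G M ξ x) := by
  have h1 := tder_comp_apply (f := fun g : G => g • x) (g := f) (x := (1 : G))
    ((hf _).mdifferentiableAt (by simp)) (mdifferentiableAt_orbit hGM x 1) ξ
  rw [one_smul] at h1
  have h2 : (fun g : G => f (g • x)) = fun g : G => g • f x := funext fun g => heq g x
  rw [h2] at h1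
  exact h1

/-- The map `(g, r, y) ↦ g • Φ_r(y)` in coordinates near `1 ∈ G` and in the chart at `p`. -/
noncomputable def orbitMap (EG G : Type*) [NormedAddCommGroup EG] [NormedSpace ℝ EG]
    [TopologicalSpace G] [ChartedSpace EG G] [Group G] [MulAction G T] (Φ : ℝ → M → T) (p : M)
    (z : EG × (ℝ × Cn n)) : T :=
  (chartAt EG (1 : G)).symm z.1 • Φ z.2.1 ((chartAt (Cn n) p).symm z.2.2)

section Orbit

variable (hGT : ContMDiff (𝓘(ℝ, EG).prod 𝓘(ℝ, Cn m)) 𝓘(ℝ, Cn m) ∞ (fun q : G × T => q.1 • q.2))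
  (hGM : ContMDiff (𝓘(ℝ, EG).prod 𝓘(ℝ, Cn n)) 𝓘(ℝ, Cn n) ∞ (fun q : G × M => q.1 • q.2))
  (hΦ : ContMDiff (𝓘(ℝ, ℝ).prod 𝓘(ℝ, Cn n)) 𝓘(ℝ, Cn m) ∞ (fun q : ℝ × M => Φ q.1 q.2))
  (heq : ∀ r (g : G) x, Φ r (g • x) = g • Φ r x)

include hΦ

theorem contMDiffAt_chart_family {p : M} {w : ℝ × Cn n} (hw : w.2 ∈ (chartAt (Cn n) p).target) :
    ContMDiffAt 𝓘(ℝ, ℝ × Cn n) 𝓘(ℝ, Cn m) ∞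
      (fun w : ℝ × Cn n => Φ w.1 ((chartAt (Cn n) p).symm w.2)) w := by
  have h1 : ContMDiffAt 𝓘(ℝ, ℝ × Cn n) (𝓘(ℝ, ℝ).prod 𝓘(ℝ, Cn n)) ∞
      (fun z : ℝ × Cn n => (z.1, (chartAt (Cn n) p).symm z.2)) w :=
    (contMDiffAt_iff_contDiffAt.2 contDiffAt_fst).prodMk (ContMDiffAt.comp w
      (contMDiffAt_chart_symm hw) (contMDiffAt_iff_contDiffAt.2 contDiffAt_snd))
  exact ContMDiffAt.comp (g := fun q : ℝ × M => Φ q.1 q.2) w (hΦ _) h1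

include hGT

theorem contMDiffAt_orbitMap {p : M} {z : EG × (ℝ × Cn n)}
    (hs : z.1 ∈ (chartAt EG (1 : G)).target) (hy : z.2.2 ∈ (chartAt (Cn n) p).target) :
    ContMDiffAt 𝓘(ℝ, EG × (ℝ × Cn n)) 𝓘(ℝ, Cn m) ∞ (orbitMap EG G Φ p) z := by
  have h1 : ContMDiffAt 𝓘(ℝ, EG × (ℝ × Cn n)) (𝓘(ℝ, EG).prod 𝓘(ℝ, Cn m)) ∞
      (fun z : EG × (ℝ × Cn n) => ((chartAt EG (1 : G)).symm z.1,
        Φ z.2.1 ((chartAt (Cn n) p).symm z.2.2))) z :=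
    (ContMDiffAt.comp z (contMDiffAt_chart_symm_group hs)
      (contMDiffAt_iff_contDiffAt.2 contDiffAt_fst)).prodMk
    (ContMDiffAt.comp (g := fun w : ℝ × Cn n => Φ w.1 ((chartAt (Cn n) p).symm w.2)) z
      (contMDiffAt_chart_family hΦ hy) (contMDiffAt_iff_contDiffAt.2 contDiffAt_snd))
  exact ContMDiffAt.comp (g := fun q : G × T => q.1 • q.2) z (hGT _) h1

theorem tder_orbitMap_fst {p : M} {w : ℝ × Cn n} (hy : w.2 ∈ (chartAt (Cn n) p).target) (ξ : EG) :
    tder (EG × (ℝ × Cn n)) (Cn m) (orbitMap EG G Φ p) (chartAt EG (1 : G) 1, w) (ξ, 0) =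
      fundLin m EG G T ξ (Φ w.1 ((chartAt (Cn n) p).symm w.2)) := by
  have hs := mem_chart_target EG (1 : G)
  rw [← tder_slice_fst (z := (chartAt EG (1 : G) 1, w))
    ((contMDiffAt_orbitMap hGT hΦ hs hy).mdifferentiableAt (by simp)) ξ]
  have h1 : (chartAt EG (1 : G)).symm (chartAt EG (1 : G) 1) = 1 :=
    (chartAt EG (1 : G)).left_inv (mem_chart_source _ _)
  have h2 := tder_comp_apply (f := (chartAt EG (1 : G)).symm)
    (g := fun g : G => g • Φ w.1 ((chartAt (Cn n) p).symm w.2)) (x := chartAt EG (1 : G) 1)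
    (mdifferentiableAt_orbit hGT _ _)
    ((contMDiffAt_chart_symm_group hs).mdifferentiableAt (by simp)) ξ
  rw [tder_chart_symm_group, h1] at h2
  exact h2

theorem tder_orbitMap_snd {p : M} {s : EG} {w : ℝ × Cn n} (hs : s ∈ (chartAt EG (1 : G)).target)
    (hy : w.2 ∈ (chartAt (Cn n) p).target) (u : ℝ × Cn n) :
    tder (EG × (ℝ × Cn n)) (Cn m) (orbitMap EG G Φ p) (s, w) (0, u) =
      tder (Cn m) (Cn m) (fun y : T => (chartAt EG (1 : G)).symm s • y)
        (Φ w.1 ((chartAt (Cn n) p).symm w.2))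
        (tder (ℝ × Cn n) (Cn m) (fun w : ℝ × Cn n => Φ w.1 ((chartAt (Cn n) p).symm w.2)) w u) := by
  rw [← tder_slice_snd (z := (s, w))
    ((contMDiffAt_orbitMap hGT hΦ hs hy).mdifferentiableAt (by simp)) u]
  exact tder_comp_apply (g := fun y : T => (chartAt EG (1 : G)).symm s • y)
    (f := fun w : ℝ × Cn n => Φ w.1 ((chartAt (Cn n) p).symm w.2))
    ((contMDiff_smul_left hGT _ _).mdifferentiableAt (by simp))
    ((contMDiffAt_chart_family hΦ hy).mdifferentiableAt (by simp)) u

/-- Contraction of the closedness of `Ω` with a field of the Lie algebra. -/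
theorem fderiv_pullFun_orbitMap (hΩ : IsKahlerForm Ω)
    (hinv : ∀ g : G, pullback (fun x : T => g • x) Ω = Ω) {p : M} {w : ℝ × Cn n}
    (hy : w.2 ∈ (chartAt (Cn n) p).target) (ξ : EG) (b c : ℝ × Cn n) :
    fderiv ℝ (pullFun Ω (orbitMap EG G Φ p) (ξ, 0) (0, c)) (chartAt EG (1 : G) 1, w) (0, b) =
      fderiv ℝ (pullFun Ω (orbitMap EG G Φ p) (ξ, 0) (0, b)) (chartAt EG (1 : G) 1, w) (0, c) := by
  have hs := mem_chart_target EG (1 : G)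
  have hq := contMDiffAt_orbitMap hGT hΦ (z := (chartAt EG (1 : G) 1, w)) hs hy
  have h1 := pullFun_cyclic hΩ hq (ξ, 0) (0, b) (0, c)
  set q₀ : ℝ × Cn n → T := fun w => Φ w.1 ((chartAt (Cn n) p).symm w.2) with hq₀
  have h2 : pullFun Ω (orbitMap EG G Φ p) (0, b) (0, c) =ᶠ[𝓝 (chartAt EG (1 : G) 1, w)]
      fun z => pullFun Ω q₀ b c z.2 := by
    have hopen : IsOpen ((chartAt EG (1 : G)).target ×ˢ
        ((Set.univ : Set ℝ) ×ˢ (chartAt (Cn n) p).target)) :=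
      (chartAt EG (1 : G)).open_target.prod (isOpen_univ.prod (chartAt (Cn n) p).open_target)
    filter_upwards [hopen.mem_nhds ⟨hs, trivial, hy⟩] with z hz
    have h3 := congrFun (hinv ((chartAt EG (1 : G)).symm z.1)) (q₀ z.2)
    rw [pullFun, tder_orbitMap_snd hGT hΦ hz.1 hz.2.2, tder_orbitMap_snd hGT hΦ hz.1 hz.2.2, pullFun,
      ← h3, pullback_apply]
    rfl
  have h4 : fderiv ℝ (pullFun Ω (orbitMap EG G Φ p) (0, b) (0, c)) (chartAt EG (1 : G) 1, w)
      (ξ, 0) = 0 := by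
    have h5 : DifferentiableAt ℝ (fun z : EG × (ℝ × Cn n) => pullFun Ω q₀ b c z.2)
        (chartAt EG (1 : G) 1, w) :=
      ((contDiffAt_pullFun hΩ.smooth hq (0, b) (0, c)).congr_of_eventuallyEq
        h2.symm).differentiableAt (by simp)
    rw [h2.fderiv_eq, ← fderiv_slice_fst h5]
    simp
  rw [h4] at h1
  linarith

include hGM heq

theorem pullFun_orbitMap_eq_localRep {p : M} {r : ℝ} {y : Cn n}
    (hy : y ∈ (chartAt (Cn n) p).target) (ξ : EG) (v : Cn n) :
    pullFun Ω (orbitMap EG G Φ p) (ξ, 0) (0, (0, v)) (chartAt EG (1 : G) 1, (r, y)) =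
      localRep (pullback (n := n) (Φ r) Ω) p y ![fieldRep (fundLin n EG G M ξ) p y, v] := by
  have hs := mem_chart_target EG (1 : G)
  have h1 : (chartAt EG (1 : G)).symm (chartAt EG (1 : G) 1) = 1 :=
    (chartAt EG (1 : G)).left_inv (mem_chart_source _ _)
  have hq₀ := (contMDiffAt_chart_family hΦ (p := p) (w := (r, y)) hy).mdifferentiableAt (n := ∞)
    (by simp)
  have hid : tder (Cn m) (Cn m) (fun y : T => (1 : G) • y) (Φ r ((chartAt (Cn n) p).symm y)) =
      ContinuousLinearMap.id ℝ _ := by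
    simp only [one_smul]
    exact tder_id _
  rw [pullFun, tder_orbitMap_fst hGT hΦ hy, tder_orbitMap_snd hGT hΦ hs hy, h1, hid,
    localRep_apply, pullback_apply,
    fundLin_equivariant hGM (contMDiff_family_slice hΦ r) (heq r)]
  have h2 : tder (Cn n) (Cn n) (chartAt (Cn n) p).symm y (fieldRep (fundLin n EG G M ξ) p y) =
      fundLin n EG G M ξ ((chartAt (Cn n) p).symm y) := by
    have h3 := tder_chart_symm_tder_chart ((chartAt (Cn n) p).map_target hy)
      (fundLin n EG G M ξ ((chartAt (Cn n) p).symm y))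
    rw [(chartAt (Cn n) p).right_inv hy] at h3
    exact h3
  have h4 := tder_slice_snd (z := (r, y)) hq₀ v
  have h5 := tder_comp_apply (f := (chartAt (Cn n) p).symm) (g := Φ r) (x := y)
    ((contMDiff_family_slice hΦ r _).mdifferentiableAt (by simp)) (mdifferentiableAt_chart_symm hy) v
  rw [h2, ← h5, ← h4]
  simp only [orbitMap, h1, one_smul]
  rfl

/-- The hamiltonians of a field of the Lie algebra for the forms `Φ_r^*Ω`. -/
theorem exists_ham_pullback [CompactSpace M] [ConnectedSpace M] [T2Space M] (hΩ : IsKahlerForm Ω)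
    (hinv : ∀ g : G, pullback (fun x : T => g • x) Ω = Ω) (ξ : EG) (r₀ : ℝ) {f₀ : M → ℝ}
    (hf₀ : IsHam (pullback (n := n) (Φ r₀) Ω) (fundLin n EG G M ξ) f₀) :
    ∃ f : ℝ → M → ℝ, C1Fam f ∧
      ∀ r, IsHam (pullback (n := n) (Φ r) Ω) (fundLin n EG G M ξ) (f r) := by
  set s₀ := chartAt EG (1 : G) 1 with hs₀
  have hs := mem_chart_target EG (1 : G)
  have h1 : (chartAt EG (1 : G)).symm s₀ = 1 :=
    (chartAt EG (1 : G)).left_inv (mem_chart_source _ _)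
  set g : ℝ → M → ℝ := fun r x => Ω (Φ r x)
    ![fundLin m EG G T ξ (Φ r x), tder ℝ (Cn m) (fun r => Φ r x) r 1] with hg
  set γ : M → ℝ × Cn n → EG × (ℝ × Cn n) → ℝ := fun p u =>
    pullFun Ω (orbitMap EG G Φ p) (ξ, 0) (0, u) with hγ
  have hγs : ∀ p u (w : ℝ × Cn n), w.2 ∈ (chartAt (Cn n) p).target →
      ContDiffAt ℝ ∞ (fun w => γ p u (s₀, w)) w := fun p u w hw =>
    ContDiffAt.comp (f := fun w : ℝ × Cn n => (s₀, w)) w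
      (contDiffAt_pullFun hΩ.smooth (contMDiffAt_orbitMap hGT hΦ hs hw) (ξ, 0) (0, u))
      (contDiffAt_const.prodMk contDiffAt_id)
  have hgγ : ∀ p (w : ℝ × Cn n), w.2 ∈ (chartAt (Cn n) p).target →
      g w.1 ((chartAt (Cn n) p).symm w.2) = γ p (1, 0) (s₀, w) := by
    intro p w hw
    have hq₀ := (contMDiffAt_chart_family hΦ hw).mdifferentiableAt (n := ∞) (by simp)
    have hid : tder (Cn m) (Cn m) (fun y : T => (1 : G) • y)
        (Φ w.1 ((chartAt (Cn n) p).symm w.2)) = ContinuousLinearMap.id ℝ _ := by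
      simp only [one_smul]
      exact tder_id _
    rw [hγ]
    simp only [pullFun]
    rw [tder_orbitMap_fst hGT hΦ hw, tder_orbitMap_snd hGT hΦ hs hw, ← hs₀, h1, hid,
      ← tder_slice_fst hq₀ 1]
    simp only [orbitMap, h1, one_smul]
    rfl
  have hgc : ∀ p, ContDiffOn ℝ ∞ (fun z : ℝ × Cn n => g z.1 ((chartAt (Cn n) p).symm z.2))
      (Set.univ ×ˢ (chartAt (Cn n) p).target) := fun p z hz => by
    refine ((hγs p (1, 0) z hz.2).congr_of_eventuallyEq ?_).contDiffWithinAt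
    filter_upwards [((isOpen_univ (X := ℝ)).prod (chartAt (Cn n) p).open_target).mem_nhds hz]
      with w hw
    exact hgγ p w hw.2
  have hgcont : Continuous (fun q : ℝ × M => g q.1 q.2) := (c1Fam_of_charts hgc).1
  set A : M → ℝ → Cn n → Cn n →L[ℝ] ℝ := fun p r y =>
    curryForm (localRep (pullback (n := n) (Φ r) Ω) p y) (fieldRep (fundLin n EG G M ξ) p y) with hA
  have hAγ : ∀ p r y v, y ∈ (chartAt (Cn n) p).target → A p r y v = γ p (0, v) (s₀, (r, y)) := by
    intro p r y v hy
    rw [hA, hγ]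
    simp only [curryForm_apply]
    exact (pullFun_orbitMap_eq_localRep hGT hGM hΦ heq hy ξ v).symm
  have hAd : ∀ p, ∀ y ∈ (chartAt (Cn n) p).target, ∀ t v, HasDerivAt (fun t => A p t y v)
      (fderiv ℝ (fun y => g t ((chartAt (Cn n) p).symm y)) y v) t := by
    intro p y hy t v
    have h2 : (fun t => A p t y v) = fun t => γ p (0, v) (s₀, (t, y)) :=
      funext fun t => hAγ p t y v hy
    have h3 : (fun y => g t ((chartAt (Cn n) p).symm y)) =ᶠ[𝓝 y] fun y => γ p (1, 0) (s₀, (t, y)) := by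
      filter_upwards [(chartAt (Cn n) p).open_target.mem_nhds hy] with y' hy'
      exact hgγ p (t, y') hy'
    have hd : ∀ u, DifferentiableAt ℝ (γ p u) (s₀, (t, y)) := fun u =>
      (contDiffAt_pullFun hΩ.smooth (contMDiffAt_orbitMap hGT hΦ (z := (s₀, (t, y))) hs hy) (ξ, 0)
        (0, u)).differentiableAt (by simp)
    have hd2 : ∀ u, DifferentiableAt ℝ (fun w => γ p u (s₀, w)) (t, y) := fun u =>
      (hγs p u (t, y) hy).differentiableAt (by simp)
    have h4 := fderiv_slice_fst (hd2 (0, v)) (1 : ℝ)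
    have h5 := fderiv_slice_snd (hd2 (1, 0)) v
    have h6 := fderiv_slice_snd (hd (0, v)) (1, 0)
    have h7 := fderiv_slice_snd (hd (1, 0)) (0, v)
    have h8 := fderiv_pullFun_orbitMap hGT hΦ hΩ hinv (w := (t, y)) hy ξ (1, 0) (0, v)
    rw [h2, h3.fderiv_eq]
    have h9 : DifferentiableAt ℝ (fun t => γ p (0, v) (s₀, (t, y))) t :=
      DifferentiableAt.comp (f := fun t : ℝ => (t, y)) t (hd2 (0, v)) (by fun_prop)
    have h10 := h9.hasDerivAt
    rw [← fderiv_apply_one_eq_deriv] at h10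
    have h11 : fderiv ℝ (fun y => γ p (1, 0) (s₀, (t, y))) y v =
        fderiv ℝ (fun t => γ p (0, v) (s₀, (t, y))) t 1 := h5.trans (h7.trans (h8.symm.trans (h6.symm.trans h4.symm)))
    rw [h11]
    exact h10
  set f : ℝ → M → ℝ := fun r x => f₀ x - ∫ t in r₀..r, g t x with hf
  have hfd : ∀ p r, ∀ y ∈ (chartAt (Cn n) p).target,
      HasFDerivAt (fun y => f r ((chartAt (Cn n) p).symm y)) (-A p r y) y := by
    intro p r y hy
    refine hasFDerivAt_primitive (chartAt (Cn n) p).open_target (hgc p) (hAd p)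
      (f₀ := fun y => f₀ ((chartAt (Cn n) p).symm y)) (fun y hy => ?_) r hy
    have h2 := (hf₀.1 ((chartAt (Cn n) p).symm y)).mdifferentiableAt (n := ∞) (by simp)
    have h3 : DifferentiableAt ℝ (fun y => f₀ ((chartAt (Cn n) p).symm y)) y :=
      mdifferentiableAt_iff_differentiableAt.1 (h2.comp y (mdifferentiableAt_chart_symm hy))
    have h4 : fderiv ℝ (fun y => f₀ ((chartAt (Cn n) p).symm y)) y = -A p r₀ y := by
      ext v
      rw [← tder_eq_fderiv, tder_comp_apply h2 (mdifferentiableAt_chart_symm hy), hf₀.2, neg_apply,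
        hA]
      simp only [curryForm_apply]
      rw [localRep_apply, fieldRep]
      have h3 := tder_chart_symm_tder_chart ((chartAt (Cn n) p).map_target hy)
        (fundLin n EG G M ξ ((chartAt (Cn n) p).symm y))
      rw [(chartAt (Cn n) p).right_inv hy] at h3
      rw [h3]
    rw [← h4]
    exact h3.hasFDerivAt
  have hfs : ∀ r, ContMDiff 𝓘(ℝ, Cn n) 𝓘(ℝ, ℝ) ∞ (f r) := by
    intro r
    refine contMDiff_of_charts fun p => (contDiffOn_infty_iff_fderiv_of_isOpen
      (chartAt (Cn n) p).open_target).2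
      ⟨fun y hy => (hfd p r y hy).differentiableAt.differentiableWithinAt, ?_⟩
    refine contDiffOn_clm_apply.2 fun v y hy => ?_
    have h2 := ((hγs p (0, v) (r, y) hy).comp (f := fun y : Cn n => (r, y)) y
      (contDiffAt_const.prodMk contDiffAt_id)).neg
    refine (h2.congr_of_eventuallyEq ?_).contDiffWithinAt
    filter_upwards [(chartAt (Cn n) p).open_target.mem_nhds hy] with y' hy'
    rw [(hfd p r y' hy').fderiv, neg_apply, hAγ p r y' v hy']
    rfl
  refine ⟨f, ⟨?_, fun r x => ContinuousLinearMap.toSpanSingleton ℝ (-g r x), ?_, fun r x => ?_⟩,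
    fun r => ⟨hfs r, fun x v => ?_⟩⟩
  · have h2 : Continuous (Function.uncurry fun (q : ℝ × M) (t : ℝ) => g t q.2) :=
      hgcont.comp (by fun_prop : Continuous fun q : (ℝ × M) × ℝ => (q.2, q.1.2))
    exact (hf₀.1.continuous.comp continuous_snd).sub
      (intervalIntegral.continuous_parametric_intervalIntegral_of_continuous h2 continuous_fst)
  · exact (ContinuousLinearMap.toSpanSingletonCLE (𝕜 := ℝ) (E := ℝ)).continuous.comp hgcont.neg
  · have h2 : Continuous fun t => g t x := hgcont.comp (by fun_prop : Continuous fun t : ℝ => (t, x))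
    have h3 := (intervalIntegral.integral_hasDerivAt_right (h2.intervalIntegrable r₀ r)
      (h2.stronglyMeasurableAtFilter _ _) h2.continuousAt).const_sub (f₀ x)
    exact h3.hasFDerivAt
  · rw [tder_eq_fderiv_chart ((hfs r x).mdifferentiableAt (by simp)),
      (hfd x r _ (mem_chart_target _ x)).fderiv, neg_apply, hA]
    simp only [curryForm_apply]
    rw [localRep_self, fieldRep_self]

end Orbit

end TransportedHam

section Retraction

variable {n m : ℕ} {X : Type*} [TopologicalSpace X] [ChartedSpace (Cn n) X]
  [IsManifold 𝓘(ℂ, Cn n) ω X] {T : Type*} [TopologicalSpace T] [ChartedSpace (Cn m) T]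
  [IsManifold 𝓘(ℂ, Cn m) ω T] {ι : X → T}

theorem tder_injective_of_ctder {f : X → T} {x : X}
    (hf : MDifferentiableAt 𝓘(ℂ, Cn n) 𝓘(ℂ, Cn m) f x)
    (h : Function.Injective (ctder (Cn n) (Cn m) f x)) :
    Function.Injective (tder (Cn n) (Cn m) f x) := by
  rw [tder_eq_restrictScalars hf]
  exact h

/-- A holomorphic immersion has a local holomorphic left inverse. -/
theorem exists_retraction {x : X} (hι : ContMDiffAt 𝓘(ℂ, Cn n) 𝓘(ℂ, Cn m) ω ι x)
    (hinj : Function.Injective (tder (Cn n) (Cn m) ι x)) :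
    ∃ R : T → X, ContMDiffAt 𝓘(ℂ, Cn m) 𝓘(ℂ, Cn n) ω R (ι x) ∧ ∀ᶠ x' in 𝓝 x, R (ι x') = x' := by
  set c := chartAt (Cn n) x
  set d := chartAt (Cn m) (ι x)
  have hx := mem_chart_source (Cn n) x
  have hcx := mem_chart_target (Cn n) x
  have hy := mem_chart_source (Cn m) (ι x)
  have hcc : c.symm (c x) = x := c.left_inv hx
  set j : Cn n → Cn m := fun w => d (ι (c.symm w)) with hj
  have hιc : ContMDiffAt 𝓘(ℂ, Cn n) 𝓘(ℂ, Cn m) ω (fun w => ι (c.symm w)) (c x) :=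
    ContMDiffAt.comp (g := ι) (c x) (by rw [hcc]; exact hι) (contMDiffAt_chart_symm_complex hcx)
  have hjc : ContDiffAt ℂ ω j (c x) :=
    contMDiffAt_iff_contDiffAt.1 (ContMDiffAt.comp (g := d) (c x)
      (contMDiffAt_chart_complex (by rw [hcc]; exact hy)) hιc)
  have hjd := hjc.differentiableAt (n := ω) (by simp)
  have hji : Function.Injective (fderiv ℂ j (c x)) := by
    have h1 : Function.Injective (fderiv ℝ j (c x)) := by
      have h2 := tder_comp (f := fun w => ι (c.symm w)) (g := d) (x := c x)
        (by simp only [hcc]; exact mdifferentiableAt_chart hy)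
        ((contMDiffAt_real hιc).mdifferentiableAt (by simp))
      have h3 := tder_comp (f := c.symm) (g := ι) (x := c x)
        (by rw [hcc]; exact (contMDiffAt_real hι).mdifferentiableAt (by simp))
        (mdifferentiableAt_chart_symm hcx)
      simp only [hcc] at h2
      rw [hcc, tder_chart_symm_self] at h3
      rw [h3, tder_chart_self, tder_eq_fderiv] at h2
      rw [h2]
      exact hinj
    rw [hjd.fderiv_restrictScalars ℝ] at h1
    exact h1
  obtain ⟨L, hL⟩ := LinearMap.exists_leftInverse_of_injective (fderiv ℂ j (c x) : Cn n →ₗ[ℂ] Cn m)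
    (LinearMap.ker_eq_bot.2 hji)
  set L' : Cn m →L[ℂ] Cn n := LinearMap.toContinuousLinearMap L
  set k : Cn n → Cn n := fun w => L' (j w) with hk
  have hkc : ContDiffAt ℂ ω k (c x) := L'.contDiff.contDiffAt.comp (c x) hjc
  have hkd : HasFDerivAt k ((ContinuousLinearEquiv.refl ℂ (Cn n) : Cn n ≃L[ℂ] Cn n) :
      Cn n →L[ℂ] Cn n) (c x) := by
    have h1 := L'.hasFDerivAt.comp (c x) hjd.hasFDerivAt
    have h2 : L'.comp (fderiv ℂ j (c x)) = ((ContinuousLinearEquiv.refl ℂ (Cn n) :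
        Cn n ≃L[ℂ] Cn n) : Cn n →L[ℂ] Cn n) :=
      ContinuousLinearMap.ext fun v => LinearMap.congr_fun hL v
    rw [← h2]
    exact h1
  set h := hkc.toOpenPartialHomeomorph k hkd (by simp)
  have hsrc : c x ∈ h.source := hkc.mem_toOpenPartialHomeomorph_source hkd (by simp)
  have hsymm : ContDiffAt ℂ ω h.symm (k (c x)) := hkc.to_localInverse hkd (by simp)
  have hsy : h.symm (k (c x)) = c x := h.left_inv hsrc
  have hkx : L' (d (ι x)) = k (c x) := by simp only [hk, hj, hcc]
  refine ⟨fun y => c.symm (h.symm (L' (d y))), ?_, ?_⟩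
  · have h1 : ContMDiffAt 𝓘(ℂ, Cn m) 𝓘(ℂ, Cn n) ω (fun y => L' (d y)) (ι x) :=
      ContMDiffAt.comp (g := L') (I' := 𝓘(ℂ, Cn m)) (ι x)
        (contMDiffAt_iff_contDiffAt.2 L'.contDiff.contDiffAt) (contMDiffAt_chart_complex hy)
    have h2 : ContMDiffAt 𝓘(ℂ, Cn m) 𝓘(ℂ, Cn n) ω (fun y => h.symm (L' (d y))) (ι x) :=
      ContMDiffAt.comp (g := h.symm) (I' := 𝓘(ℂ, Cn n)) (ι x)
        (by rw [hkx]; exact contMDiffAt_iff_contDiffAt.2 hsymm) h1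
    exact ContMDiffAt.comp (g := c.symm) (I' := 𝓘(ℂ, Cn n)) (ι x)
      (by rw [hkx, hsy]; exact contMDiffAt_chart_symm_complex hcx) h2
  · filter_upwards [c.open_source.mem_nhds hx,
      (c.continuousAt hx).eventually (h.open_source.mem_nhds hsrc)] with x' h1 h2
    have h3 : L' (d (ι x')) = k (c x') := by simp only [hk, hj, c.left_inv h1]
    have h4 : h.symm (k (c x')) = c x' := h.left_inv h2
    simp only [h3, h4, c.left_inv h1]

variable [CompactSpace X] [T2Space T]

theorem contMDiff_lift_real (hι : ContMDiff 𝓘(ℂ, Cn n) 𝓘(ℂ, Cn m) ω ι)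
    (hinj : Function.Injective ι) (himm : ∀ x, Function.Injective (tder (Cn n) (Cn m) ι x))
    {E H : Type*} [NormedAddCommGroup E] [NormedSpace ℝ E] [TopologicalSpace H]
    {I : ModelWithCorners ℝ E H} {N : Type*} [TopologicalSpace N] [ChartedSpace H N] {u : N → X}
    (hu : ContMDiff I 𝓘(ℝ, Cn m) ∞ (fun x => ι (u x))) : ContMDiff I 𝓘(ℝ, Cn n) ∞ u := by
  have hemb := (hι.continuous.isClosedEmbedding hinj).isEmbedding
  have hc : Continuous u := hemb.continuous_iff.2 hu.continuous
  intro x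
  obtain ⟨R, hR, hRι⟩ := exists_retraction (hι (u x)) (himm (u x))
  refine (ContMDiffAt.comp (g := R) x (contMDiffAt_real hR) (hu x)).congr_of_eventuallyEq ?_
  filter_upwards [hc.continuousAt.eventually hRι] with x' hx'
  exact hx'.symm

theorem contMDiff_lift_complex (hι : ContMDiff 𝓘(ℂ, Cn n) 𝓘(ℂ, Cn m) ω ι)
    (hinj : Function.Injective ι) (himm : ∀ x, Function.Injective (tder (Cn n) (Cn m) ι x))
    {k : ℕ} {N : Type*} [TopologicalSpace N] [ChartedSpace (Cn k) N] {u : N → X}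
    (hu : ContMDiff 𝓘(ℂ, Cn k) 𝓘(ℂ, Cn m) ω (fun x => ι (u x))) :
    ContMDiff 𝓘(ℂ, Cn k) 𝓘(ℂ, Cn n) ω u := by
  have hemb := (hι.continuous.isClosedEmbedding hinj).isEmbedding
  have hc : Continuous u := hemb.continuous_iff.2 hu.continuous
  intro x
  obtain ⟨R, hR, hRι⟩ := exists_retraction (hι (u x)) (himm (u x))
  refine (ContMDiffAt.comp (g := R) x hR (hu x)).congr_of_eventuallyEq ?_
  filter_upwards [hc.continuousAt.eventually hRι] with x' hx'
  exact hx'.symm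

end Retraction

section Flow

theorem expUnit_add (a b : ℂ) : expUnit (a + b) = expUnit a * expUnit b :=
  Units.ext (Complex.exp_add a b)

theorem expUnit_zero : expUnit 0 = 1 := Units.ext Complex.exp_zero

theorem contMDiff_expUnit : ContMDiff 𝓘(ℂ, ℂ) 𝓘(ℂ, ℂ) ω expUnit := by
  apply ContMDiff.of_comp_isOpenEmbedding Units.isOpenEmbedding_val
  exact contMDiff_iff_contDiff.2 Complex.contDiff_exp

variable {m : ℕ} {T : Type*} [TopologicalSpace T] [ChartedSpace (Cn m) T]
  [IsManifold 𝓘(ℂ, Cn m) ω T] [MulAction ℂˣ T]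
  (hρ : ContMDiff (𝓘(ℂ, ℂ).prod 𝓘(ℂ, Cn m)) 𝓘(ℂ, Cn m) ω (fun q : ℂˣ × T => q.1 • q.2))

include hρ

theorem contMDiff_smul_complex (c : ℂˣ) : ContMDiff 𝓘(ℂ, Cn m) 𝓘(ℂ, Cn m) ω (fun y : T => c • y) :=
  ContMDiff.comp (g := fun q : ℂˣ × T => q.1 • q.2) hρ (contMDiff_const.prodMk contMDiff_id)

theorem contMDiff_exp_orbit (y : T) :
    ContMDiff 𝓘(ℂ, ℂ) 𝓘(ℂ, Cn m) ω (fun w : ℂ => expUnit w • y) :=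
  ContMDiff.comp (g := fun q : ℂˣ × T => q.1 • q.2) hρ (contMDiff_expUnit.prodMk contMDiff_const)

theorem contMDiff_exp_flow : ContMDiff (𝓘(ℝ, ℝ).prod 𝓘(ℝ, Cn m)) 𝓘(ℝ, Cn m) ∞
    (fun q : ℝ × T => expUnit (-(q.1 : ℂ)) • q.2) := by
  have h1 : ContMDiff 𝓘(ℝ, ℝ) 𝓘(ℝ, ℂ) ∞ (fun t : ℝ => expUnit (-(t : ℂ))) :=
    ContMDiff.comp (contMDiff_real contMDiff_expUnit)
      (contMDiff_iff_contDiff.2 Complex.ofRealCLM.contDiff.neg)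
  exact ContMDiff.comp (g := fun q : ℂˣ × T => q.1 • q.2) (contMDiff_action_real hρ)
    ((h1.comp contMDiff_fst).prodMk contMDiff_snd)

end Flow

section CircleField

variable {n : ℕ} {T : Type*} [TopologicalSpace T] [ChartedSpace (Cn (n + 1)) T]
  [IsManifold 𝓘(ℂ, Cn (n + 1)) ω T] [MulAction ℂˣ T]
  (hρ : ContMDiff (𝓘(ℂ, ℂ).prod 𝓘(ℂ, Cn (n + 1))) 𝓘(ℂ, Cn (n + 1)) ω (fun q : ℂˣ × T => q.1 • q.2))

include hρ

theorem circleField_eq (y : T) :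
    circleField n T y = ctder ℂ (Cn (n + 1)) (fun w : ℂ => expUnit w • y) 0 Complex.I := by
  have hk := (contMDiff_exp_orbit hρ y 0).mdifferentiableAt (n := ω) (by simp)
  have hkr := (contMDiffAt_real (contMDiff_exp_orbit hρ y 0)).mdifferentiableAt (n := ∞) (by simp)
  have hd : HasFDerivAt (fun θ : ℝ => Complex.I * (θ : ℂ))
      (Complex.I • Complex.ofRealCLM : ℝ →L[ℝ] ℂ) 0 :=
    (Complex.I • Complex.ofRealCLM : ℝ →L[ℝ] ℂ).hasFDerivAt
  have h0 : Complex.I * ((0 : ℝ) : ℂ) = 0 := by simp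
  have h1 := tder_comp_apply (f := fun θ : ℝ => Complex.I * (θ : ℂ))
    (g := fun w : ℂ => expUnit w • y) (x := (0 : ℝ)) (by rw [h0]; exact hkr)
    hd.differentiableAt.mdifferentiableAt (1 : ℝ)
  rw [h0, tder_eq_fderiv, hd.fderiv, tder_eq_restrictScalars hk] at h1
  refine h1.trans ?_
  simp

/-- The flow of `e^{-s}` is generated by `J W`. -/
theorem tder_exp_flow (y : T) (t : ℝ) :
    tder ℝ (Cn (n + 1)) (fun s : ℝ => expUnit (-(s : ℂ)) • y) t 1 =
      J (n + 1) (circleField n T (expUnit (-(t : ℂ)) • y)) := by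
  set y' := expUnit (-(t : ℂ)) • y with hy'
  have hk := (contMDiff_exp_orbit hρ y' 0).mdifferentiableAt (n := ω) (by simp)
  have hkr := (contMDiffAt_real (contMDiff_exp_orbit hρ y' 0)).mdifferentiableAt (n := ∞) (by simp)
  have hd : HasFDerivAt (fun s : ℝ => (t : ℂ) - (s : ℂ)) (-Complex.ofRealCLM : ℝ →L[ℝ] ℂ) t :=
    Complex.ofRealCLM.hasFDerivAt.const_sub _
  have h0 : (t : ℂ) - (t : ℂ) = 0 := sub_self _
  have hfun : (fun s : ℝ => expUnit (-(s : ℂ)) • y) =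
      fun s : ℝ => expUnit ((t : ℂ) - (s : ℂ)) • y' := by
    funext s
    rw [hy', smul_smul, ← expUnit_add]
    congr 2
    ring
  have h1 := tder_comp_apply (f := fun s : ℝ => (t : ℂ) - (s : ℂ))
    (g := fun w : ℂ => expUnit w • y') (x := t) (by rw [h0]; exact hkr)
    hd.differentiableAt.mdifferentiableAt (1 : ℝ)
  rw [h0, tder_eq_fderiv, hd.fderiv, tder_eq_restrictScalars hk] at h1
  rw [hfun, h1, circleField_eq hρ, J_apply, ← map_smul]
  simp

end CircleField

section Commute

variable {E F : Type*} [NormedAddCommGroup E] [NormedSpace ℝ E] [NormedAddCommGroup F]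
  [NormedSpace ℝ F]

theorem hasDerivAt_slice {Q : ℝ × E → F} {z : ℝ × E} (h : DifferentiableAt ℝ Q z) :
    HasDerivAt (fun s => Q (s, z.2)) (fderiv ℝ Q z (1, 0)) z.1 := by
  have hd : HasFDerivAt (fun s : ℝ => (s, z.2)) (ContinuousLinearMap.inl ℝ ℝ E) z.1 :=
    hasFDerivAt_prodMk_left z.1 z.2
  have h1 : HasFDerivAt Q (fderiv ℝ Q z) ((fun s : ℝ => (s, z.2)) z.1) := h.hasFDerivAt
  have h2 := (h1.comp z.1 hd).hasDerivAt
  have h3 : ((fderiv ℝ Q z).comp (ContinuousLinearMap.inl ℝ ℝ E)) 1 = fderiv ℝ Q z (1, 0) := by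
    simp
  rw [h3] at h2
  exact h2

theorem hasDerivAt_fderiv_slice {f : ℝ → E → F} {s : ℝ} {y : E}
    (hf : ContDiffAt ℝ ∞ (fun z : ℝ × E => f z.1 z.2) (s, y)) (u : E) :
    HasDerivAt (fun s => fderiv ℝ (f s) y u)
      (fderiv ℝ (fun y => deriv (fun s => f s y) s) y u) s := by
  set Q : ℝ × E → F := fun z => f z.1 z.2 with hQ
  have hev : ∀ᶠ z in 𝓝 (s, y), DifferentiableAt ℝ Q z := by
    filter_upwards [(hf.of_le (m := 1) (by norm_cast)).eventually (by simp)] with z hz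
    exact hz.differentiableAt (by simp)
  have h1 : (fun s' => fderiv ℝ (f s') y u) =ᶠ[𝓝 s] fun s' => fderiv ℝ Q (s', y) (0, u) := by
    have hc : ContinuousAt (fun s' : ℝ => (s', y)) s := by fun_prop
    filter_upwards [hc.eventually hev] with s' hs'
    exact fderiv_slice_snd hs' u
  have h2 : (fun y' => deriv (fun s => f s y') s) =ᶠ[𝓝 y] fun y' => fderiv ℝ Q (s, y') (1, 0) := by
    have hc : ContinuousAt (fun y' : E => (s, y')) y := by fun_prop
    filter_upwards [hc.eventually hev] with y' hy'
    exact (hasDerivAt_slice hy').deriv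
  have hd : DifferentiableAt ℝ (fderiv ℝ Q) (s, y) :=
    (hf.fderiv_right (m := ∞) (by simp)).differentiableAt (by simp)
  have h3 : DifferentiableAt ℝ (fun z => fderiv ℝ Q z (0, u)) (s, y) :=
    hd.clm_apply (differentiableAt_const _)
  have h4 : DifferentiableAt ℝ (fun z => fderiv ℝ Q z ((1 : ℝ), (0 : E))) (s, y) :=
    hd.clm_apply (differentiableAt_const _)
  have h5 := (hasDerivAt_slice h3).congr_of_eventuallyEq h1
  have h6 := fderiv_mixed (Q := Q) (hf.of_le (by norm_cast)) (1 : ℝ) u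
  have h7 := fderiv_slice_fst h3 (1 : ℝ)
  have h8 := fderiv_slice_snd h4 u
  rw [h2.fderiv_eq, h8, ← h6, h7]
  exact h5

theorem contDiffAt_deriv_slice {f : ℝ → E → F} {s : ℝ} {y : E}
    (hf : ContDiffAt ℝ ∞ (fun z : ℝ × E => f z.1 z.2) (s, y)) :
    ContDiffAt ℝ ∞ (fun z : ℝ × E => deriv (fun s => f s z.2) z.1) (s, y) := by
  have h1 : (fun z : ℝ × E => deriv (fun s => f s z.2) z.1) =ᶠ[𝓝 (s, y)]
      fun z => fderiv ℝ (fun z : ℝ × E => f z.1 z.2) z (1, 0) := by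
    filter_upwards [(hf.of_le (m := 1) (by norm_cast)).eventually (by simp)] with z hz
    exact (hasDerivAt_slice (hz.differentiableAt (by simp))).deriv
  exact ((hf.fderiv_right (m := ∞) (by simp)).clm_apply contDiffAt_const).congr_of_eventuallyEq h1

theorem contDiffAt_slice_snd {f : ℝ → E → F} {s : ℝ} {y : E} {r : WithTop ℕ∞}
    (hf : ContDiffAt ℝ r (fun z : ℝ × E => f z.1 z.2) (s, y)) : ContDiffAt ℝ r (f s) y :=
  ContDiffAt.comp (f := fun y : E => (s, y)) (g := fun z : ℝ × E => f z.1 z.2) y hf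
    (contDiffAt_const.prodMk contDiffAt_id)

theorem fderiv_fderiv_apply {u : E → F} {y : E} (hu : ContDiffAt ℝ ∞ u y) (v w : E) :
    fderiv ℝ (fun z => fderiv ℝ u z w) y v = fderiv ℝ (fderiv ℝ u) y v w := by
  have h : DifferentiableAt ℝ (fderiv ℝ u) y :=
    (hu.fderiv_right (m := ∞) (by simp)).differentiableAt (by simp)
  rw [fderiv_clm_apply h (differentiableAt_const _)]
  simp

theorem hasDerivAt_fderiv_fderiv_slice {f : ℝ → E → ℝ} {s : ℝ} {y : E}
    (hf : ∀ᶠ z in 𝓝 (s, y), ContDiffAt ℝ ∞ (fun z : ℝ × E => f z.1 z.2) z) (u w : E) :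
    HasDerivAt (fun s => fderiv ℝ (fderiv ℝ (f s)) y u w)
      (fderiv ℝ (fderiv ℝ (fun y => deriv (fun s => f s y) s)) y u w) s := by
  have hf0 := hf.self_of_nhds
  have hg : ContDiffAt ℝ ∞ (fun z : ℝ × E => fderiv ℝ (f z.1) z.2 w) (s, y) :=
    (contDiffAt_fderiv_slice hf0).clm_apply contDiffAt_const
  have h1 := hasDerivAt_fderiv_slice (f := fun s y => fderiv ℝ (f s) y w) hg u
  have hds := contDiffAt_slice_snd (f := fun s y => deriv (fun s => f s y) s)
    (contDiffAt_deriv_slice hf0)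
  have h2 : (fun y' => deriv (fun s => fderiv ℝ (f s) y' w) s) =ᶠ[𝓝 y]
      fun y' => fderiv ℝ (fun y => deriv (fun s => f s y) s) y' w := by
    have hc : ContinuousAt (fun y' : E => (s, y')) y := by fun_prop
    filter_upwards [hc.eventually hf] with y' hy'
    exact (hasDerivAt_fderiv_slice hy' w).deriv
  rw [h2.fderiv_eq, fderiv_fderiv_apply hds] at h1
  refine h1.congr_of_eventuallyEq ?_
  have hc : ContinuousAt (fun s' : ℝ => (s', y)) s := by fun_prop
  filter_upwards [hc.eventually hf] with s' hs'
  exact (fderiv_fderiv_apply (contDiffAt_slice_snd (f := f) hs') u w).symm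

theorem hasDerivAt_ddcLocal {n : ℕ} {f : ℝ → Cn n → ℝ} {s : ℝ} {y : Cn n}
    (hf : ∀ᶠ z in 𝓝 (s, y), ContDiffAt ℝ ∞ (fun z : ℝ × Cn n => f z.1 z.2) z) (u v : Cn n) :
    HasDerivAt (fun s => ddcLocal (f s) y ![u, v])
      (ddcLocal (fun y => deriv (fun s => f s y) s) y ![u, v]) s := by
  have hds := contDiffAt_slice_snd (f := fun s y => deriv (fun s => f s y) s)
    (contDiffAt_deriv_slice hf.self_of_nhds)
  rw [ddcLocal_apply (hds.of_le (by norm_cast))]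
  refine HasDerivAt.congr_of_eventuallyEq
    ((hasDerivAt_fderiv_fderiv_slice hf u (J n v)).neg.add
      (hasDerivAt_fderiv_fderiv_slice hf v (J n u))) ?_
  have hc : ContinuousAt (fun s' : ℝ => (s', y)) s := by fun_prop
  filter_upwards [hc.eventually hf] with s' hs'
  exact ddcLocal_apply ((contDiffAt_slice_snd (f := f) hs').of_le (by norm_cast)) u v

end Commute

section Variation

variable {n : ℕ} {T : Type*} [TopologicalSpace T] [ChartedSpace (Cn (n + 1)) T]
  [IsManifold 𝓘(ℂ, Cn (n + 1)) ω T] [MulAction ℂˣ T]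
  {X : Type*} [TopologicalSpace X] [ChartedSpace (Cn n) X] [IsManifold 𝓘(ℂ, Cn n) ω X] {ι : X → T}
  {Ω : T → Alt2 (n + 1)} {H : T → ℝ}
  (hρ : ContMDiff (𝓘(ℂ, ℂ).prod 𝓘(ℂ, Cn (n + 1))) 𝓘(ℂ, Cn (n + 1)) ω (fun q : ℂˣ × T => q.1 • q.2))
  (hι : ContMDiff 𝓘(ℂ, Cn n) 𝓘(ℂ, Cn (n + 1)) ω ι)

include hρ hι

theorem contMDiff_fibre_flow : ContMDiff (𝓘(ℝ, ℝ).prod 𝓘(ℝ, Cn n)) 𝓘(ℝ, Cn (n + 1)) ∞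
    (fun q : ℝ × X => expUnit (-(q.1 : ℂ)) • ι q.2) :=
  ContMDiff.comp (g := fun q : ℝ × T => expUnit (-(q.1 : ℂ)) • q.2) (contMDiff_exp_flow hρ)
    (contMDiff_fst.prodMk ((contMDiff_real hι).comp contMDiff_snd))

theorem contMDiff_fibre_slice (t : ℝ) : ContMDiff 𝓘(ℂ, Cn n) 𝓘(ℂ, Cn (n + 1)) ω
    (fun x : X => expUnit (-(t : ℂ)) • ι x) :=
  ContMDiff.comp (g := fun y : T => expUnit (-(t : ℂ)) • y) (contMDiff_smul_complex hρ _) hι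

theorem contract_flow (hΩ : IsKahlerForm Ω) (hH : ContMDiff 𝓘(ℝ, Cn (n + 1)) 𝓘(ℝ, ℝ) ∞ H)
    (hW : ∀ (x : T) (v : Cn (n + 1)), Ω x ![circleField n T x, v] = tder (Cn (n + 1)) ℝ H x v)
    {p : X} {z : ℝ × Cn n} (hz : z.2 ∈ (chartAt (Cn n) p).target) (v : Cn n) :
    pullFun Ω (fun z : ℝ × Cn n => expUnit (-(z.1 : ℂ)) • ι ((chartAt (Cn n) p).symm z.2))
      (1, 0) (0, v) z =
    -fderiv ℝ (fun y => H (expUnit (-(z.1 : ℂ)) • ι ((chartAt (Cn n) p).symm y))) z.2 (J n v) := by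
  have hq := contMDiffAt_chart_family (Φ := fun (s : ℝ) (x : X) => expUnit (-(s : ℂ)) • ι x)
    (contMDiff_fibre_flow hρ hι) hz
  have hqd := hq.mdifferentiableAt (n := ∞) (by simp)
  have h1 := tder_slice_fst hqd (1 : ℝ)
  have h2 := tder_slice_snd hqd v
  dsimp only at h1 h2
  rw [tder_exp_flow hρ] at h1
  have hc : ContMDiffAt 𝓘(ℂ, Cn n) 𝓘(ℂ, Cn (n + 1)) ω
      (fun y => expUnit (-(z.1 : ℂ)) • ι ((chartAt (Cn n) p).symm y)) z.2 :=
    ContMDiffAt.comp (g := fun x : X => expUnit (-(z.1 : ℂ)) • ι x) z.2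
      (contMDiff_fibre_slice hρ hι z.1 _) (contMDiffAt_chart_symm_complex hz)
  have hcd := hc.mdifferentiableAt (n := ω) (by simp)
  have hcr := (contMDiffAt_real hc).mdifferentiableAt (n := ∞) (by simp)
  rw [pullFun, ← h1, ← h2, (hΩ.isPositiveForm _).1.J_left, ← tder_J hcd, hW, ← tder_eq_fderiv,
    tder_comp_apply ((hH _).mdifferentiableAt (n := ∞) (by simp)) hcr]

theorem hasDerivAt_omegaT (hΩ : IsKahlerForm Ω) (hH : ContMDiff 𝓘(ℝ, Cn (n + 1)) 𝓘(ℝ, ℝ) ∞ H)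
    (hW : ∀ (x : T) (v : Cn (n + 1)), Ω x ![circleField n T x, v] = tder (Cn (n + 1)) ℝ H x v)
    (x : X) (s : ℝ) (u v : Cn n) : HasDerivAt (fun s => omegaT ι Ω s x ![u, v])
      (ddc (n := n) (fun x => H (expUnit (-(s : ℂ)) • ι x)) x ![u, v]) s := by
  have hx := mem_chart_target (Cn n) x
  set c := chartAt (Cn n) x with hcdef
  set q : ℝ × Cn n → T := fun z => expUnit (-(z.1 : ℂ)) • ι (c.symm z.2) with hqdef
  have hfl := contMDiff_fibre_flow hρ hι
  have hq : ∀ s, ContMDiffAt 𝓘(ℝ, ℝ × Cn n) 𝓘(ℝ, Cn (n + 1)) ∞ q (s, c x) := fun s =>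
    contMDiffAt_chart_family (Φ := fun (s : ℝ) (x : X) => expUnit (-(s : ℂ)) • ι x) hfl
      (w := (s, c x)) hx
  have hform : ∀ s, omegaT ι Ω s x ![u, v] = pullFun Ω q (0, u) (0, v) (s, c x) := by
    intro s
    have hcc : c.symm (c x) = x := c.left_inv (mem_chart_source _ _)
    have h1 : ∀ w, tder (Cn n) (Cn (n + 1)) (fun x : X => expUnit (-(s : ℂ)) • ι x) x w =
        tder (ℝ × Cn n) (Cn (n + 1)) q (s, c x) (0, w) := by
      intro w
      rw [← tder_slice_snd ((hq s).mdifferentiableAt (n := ∞) (by simp))]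
      have h2 := tder_comp_apply (f := c.symm) (g := fun x : X => expUnit (-(s : ℂ)) • ι x)
        (x := c x) ((contMDiff_real (contMDiff_fibre_slice hρ hι s) _).mdifferentiableAt (n := ∞)
          (by simp)) (mdifferentiableAt_chart_symm hx) w
      rw [hcc, tder_chart_symm_self] at h2
      exact h2.symm
    rw [omegaT, pullback_apply, pullFun, ← h1, ← h1]
    simp only [hqdef, hcc]
  set h : Cn n → ℝ := fun y => H (expUnit (-(s : ℂ)) • ι (c.symm y)) with hh
  have hhs : ContDiffAt ℝ ∞ h (c x) := by
    have h1 : ContMDiff 𝓘(ℝ, Cn n) 𝓘(ℝ, ℝ) ∞ (fun x : X => H (expUnit (-(s : ℂ)) • ι x)) :=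
      hH.comp (contMDiff_real (contMDiff_fibre_slice hρ hι s))
    exact contDiffAt_comp_chart_symm h1 hx
  have hd : ∀ a b, DifferentiableAt ℝ (pullFun Ω q a b) (s, c x) := fun a b =>
    (contDiffAt_pullFun hΩ.isSmoothForm (hq s) a b).differentiableAt (by simp)
  have hslice : ∀ v w : Cn n, fderiv ℝ (pullFun Ω q (1, 0) (0, v)) (s, c x) (0, w) =
      -fderiv ℝ (fderiv ℝ h) (c x) w (J n v) := by
    intro v w
    rw [← fderiv_slice_snd (hd _ _) w]
    have h1 : (fun y => pullFun Ω q (1, 0) (0, v) (s, y)) =ᶠ[𝓝 (c x)]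
        fun y => -fderiv ℝ h y (J n v) := by
      filter_upwards [c.open_target.mem_nhds hx] with y hy
      exact contract_flow hρ hι hΩ hH hW (z := (s, y)) hy v
    rw [h1.fderiv_eq, fderiv_fun_neg, neg_apply, fderiv_fderiv_apply hhs]
  have hcyc := pullFun_cyclic hΩ (hq s) (1, 0) (0, u) (0, v)
  rw [hslice, hslice] at hcyc
  have hddc : ddc (n := n) (fun x => H (expUnit (-(s : ℂ)) • ι x)) x ![u, v] =
      fderiv ℝ (pullFun Ω q (0, u) (0, v)) (s, c x) (1, 0) := by
    have h1 : ddc (n := n) (fun x => H (expUnit (-(s : ℂ)) • ι x)) x ![u, v] =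
      ddcLocal h (c x) ![u, v] := rfl
    rw [h1, ddcLocal_apply (hhs.of_le (by norm_cast))]
    linarith
  rw [hddc]
  refine (hasDerivAt_slice (hd (0, u) (0, v))).congr_of_eventuallyEq ?_
  exact Filter.Eventually.of_forall hform

theorem exists_deriv_potential [CompactSpace X] [ConnectedSpace X] (hΩ : IsKahlerForm Ω)
    (hH : ContMDiff 𝓘(ℝ, Cn (n + 1)) 𝓘(ℝ, ℝ) ∞ H)
    (hW : ∀ (x : T) (v : Cn (n + 1)), Ω x ![circleField n T x, v] = tder (Cn (n + 1)) ℝ H x v)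
    {φ : ℝ → X → ℝ}
    (hφ : ContMDiff (𝓘(ℝ, ℝ).prod 𝓘(ℝ, Cn n)) 𝓘(ℝ, ℝ) ∞ (fun q : ℝ × X => φ q.1 q.2))
    (hφω : ∀ t : ℝ, omegaT ι Ω t = perturb (omegaT ι Ω 0) (φ t)) (t : ℝ) :
    ∃ c : ℝ, ∀ x : X, HasDerivAt (fun s => φ s x) (H (expUnit (-(t : ℂ)) • ι x) + c) t := by
  have hch := contDiffOn_charts_of_contMDiff (n := n) hφ
  have hat : ∀ (p : X) (s : ℝ) (y : Cn n), y ∈ (chartAt (Cn n) p).target →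
      ∀ᶠ z in 𝓝 (s, y), ContDiffAt ℝ ∞
        (fun z : ℝ × Cn n => φ z.1 ((chartAt (Cn n) p).symm z.2)) z := by
    intro p s y hy
    have ho := (isOpen_univ (X := ℝ)).prod (chartAt (Cn n) p).open_target
    filter_upwards [ho.mem_nhds (show (s, y) ∈ _ from ⟨trivial, hy⟩)] with z hz
    exact (hch p).contDiffAt (ho.mem_nhds hz)
  have hdiff : ∀ x, DifferentiableAt ℝ (fun s => φ s x) t := by
    intro x
    have h1 := hasDerivAt_slice
      (((hat x t _ (mem_chart_target _ x)).self_of_nhds).differentiableAt (by simp))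
    dsimp only at h1
    rw [(chartAt (Cn n) x).left_inv (mem_chart_source _ _)] at h1
    exact h1.differentiableAt
  have hψ : ContMDiff 𝓘(ℝ, Cn n) 𝓘(ℝ, ℝ) ∞ (fun x => deriv (fun s => φ s x) t) := by
    refine contMDiff_of_charts fun p y hy => ?_
    exact (contDiffAt_slice_snd (f := fun s y => deriv (fun s => φ s ((chartAt (Cn n) p).symm y)) s)
      (contDiffAt_deriv_slice (f := fun s y => φ s ((chartAt (Cn n) p).symm y))
        (hat p t y hy).self_of_nhds)).contDiffWithinAt
  have hHt : ContMDiff 𝓘(ℝ, Cn n) 𝓘(ℝ, ℝ) ∞ (fun x : X => H (expUnit (-(t : ℂ)) • ι x)) :=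
    hH.comp (contMDiff_real (contMDiff_fibre_slice hρ hι t))
  have hsub : ContMDiff 𝓘(ℝ, Cn n) 𝓘(ℝ, ℝ) ∞
      (fun x : X => deriv (fun s => φ s x) t + (-1) * H (expUnit (-(t : ℂ)) • ι x)) :=
    hψ.add (contMDiff_const.mul hHt)
  obtain ⟨c, hc⟩ := exists_eq_const_of_ddc_eq_zero hsub (by
    intro x
    have hx := mem_chart_target (Cn n) x
    refine alt2_ext fun u v => ?_
    have h1 := hasDerivAt_omegaT hρ hι hΩ hH hW x t u v
    have h2 := hasDerivAt_ddcLocal (f := fun s y => φ s ((chartAt (Cn n) x).symm y))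
      (hat x t _ hx) u v
    have h3 : (fun s => omegaT ι Ω s x ![u, v]) = fun s => omegaT ι Ω 0 x ![u, v] +
        ddcLocal (fun y => φ s ((chartAt (Cn n) x).symm y)) (chartAt (Cn n) x x) ![u, v] := by
      funext s
      rw [hφω s]
      rfl
    rw [h3] at h1
    have h4 := h1.unique (h2.const_add _)
    rw [ddc_add_mul hψ hHt]
    have h8 : ddc (n := n) (fun x => deriv (fun s => φ s x) t) x ![u, v] =
        ddcLocal (fun y => deriv (fun s => φ s ((chartAt (Cn n) x).symm y)) t)
          (chartAt (Cn n) x x) ![u, v] := rfl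
    rw [h8]
    change _ = (0 : ℝ)
    linarith)
  refine ⟨c, fun x => ?_⟩
  have h1 : H (expUnit (-(t : ℂ)) • ι x) + c = deriv (fun s => φ s x) t := by
    have := hc x
    linarith
  rw [h1]
  exact (hdiff x).hasDerivAt

end Variation

section Ddc

variable {n m : ℕ} {X : Type*} [TopologicalSpace X] [ChartedSpace (Cn n) X]
  [IsManifold 𝓘(ℂ, Cn n) ω X] {Y : Type*} [TopologicalSpace Y] [ChartedSpace (Cn m) Y]
  [IsManifold 𝓘(ℂ, Cn m) ω Y]

theorem tder_eq_fderiv_charts {f : X → Y} {x : X}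
    (hf : MDifferentiableAt 𝓘(ℝ, Cn n) 𝓘(ℝ, Cn m) f x) :
    fderiv ℝ (fun w => chartAt (Cn m) (f x) (f ((chartAt (Cn n) x).symm w))) (chartAt (Cn n) x x) =
      tder (Cn n) (Cn m) f x := by
  have hcc : (chartAt (Cn n) x).symm (chartAt (Cn n) x x) = x :=
    (chartAt (Cn n) x).left_inv (mem_chart_source _ _)
  have hd := mdifferentiableAt_chart (mem_chart_source (Cn m) (f x))
  have h1 : MDifferentiableAt 𝓘(ℝ, Cn n) 𝓘(ℝ, Cn m)
      (fun y => chartAt (Cn m) (f x) (f y)) x :=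
    MDifferentiableAt.comp (g := chartAt (Cn m) (f x)) x hd hf
  rw [← tder_eq_fderiv_chart h1, tder_comp hd hf, tder_chart_self]
  rfl

/-- Naturality of `d dᶜ` under holomorphic maps. -/
theorem ddc_comp {f : X → Y} {u : Y → ℝ} (hu : ContMDiff 𝓘(ℝ, Cn m) 𝓘(ℝ, ℝ) ∞ u) {x : X}
    (hf : ContMDiffAt 𝓘(ℂ, Cn n) 𝓘(ℂ, Cn m) ω f x) :
    ddc (n := n) (fun x => u (f x)) x = pullback (n := n) f (ddc (n := m) u) x := by
  set c := chartAt (Cn n) x with hc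
  set d := chartAt (Cn m) (f x) with hd
  have hcc : c.symm (c x) = x := c.left_inv (mem_chart_source _ _)
  have hcx := mem_chart_target (Cn n) x
  have hdy := mem_chart_source (Cn m) (f x)
  have hfc : ContMDiffAt 𝓘(ℂ, Cn n) 𝓘(ℂ, Cn m) ω (fun w => f (c.symm w)) (c x) :=
    ContMDiffAt.comp (g := f) (c x) (by rw [hcc]; exact hf) (contMDiffAt_chart_symm_complex hcx)
  have hτ : ContDiffAt ℂ ω (fun w => d (f (c.symm w))) (c x) :=
    contMDiffAt_iff_contDiffAt.1 (ContMDiffAt.comp (g := d) (c x)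
      (contMDiffAt_chart_complex (by rw [hcc]; exact hdy)) hfc)
  have hud : ContDiffAt ℝ ∞ (fun y => u (d.symm y)) (d (f (c.symm (c x)))) := by
    rw [hcc]
    exact contDiffAt_comp_chart_symm hu (mem_chart_target _ _)
  have h1 := ddcLocal_comp (τ := fun w => d (f (c.symm w))) (hud.of_le (by norm_cast)) hτ
  have h2 : ddc (n := n) (fun x => u (f x)) x =
      ddcLocal (fun w => u (d.symm (d (f (c.symm w))))) (c x) := by
    refine ddcLocal_congr ?_
    have h3 : ∀ᶠ w in 𝓝 (c x), f (c.symm w) ∈ d.source :=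
      hfc.continuousAt.eventually (d.open_source.mem_nhds (by beta_reduce; rw [hcc]; exact hdy))
    filter_upwards [h3] with w hw
    simp only [Function.comp_apply, d.left_inv hw]
    rfl
  rw [h2, h1, tder_eq_fderiv_charts ((contMDiffAt_real hf).mdifferentiableAt (by simp)), hcc]
  rfl

end Ddc

section Fibres

variable {n : ℕ} {EG : Type*} [NormedAddCommGroup EG] [NormedSpace ℝ EG]
  {G : Type*} [TopologicalSpace G] [ChartedSpace EG G] [Group G]
  {T : Type*} [TopologicalSpace T] [T2Space T] [ChartedSpace (Cn (n + 1)) T]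
  [IsManifold 𝓘(ℂ, Cn (n + 1)) ω T] [MulAction ℂˣ T] [MulAction G T] {π : T → ℂ}
  (hT : IsTestConfiguration (n := n) EG G π)
  {X : Type*} [TopologicalSpace X] [CompactSpace X] [ChartedSpace (Cn n) X]
  [IsManifold 𝓘(ℂ, Cn n) ω X] [MulAction G X] {ι : X → T} (hι : IsGenericFibre (n := n) π ι)
  (hιG : ∀ (g : G) (x : X), ι (g • x) = g • ι x)

include hT in
theorem tder_smul_injective (c : ℂˣ) (y : T) :
    Function.Injective (tder (Cn (n + 1)) (Cn (n + 1)) (fun y : T => c • y) y) := by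
  have h : ∀ c : ℂˣ, ∀ y, MDifferentiableAt 𝓘(ℝ, Cn (n + 1)) 𝓘(ℝ, Cn (n + 1)) (fun y : T => c • y) y :=
    fun c y => (contMDiff_real (contMDiff_smul_complex hT.action_holomorphic c) y).mdifferentiableAt
      (n := ∞) (by simp)
  exact Function.LeftInverse.injective (tder_leftInverse (g := fun y : T => c⁻¹ • y) (h c⁻¹ _) (h c y)
    (Filter.Eventually.of_forall fun y => inv_smul_smul c y))

include hι in
theorem tder_fibre_injective (x : X) : Function.Injective (tder (Cn n) (Cn (n + 1)) ι x) :=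
  tder_injective_of_ctder ((hι.holomorphic x).mdifferentiableAt (n := ω) (by simp)) (hι.immersion x)

include hT hι

theorem fibre_immersion (t : ℝ) (x : X) : Function.Injective
    (tder (Cn n) (Cn (n + 1)) (fun x : X => expUnit (-(t : ℂ)) • ι x) x) := by
  rw [tder_comp (g := fun y : T => expUnit (-(t : ℂ)) • y)
    ((contMDiff_real (contMDiff_smul_complex hT.action_holomorphic _) _).mdifferentiableAt
      (n := ∞) (by simp)) ((contMDiff_real hι.holomorphic x).mdifferentiableAt (n := ∞) (by simp))]
  exact (tder_smul_injective hT _ _).comp (tder_fibre_injective hι x)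

theorem fibre_proj (t : ℝ) (x : X) :
    π (expUnit (-(t : ℂ)) • ι x) = ((Real.exp (-t) : ℝ) : ℂ) := by
  have h : π (ι x) = 1 := by
    have : ι x ∈ π ⁻¹' {1} := hι.range_eq ▸ Set.mem_range_self x
    exact this
  rw [hT.equivariant, h, mul_one]
  simp [expUnit]

theorem isPositiveForm_omegaT {Ω : T → Alt2 (n + 1)} (hΩ : IsKahlerForm Ω) (t : ℝ) (x : X) :
    IsPositiveForm (omegaT (n := n) ι Ω t x) := by
  have h := ((contMDiff_fibre_slice hT.action_holomorphic hι.holomorphic t) x).mdifferentiableAt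
    (n := ω) (by simp)
  exact (hΩ.isPositiveForm _).pullback h (ctder_injective_of_tder h (fibre_immersion hT hι t x))

theorem smoothFamily_omegaT {Ω : T → Alt2 (n + 1)} (hΩ : IsKahlerForm Ω) :
    SmoothFamily (fun t => omegaT (n := n) ι Ω t) :=
  smoothFamily_pullback (Φ := fun (t : ℝ) (x : X) => expUnit (-(t : ℂ)) • ι x) hΩ.isSmoothForm
    (contMDiff_fibre_flow hT.action_holomorphic hι.holomorphic)

include hιG

theorem contMDiff_action_fibre : ContMDiff (𝓘(ℝ, EG).prod 𝓘(ℝ, Cn n)) 𝓘(ℝ, Cn n) ∞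
    (fun q : G × X => q.1 • q.2) := by
  refine contMDiff_lift_real hι.holomorphic hι.injective (tder_fibre_injective hι) ?_
  have h : (fun q : G × X => ι (q.1 • q.2)) = fun q => q.1 • ι q.2 := funext fun q => hιG _ _
  rw [h]
  exact ContMDiff.comp (g := fun q : G × T => q.1 • q.2) hT.group_smooth
    (contMDiff_fst.prodMk ((contMDiff_real hι.holomorphic).comp contMDiff_snd))

theorem contMDiff_action_fibre_complex (g : G) :
    ContMDiff 𝓘(ℂ, Cn n) 𝓘(ℂ, Cn n) ω (fun x : X => g • x) := by
  refine contMDiff_lift_complex hι.holomorphic hι.injective (tder_fibre_injective hι) ?_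
  have h : (fun x : X => ι (g • x)) = fun x => g • ι x := funext fun x => hιG _ _
  rw [h]
  exact (hT.group_holomorphic g).comp hι.holomorphic

theorem fibre_equivariant (t : ℝ) (g : G) (x : X) :
    expUnit (-(t : ℂ)) • ι (g • x) = g • expUnit (-(t : ℂ)) • ι x := by
  rw [hιG, hT.group_comm]

theorem pullback_omegaT {Ω : T → Alt2 (n + 1)} (hinv : ∀ g : G, pullback (fun x : T => g • x) Ω = Ω)
    (t : ℝ) (g : G) (x : X) :
    pullback (n := n) (fun x : X => g • x) (omegaT (n := n) ι Ω t) x = omegaT ι Ω t x := by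
  have hQ : ∀ x, MDifferentiableAt 𝓘(ℝ, Cn n) 𝓘(ℝ, Cn (n + 1))
      (fun x : X => expUnit (-(t : ℂ)) • ι x) x := fun x =>
    ((contMDiff_real (contMDiff_fibre_slice hT.action_holomorphic hι.holomorphic t)) x).mdifferentiableAt
      (n := ∞) (by simp)
  have hg := ((contMDiff_real (contMDiff_action_fibre_complex hT hι hιG g)) x).mdifferentiableAt
    (n := ∞) (by simp)
  have hgT : ∀ y, MDifferentiableAt 𝓘(ℝ, Cn (n + 1)) 𝓘(ℝ, Cn (n + 1)) (fun y : T => g • y) y := fun y =>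
    ((contMDiff_real (hT.group_holomorphic g)) y).mdifferentiableAt (n := ∞) (by simp)
  rw [omegaT, pullback_pullback _ hg (hQ _)]
  simp only [fibre_equivariant hT hι hιG]
  rw [← pullback_pullback (g := fun y : T => g • y) _ (hQ x) (hgT _), hinv g]

/-- The potentials of invariant forms are invariant. -/
theorem potential_invariant [ConnectedSpace X] {Ω : T → Alt2 (n + 1)}
    (hinv : ∀ g : G, pullback (fun x : T => g • x) Ω = Ω) {t : ℝ} {φ : X → ℝ}
    (hφ : ContMDiff 𝓘(ℝ, Cn n) 𝓘(ℝ, ℝ) ∞ φ)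
    (hφω : omegaT ι Ω t = perturb (omegaT ι Ω 0) φ) (g : G) (x : X) : φ (g • x) = φ x := by
  have hg := contMDiff_action_fibre_complex hT hι hιG g
  have hφg : ContMDiff 𝓘(ℝ, Cn n) 𝓘(ℝ, ℝ) ∞ (fun x => φ (g • x)) := hφ.comp (contMDiff_real hg)
  have hsub : ContMDiff 𝓘(ℝ, Cn n) 𝓘(ℝ, ℝ) ∞ (fun x => φ (g • x) + (-1) * φ x) :=
    hφg.add (contMDiff_const.mul hφ)
  obtain ⟨c, hc⟩ := exists_eq_const_of_ddc_eq_zero hsub (by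
    intro x
    have h8 := ddc_comp (f := fun x : X => g • x) hφ (hg x)
    refine alt2_ext fun u v => ?_
    rw [ddc_add_mul hφg hφ]
    change _ = (0 : ℝ)
    have h9 : ∀ x u v, ddc (n := n) φ x ![u, v] =
        omegaT ι Ω t x ![u, v] - omegaT ι Ω 0 x ![u, v] := by
      intro x u v
      rw [hφω]
      change _ = (omegaT ι Ω 0 x ![u, v] + ddc (n := n) φ x ![u, v]) - _
      ring
    rw [h8, pullback_apply, h9, h9, ← pullback_apply, ← pullback_apply,
      pullback_omegaT hT hι hιG hinv, pullback_omegaT hT hι hιG hinv]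
    ring)
  obtain ⟨a, -, ha⟩ := isCompact_univ.exists_isMaxOn Set.univ_nonempty hφ.continuous.continuousOn
  obtain ⟨b, -, hb⟩ := isCompact_univ.exists_isMinOn Set.univ_nonempty hφ.continuous.continuousOn
  have h1 := hc a
  have h2 := hc b
  have h3 := hc x
  have h4 : φ (g • a) ≤ φ a := ha (Set.mem_univ _)
  have h5 : φ b ≤ φ (g • b) := hb (Set.mem_univ _)
  linarith

end Fibres

/-- Chain rule for a function of `s` that is given by a mean value of the partial derivative in the
last variable, at an intermediate point of a compact parameter interval. -/
theorem hasDerivAt_of_intermediate {D : ℝ × ℝ × ℝ → ℝ} (hD : Continuous D) {K : Set ℝ}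
    (hK : IsCompact K) {t d : ℝ} (hd : ∀ v ∈ K, D (t, v, t) = d) {e : ℝ → ℝ}
    (he : ∀ s, ∃ v ∈ K, ∃ r ∈ Set.uIcc t s, e s - e t = (s - t) * D (s, v, r)) :
    HasDerivAt e d t := by
  rw [hasDerivAt_iff_isLittleO, Asymptotics.isLittleO_iff]
  intro ε hε
  have h1 : ∀ᶠ p in 𝓝 (t, t), ∀ v ∈ K, |D (p.1, v, p.2) - d| < ε := by
    refine hK.eventually_forall_of_forall_eventually (P := fun (p : ℝ × ℝ) v =>
      |D (p.1, v, p.2) - d| < ε) fun v hv => ?_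
    have hc : Continuous fun z : (ℝ × ℝ) × ℝ => |D (z.1.1, z.2, z.1.2) - d| := by fun_prop
    refine hc.continuousAt.eventually (gt_mem_nhds ?_)
    simp only [hd v hv, sub_self, abs_zero]
    exact hε
  obtain ⟨δ, hδ, hball⟩ := Metric.eventually_nhds_iff_ball.1 h1
  filter_upwards [Metric.ball_mem_nhds t hδ] with s hs
  obtain ⟨v, hv, r, hr, h2⟩ := he s
  have hr' : r ∈ Metric.ball t δ := by
    rw [Metric.mem_ball, Real.dist_eq] at hs ⊢
    exact (Set.abs_sub_left_of_mem_uIcc hr).trans_lt hs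
  have h3 := hball (s, r) (by rw [← ball_prod_same]; exact ⟨hs, hr'⟩) v hv
  rw [h2, smul_eq_mul, ← mul_sub, norm_mul, mul_comm]
  exact mul_le_mul_of_nonneg_right h3.le (norm_nonneg _)

section Energy

variable {n : ℕ} {EG : Type*} [NormedAddCommGroup EG] [NormedSpace ℝ EG] [FiniteDimensional ℝ EG]
  {G : Type*} [TopologicalSpace G] [ChartedSpace EG G] [Group G] [IsManifold 𝓘(ℝ, EG) ∞ G]
  {X : Type*} [TopologicalSpace X] [CompactSpace X] [ConnectedSpace X] [ChartedSpace (Cn n) X]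
  [IsManifold 𝓘(ℂ, Cn n) ω X] [MeasurableSpace X] [BorelSpace X] [MulAction G X]

theorem segment_mem_potentials {η : X → Alt2 n} {φ₀ φ₁ : X → ℝ} (h₀ : φ₀ ∈ potentials G η)
    (h₁ : φ₁ ∈ potentials G η) {v : ℝ} (hv : v ∈ Set.Icc (0 : ℝ) 1) :
    (fun x => φ₀ x + v * (φ₁ x - φ₀ x)) ∈ potentials G η := by
  have hs : ContMDiff 𝓘(ℝ, Cn n) 𝓘(ℝ, ℝ) ∞ (fun x => φ₁ x + (-1) * φ₀ x) :=
    h₁.1.1.add (contMDiff_const.mul h₀.1.1)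
  have heq : (fun x => φ₀ x + v * (φ₁ x - φ₀ x)) = fun x => φ₀ x + v * (φ₁ x + (-1) * φ₀ x) := by
    funext x
    ring
  rw [heq]
  refine ⟨⟨h₀.1.1.add (contMDiff_const.mul hs), fun g x => by
    beta_reduce
    rw [h₀.1.2, h₁.1.2]⟩, fun x w hw => ?_⟩
  have h2 : 0 < η x ![w, J n w] + ddc φ₀ x ![w, J n w] := h₀.2 x w hw
  have h3 : 0 < η x ![w, J n w] + ddc φ₁ x ![w, J n w] := h₁.2 x w hw
  change 0 < η x ![w, J n w] + ddc (n := n) _ x ![w, J n w]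
  rw [ddc_add_mul h₀.1.1 hs, ddc_add_mul h₁.1.1 h₀.1.1]
  obtain ⟨hv0, hv1⟩ := hv
  rcases hv0.eq_or_lt with rfl | hv0
  · linarith
  · nlinarith [mul_pos hv0 h3, mul_nonneg (sub_nonneg.2 hv1) h2.le]

theorem exists_energy_sub_eq {η : X → Alt2 n} {E : (X → ℝ) → ℝ} (hE : IsModifiedKEnergy EG G η E)
    {φ₀ φ₁ : X → ℝ} (h₀ : φ₀ ∈ potentials G η) (h₁ : φ₁ ∈ potentials G η) :
    ∃ v ∈ Set.Icc (0 : ℝ) 1, E φ₁ - E φ₀ = -∫ x, (φ₁ x - φ₀ x) *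
      redScal EG G (perturb η (fun x => φ₀ x + v * (φ₁ x - φ₀ x))) x
        ∂(vol (perturb η (fun x => φ₀ x + v * (φ₁ x - φ₀ x)))) := by
  have hd : ∀ v ∈ Set.Icc (0 : ℝ) 1, HasDerivAt (fun v => E (fun x => φ₀ x + v * (φ₁ x - φ₀ x)))
      (-∫ x, (φ₁ x - φ₀ x) * redScal EG G (perturb η (fun x => φ₀ x + v * (φ₁ x - φ₀ x))) x
        ∂(vol (perturb η (fun x => φ₀ x + v * (φ₁ x - φ₀ x))))) v := by
    intro v hv
    have h1 := hE _ (segment_mem_potentials h₀ h₁ hv) (fun x => φ₁ x - φ₀ x)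
      ⟨h₁.1.1.sub h₀.1.1, fun g x => by
        beta_reduce
        rw [h₀.1.2, h₁.1.2]⟩
    have h2 : HasDerivAt (fun s : ℝ => s - v) 1 v := (hasDerivAt_id v).sub_const v
    have h3 := HasDerivAt.comp (h := fun s : ℝ => s - v) v (by rw [sub_self]; exact h1) h2
    rw [mul_one] at h3
    refine h3.congr_of_eventuallyEq (Filter.Eventually.of_forall fun s => ?_)
    simp only [Function.comp_apply]
    congr 1
    funext x
    ring
  obtain ⟨v, hv, h1⟩ := exists_hasDerivAt_eq_slope _ _ (zero_lt_one (α := ℝ))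
    (fun v hv => (hd v hv).continuousAt.continuousWithinAt) fun v hv => hd v ⟨hv.1.le, hv.2.le⟩
  refine ⟨v, ⟨hv.1.le, hv.2.le⟩, ?_⟩
  rw [h1]
  simp

/-- The derivative of the modified K-energy along a smooth path of potentials. -/
theorem hasDerivAt_energy (hG : ContMDiff (𝓘(ℝ, EG).prod 𝓘(ℝ, Cn n)) 𝓘(ℝ, Cn n) ∞
    (fun q : G × X => q.1 • q.2))
    (hGh : ∀ g : G, ContMDiff 𝓘(ℂ, Cn n) 𝓘(ℂ, Cn n) ω (fun x : X => g • x)) {η : X → Alt2 n}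
    (hη : SmoothFamily (fun _ : ℝ => η)) (hpos : ∀ x, IsPositiveForm (η x)) {φ : ℝ → X → ℝ}
    (hφ : ContMDiff (𝓘(ℝ, ℝ).prod 𝓘(ℝ, Cn n)) 𝓘(ℝ, ℝ) ∞ (fun q : ℝ × X => φ q.1 q.2))
    (hmem : ∀ t, φ t ∈ potentials G η) {E : (X → ℝ) → ℝ} (hE : IsModifiedKEnergy EG G η E) (t : ℝ) :
    HasDerivAt (fun s => E (φ s)) (-∫ x, deriv (fun s => φ s x) t *
      redScal EG G (perturb η (φ t)) x ∂(vol (perturb η (φ t)))) t := by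
  set ψ : ℝ × ℝ × ℝ → X → ℝ := fun b x => φ t x + Real.sin b.2.1 ^ 2 * (φ b.1 x - φ t x) with hψ
  have hcoord : ∀ f : ℝ × ℝ × ℝ → ℝ, ContDiff ℝ ∞ f →
      ContMDiff (𝓘(ℝ, ℝ × ℝ × ℝ).prod 𝓘(ℝ, Cn n)) 𝓘(ℝ, ℝ) ∞
        (fun q : (ℝ × ℝ × ℝ) × X => f q.1) := fun f hf => hf.contMDiff.comp contMDiff_fst
  have hφ1 : ∀ f : ℝ × ℝ × ℝ → ℝ, ContDiff ℝ ∞ f →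
      ContMDiff (𝓘(ℝ, ℝ × ℝ × ℝ).prod 𝓘(ℝ, Cn n)) 𝓘(ℝ, ℝ) ∞
        (fun q : (ℝ × ℝ × ℝ) × X => φ (f q.1) q.2) := fun f hf =>
    ContMDiff.comp (g := fun q : ℝ × X => φ q.1 q.2) hφ ((hcoord f hf).prodMk contMDiff_snd)
  have hφt := hφ1 (fun _ => t) contDiff_const
  have hψs : ContMDiff (𝓘(ℝ, ℝ × ℝ × ℝ).prod 𝓘(ℝ, Cn n)) 𝓘(ℝ, ℝ) ∞
      (fun q : (ℝ × ℝ × ℝ) × X => ψ q.1 q.2) :=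
    hφt.add ((hcoord (fun b => Real.sin b.2.1 ^ 2)
      (Real.contDiff_sin.comp (contDiff_fst.comp contDiff_snd) |>.pow 2)).mul
      ((hφ1 _ contDiff_fst).sub hφt))
  have hψm : ∀ b, ψ b ∈ potentials G η := fun b =>
    segment_mem_potentials (hmem t) (hmem b.1) ⟨sq_nonneg _, Real.sin_sq_le_one _⟩
  have hh : C1Fam (fun (b : ℝ × ℝ × ℝ) x => φ b.2.2 x - φ t x) :=
    (c1Fam_of_contMDiff (n := n) (hφ1 _ (contDiff_snd.comp contDiff_snd))).sub
      (c1Fam_of_contMDiff (n := n) hφt)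
  have hpos' : ∀ b x, IsPositiveForm (perturb η (ψ b) x) := fun b x =>
    isPositiveForm_perturb hpos (hψm b).1.1 ((hψm b).2 x)
  obtain ⟨Φ, hΦ, hinteg⟩ := exists_redScal_integral (EG := EG) (G := G)
    (smoothFamily_perturb (hη.const 0) hψs) hpos'
    (fun ξ b₀ f₀ hf₀ => exists_ham_perturb hG hGh hψs (fun b => (hψm b).1.2) ξ b₀ hf₀) hh
  have hψt : ∀ v r, ψ (t, v, r) = φ t := fun v r => by
    funext x
    simp only [hψ, sub_self, mul_zero, add_zero]
  have hpost : ∀ x, IsPositiveForm (perturb η (φ t) x) := by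
    have := hpos' (t, 0, 0)
    rwa [hψt] at this
  have hηt : SmoothFamily (fun _ : ℝ => perturb η (φ t)) :=
    (smoothFamily_perturb hη hφ).const t
  have hfin : IsFiniteMeasure (densVol (perturb η (φ t))) :=
    isFiniteMeasure_densVol hηt (fun _ x => (hpost x).isNondeg) 0
  have hcont : Continuous (redScal EG G (perturb η (φ t))) :=
    continuous_redScal hηt hpost (exists_projection_scal hηt hpost)
  set D : ℝ × ℝ × ℝ → ℝ := fun b => -fderiv ℝ Φ b (0, 0, 1) with hD
  have hDc : Continuous D :=
    ((hΦ.continuous_fderiv (by simp)).clm_apply continuous_const).neg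
  have hline : ∀ s v r, HasDerivAt (fun r => -Φ (s, v, r)) (D (s, v, r)) r := by
    intro s v r
    have h1 : HasDerivAt (fun r : ℝ => (s, v, r)) ((0, 0, 1) : ℝ × ℝ × ℝ) r :=
      (hasDerivAt_const r s).prodMk ((hasDerivAt_const r v).prodMk (hasDerivAt_id r))
    have h2 : HasFDerivAt Φ (fderiv ℝ Φ (s, v, r)) ((fun r : ℝ => (s, v, r)) r) :=
      (hΦ.differentiable (by simp) _).hasFDerivAt
    exact (h2.comp_hasDerivAt r h1).neg
  refine hasDerivAt_of_intermediate hDc (K := Set.Icc 0 (Real.pi / 2)) isCompact_Icc ?_ ?_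
  · intro v _
    refine (hline t v t).unique ?_
    have h1 : C1Fam (fun r x => (φ r x - φ t x) * redScal EG G (perturb η (φ t)) x) :=
      ((c1Fam_of_contMDiff (n := n) hφ).sub
        (c1Fam_of_continuous (hmem t).1.1.continuous)).mul (c1Fam_of_continuous hcont)
    have h2 := (h1.hasDerivAt_integral (densVol (perturb η (φ t))) t).neg
    have h3 : ∀ x, deriv (fun r => (φ r x - φ t x) * redScal EG G (perturb η (φ t)) x) t =
        deriv (fun s => φ s x) t * redScal EG G (perturb η (φ t)) x := by
      intro x
      rw [deriv_mul_const_field, deriv_sub_const]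
    simp only [h3] at h2
    rw [← vol_eq_densVol hpost] at h2
    refine h2.congr_of_eventuallyEq (Filter.Eventually.of_forall fun r => ?_)
    beta_reduce
    rw [← hinteg]
    simp only [hψt]
    rfl
  · intro s
    obtain ⟨w, hw, h1⟩ := exists_energy_sub_eq hE (hmem t) (hmem s)
    have hsin : ContinuousOn (fun v : ℝ => Real.sin v ^ 2) (Set.Icc 0 (Real.pi / 2)) := by fun_prop
    obtain ⟨v, hv, hvw⟩ := intermediate_value_Icc (by positivity) hsin
      (show w ∈ Set.Icc (Real.sin 0 ^ 2) (Real.sin (Real.pi / 2) ^ 2) by simpa using hw)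
    have h2 : E (φ s) - E (φ t) = -Φ (s, v, s) := by
      rw [h1, ← hinteg]
      simp only [hψ, hvw]
    have h3 : Φ (s, v, t) = 0 := by
      rw [← hinteg]
      simp
    refine ⟨v, hv, ?_⟩
    rw [h2]
    rcases lt_trichotomy t s with hts | rfl | hts
    · obtain ⟨r, hr, h4⟩ := exists_hasDerivAt_eq_slope (fun r => -Φ (s, v, r)) _ hts
        (fun r _ => (hline s v r).continuousAt.continuousWithinAt) fun r _ => hline s v r
      refine ⟨r, Set.Icc_subset_uIcc ⟨hr.1.le, hr.2.le⟩, ?_⟩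
      rw [h4, h3]
      field_simp [sub_ne_zero.2 hts.ne']
      ring
    · exact ⟨t, Set.left_mem_uIcc, by rw [h3]; ring⟩
    · obtain ⟨r, hr, h4⟩ := exists_hasDerivAt_eq_slope (fun r => -Φ (s, v, r)) _ hts
        (fun r _ => (hline s v r).continuousAt.continuousWithinAt) fun r _ => hline s v r
      refine ⟨r, Set.Icc_subset_uIcc' ⟨hr.1.le, hr.2.le⟩, ?_⟩
      rw [h4, h3]
      have h5 : t - s ≠ 0 := sub_ne_zero.2 hts.ne'
      field_simp
      ring

end Energy

section Transport

variable {n : ℕ} {Y : Type*} [TopologicalSpace Y] [CompactSpace Y] [ConnectedSpace Y]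
  [ChartedSpace (Cn n) Y] [IsManifold 𝓘(ℝ, Cn n) ∞ Y] [MeasurableSpace Y] [BorelSpace Y]
  {K : Type*} [TopologicalSpace K] [CompactSpace K] [ConnectedSpace K]
  [ChartedSpace (Cn n) K] [IsManifold 𝓘(ℝ, Cn n) ∞ K] [MeasurableSpace K] [BorelSpace K]
  {Θ : Y ≃ₜ K} (hΘ : ContMDiff 𝓘(ℝ, Cn n) 𝓘(ℝ, Cn n) ∞ Θ) (α : K → Alt2 n)

include hΘ

theorem integral_comp_densVol (f : K → ℝ) :
    ∫ y, f (Θ y) ∂(densVol (pullback (n := n) Θ α)) = ∫ x, f x ∂(densVol α) := by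
  rw [← map_densVol_pullback Θ hΘ α, Θ.measurableEmbedding.integral_map]

theorem average_comp_densVol (f : K → ℝ) :
    ⨍ y, f (Θ y) ∂(densVol (pullback (n := n) Θ α)) = ⨍ x, f x ∂(densVol α) := by
  have h : (densVol α).real Set.univ = (densVol (pullback (n := n) Θ α)).real Set.univ := by
    rw [Measure.real, Measure.real, ← map_densVol_pullback Θ hΘ α,
      Measure.map_apply Θ.continuous.measurable MeasurableSet.univ, Set.preimage_univ]
  rw [average_eq, average_eq, integral_comp_densVol hΘ, h]

theorem tder_equiv_left (hΘ' : ContMDiff 𝓘(ℝ, Cn n) 𝓘(ℝ, Cn n) ∞ Θ.symm) (x : K) (v : Cn n) :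
    tder (Cn n) (Cn n) Θ (Θ.symm x) (tder (Cn n) (Cn n) Θ.symm x v) = v :=
  tder_leftInverse ((hΘ _).mdifferentiableAt (n := ∞) (by simp))
    ((hΘ' _).mdifferentiableAt (n := ∞) (by simp))
    (Filter.Eventually.of_forall Θ.apply_symm_apply) v

variable {V : Type*} [AddCommGroup V] [Module ℝ V] {ZY : V →ₗ[ℝ] (Y → Cn n)}
  {ZK : V →ₗ[ℝ] (K → Cn n)}
  (hZ : ∀ ξ y, ZK ξ (Θ y) = tder (Cn n) (Cn n) Θ y (ZY ξ y))

include hZ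

theorem comp_mem_hamPot {f : K → ℝ} (hf : f ∈ hamPot α ZK) :
    (fun y => f (Θ y)) ∈ hamPot (pullback (n := n) Θ α) ZY := by
  obtain ⟨⟨ξ, hs, hd⟩, h0⟩ := hf
  refine ⟨⟨ξ, hs.comp hΘ, fun y v => ?_⟩, by rw [integral_comp_densVol hΘ]; exact h0⟩
  rw [tder_comp_apply ((hs _).mdifferentiableAt (n := ∞) (by simp))
    ((hΘ _).mdifferentiableAt (n := ∞) (by simp)), hd, pullback_apply, hZ]

theorem comp_symm_mem_hamPot (hΘ' : ContMDiff 𝓘(ℝ, Cn n) 𝓘(ℝ, Cn n) ∞ Θ.symm) {f : Y → ℝ}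
    (hf : f ∈ hamPot (pullback (n := n) Θ α) ZY) : (fun x => f (Θ.symm x)) ∈ hamPot α ZK := by
  obtain ⟨⟨ξ, hs, hd⟩, h0⟩ := hf
  refine ⟨⟨ξ, hs.comp hΘ', fun x v => ?_⟩, ?_⟩
  · rw [tder_comp_apply ((hs _).mdifferentiableAt (n := ∞) (by simp))
      ((hΘ' _).mdifferentiableAt (n := ∞) (by simp)), hd, pullback_apply, ← hZ,
      tder_equiv_left hΘ hΘ', Θ.apply_symm_apply]
  · rw [← integral_comp_densVol hΘ]
    simpa only [Θ.symm_apply_apply] using h0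

end Transport

section Reduced

variable {n : ℕ} {EG : Type*} [NormedAddCommGroup EG] [NormedSpace ℝ EG] [FiniteDimensional ℝ EG]
  {G : Type*} [TopologicalSpace G] [ChartedSpace EG G] [Group G] [IsManifold 𝓘(ℝ, EG) ∞ G]
  {Y : Type*} [TopologicalSpace Y] [CompactSpace Y] [ConnectedSpace Y]
  [ChartedSpace (Cn n) Y] [IsManifold 𝓘(ℂ, Cn n) ω Y] [MeasurableSpace Y] [BorelSpace Y]
  [MulAction G Y]
  {K : Type*} [TopologicalSpace K] [CompactSpace K] [ConnectedSpace K]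
  [ChartedSpace (Cn n) K] [IsManifold 𝓘(ℂ, Cn n) ω K] [MeasurableSpace K] [BorelSpace K]
  [MulAction G K]

/-- The integral of a function against the reduced scalar curvature can be computed after a
diffeomorphism that need not be holomorphic, if the scalar curvature is transported as a function. -/
theorem integral_mul_redScal_transport
    (hGY : ContMDiff (𝓘(ℝ, EG).prod 𝓘(ℝ, Cn n)) 𝓘(ℝ, Cn n) ∞ (fun q : G × Y => q.1 • q.2))
    {Θ : Y ≃ₜ K} (hΘ : ContMDiff 𝓘(ℝ, Cn n) 𝓘(ℝ, Cn n) ∞ Θ)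
    (hΘ' : ContMDiff 𝓘(ℝ, Cn n) 𝓘(ℝ, Cn n) ∞ Θ.symm) (heq : ∀ (g : G) y, Θ (g • y) = g • Θ y)
    {α : K → Alt2 n} {η : Y → Alt2 n} (hη : SmoothFamily (fun _ : ℝ => η))
    (hpos : ∀ y, IsPositiveForm (η y)) (hηα : η = pullback (n := n) Θ α) {σ h : K → ℝ}
    (hσ : ∀ y, scal η y = σ (Θ y)) {Φ : ℝ}
    (hΦ : ∀ p ∈ hamPot α (fundLin n EG G K), (∀ f ∈ hamPot α (fundLin n EG G K),
        ∫ x, (σ x - p x) * f x ∂(densVol α) = 0) →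
        ∫ x, h x * (σ x - (⨍ y, σ y ∂(densVol α)) - p x) ∂(densVol α) = Φ) :
    ∫ y, h (Θ y) * redScal EG G η y ∂(vol η) = Φ := by
  have hZ : ∀ ξ y, fundLin n EG G K ξ (Θ y) = tder (Cn n) (Cn n) Θ y (fundLin n EG G Y ξ y) :=
    fun ξ y => fundLin_equivariant hGY hΘ heq ξ y
  obtain ⟨h1, h2⟩ := proj_spec hpos (exists_projection_scal (EG := EG) (G := G) hη hpos)
  set p := proj EG G η (scal η) with hp
  simp only [redScal, vol_eq_densVol hpos, ← hp, hσ] at h2 ⊢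
  rw [hηα] at h1 h2 ⊢
  rw [← hΦ _ (comp_symm_mem_hamPot hΘ α hZ hΘ' h1) ?_]
  · rw [average_comp_densVol hΘ α, ← integral_comp_densVol hΘ α]
    simp only [Θ.symm_apply_apply]
  · intro f hf
    rw [← integral_comp_densVol hΘ α]
    simp only [Θ.symm_apply_apply]
    exact h2 _ (comp_mem_hamPot hΘ α hZ hf)

end Reduced

section Trivialization

variable {n : ℕ} {EG : Type*} [NormedAddCommGroup EG] [NormedSpace ℝ EG]
  {G : Type*} [TopologicalSpace G] [ChartedSpace EG G] [Group G]
  {T : Type*} [TopologicalSpace T] [T2Space T] [ChartedSpace (Cn (n + 1)) T]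
  [IsManifold 𝓘(ℂ, Cn (n + 1)) ω T] [MulAction ℂˣ T] [MulAction G T] {π : T → ℂ}
  {M : Type*} [TopologicalSpace M] [ChartedSpace (Cn n) M] [IsManifold 𝓘(ℂ, Cn n) ω M]
  [MulAction G M]
  {F : (M × ℂ) ≃ₘ^∞⟮𝓘(ℝ, Cn n).prod 𝓘(ℝ, ℂ), 𝓘(ℝ, Cn (n + 1))⟯ T}

theorem contMDiff_trivialization_family (F : (M × ℂ) ≃ₘ^∞⟮𝓘(ℝ, Cn n).prod 𝓘(ℝ, ℂ),
    𝓘(ℝ, Cn (n + 1))⟯ T) : ContMDiff (𝓘(ℝ, ℝ).prod 𝓘(ℝ, Cn n)) 𝓘(ℝ, Cn (n + 1)) ∞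
      (fun q : ℝ × M => F (q.2, (q.1 : ℂ))) :=
  F.contMDiff.comp (contMDiff_snd.prodMk (Complex.ofRealCLM.contDiff.contMDiff.comp contMDiff_fst))

theorem contMDiff_trivialization_slice (F : (M × ℂ) ≃ₘ^∞⟮𝓘(ℝ, Cn n).prod 𝓘(ℝ, ℂ),
    𝓘(ℝ, Cn (n + 1))⟯ T) (z : ℂ) : ContMDiff 𝓘(ℝ, Cn n) 𝓘(ℝ, Cn (n + 1)) ∞ (fun x => F (x, z)) :=
  F.contMDiff.comp (contMDiff_id.prodMk contMDiff_const)

theorem contMDiff_trivialization_fst (F : (M × ℂ) ≃ₘ^∞⟮𝓘(ℝ, Cn n).prod 𝓘(ℝ, ℂ),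
    𝓘(ℝ, Cn (n + 1))⟯ T) : ContMDiff 𝓘(ℝ, Cn (n + 1)) 𝓘(ℝ, Cn n) ∞ (fun y => (F.symm y).1) :=
  contMDiff_fst.comp F.symm.contMDiff

theorem tder_trivialization_injective (F : (M × ℂ) ≃ₘ^∞⟮𝓘(ℝ, Cn n).prod 𝓘(ℝ, ℂ),
    𝓘(ℝ, Cn (n + 1))⟯ T) (z : ℂ) (x : M) :
    Function.Injective (tder (Cn n) (Cn (n + 1)) (fun x => F (x, z)) x) :=
  Function.LeftInverse.injective (tder_leftInverse
    ((contMDiff_trivialization_fst F _).mdifferentiableAt (n := ∞) (by simp))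
    ((contMDiff_trivialization_slice F z x).mdifferentiableAt (n := ∞) (by simp))
    (Filter.Eventually.of_forall fun x => by rw [F.symm_apply_apply]))

variable (hF : IsTrivialization G π F)

include hF

theorem trivialization_apply_fst (y : T) : F ((F.symm y).1, π y) = y := by
  have h1 : F (F.symm y) = y := F.apply_symm_apply y
  have h2 : π y = (F.symm y).2 := by
    conv_lhs => rw [← h1]
    exact hF.fibre _ _
  rw [h2]
  exact h1

variable (hT : IsTestConfiguration (n := n) EG G π)

include hT

theorem exists_tder_trivialization_eq (z : ℂ) (x : M) {u : Cn (n + 1)}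
    (hu : tder (Cn (n + 1)) ℂ π (F (x, z)) u = 0) :
    ∃ w, tder (Cn n) (Cn (n + 1)) (fun x => F (x, z)) x w = u := by
  set A : Cn n →ₗ[ℝ] Cn (n + 1) := (tder (Cn n) (Cn (n + 1)) (fun x => F (x, z)) x).toLinearMap
  set P : Cn (n + 1) →ₗ[ℝ] ℂ := (tder (Cn (n + 1)) ℂ π (F (x, z))).toLinearMap
  have hπ := contMDiff_real hT.holomorphic
  have hle : LinearMap.range A ≤ LinearMap.ker P := by
    rintro _ ⟨v, rfl⟩
    have h1 := tder_comp_apply (f := fun x => F (x, z)) (g := π) (x := x)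
      ((hπ _).mdifferentiableAt (n := ∞) (by simp))
      ((contMDiff_trivialization_slice F z x).mdifferentiableAt (n := ∞) (by simp)) v
    simp only [hF.fibre] at h1
    rw [tder_const] at h1
    exact h1.symm
  have hdim : ∀ k, Module.finrank ℝ (Cn k) = 2 * k := fun k => by
    rw [finrank_real_of_complex, Module.finrank_pi, Fintype.card_fin]
  have hsurj : Function.Surjective P := by
    have h1 := tder_eq_restrictScalars ((hT.holomorphic (F (x, z))).mdifferentiableAt (n := ω) (by simp))
    intro c
    obtain ⟨v, hv⟩ := hT.submersion (F (x, z)) c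
    refine ⟨v, ?_⟩
    change tder (Cn (n + 1)) ℂ π (F (x, z)) v = c
    rw [h1]
    exact hv
  have h1 : Module.finrank ℝ (LinearMap.range A) = 2 * n := by
    rw [LinearMap.finrank_range_of_inj (tder_trivialization_injective F z x), hdim]
  have h2 : Module.finrank ℝ (LinearMap.ker P) = 2 * n := by
    have h3 := LinearMap.finrank_range_add_finrank_ker P
    rw [LinearMap.range_eq_top.2 hsurj, finrank_top, Complex.finrank_real_complex, hdim] at h3
    omega
  have h3 := Submodule.eq_of_le_of_finrank_eq hle (h1.trans h2.symm)
  have h4 : u ∈ LinearMap.range A := by rw [h3]; exact hu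
  exact h4

theorem isNondeg_pullback_trivialization {Ω : T → Alt2 (n + 1)} (hΩ : IsKahlerForm Ω) (z : ℂ) (x : M) :
    IsNondeg (pullback (n := n) (fun x => F (x, z)) Ω x) := by
  intro v hv
  have hπ := contMDiff_real hT.holomorphic
  set u := tder (Cn n) (Cn (n + 1)) (fun x => F (x, z)) x v with hu
  have h0 : tder (Cn (n + 1)) ℂ π (F (x, z)) u = 0 := by
    have h1 := tder_comp_apply (f := fun x => F (x, z)) (g := π) (x := x)
      ((hπ _).mdifferentiableAt (n := ∞) (by simp))
      ((contMDiff_trivialization_slice F z x).mdifferentiableAt (n := ∞) (by simp)) v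
    simp only [hF.fibre] at h1
    rw [tder_const] at h1
    exact h1.symm
  have h1 : tder (Cn (n + 1)) ℂ π (F (x, z)) (J (n + 1) u) = 0 := by
    rw [tder_eq_restrictScalars ((hT.holomorphic (F (x, z))).mdifferentiableAt (n := ω) (by simp))]
      at h0 ⊢
    change ctder (Cn (n + 1)) ℂ π (F (x, z)) (Complex.I • u) = 0
    rw [map_smul]
    exact smul_eq_zero_of_right _ h0
  obtain ⟨w, hw⟩ := exists_tder_trivialization_eq hF hT z x h1
  have h2 := hv w
  rw [pullback_apply, hw, ← hu] at h2
  have h3 : u = 0 := by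
    by_contra hne
    exact (hΩ.positive _ u hne).ne' h2
  exact tder_trivialization_injective F z x (by rw [map_zero]; exact h3)

theorem contMDiff_action_trivialization : ContMDiff (𝓘(ℝ, EG).prod 𝓘(ℝ, Cn n)) 𝓘(ℝ, Cn n) ∞
    (fun q : G × M => q.1 • q.2) := by
  have h : (fun q : G × M => q.1 • q.2) = fun q => (F.symm (q.1 • F (q.2, 0))).1 := by
    funext q
    rw [← hF.equivariant, F.symm_apply_apply]
  rw [h]
  refine (contMDiff_trivialization_fst F).comp (ContMDiff.comp (g := fun q : G × T => q.1 • q.2)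
    hT.group_smooth (contMDiff_fst.prodMk ?_))
  exact (contMDiff_trivialization_slice F 0).comp contMDiff_snd

variable {X : Type*} [TopologicalSpace X] [CompactSpace X] [ChartedSpace (Cn n) X] [T2Space M]
  [IsManifold 𝓘(ℂ, Cn n) ω X] [MulAction G X] {ι : X → T} (hι : IsGenericFibre (n := n) π ι)
  (hιG : ∀ (g : G) (x : X), ι (g • x) = g • ι x)

include hι hιG

/-- The diffeomorphism of the generic fibre with `M` given by the flow and the trivialization. -/
theorem exists_fibre_diffeo (t : ℝ) : ∃ Θ : X ≃ₜ M,
    ContMDiff 𝓘(ℝ, Cn n) 𝓘(ℝ, Cn n) ∞ Θ ∧ ContMDiff 𝓘(ℝ, Cn n) 𝓘(ℝ, Cn n) ∞ Θ.symm ∧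
    (∀ (g : G) x, Θ (g • x) = g • Θ x) ∧
    ∀ x, F (Θ x, ((Real.exp (-t) : ℝ) : ℂ)) = expUnit (-(t : ℂ)) • ι x := by
  set θ : X → M := fun x => (F.symm (expUnit (-(t : ℂ)) • ι x)).1 with hθ
  have hFθ : ∀ x, F (θ x, ((Real.exp (-t) : ℝ) : ℂ)) = expUnit (-(t : ℂ)) • ι x := fun x => by
    rw [← fibre_proj hT hι t x]
    exact trivialization_apply_fst hF _
  have hθs : ContMDiff 𝓘(ℝ, Cn n) 𝓘(ℝ, Cn n) ∞ θ :=
    (contMDiff_trivialization_fst F).comp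
      (contMDiff_real (contMDiff_fibre_slice hT.action_holomorphic hι.holomorphic t))
  have hinj : Function.Injective θ := fun x x' h => by
    have h1 := (hFθ x).symm.trans ((congrArg (fun y => F (y, ((Real.exp (-t) : ℝ) : ℂ))) h).trans
      (hFθ x'))
    exact hι.injective (MulAction.injective _ h1)
  have hsurj : Function.Surjective θ := fun y => by
    have h1 : (expUnit (-(t : ℂ)))⁻¹ • F (y, ((Real.exp (-t) : ℝ) : ℂ)) ∈ π ⁻¹' {1} := by
      change π _ = 1
      have h2 : (((expUnit (-(t : ℂ)))⁻¹ : ℂˣ) : ℂ) * (expUnit (-(t : ℂ)) : ℂˣ) = 1 := by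
        rw [← Units.val_mul, inv_mul_cancel, Units.val_one]
      rw [hT.equivariant, hF.fibre, ← h2]
      simp [expUnit]
    rw [← hι.range_eq] at h1
    obtain ⟨x, hx⟩ := h1
    refine ⟨x, ?_⟩
    simp only [hθ]
    rw [hx, smul_inv_smul, F.symm_apply_apply]
  set e : X ≃ M := Equiv.ofBijective θ ⟨hinj, hsurj⟩ with he
  have hec : Continuous e := hθs.continuous
  refine ⟨hec.homeoOfEquivCompactToT2, hθs, ?_, fun g x => ?_, hFθ⟩
  · refine contMDiff_lift_real hι.holomorphic hι.injective (tder_fibre_injective hι) ?_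
    have h1 : (fun y => ι (e.symm y)) =
        fun y => (expUnit (-(t : ℂ)))⁻¹ • F (y, ((Real.exp (-t) : ℝ) : ℂ)) := by
      funext y
      obtain ⟨x, rfl⟩ := hsurj y
      have h2 : e.symm (θ x) = x := e.symm_apply_apply x
      rw [h2, hFθ, inv_smul_smul]
    change ContMDiff _ _ _ (fun y => ι (e.symm y))
    rw [h1]
    exact (contMDiff_real (contMDiff_smul_complex hT.action_holomorphic _)).comp
      (contMDiff_trivialization_slice F _)
  · change θ (g • x) = g • θ x
    have h1 : F (θ (g • x), ((Real.exp (-t) : ℝ) : ℂ)) = F (g • θ x, ((Real.exp (-t) : ℝ) : ℂ)) := by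
      rw [hFθ, hF.equivariant, hFθ, fibre_equivariant hT hι hιG]
    exact congrArg Prod.fst (F.injective h1)

end Trivialization

section RealPotential

variable {n : ℕ} {X : Type*} [TopologicalSpace X] [CompactSpace X] [ConnectedSpace X]
  [ChartedSpace (Cn n) X] [IsManifold 𝓘(ℂ, Cn n) ω X] [MeasurableSpace X] [BorelSpace X]

theorem ddc_eq_zero_of_tder_eq {u w : X → ℝ} (hu : ContMDiff 𝓘(ℝ, Cn n) 𝓘(ℝ, ℝ) ∞ u)
    (hw : ContMDiff 𝓘(ℝ, Cn n) 𝓘(ℝ, ℝ) ∞ w)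
    (h : ∀ x v, tder (Cn n) ℝ u x v = tder (Cn n) ℝ w x (J n v)) (x : X) :
    ddc (n := n) w x = 0 := by
  have hx := mem_chart_target (Cn n) x
  set c := chartAt (Cn n) x with hc
  have hcu := contDiffAt_comp_chart_symm hu hx
  have hcw := contDiffAt_comp_chart_symm hw hx
  have hloc : ∀ b, (fun y => fderiv ℝ (fun y => w (c.symm y)) y (J n b)) =ᶠ[𝓝 (c x)]
      fun y => fderiv ℝ (fun y => u (c.symm y)) y b := by
    intro b
    filter_upwards [c.open_target.mem_nhds hx] with y hy
    have hs := mdifferentiableAt_chart_symm hy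
    rw [← tder_eq_fderiv, ← tder_eq_fderiv,
      tder_comp_apply ((hw _).mdifferentiableAt (n := ∞) (by simp)) hs,
      tder_comp_apply ((hu _).mdifferentiableAt (n := ∞) (by simp)) hs,
      tder_J ((contMDiffAt_chart_symm_complex hy).mdifferentiableAt (n := ω) (by simp)), h]
  refine alt2_ext fun a b => ?_
  have h1 : ddc (n := n) w x ![a, b] = ddcLocal (fun y => w (c.symm y)) (c x) ![a, b] := rfl
  rw [h1, ddcLocal_apply (hcw.of_le (by norm_cast)), ← fderiv_fderiv_apply hcw,
    ← fderiv_fderiv_apply hcw, (hloc b).fderiv_eq, (hloc a).fderiv_eq, fderiv_fderiv_apply hcu,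
    fderiv_fderiv_apply hcu, ((hcu.of_le (m := 2) (by norm_cast)).isSymmSndFDerivAt (by simp)).eq]
  exact neg_add_cancel _

/-- The real potential of a vector field is unique. -/
theorem IsRealPotential.unique {η : X → Alt2 n} (hη : SmoothFamily (fun _ : ℝ => η))
    (hpos : ∀ x, IsPositiveForm (η x)) {V : X → Cn n} {f f' : X → ℝ}
    (hf : IsRealPotential η V f) (hf' : IsRealPotential η V f') : f = f' := by
  obtain ⟨hfs, hf0, h, hhs, -, A, B, hA, hB, hV⟩ := hf
  obtain ⟨hfs', hf0', h', hhs', -, A', B', hA', hB', hV'⟩ := hf'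
  rw [vol_eq_densVol hpos] at hf0 hf0'
  have hfin : IsFiniteMeasure (densVol η) :=
    isFiniteMeasure_densVol hη (fun _ x => (hpos x).isNondeg) 0
  have hgrad : ∀ {f : X → ℝ} {A : X → Cn n}, IsGradient η f A →
      ∀ x v, tder (Cn n) ℝ f x v = η x ![A x, J n v] := fun h x v => (h x v).symm
  have hneg : ∀ {f : X → ℝ}, ContMDiff 𝓘(ℝ, Cn n) 𝓘(ℝ, ℝ) ∞ f →
      ContMDiff 𝓘(ℝ, Cn n) 𝓘(ℝ, ℝ) ∞ (fun x => (-1) * f x) := fun hf => contMDiff_const.mul hf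
  have hus : ContMDiff 𝓘(ℝ, Cn n) 𝓘(ℝ, ℝ) ∞ (fun x => f x + (-1) * f' x) := hfs.add (hneg hfs')
  have hws : ContMDiff 𝓘(ℝ, Cn n) 𝓘(ℝ, ℝ) ∞ (fun x => h x + (-1) * h' x) := hhs.add (hneg hhs')
  have hdu : ∀ x v, tder (Cn n) ℝ (fun x => f x + (-1) * f' x) x v =
      tder (Cn n) ℝ f x v - tder (Cn n) ℝ f' x v := by
    intro x v
    rw [tder_add_fun hfs (hneg hfs'), tder_const_mul_fun hfs']
    simp [sub_eq_add_neg]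
  have hdw : ∀ x v, tder (Cn n) ℝ (fun x => h x + (-1) * h' x) x v =
      tder (Cn n) ℝ h x v - tder (Cn n) ℝ h' x v := by
    intro x v
    rw [tder_add_fun hhs (hneg hhs'), tder_const_mul_fun hhs']
    simp [sub_eq_add_neg]
  have hrel : ∀ x v, tder (Cn n) ℝ (fun x => f x + (-1) * f' x) x v =
      tder (Cn n) ℝ (fun x => h x + (-1) * h' x) x (J n v) := by
    intro x v
    rw [hdu, hdw, hgrad hA, hgrad hA', hgrad hB, hgrad hB', J_J, form_neg_right, form_neg_right]
    have h1 : A x + J n (B x) = A' x + J n (B' x) := (hV x).symm.trans (hV' x)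
    have h2 := congrArg (fun a => η x ![a, J n v]) h1
    simp only [form_add_left] at h2
    rw [(hpos x).1, (hpos x).1] at h2
    linarith
  obtain ⟨c, hc⟩ := exists_eq_const_of_ddc_eq_zero hws (ddc_eq_zero_of_tder_eq hus hws hrel)
  have hu0 : ∀ x, tder (Cn n) ℝ (fun x => f x + (-1) * f' x) x = 0 := by
    intro x
    ext v
    have h1 : (fun x => h x + (-1) * h' x) = fun _ => c := funext hc
    rw [hrel, h1, tder_const]
    rfl
  obtain ⟨x₀⟩ : Nonempty X := inferInstance
  have hconst := fun x => exists_eq_const_of_tder_eq_zero hus hu0 x x₀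
  have h1 : ∫ x, (f x + (-1) * f' x) ∂(densVol η) = 0 := by
    rw [integral_add (integrable_of_continuous hfs.continuous)
      (integrable_of_continuous (hneg hfs').continuous), integral_const_mul, hf0, hf0']
    simp
  have hvol := densVol_real_univ_pos hη (fun _ x => (hpos x).isNondeg) 0
  simp only [hconst, integral_const, smul_eq_mul, mul_eq_zero, hvol.ne', false_or] at h1
  funext x
  have h2 := hconst x
  rw [h1] at h2
  linarith

end RealPotential

section ReducedConst

variable {n : ℕ} {EG : Type*} [NormedAddCommGroup EG] [NormedSpace ℝ EG] [FiniteDimensional ℝ EG]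
  {G : Type*} [TopologicalSpace G] [ChartedSpace EG G] [Group G]
  {X : Type*} [TopologicalSpace X] [CompactSpace X] [ConnectedSpace X] [ChartedSpace (Cn n) X]
  [IsManifold 𝓘(ℂ, Cn n) ω X] [MeasurableSpace X] [BorelSpace X] [MulAction G X]

theorem integral_add_const_mul_redScal {η : X → Alt2 n} (hη : SmoothFamily (fun _ : ℝ => η))
    (hpos : ∀ x, IsPositiveForm (η x)) {h : X → ℝ} (hh : Continuous h) (c : ℝ) :
    ∫ x, (h x + c) * redScal EG G η x ∂(vol η) = ∫ x, h x * redScal EG G η x ∂(vol η) := by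
  have hfin : IsFiniteMeasure (densVol η) :=
    isFiniteMeasure_densVol hη (fun _ x => (hpos x).isNondeg) 0
  have hcont : Continuous (redScal EG G η) :=
    continuous_redScal hη hpos (exists_projection_scal hη hpos)
  have h0 := integral_redScal (EG := EG) (G := G) hη hpos
  rw [vol_eq_densVol hpos] at h0 ⊢
  have h1 : Integrable (fun x => h x * redScal EG G η x) (densVol η) :=
    integrable_of_continuous (hh.mul hcont)
  have h2 : Integrable (fun x => c * redScal EG G η x) (densVol η) :=
    integrable_of_continuous (continuous_const.mul hcont)
  simp only [add_mul]
  rw [integral_add h1 h2, integral_const_mul, h0, mul_zero, add_zero]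

end ReducedConst

section Limit

variable {n : ℕ} {EG : Type*} [NormedAddCommGroup EG] [NormedSpace ℝ EG] [FiniteDimensional ℝ EG]
  {G : Type*} [TopologicalSpace G] [ChartedSpace EG G] [Group G] [IsManifold 𝓘(ℝ, EG) ∞ G]
  {T : Type*} [TopologicalSpace T] [T2Space T] [ChartedSpace (Cn (n + 1)) T]
  [IsManifold 𝓘(ℂ, Cn (n + 1)) ω T] [MulAction ℂˣ T] [MulAction G T] {π : T → ℂ}
  (hT : IsTestConfiguration (n := n) EG G π)
  {M : Type*} [TopologicalSpace M] [T2Space M] [CompactSpace M] [ConnectedSpace M]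
  [ChartedSpace (Cn n) M] [IsManifold 𝓘(ℂ, Cn n) ω M] [MeasurableSpace M] [BorelSpace M]
  [MulAction G M]
  {F : (M × ℂ) ≃ₘ^∞⟮𝓘(ℝ, Cn n).prod 𝓘(ℝ, ℂ), 𝓘(ℝ, Cn (n + 1))⟯ T}
  (hF : IsTrivialization G π F) {Ω : T → Alt2 (n + 1)} {H : T → ℝ}

theorem smoothFamily_centralForm (hΩ : IsKahlerForm Ω) :
    SmoothFamily (fun _ : ℝ => centralForm F Ω) := by
  have h := (smoothFamily_pullback (Φ := fun (r : ℝ) (x : M) => F (x, (r : ℂ))) hΩ.isSmoothForm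
    (contMDiff_trivialization_family F)).const 0 (B' := ℝ)
  simp only [Complex.ofReal_zero] at h
  exact h

include hF in
theorem isPositiveForm_centralForm (hΩ : IsKahlerForm Ω) (x : M) :
    IsPositiveForm (centralForm F Ω x) := by
  have h := (hF.holomorphic x).mdifferentiableAt (n := ω) (by simp)
  exact (hΩ.isPositiveForm _).pullback h
    (ctder_injective_of_tder h (tder_trivialization_injective F 0 x))

include hT hF

theorem tder_centralField (x : M) : tder (Cn n) (Cn (n + 1)) (fun x => F (x, 0)) x (centralField F x) =
    circleField n T (F (x, 0)) := by
  set k : ℝ → T := fun θ => expUnit (Complex.I * (θ : ℂ)) • F (x, 0) with hk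
  have hks : ContMDiff 𝓘(ℝ, ℝ) 𝓘(ℝ, Cn (n + 1)) ∞ k :=
    ContMDiff.comp (g := fun w : ℂ => expUnit w • F (x, 0))
      (contMDiff_real (contMDiff_exp_orbit hT.action_holomorphic (F (x, 0))))
      (contMDiff_iff_contDiff.2 (contDiff_const.mul Complex.ofRealCLM.contDiff))
  have hk0 : (F.symm (k 0)).1 = x := by
    simp [hk, expUnit_zero]
  have h1 := tder_comp_apply (f := fun θ => (F.symm (k θ)).1) (g := fun x => F (x, 0)) (x := (0 : ℝ))
    ((contMDiff_trivialization_slice F 0 _).mdifferentiableAt (n := ∞) (by simp))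
    (((contMDiff_trivialization_fst F).comp hks 0).mdifferentiableAt (n := ∞) (by simp)) (1 : ℝ)
  have h2 : (fun θ => F ((F.symm (k θ)).1, 0)) = k := by
    funext θ
    have h3 : π (k θ) = 0 := by rw [hT.equivariant, hF.fibre, mul_zero]
    conv_rhs => rw [← trivialization_apply_fst hF (k θ), h3]
  rw [hk0, h2] at h1
  exact h1.symm

theorem isRealPotential_central (hΩ : IsInvariantKahler G Ω H) :
    IsRealPotential (centralForm F Ω) (fun x => J n (centralField F x))
      (fun x => H (F (x, 0)) - ⨍ y, H (F (y, 0)) ∂(vol (centralForm F Ω))) := by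
  have hpos := isPositiveForm_centralForm hF hΩ.kahler
  have hη := smoothFamily_centralForm (F := F) hΩ.kahler
  have hfin : IsFiniteMeasure (densVol (centralForm F Ω)) :=
    isFiniteMeasure_densVol hη (fun _ x => (hpos x).isNondeg) 0
  have hFs := contMDiff_trivialization_slice F 0
  have hH : ContMDiff 𝓘(ℝ, Cn n) 𝓘(ℝ, ℝ) ∞ (fun x : M => H (F (x, 0))) := hΩ.smooth.comp hFs
  refine ⟨hH.sub contMDiff_const, ?_, fun _ => 0, contMDiff_const, by simp,
    fun x => J n (centralField F x), fun _ => 0, fun x v => ?_, fun x v => ?_, fun x => by simp⟩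
  · rw [vol_eq_densVol hpos]
    exact integral_sub_average _ _
  · have hd := (hF.holomorphic x).mdifferentiableAt (n := ω) (by simp)
    have h1 : tder (Cn n) ℝ (fun x : M => H (F (x, 0)) -
        ⨍ y, H (F (y, 0)) ∂(vol (centralForm F Ω))) x = tder (Cn n) ℝ (fun x : M => H (F (x, 0))) x := by
      have h2 : ContMDiff 𝓘(ℝ, Cn n) 𝓘(ℝ, ℝ) ∞
        (fun _ : M => -⨍ y, H (F (y, 0)) ∂(vol (centralForm F Ω))) := contMDiff_const
      have h3 := tder_add_fun hH h2 x
      rw [tder_const, add_zero] at h3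
      simpa only [sub_eq_add_neg] using h3
    change _ = tder (Cn n) ℝ _ x v
    rw [h1, (hpos x).1, tder_comp_apply ((hΩ.smooth _).mdifferentiableAt (n := ∞) (by simp))
      ((hFs x).mdifferentiableAt (n := ∞) (by simp)), centralForm, pullback_apply,
      tder_centralField hT hF]
    exact hΩ.hamiltonian _ _
  · change _ = tder (Cn n) ℝ (fun _ : M => (0 : ℝ)) x v
    rw [form_zero_left, tder_const]
    rfl

theorem limitValue_eq_neg_futaki (hΩ : IsInvariantKahler G Ω H) : limitValue EG G F Ω H
    = -futaki EG G (centralForm F Ω) (fun x => J n (centralField F x)) := by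
  have hpos := isPositiveForm_centralForm hF hΩ.kahler
  have hη := smoothFamily_centralForm (F := F) hΩ.kahler
  have hpot := isRealPotential_central hT hF hΩ
  have hex : ∃ f, IsRealPotential (centralForm F Ω) (fun x => J n (centralField F x)) f := ⟨_, hpot⟩
  have h1 : realPotential (centralForm F Ω) (fun x => J n (centralField F x)) =
      fun x => H (F (x, 0)) - ⨍ y, H (F (y, 0)) ∂(vol (centralForm F Ω)) := by
    rw [realPotential, dif_pos hex]
    exact hex.choose_spec.unique hη hpos hpot
  have hH : Continuous (fun x : M => H (F (x, 0))) :=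
    hΩ.smooth.continuous.comp (contMDiff_trivialization_slice F 0).continuous
  rw [limitValue, futaki, h1, ← integral_add_const_mul_redScal hη hpos hH
    (-⨍ y, H (F (y, 0)) ∂(vol (centralForm F Ω)))]
  simp only [sub_eq_add_neg]

variable {X : Type*} [TopologicalSpace X] [CompactSpace X] [ConnectedSpace X]
  [ChartedSpace (Cn n) X] [IsManifold 𝓘(ℂ, Cn n) ω X] [MeasurableSpace X] [BorelSpace X]
  [MulAction G X] {ι : X → T} (hι : IsGenericFibre (n := n) π ι)
  (hιG : ∀ (g : G) (x : X), ι (g • x) = g • ι x)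

include hι hιG

/-- The integrals of `H` against the reduced scalar curvature of the fibres extend to a `C¹` function
of `r = e^{-t}` up to the central fibre. -/
theorem exists_fibre_integral_profile (hΩ : IsInvariantKahler G Ω H) :
    ∃ Φ : ℝ → ℝ, ContDiff ℝ 1 Φ ∧
      (∀ t : ℝ, ∫ x, H (expUnit (-(t : ℂ)) • ι x) * redScal EG G (omegaT ι Ω t) x
        ∂(vol (omegaT ι Ω t)) = Φ (Real.exp (-t))) ∧
      limitValue EG G F Ω H = -Φ 0 := by
  have hfam := contMDiff_trivialization_family F
  have hGM := contMDiff_action_trivialization hF hT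
  have hscal := contMDiff_fibreScal hΩ.kahler hT.holomorphic hT.submersion
  obtain ⟨Φ, hΦ, hinteg⟩ := exists_reduced_integral (Z := fundLin n EG G M)
    (smoothFamily_pullback (Φ := fun (r : ℝ) (x : M) => F (x, (r : ℂ))) hΩ.kahler.isSmoothForm hfam)
    (fun r x => isNondeg_pullback_trivialization hF hT hΩ.kahler r x)
    (fun ξ r₀ f₀ hf₀ => exists_ham_pullback (Φ := fun (r : ℝ) (x : M) => F (x, (r : ℂ)))
      hT.group_smooth hGM hfam (fun r g x => hF.equivariant g x r) hΩ.kahler hΩ.group_invariant ξ r₀ hf₀)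
    (σ := fun r x => fibreScal π Ω (F (x, (r : ℂ)))) (h := fun r x => H (F (x, (r : ℂ))))
    (c1Fam_of_contMDiff (n := n) (hscal.comp hfam))
    (c1Fam_of_contMDiff (n := n) (hΩ.smooth.comp hfam))
  refine ⟨Φ, hΦ, fun t => ?_, ?_⟩
  · obtain ⟨Θ, hΘ, hΘ', heq, hFΘ⟩ := exists_fibre_diffeo hF hT hι hιG t
    have hη : omegaT ι Ω t = pullback (n := n) Θ
        (pullback (n := n) (fun x : M => F (x, ((Real.exp (-t) : ℝ) : ℂ))) Ω) := by
      funext x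
      rw [pullback_pullback _ ((hΘ x).mdifferentiableAt (n := ∞) (by simp))
        ((contMDiff_trivialization_slice F _ _).mdifferentiableAt (n := ∞) (by simp))]
      simp only [hFΘ]
      rfl
    have h1 := integral_mul_redScal_transport (contMDiff_action_fibre hT hι hιG) hΘ hΘ' heq
      ((smoothFamily_omegaT hT hι hΩ.kahler).const t) (isPositiveForm_omegaT hT hι hΩ.kahler t) hη
      (σ := fun x => fibreScal π Ω (F (x, ((Real.exp (-t) : ℝ) : ℂ))))
      (h := fun x => H (F (x, ((Real.exp (-t) : ℝ) : ℂ)))) (fun x => by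
        rw [hFΘ]
        exact scal_pullback_eq_fibreScal hΩ.kahler hT.holomorphic hT.submersion
          (contMDiff_fibre_slice hT.action_holomorphic hι.holomorphic t x) (fibre_immersion hT hι t x)
          (Filter.Eventually.of_forall fun x' => by rw [fibre_proj hT hι, fibre_proj hT hι]))
      (hinteg (Real.exp (-t))).2
    simpa only [hFΘ] using h1
  · have hη : centralForm F Ω = pullback (n := n) (Homeomorph.refl M)
        (pullback (n := n) (fun x : M => F (x, ((0 : ℝ) : ℂ))) Ω) := by
      simp only [Complex.ofReal_zero]
      exact (pullback_id _).symm
    have h1 := integral_mul_redScal_transport (Θ := Homeomorph.refl M) hGM contMDiff_id contMDiff_id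
      (fun g x => rfl) (smoothFamily_centralForm hΩ.kahler) (isPositiveForm_centralForm hF hΩ.kahler) hη
      (σ := fun x => fibreScal π Ω (F (x, ((0 : ℝ) : ℂ))))
      (h := fun x => H (F (x, ((0 : ℝ) : ℂ)))) (fun x => by
        rw [Complex.ofReal_zero]
        exact scal_pullback_eq_fibreScal hΩ.kahler hT.holomorphic hT.submersion
          (hF.holomorphic x) (tder_trivialization_injective F 0 x)
          (Filter.Eventually.of_forall fun x' => by rw [hF.fibre, hF.fibre]))
      (hinteg 0).2
    rw [limitValue, ← h1]
    simp

end Limit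

/-- A `C¹` function is Lipschitz at `0` along `e^{-t}`, `t ≥ 0`. -/
theorem exists_exp_decay {Φ : ℝ → ℝ} (hΦ : ContDiff ℝ 1 Φ) :
    ∃ C : ℝ, ∀ t : ℝ, 0 ≤ t → |Φ (Real.exp (-t)) - Φ 0| ≤ C * Real.exp (-t) := by
  obtain ⟨C, hC⟩ := (isCompact_Icc (a := (0 : ℝ)) (b := 1)).bddAbove_image
    (hΦ.continuous_deriv (by simp)).norm.continuousOn
  refine ⟨C, fun t ht => ?_⟩
  have h1 := (convex_Icc (0 : ℝ) 1).norm_image_sub_le_of_norm_deriv_le (f := Φ) (C := C)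
    (fun x _ => hΦ.differentiable (by simp) x) (fun x hx => hC ⟨x, hx, rfl⟩)
    (Set.left_mem_Icc.2 zero_le_one)
    (show Real.exp (-t) ∈ Set.Icc (0 : ℝ) 1 from
      ⟨(Real.exp_pos _).le, Real.exp_le_one_iff.2 (by linarith)⟩)
  rw [sub_zero, Real.norm_eq_abs, Real.norm_eq_abs, abs_of_pos (Real.exp_pos _)] at h1
  exact h1

end RelFutaki

theorem energy_derivative_decays_to_minus_relative_Futaki
    {n : ℕ}
    -- the compact Lie group `G`
    {EG : Type*} [NormedAddCommGroup EG] [NormedSpace ℝ EG] [FiniteDimensional ℝ EG]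
    {G : Type*} [TopologicalSpace G] [ChartedSpace EG G] [Group G] [LieGroup 𝓘(ℝ, EG) ∞ G]
    [CompactSpace G] [T2Space G]
    -- the total space `T` of the test configuration
    {T : Type*} [TopologicalSpace T] [T2Space T] [ChartedSpace (Cn (n + 1)) T]
    [IsManifold 𝓘(ℂ, Cn (n + 1)) ω T] [MulAction ℂˣ T] [MulAction G T]
    {π : T → ℂ} (hT : IsTestConfiguration (n := n) EG G π)
    -- the generic fibre `X`
    {X : Type*} [TopologicalSpace X] [T2Space X] [CompactSpace X] [ConnectedSpace X]
    [ChartedSpace (Cn n) X] [IsManifold 𝓘(ℂ, Cn n) ω X] [MeasurableSpace X] [BorelSpace X]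
    [MulAction G X]
    {ι : X → T} (hι : IsGenericFibre (n := n) π ι) (hιG : ∀ (g : G) (x : X), ι (g • x) = g • ι x)
    -- the central fibre `M` with its complex structure, and the trivialization `F`
    {M : Type*} [TopologicalSpace M] [T2Space M] [CompactSpace M] [ConnectedSpace M]
    [ChartedSpace (Cn n) M] [IsManifold 𝓘(ℂ, Cn n) ω M] [MeasurableSpace M] [BorelSpace M]
    [MulAction G M]
    {F : (M × ℂ) ≃ₘ^∞⟮𝓘(ℝ, Cn n).prod 𝓘(ℝ, ℂ), 𝓘(ℝ, Cn (n + 1))⟯ T}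
    (hF : IsTrivialization G π F)
    -- the invariant Kähler form and the hamiltonian of the `S¹`-action
    {Ω : T → Alt2 (n + 1)} {H : T → ℝ} (hΩ : IsInvariantKahler G Ω H)
    -- the potentials `φ_t` of the forms `ω_t`, relative to `ω_0 = Ω|_X`
    {φ : ℝ → X → ℝ}
    (hφ : ContMDiff (𝓘(ℝ, ℝ).prod 𝓘(ℝ, Cn n)) 𝓘(ℝ, ℝ) ∞ (fun q : ℝ × X => φ q.1 q.2))
    (hφω : ∀ t : ℝ, omegaT ι Ω t = perturb (omegaT ι Ω 0) (φ t))
    -- the modified K-energy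
    {E : (X → ℝ) → ℝ} (hE : IsModifiedKEnergy EG G (omegaT ι Ω 0) E) :
    -- `φ̇_t = ρ_{e^{-t}}^* H` modulo constants
    (∀ t : ℝ, ∃ c : ℝ, ∀ x : X,
      HasDerivAt (fun s => φ s x) (H (expUnit (-(t : ℂ)) • ι x) + c) t) ∧
    -- `(d/dt) E^G(φ_t) = -(1/n!) ∫ φ̇_t S^G(ω_t) ω_tⁿ`
    (∀ t : ℝ, HasDerivAt (fun s => E (φ s))
      (-∫ x, deriv (fun s => φ s x) t * redScal EG G (omegaT ι Ω t) x ∂(vol (omegaT ι Ω t))) t) ∧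
    -- exponential convergence as `t → ∞`
    (∃ C : ℝ, ∀ t : ℝ, 0 ≤ t →
      |deriv (fun s => E (φ s)) t - limitValue EG G F Ω H| ≤ C * Real.exp (-t)) ∧
    -- the limit is minus the relative Futaki invariant of the central fibre on the real holomorphic
    -- field `J W = ∇H` that corresponds to `W`, whose real potential is `F₀^* H` minus its mean
    IsRealPotential (centralForm F Ω) (fun x => J n (centralField F x))
      (fun x => H (F (x, 0)) - ⨍ y, H (F (y, 0)) ∂(vol (centralForm F Ω))) ∧
    limitValue EG G F Ω H
      = -futaki EG G (centralForm F Ω) (fun x => J n (centralField F x)) ∧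
    -- if the metric on the central fibre is extremal with `S^G = 0`, all of this vanishes, and the
    -- limit is also minus the invariant evaluated on `W` itself
    ((∀ x : M, redScal EG G (centralForm F Ω) x = 0) →
      limitValue EG G F Ω H = 0 ∧
      futaki EG G (centralForm F Ω) (fun x => J n (centralField F x)) = 0 ∧
      limitValue EG G F Ω H = -futaki EG G (centralForm F Ω) (centralField F) ∧
      futaki EG G (centralForm F Ω) (centralField F) = 0) := by
  have hφs : ∀ t, ContMDiff 𝓘(ℝ, Cn n) 𝓘(ℝ, ℝ) ∞ (φ t) := contMDiff_slice hφ
  have hpos := isPositiveForm_omegaT hT hι hΩ.kahler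
  have hsm := smoothFamily_omegaT hT hι hΩ.kahler
  have hmem : ∀ t, φ t ∈ potentials G (omegaT ι Ω 0) := fun t =>
    ⟨⟨hφs t, potential_invariant hT hι hιG hΩ.group_invariant (hφs t) (hφω t)⟩, fun x v hv => by
      rw [← hφω t]
      exact (hpos t x).2 v hv⟩
  have hdot := exists_deriv_potential hT.action_holomorphic hι.holomorphic hΩ.kahler hΩ.smooth
    hΩ.hamiltonian hφ hφω
  have hderiv : ∀ t : ℝ, HasDerivAt (fun s => E (φ s)) (-∫ x, deriv (fun s => φ s x) t *
      redScal EG G (omegaT ι Ω t) x ∂(vol (omegaT ι Ω t))) t := by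
    intro t
    rw [hφω t]
    exact hasDerivAt_energy (contMDiff_action_fibre hT hι hιG)
      (contMDiff_action_fibre_complex hT hι hιG) (hsm.const 0) (hpos 0) hφ hmem hE t
  refine ⟨hdot, hderiv, ?_, isRealPotential_central hT hF hΩ, limitValue_eq_neg_futaki hT hF hΩ,
    fun h0 => ?_⟩
  · obtain ⟨Φ, hΦ, hinteg, hlim⟩ := exists_fibre_integral_profile hT hF hι hιG hΩ
    obtain ⟨C, hC⟩ := exists_exp_decay hΦ
    refine ⟨C, fun t ht => ?_⟩
    obtain ⟨c, hc⟩ := hdot t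
    have hH : Continuous (fun x : X => H (expUnit (-(t : ℂ)) • ι x)) := hΩ.smooth.continuous.comp
      (contMDiff_fibre_slice hT.action_holomorphic hι.holomorphic t).continuous
    have h1 : deriv (fun s => E (φ s)) t = -Φ (Real.exp (-t)) := by
      rw [(hderiv t).deriv, ← hinteg t,
        ← integral_add_const_mul_redScal (hsm.const t) (hpos t) hH c]
      simp only [fun x => (hc x).deriv]
    rw [h1, hlim, neg_sub_neg, abs_sub_comm]
    exact hC t ht
  · simp [limitValue, futaki, h0]
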